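/- Let n ≥ 3 and let K/ℚ be a totally real Galois extension of degree n with cyclic Galois group G such that every totally positive unit of the ring of integers 𝓞 of K is the square of a unit; fix a generator σ of G. Fix an integral ideal 𝔐 of 𝓞 with (2) ∣ 𝔐 and an element μ ∈ 𝓞 coprime to 𝔐. Assume Conjecture C_n holds with some exponent δ ≤ 2/n, and set ν = δ/(2n(12n+1)). Then for every ε > 0 there exists a constant C (depending only on ε, K, 𝔐 and μ) such that for all x ≥ 2, |∑ spin(σ,𝔭)| ≤ C·x^{1−ν+ε}, where the sum runs over all odd principal prime ideals 𝔭 of 𝓞 with N𝔭 ≤ x which possess a totally positive generator π satisfying π ≡ μ (mod 𝔐). -/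

import Mathlib

set_option synthInstance.maxHeartbeats 1000000
set_option maxHeartbeats 2000000

open NumberField
open scoped Classical

noncomputable section

variable {K : Type*} [Field K] [NumberField K]

/-- The quadratic residue symbol `(α/𝔭)` modulo a prime ideal `𝔭` of the ring of
integers: `1` if `α` is a nonzero square modulo `𝔭`, `-1` if it is a nonzero
non-square, and `0` if `α ∈ 𝔭`. -/
def legSym (𝔭 : Ideal (𝓞 K)) (α : 𝓞 K) : ℤ :=
  if Ideal.Quotient.mk 𝔭 α = 0 then 0
  else if IsSquare (Ideal.Quotient.mk 𝔭 α) then 1 else -1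

/-- The quadratic residue symbol `(α/𝔟)` for an ideal `𝔟`, extended multiplicatively over
the prime factorization of `𝔟` (with multiplicity). -/
def quadSym (𝔟 : Ideal (𝓞 K)) (α : 𝓞 K) : ℤ :=
  ((UniqueFactorizationMonoid.normalizedFactors 𝔟).map (fun 𝔭 => legSym 𝔭 α)).prod

/-- An element of `𝓞 K` is totally positive if it is positive under every real embedding. -/
def TotPos (α : 𝓞 K) : Prop := ∀ v : K →+* ℝ, 0 < v (α : K)

/-- The image of an ideal under a field automorphism. -/
def galMap (σ : K ≃ₐ[ℚ] K) (𝔞 : Ideal (𝓞 K)) : Ideal (𝓞 K) :=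
  Ideal.map (RingOfIntegers.mapRingHom (σ : K →+* K)) 𝔞

/-- The spin `spin(σ,𝔞) = (α/σ𝔞)` of a principal ideal `𝔞` having a totally positive
generator `α`; under the standing hypotheses (totally real, totally positive units are
squares) this is independent of the chosen totally positive generator, so the value below,
computed at an arbitrarily chosen such generator, is the spin. For ideals with no totally
positive generator the value is irrelevant (set to `0`). -/
def spin (σ : K ≃ₐ[ℚ] K) (𝔞 : Ideal (𝓞 K)) : ℤ :=
  if h : ∃ α : 𝓞 K, Ideal.span {α} = 𝔞 ∧ TotPos α then
    quadSym (galMap σ 𝔞) h.choose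
  else 0

/-- An ideal of the ring of integers is odd if it is coprime to `2`. -/
def OddIdeal (𝔞 : Ideal (𝓞 K)) : Prop := IsCoprime 𝔞 (Ideal.span {(2 : 𝓞 K)})

/-- **Conjecture `C_n`** with exponent `δ`: for every `ε > 0` there is a constant `C(ε)`
such that for all `Q ≥ 3`, all real `M ≥ 0`, all `1 ≤ N ≤ Q^{1/n}` and every non-principal
real Dirichlet character `χ` of modulus `q ≤ Q`,
`|∑_{M < m ≤ M+N} χ(m)| ≤ C(ε) Q^{(1-δ)/n+ε}`. -/
def ConjectureC (n : ℕ) (δ : ℝ) : Prop :=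
  ∀ ε : ℝ, 0 < ε → ∃ C : ℝ, 0 < C ∧
    ∀ Q : ℝ, 3 ≤ Q → ∀ M : ℝ, 0 ≤ M → ∀ N : ℝ, 1 ≤ N → N ≤ Q ^ ((1 : ℝ) / n) →
      ∀ q : ℕ, 0 < q → (q : ℝ) ≤ Q → ∀ χ : DirichletCharacter ℤ q, χ ≠ 1 →
        |∑ m ∈ Finset.Ioc ⌊M⌋₊ ⌊M + N⌋₊, ((χ (m : ZMod q) : ℤ) : ℝ)| ≤
          C * Q ^ ((1 - δ) / n + ε)

section

open UniqueFactorizationMonoid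
open Filter (Tendsto atTop)
open Ideal (isPrime_of_prime prime_of_isPrime one_eq_top span isCoprime_iff_sup_eq span_singleton_le_iff_mem dvd_iff_le zero_eq_bot span_singleton_eq_bot mem_span_singleton absNorm_mem isCoprime_iff_exists mul_le_left span_singleton_one absNorm_dvd_absNorm_of_le absNorm_top dvd_span_singleton span_singleton_mul_span_singleton absNorm_apply mem_span_singleton_self mapHom absNorm finiteQuotientOfFreeOfNeBot)
open Ideal.Quotient (eq_zero_iff_mem field mk_surjective)
open Fintype (ofFinite card_fin sum_equiv piFinset card_piFinset mem_piFinset card_pos card)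
open NumberField.RingOfIntegers (mapRingHom basis)
open Finset (mem_product mem_image univ mem_image_of_mem mem_univ sum_image sum_mul_sum sum_product sum_congr mul_sum mem_filter sum_const sum_mul sum_comm sum_filter sum_eq_single prod_pos prod_mul_distrib prod_congr sum_eq_zero sum_add_distrib prod_const card_univ single_le_sum card_product card_le_card card_image_le range mem_range mem_singleton mul_prod_erase Icc mem_Icc sum_le_sum sum_div sum_range_succ abs_sum_le_sum_abs sum_nbij' mem_powerset card_range sum_nonneg sum_sub_distrib card_le_card_of_injOn dvd_prod_of_mem abs_prod sum_fiberwise_of_maps_to sum_le_card_nsmul univ_nonempty Ioc Ico ne_of_mem_erase card_erase_of_mem mem_erase le_sup mem_inter)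
open AddSubgroup (mem_addSubgroupOf coe_neg zmultiples)
open QuotientAddGroup (out_eq' mk_nsmul induction_on)
open Complex (norm_exp add_re re_ofReal_mul I_re zero_re I_ne_zero ofReal_re exp_add I_sq conj_ofReal conj_I cpow_def_of_ne_zero ofReal_log slitPlane exp_ne_zero exp_conj ofRealHom norm_real I exp)
open Real (sqrt sqrt_eq_rpow sqrt_sq sqrt_pos rpow_natCast rpow_mul rpow_one mul_rpow rpow_add sqrt_nonneg one_le_rpow rpow_le_rpow rpow_le_rpow_of_exponent_le log_le_log log_nonneg pi log)
open Module (Basis finrank finrank_pos)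
open Algebra (smul_def coe_norm_int trace)
open Submodule (smul_mem cardQuot_apply)
open Multiset (le_iff_subset mem_toFinset toFinset_val)
open Nat (cast_mul le_floor one_le_iff_ne_zero cast_one cast_pow floor_le mod_lt mod_eq_of_lt le_succ succ_ne_zero cast_nonneg cast_le cast_add cast_pred)
open Subgroup (zpowers)
open IsGalois (card_aut_eq_finrank)

local notation "OK" => 𝓞 K
local notation "IK" => Ideal (𝓞 K)
local notation "IQ" => Ideal.Quotient.mk

variable (K) in
/-- Every totally positive unit is a square. -/
abbrev UnitsSq : Prop := ∀ u : OKˣ, TotPos (u : OK) → ∃ w : OKˣ, u = w ^ 2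

theorem mem_normalizedFactors_ideal {𝔟 𝔭 : IK} (h : 𝔭 ∈ normalizedFactors 𝔟) :
    𝔭 ≠ ⊥ ∧ 𝔭.IsPrime ∧ 𝔟 ≤ 𝔭 := by
  have h1 := prime_of_normalized_factor 𝔭 h
  exact ⟨h1.ne_zero, isPrime_of_prime h1, Ideal.le_of_dvd (dvd_of_mem_normalizedFactors h)⟩

theorem legSym_eq_zero_iff {𝔭 : IK} {a : OK} : legSym 𝔭 a = 0 ↔ a ∈ 𝔭 := by
  rw [← eq_zero_iff_mem, legSym]
  split_ifs <;> simp_all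

theorem legSym_congr {𝔭 : IK} {a b : OK} (h : a - b ∈ 𝔭) :
    legSym 𝔭 a = legSym 𝔭 b := by
  have : IQ 𝔭 a = IQ 𝔭 b := Ideal.Quotient.eq.2 h
  simp only [legSym, this]

theorem legSym_mul {𝔭 : IK} (h0 : 𝔭 ≠ ⊥) (hp : 𝔭.IsPrime) (a b : OK) :
    legSym 𝔭 (a * b) = legSym 𝔭 a * legSym 𝔭 b := by
  have : 𝔭.IsMaximal := hp.isMaximal h0
  let _ : Field (OK ⧸ 𝔭) := field 𝔭
  have : Finite (OK ⧸ 𝔭) := finiteQuotientOfFreeOfNeBot 𝔭 h0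
  let _ : Fintype (OK ⧸ 𝔭) := ofFinite _
  have key : ∀ x : OK, legSym 𝔭 x = quadraticChar (OK ⧸ 𝔭) (IQ 𝔭 x) := by
    intro x
    simp only [quadraticChar_apply, quadraticCharFun, legSym]
    congr
  rw [key, key, key, map_mul, map_mul]

theorem legSym_trichotomy (𝔭 : IK) (a : OK) :
    legSym 𝔭 a = 0 ∨ legSym 𝔭 a = 1 ∨ legSym 𝔭 a = -1 := by
  unfold legSym; split_ifs <;> simp

theorem quadSym_mul_right (𝔟 : IK) (a b : OK) :
    quadSym 𝔟 (a * b) = quadSym 𝔟 a * quadSym 𝔟 b := by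
  unfold quadSym
  rw [← Multiset.prod_map_mul]
  congr 1
  apply Multiset.map_congr rfl
  intro 𝔭 h
  obtain ⟨h0, h1, -⟩ := mem_normalizedFactors_ideal h
  exact legSym_mul h0 h1 a b

theorem quadSym_mul_left {𝔞 𝔟 : IK} (ha : 𝔞 ≠ ⊥) (hb : 𝔟 ≠ ⊥) (a : OK) :
    quadSym (𝔞 * 𝔟) a = quadSym 𝔞 a * quadSym 𝔟 a := by
  unfold quadSym
  rw [normalizedFactors_mul ha hb, Multiset.map_add, Multiset.prod_add]

theorem quadSym_of_prime {𝔭 : IK} (h0 : 𝔭 ≠ ⊥) (hp : 𝔭.IsPrime) (a : OK) :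
    quadSym 𝔭 a = legSym 𝔭 a := by
  unfold quadSym
  rw [normalizedFactors_irreducible (prime_of_isPrime h0 hp).irreducible]
  simp

theorem quadSym_top (a : OK) : quadSym ⊤ a = 1 := by
  unfold quadSym
  rw [← one_eq_top, UniqueFactorizationMonoid.normalizedFactors_one]
  simp

theorem quadSym_congr {𝔟 : IK} {a b : OK} (h : a - b ∈ 𝔟) :
    quadSym 𝔟 a = quadSym 𝔟 b := by
  unfold quadSym
  congr 1
  apply Multiset.map_congr rfl
  intro 𝔭 hp
  exact legSym_congr ((mem_normalizedFactors_ideal hp).2.2 h)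

theorem quadSym_trichotomy (𝔟 : IK) (a : OK) :
    quadSym 𝔟 a = 0 ∨ quadSym 𝔟 a = 1 ∨ quadSym 𝔟 a = -1 := by
  unfold quadSym
  induction UniqueFactorizationMonoid.normalizedFactors 𝔟 using Multiset.induction with
  | empty => simp
  | cons 𝔭 s ih =>
    rw [Multiset.map_cons, Multiset.prod_cons]
    rcases legSym_trichotomy 𝔭 a with h | h | h <;> rcases ih with h' | h' | h' <;> simp [h, h']

theorem abs_quadSym_le (𝔟 : IK) (a : OK) : |quadSym 𝔟 a| ≤ 1 := by
  rcases quadSym_trichotomy 𝔟 a with h | h | h <;> simp [h]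

theorem quadSym_eq_zero_iff {𝔟 : IK} (hb : 𝔟 ≠ ⊥) {a : OK} :
    quadSym 𝔟 a = 0 ↔ ¬ IsCoprime (span {a}) 𝔟 := by
  unfold quadSym
  rw [Multiset.prod_eq_zero_iff, Multiset.mem_map]
  constructor
  · rintro ⟨𝔭, hp, h⟩ hc
    obtain ⟨h0, h1, h2⟩ := mem_normalizedFactors_ideal hp
    rw [legSym_eq_zero_iff] at h
    rw [isCoprime_iff_sup_eq] at hc
    exact h1.ne_top (top_le_iff.1 (hc ▸ sup_le ((span_singleton_le_iff_mem _).2 h) h2))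
  · intro hc
    rw [isCoprime_iff_sup_eq] at hc
    obtain ⟨𝔭, hm, hle⟩ := Ideal.exists_le_maximal _ hc
    have h2 : 𝔟 ≤ 𝔭 := le_sup_right.trans hle
    have h0 : 𝔭 ≠ ⊥ := fun h => hb (le_bot_iff.1 (h ▸ h2))
    have hpp := prime_of_isPrime h0 hm.isPrime
    refine ⟨𝔭, ?_, legSym_eq_zero_iff.2 ((span_singleton_le_iff_mem _).1 (le_sup_left.trans hle))⟩
    obtain ⟨q, hq, hqe⟩ := exists_mem_normalizedFactors_of_dvd hb hpp.irreducible
      (dvd_iff_le.2 h2)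
    rwa [associated_iff_eq.1 hqe]

theorem quadSym_ne_zero_iff {𝔟 : IK} (hb : 𝔟 ≠ ⊥) {a : OK} :
    quadSym 𝔟 a ≠ 0 ↔ IsCoprime (span {a}) 𝔟 := by
  rw [Ne, quadSym_eq_zero_iff hb, not_not]

theorem quadSym_sq {𝔟 : IK} {a : OK} (h : quadSym 𝔟 a ≠ 0) :
    quadSym 𝔟 a * quadSym 𝔟 a = 1 := by
  rcases quadSym_trichotomy 𝔟 a with h' | h' | h' <;> simp_all

/-- The action of an automorphism on integers. -/
def gal (τ : Gal(K/ℚ)) : OK ≃+* OK := RingOfIntegers.mapRingEquiv (τ : K ≃+* K)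

@[simp] theorem coe_gal (τ : Gal(K/ℚ)) (a : OK) : ((gal τ a : OK) : K) = τ (a : K) := rfl

theorem galMap_eq (τ : Gal(K/ℚ)) (𝔞 : IK) : galMap τ 𝔞 = 𝔞.map (gal τ) := rfl

theorem gal_mul (τ τ' : Gal(K/ℚ)) (a : OK) : gal (τ * τ') a = gal τ (gal τ' a) := rfl

theorem gal_one (a : OK) : gal (1 : Gal(K/ℚ)) a = a := rfl

theorem galMap_mul (τ τ' : Gal(K/ℚ)) (𝔞 : IK) :
    galMap (τ * τ') 𝔞 = galMap τ (galMap τ' 𝔞) :=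
  (Ideal.map_map (I := 𝔞) (mapRingHom (τ' : K →+* K))
    (mapRingHom (τ : K →+* K))).symm

theorem galMap_one (𝔞 : IK) : galMap 1 𝔞 = 𝔞 := Ideal.map_id 𝔞

theorem galMap_inv_apply (τ : Gal(K/ℚ)) (𝔞 : IK) : galMap τ⁻¹ (galMap τ 𝔞) = 𝔞 := by
  rw [← galMap_mul, inv_mul_cancel, galMap_one]

theorem galMap_apply_inv (τ : Gal(K/ℚ)) (𝔞 : IK) : galMap τ (galMap τ⁻¹ 𝔞) = 𝔞 := by
  rw [← galMap_mul, mul_inv_cancel, galMap_one]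

theorem gal_inv_apply (τ : Gal(K/ℚ)) (a : OK) : gal τ⁻¹ (gal τ a) = a := by
  rw [← gal_mul, inv_mul_cancel, gal_one]

theorem gal_apply_inv (τ : Gal(K/ℚ)) (a : OK) : gal τ (gal τ⁻¹ a) = a := by
  rw [← gal_mul, mul_inv_cancel, gal_one]

/-- The action of an automorphism on ideals as a multiplicative equivalence. -/
def galIdeal (τ : Gal(K/ℚ)) : IK ≃* IK where
  toFun := galMap τ
  invFun := galMap τ⁻¹
  left_inv := galMap_inv_apply τ
  right_inv := galMap_apply_inv τ
  map_mul' _ _ := Ideal.map_mul _ _ _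

@[simp] theorem galIdeal_apply (τ : Gal(K/ℚ)) (𝔞 : IK) : galIdeal τ 𝔞 = galMap τ 𝔞 := rfl

theorem galMap_mul_ideal (τ : Gal(K/ℚ)) (𝔞 𝔟 : IK) :
    galMap τ (𝔞 * 𝔟) = galMap τ 𝔞 * galMap τ 𝔟 := Ideal.map_mul _ _ _

theorem galMap_ne_bot {τ : Gal(K/ℚ)} {𝔞 : IK} (h : 𝔞 ≠ ⊥) : galMap τ 𝔞 ≠ ⊥ := by
  intro h'
  apply h
  have := galMap_inv_apply τ 𝔞
  rw [h'] at this
  rw [← this]; exact Ideal.map_bot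

theorem galMap_span (τ : Gal(K/ℚ)) (a : OK) :
    galMap τ (span {a}) = span {gal τ a} := by
  rw [galMap_eq, Ideal.map_span, Set.image_singleton]

theorem gal_mem_galMap {τ : Gal(K/ℚ)} {𝔞 : IK} {a : OK} :
    gal τ a ∈ galMap τ 𝔞 ↔ a ∈ 𝔞 := by
  constructor
  · intro h
    have := Ideal.mem_map_of_mem (gal τ⁻¹) h
    rw [gal_inv_apply] at this
    rwa [← galMap_inv_apply τ 𝔞]
  · exact fun h => Ideal.mem_map_of_mem (gal τ) h

theorem normalizedFactors_galMap (τ : Gal(K/ℚ)) (𝔟 : IK) :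
    normalizedFactors (galMap τ 𝔟) = (normalizedFactors 𝔟).map (galMap τ) := by
  by_cases hb : 𝔟 = ⊥
  · subst hb
    have : galMap τ (⊥ : IK) = ⊥ := Ideal.map_bot
    rw [this, ← zero_eq_bot, normalizedFactors_zero]; rfl
  have h := Ideal.prod_normalizedFactors_eq_self hb
  conv_lhs => rw [← h]
  have : galMap τ (normalizedFactors 𝔟).prod = ((normalizedFactors 𝔟).map (galMap τ)).prod :=
    map_multiset_prod (galIdeal τ) _
  rw [this]
  refine (normalizedFactors_prod_of_prime ?_)
  intro 𝔭 hp
  obtain ⟨𝔮, hq, rfl⟩ := Multiset.mem_map.1 hp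
  exact (MulEquiv.prime_iff (galIdeal τ)).2 (prime_of_normalized_factor 𝔮 hq)

theorem legSym_galMap (τ : Gal(K/ℚ)) (𝔭 : IK) (a : OK) :
    legSym (galMap τ 𝔭) (gal τ a) = legSym 𝔭 a := by
  have h1 : IQ (galMap τ 𝔭) (gal τ a) = 0 ↔ IQ 𝔭 a = 0 := by
    rw [eq_zero_iff_mem, eq_zero_iff_mem, gal_mem_galMap]
  have hsq : ∀ (𝔮 : IK) (x : OK), IsSquare (IQ 𝔮 x) ↔
      ∃ v, x - v * v ∈ 𝔮 := by
    intro 𝔮 x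
    constructor
    · rintro ⟨r, hr⟩
      obtain ⟨v, rfl⟩ := mk_surjective r
      exact ⟨v, by rw [← Ideal.Quotient.eq, hr, map_mul]⟩
    · rintro ⟨v, hv⟩
      exact ⟨IQ 𝔮 v, by rw [← map_mul]; exact Ideal.Quotient.eq.2 hv⟩
  have h2 : IsSquare (IQ (galMap τ 𝔭) (gal τ a)) ↔
      IsSquare (IQ 𝔭 a) := by
    rw [hsq, hsq]
    constructor
    · rintro ⟨v, hv⟩
      refine ⟨gal τ⁻¹ v, ?_⟩
      rw [← gal_mem_galMap (τ := τ), map_sub, map_mul, gal_apply_inv]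
      exact hv
    · rintro ⟨v, hv⟩
      refine ⟨gal τ v, ?_⟩
      rw [← map_mul, ← map_sub, gal_mem_galMap]
      exact hv
  simp only [legSym, h1, h2]

theorem quadSym_galMap (τ : Gal(K/ℚ)) (𝔟 : IK) (a : OK) :
    quadSym (galMap τ 𝔟) (gal τ a) = quadSym 𝔟 a := by
  unfold quadSym
  rw [normalizedFactors_galMap, Multiset.map_map]
  simp only [Function.comp_def, legSym_galMap]

/-- A finite set of representatives of `M` modulo `Λ`. -/
def IsReps {V : Type*} [AddCommGroup V] (M Λ : AddSubgroup V) (s : Finset V) : Prop :=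
  (∀ r ∈ s, r ∈ M) ∧ ∀ x ∈ M, ∃! r, r ∈ s ∧ x - r ∈ Λ

/-- The sum of a function over representatives of `M` modulo `Λ`. -/
def cosetSum {V : Type*} [AddCommGroup V] (M Λ : AddSubgroup V) (φ : V → ℂ) : ℂ :=
  if h : ∃ s, IsReps M Λ s then ∑ r ∈ h.choose, φ r else 0

section reps

variable {V : Type*} [AddCommGroup V] {M Λ M₁ M₂ Λ' M' : AddSubgroup V} {φ φ' : V → ℂ}
  {s t : Finset V}

theorem IsReps.sum_eq (hs : IsReps M Λ s) (ht : IsReps M Λ t)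
    (hφ : ∀ x ∈ M, ∀ y ∈ M, x - y ∈ Λ → φ x = φ y) : ∑ r ∈ s, φ r = ∑ r ∈ t, φ r := by
  choose! f hf hf' using ht.2
  choose! g hg hg' using hs.2
  refine Finset.sum_bij' (fun r _ => f r) (fun r _ => g r) ?_ ?_ ?_ ?_ ?_
  · exact fun r hr => (hf r (hs.1 r hr)).1
  · exact fun r hr => (hg r (ht.1 r hr)).1
  · intro r hr
    have h1 := hf r (hs.1 r hr)
    refine (hg' _ (ht.1 _ h1.1) r ⟨hr, ?_⟩).symm
    rw [← neg_sub]; exact Λ.neg_mem h1.2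
  · intro r hr
    have h1 := hg r (ht.1 r hr)
    refine (hf' _ (hs.1 _ h1.1) r ⟨hr, ?_⟩).symm
    rw [← neg_sub]; exact Λ.neg_mem h1.2
  · intro r hr
    have h1 := hf r (hs.1 r hr)
    exact hφ _ (hs.1 r hr) _ (ht.1 _ h1.1) h1.2

theorem cosetSum_eq (hs : IsReps M Λ s)
    (hφ : ∀ x ∈ M, ∀ y ∈ M, x - y ∈ Λ → φ x = φ y) : cosetSum M Λ φ = ∑ r ∈ s, φ r := by
  have h : ∃ s, IsReps M Λ s := ⟨s, hs⟩
  rw [cosetSum, dif_pos h]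
  exact h.choose_spec.sum_eq hs hφ

theorem IsReps.inj (hs : IsReps M Λ s) {x y : V} (hx : x ∈ s) (hy : y ∈ s) (h : x - y ∈ Λ) :
    x = y :=
  (hs.2 x (hs.1 x hx)).unique ⟨hx, by rw [sub_self]; exact Λ.zero_mem⟩ ⟨hy, h⟩

theorem IsReps.change (hs : IsReps M Λ s) (hM : M ≤ M') (hinf : ∀ x ∈ M, x ∈ Λ' → x ∈ Λ)
    (hΛ : Λ ≤ Λ') (hsup : ∀ x ∈ M', ∃ y ∈ M, x - y ∈ Λ') : IsReps M' Λ' s := by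
  refine ⟨fun r hr => hM (hs.1 r hr), fun x hx => ?_⟩
  obtain ⟨y, hy, hxy⟩ := hsup x hx
  obtain ⟨r, ⟨hr, hr'⟩, hu⟩ := hs.2 y hy
  refine ⟨r, ⟨hr, ?_⟩, ?_⟩
  · have := Λ'.add_mem hxy (hΛ hr')
    simpa using this
  · rintro z ⟨hz, hz'⟩
    apply hu z ⟨hz, ?_⟩
    apply hinf _ (M.sub_mem hy (hs.1 z hz))
    have := Λ'.sub_mem hz' hxy
    simpa using this

theorem IsReps.prod {s₁ s₂ : Finset V} (h₁ : IsReps M₁ Λ s₁) (h₂ : IsReps M₂ Λ s₂)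
    (hl1 : Λ ≤ M₁) (hl2 : Λ ≤ M₂) (hM₁ : M₁ ≤ M) (hM₂ : M₂ ≤ M)
    (hinf : ∀ x ∈ M₁, x ∈ M₂ → x ∈ Λ) (hsup : ∀ x ∈ M, ∃ y ∈ M₁, ∃ z ∈ M₂, x = y + z) :
    IsReps M Λ ((s₁ ×ˢ s₂).image fun p => p.1 + p.2) ∧
      Set.InjOn (fun p : V × V => p.1 + p.2) (s₁ ×ˢ s₂ : Finset (V × V)) := by
  have key : ∀ p ∈ s₁ ×ˢ s₂, ∀ p' ∈ s₁ ×ˢ s₂, p.1 + p.2 - (p'.1 + p'.2) ∈ Λ → p = p' := by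
    rintro ⟨a, b⟩ hp ⟨a', b'⟩ hp' h
    rw [mem_product] at hp hp'
    simp only at *
    have ha := M₁.sub_mem (h₁.1 a hp.1) (h₁.1 a' hp'.1)
    have hb := M₂.sub_mem (h₂.1 b hp.2) (h₂.1 b' hp'.2)
    have e1 : a - a' = (a + b - (a' + b')) - (b - b') := by abel
    have e2 : b - b' = (a + b - (a' + b')) - (a - a') := by abel
    have ha2 : a - a' ∈ M₂ := by rw [e1]; exact M₂.sub_mem (hl2 h) hb
    have hb2 : b - b' ∈ M₁ := by rw [e2]; exact M₁.sub_mem (hl1 h) ha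
    rw [h₁.inj hp.1 hp'.1 (hinf _ ha ha2), h₂.inj hp.2 hp'.2 (hinf _ hb2 hb)]
  refine ⟨⟨?_, ?_⟩, ?_⟩
  · intro r hr
    obtain ⟨p, hp, rfl⟩ := mem_image.1 hr
    rw [mem_product] at hp
    exact M.add_mem (hM₁ (h₁.1 _ hp.1)) (hM₂ (h₂.1 _ hp.2))
  · intro x hx
    obtain ⟨y, hy, z, hz, rfl⟩ := hsup x hx
    obtain ⟨a, ⟨ha, ha'⟩, -⟩ := h₁.2 y hy
    obtain ⟨b, ⟨hb, hb'⟩, -⟩ := h₂.2 z hz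
    have hab : y + z - (a + b) ∈ Λ := by
      rw [add_sub_add_comm]; exact Λ.add_mem ha' hb'
    refine ⟨a + b, ⟨mem_image.2 ⟨(a, b), mem_product.2 ⟨ha, hb⟩, rfl⟩, hab⟩, ?_⟩
    rintro w ⟨hw, hw'⟩
    obtain ⟨p, hp, rfl⟩ := mem_image.1 hw
    have := key p hp (a, b) (mem_product.2 ⟨ha, hb⟩) (by
      have := Λ.sub_mem hab hw'
      simpa using this)
    rw [this]
  · intro p hp p' hp' h
    refine key p hp p' hp' ?_
    simp only at h
    rw [h, sub_self]; exact Λ.zero_mem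

theorem exists_isReps [hfin : Finite (M ⧸ Λ.addSubgroupOf M)] : ∃ s, IsReps M Λ s := by
  have : Fintype (M ⧸ Λ.addSubgroupOf M) := ofFinite _
  have key : ∀ a b : M, (QuotientAddGroup.mk a : M ⧸ Λ.addSubgroupOf M) = QuotientAddGroup.mk b ↔
      (a : V) - b ∈ Λ := by
    intro a b
    rw [QuotientAddGroup.eq, mem_addSubgroupOf, ← Λ.neg_mem_iff]
    simp only [AddSubgroup.coe_add, coe_neg, neg_add_rev, neg_neg, neg_add_eq_sub, sub_eq_add_neg, add_comm]
  refine ⟨univ.image fun q : M ⧸ Λ.addSubgroupOf M => (q.out : V), ?_, ?_⟩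
  · intro r hr
    obtain ⟨q, -, rfl⟩ := mem_image.1 hr
    exact (q.out).2
  · intro x hx
    set q : M ⧸ Λ.addSubgroupOf M := QuotientAddGroup.mk ⟨x, hx⟩ with hq
    refine ⟨(q.out : V), ⟨mem_image_of_mem _ (mem_univ _), ?_⟩, ?_⟩
    · exact (key ⟨x, hx⟩ q.out).1 (by rw [← hq]; exact (out_eq' q).symm)
    · rintro y ⟨hy, hy'⟩
      obtain ⟨q', -, rfl⟩ := mem_image.1 hy
      have := (key ⟨x, hx⟩ q'.out).2 hy'
      rw [hq, this, out_eq' q']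

theorem finite_quot_of_fg (hM : M.FG) (k : ℕ) (hk : k ≠ 0) (h : ∀ x ∈ M, k • x ∈ Λ) :
    Finite (M ⧸ Λ.addSubgroupOf M) := by
  have : AddGroup.FG M := (AddGroup.fg_iff_addSubgroup_fg M).2 hM
  have : AddGroup.FG (M ⧸ Λ.addSubgroupOf M) := QuotientAddGroup.fg (Λ.addSubgroupOf M)
  refine AddCommGroup.finite_of_fg_torsion _ ?_
  intro q
  obtain ⟨x, rfl⟩ := QuotientAddGroup.mk_surjective q
  rw [isOfFinAddOrder_iff_nsmul_eq_zero]
  refine ⟨k, Nat.pos_of_ne_zero hk, ?_⟩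
  rw [← mk_nsmul, QuotientAddGroup.eq_zero_iff, mem_addSubgroupOf]
  exact h x x.2

theorem cosetSum_prod (h₁ : ∃ s, IsReps M₁ Λ s) (h₂ : ∃ s, IsReps M₂ Λ s)
    (hl1 : Λ ≤ M₁) (hl2 : Λ ≤ M₂) (hM₁ : M₁ ≤ M) (hM₂ : M₂ ≤ M)
    (hinf : ∀ x ∈ M₁, x ∈ M₂ → x ∈ Λ) (hsup : ∀ x ∈ M, ∃ y ∈ M₁, ∃ z ∈ M₂, x = y + z)
    (hφ : ∀ x ∈ M, ∀ y ∈ M, x - y ∈ Λ → φ x = φ y)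
    (hmul : ∀ x ∈ M₁, ∀ y ∈ M₂, φ (x + y) = φ x * φ y) :
    cosetSum M Λ φ = cosetSum M₁ Λ φ * cosetSum M₂ Λ φ := by
  obtain ⟨s₁, h₁⟩ := h₁
  obtain ⟨s₂, h₂⟩ := h₂
  obtain ⟨h, hinj⟩ := h₁.prod h₂ hl1 hl2 hM₁ hM₂ hinf hsup
  rw [cosetSum_eq h hφ, sum_image hinj,
    cosetSum_eq h₁ (fun x hx y hy => hφ x (hM₁ hx) y (hM₁ hy)),
    cosetSum_eq h₂ (fun x hx y hy => hφ x (hM₂ hx) y (hM₂ hy)), sum_mul_sum,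
    sum_product]
  refine sum_congr rfl fun x hx => sum_congr rfl fun y hy => ?_
  exact hmul x (h₁.1 x hx) y (h₂.1 y hy)

theorem cosetSum_change (h : ∃ s, IsReps M Λ s) (hM : M ≤ M') (hinf : ∀ x ∈ M, x ∈ Λ' → x ∈ Λ)
    (hΛ : Λ ≤ Λ') (hsup : ∀ x ∈ M', ∃ y ∈ M, x - y ∈ Λ')
    (hφ : ∀ x ∈ M', ∀ y ∈ M', x - y ∈ Λ' → φ x = φ y) :
    cosetSum M Λ φ = cosetSum M' Λ' φ := by
  obtain ⟨s, h⟩ := h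
  rw [cosetSum_eq h (fun x hx y hy hxy => hφ x (hM hx) y (hM hy) (hΛ hxy)),
    cosetSum_eq (h.change hM hinf hΛ hsup) hφ]

theorem cosetSum_congr (hφ : ∀ x ∈ M, φ x = φ' x) : cosetSum M Λ φ = cosetSum M Λ φ' := by
  unfold cosetSum
  split_ifs with h
  · exact sum_congr rfl fun x hx => hφ x (h.choose_spec.1 x hx)
  · rfl

end reps

theorem summable_gauss {a : ℂ} (ha : 0 < a.re) (b : ℂ) :
    Summable fun n : ℤ => exp (-pi * a * n ^ 2 + 2 * pi * b * n) := by
  have h := (summable_jacobiTheta₂_term_iff (-I * b) (I * a)).2 (by simpa using ha)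
  refine h.congr fun n => ?_
  unfold jacobiTheta₂_term
  congr 1
  linear_combination (pi * (n : ℂ) ^ 2 * a - 2 * pi * n * b) * Complex.I_mul_I

open Topology in
theorem tendsto_gauss_tsum {l : Filter ℝ} {a : ℝ → ℂ} (ha : Tendsto (fun t => (a t).re) l atTop)
    [l.IsCountablyGenerated] (b : ℝ) :
    Tendsto (fun t => ∑' n : ℤ, exp (-pi * a t * n ^ 2 + 2 * pi * (b * I) * n))
      l (𝓝 1) := by
  have h1 : (1 : ℂ) = ∑' n : ℤ, if n = 0 then (1 : ℂ) else 0 := by rw [tsum_ite_eq]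
  have hnorm : ∀ (z : ℂ) (n : ℤ),
      ‖exp (-pi * z * n ^ 2 + 2 * pi * (b * I) * n)‖ =
        Real.exp (-pi * z.re * (n : ℝ) ^ 2) := by
    intro z n
    rw [norm_exp]
    congr 1
    have e1 : (-pi * z * n ^ 2 + 2 * pi * (b * I) * n : ℂ) =
      ((-pi * (n : ℝ) ^ 2 : ℝ) : ℂ) * z + ((2 * pi * b * n : ℝ) : ℂ) * I := by
      push_cast; ring
    rw [e1]
    simp only [add_re, re_ofReal_mul, I_re, mul_zero, add_zero]
    ring
  rw [h1]
  refine tendsto_tsum_of_dominated_convergence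
    (bound := fun n : ℤ => Real.exp (-pi * 1 * (n : ℝ) ^ 2)) ?_ ?_ ?_
  · refine (summable_gauss (a := 1) (by simp) 0).norm.congr fun n => ?_
    have := hnorm 1 n
    rw [Complex.one_re] at this
    rw [← this, norm_exp, norm_exp]
    congr 1
    have e1 : (2 * pi * (b * I) * n : ℂ) = ((2 * pi * b * n : ℝ) : ℂ) * I := by
      push_cast; ring
    rw [add_re, add_re, e1]
    simp only [mul_zero, zero_mul, zero_re, re_ofReal_mul, I_re]
  · intro n
    by_cases hn : n = 0
    · subst hn; simpa using tendsto_const_nhds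
    · rw [if_neg hn, tendsto_zero_iff_norm_tendsto_zero]
      simp only [hnorm]
      refine Real.tendsto_exp_atBot.comp ?_
      have hpos : 0 < pi * (n : ℝ) ^ 2 := by positivity
      have := (ha.const_mul_atTop hpos)
      refine (Filter.tendsto_neg_atTop_atBot.comp this).congr fun t => ?_
      simp only [Function.comp]; ring
  · filter_upwards [ha.eventually_ge_atTop 1] with t ht n
    rw [hnorm]
    apply Real.exp_le_exp.2
    have : 0 ≤ pi * (n : ℝ) ^ 2 := by positivity
    nlinarith

open Topology in
/-- The quadratic Gauss sum of modulus `2 D`, up to a positive factor. -/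
theorem gauss_rank_one (D : ℕ) (hD : 0 < D) : ∃ r : ℝ, 0 < r ∧
    ∑ k : Fin (2 * D), exp (pi * I * (k : ℕ) ^ 2 / (2 * D)) =
      r * exp (pi * I / 4) := by
  have : NeZero (2 * D) := ⟨by omega⟩
  set N : ℝ := 2 * D with hN
  have hN0 : 0 < N := by positivity
  have hNC : (N : ℂ) ≠ 0 := by exact_mod_cast hN0.ne'
  have hND : (N : ℂ) = 2 * D := by rw [hN]; push_cast; rfl
  set a : ℝ → ℂ := fun t => t - I / N with ha
  set z : ℝ → ℂ := fun t => -I * N / a t with hz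
  have hare : ∀ t, (a t).re = t := by
    intro t
    have : a t = (t : ℂ) - ((1 / N : ℝ) : ℂ) * I := by
      simp only [ha]; push_cast; ring
    rw [this, Complex.sub_re, re_ofReal_mul]; simp
  have ha0 : a 0 ≠ 0 := by
    simp only [ha, Complex.ofReal_zero, zero_sub, neg_ne_zero]
    exact div_ne_zero I_ne_zero hNC
  have hacont : Continuous a := by simp only [ha]; fun_prop
  set S := ∑ k : Fin (2 * D), exp (pi * I * (k : ℕ) ^ 2 / (2 * D)) with hS
  let Θ : ℝ → ℂ := fun t => ∑' n : ℤ, exp (-pi * a t * n ^ 2)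
  have hsqrt : ∀ t : ℝ, 0 < t → ((t : ℂ)) ^ (1 / 2 : ℂ) = ((sqrt t : ℝ) : ℂ) := by
    intro t ht
    rw [sqrt_eq_rpow, Complex.ofReal_cpow ht.le]; norm_num
  have hA : Tendsto (fun t : ℝ => (sqrt t * N : ℝ) * Θ t) (𝓝[>] 0) (𝓝 S) := by
    have h1 : ∀ t : ℝ, 0 < t → (sqrt t * N : ℝ) * Θ t =
        ∑ k : Fin (2 * D), exp (pi * I * (k : ℕ) ^ 2 / (2 * D)) *
          ∑' n : ℤ, exp (-pi * ((1 / (t * N ^ 2) : ℝ) : ℂ) * n ^ 2 +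
            2 * pi * ((-((k : ℕ) : ℝ) / N : ℝ) * I) * n) := by
      intro t ht
      have hs : Summable fun n : ℤ => exp (-pi * a t * n ^ 2) := by
        simpa using summable_gauss (a := a t) (by rw [hare]; exact ht) 0
      have e1 : Θ t = ∑ k : Fin (2 * D), ∑' m : ℤ,
          exp (-pi * a t * ((m * (2 * D : ℕ) + (k : ℕ) : ℤ) : ℂ) ^ 2) := by
        have h2 := (Int.divModEquiv (2 * D)).symm.tsum_eq
          (fun n : ℤ => exp (-pi * a t * n ^ 2))
        have h3 : Summable fun p : ℤ × Fin (2 * D) => exp (-pi * a t *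
            (((Int.divModEquiv (2 * D)).symm p : ℤ) : ℂ) ^ 2) :=
          (Int.divModEquiv (2 * D)).symm.summable_iff.2 hs
        have h4 : Summable fun p : Fin (2 * D) × ℤ => exp (-pi * a t *
            (((Int.divModEquiv (2 * D)).symm p.swap : ℤ) : ℂ) ^ 2) :=
          (Equiv.prodComm _ _).summable_iff.2 h3
        rw [show Θ t = _ from h2.symm, ← (Equiv.prodComm (Fin (2 * D)) ℤ).tsum_eq]
        refine Eq.trans h4.tsum_prod ?_
        rw [tsum_fintype]
        rfl
      rw [e1, mul_sum]
      refine sum_congr rfl fun k _ => ?_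
      have hb : 0 < ((1 / (t * N ^ 2) : ℝ) : ℂ).re := by rw [ofReal_re]; positivity
      have e2 := Complex.tsum_exp_neg_quadratic hb ((-((k : ℕ) : ℝ) / N : ℝ) * I)
      rw [e2, hsqrt _ (by positivity)]
      have e3 : ∀ m : ℤ, exp (-pi * a t * ((m * (2 * D : ℕ) + (k : ℕ) : ℤ) : ℂ) ^ 2) =
          exp (pi * I * (k : ℕ) ^ 2 / (2 * D)) *
          exp (-pi / ((1 / (t * N ^ 2) : ℝ) : ℂ) * (m + I *
            ((-((k : ℕ) : ℝ) / N : ℝ) * I)) ^ 2) := by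
        intro m
        rw [← exp_add, Complex.exp_eq_exp_iff_exists_int]
        refine ⟨m * (k : ℕ) + D * m ^ 2, ?_⟩
        have ht' : (t : ℂ) ≠ 0 := by exact_mod_cast ht.ne'
        have hDC : (D : ℂ) ≠ 0 := by exact_mod_cast hD.ne'
        simp only [ha]
        push_cast
        rw [hND]
        field_simp
        have : I ^ 2 = -1 := I_sq
        have h4 : I ^ 4 = 1 := Complex.I_pow_four
        ring_nf
        simp only [this, h4]
        ring
      simp only [e3]
      rw [tsum_mul_left]
      have e4 : sqrt (1 / (t * N ^ 2)) = 1 / (sqrt t * N) := by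
        rw [Real.sqrt_div zero_le_one, Real.sqrt_one, Real.sqrt_mul ht.le, sqrt_sq hN0.le]
      rw [e4]
      push_cast
      have : (sqrt t : ℂ) ≠ 0 := by exact_mod_cast (sqrt_pos.2 ht).ne'
      field_simp
    have h2 : Tendsto (fun t : ℝ => ∑ k : Fin (2 * D), exp (pi * I * (k : ℕ) ^ 2 / (2 * D)) *
          ∑' n : ℤ, exp (-pi * ((1 / (t * N ^ 2) : ℝ) : ℂ) * n ^ 2 +
            2 * pi * ((-((k : ℕ) : ℝ) / N : ℝ) * I) * n)) (𝓝[>] 0) (𝓝 S) := by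
      have : S = ∑ k : Fin (2 * D), exp (pi * I * (k : ℕ) ^ 2 / (2 * D)) * 1 := by
        simp only [mul_one, hS]
      rw [this]
      refine tendsto_finset_sum _ fun k _ => Tendsto.const_mul _ ?_
      refine tendsto_gauss_tsum ?_ _
      simp only [ofReal_re]
      have : Tendsto (fun t : ℝ => t⁻¹) (𝓝[>] 0) atTop := tendsto_inv_nhdsGT_zero
      refine (this.atTop_mul_const (show 0 < 1 / N ^ 2 by positivity)).congr fun t => ?_
      rw [one_div, one_div, mul_inv]
    refine h2.congr' ?_
    filter_upwards [self_mem_nhdsWithin] with t ht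
    exact (h1 t ht).symm
  have hB : Tendsto (fun t : ℝ => (sqrt t * N : ℝ) * Θ t) (𝓝[>] 0)
      (𝓝 (N * (1 / a 0 ^ (1 / 2 : ℂ) * (1 / z 0 ^ (1 / 2 : ℂ) * 1)))) := by
    have hat : Tendsto a (𝓝[>] 0) (𝓝 (a 0)) := (hacont.tendsto 0).mono_left nhdsWithin_le_nhds
    have hane : ∀ t : ℝ, 0 < t → a t ≠ 0 := by
      intro t ht h
      have := hare t
      rw [h, zero_re] at this; linarith
    have hz0 : z 0 = ((N ^ 2 : ℝ) : ℂ) := by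
      simp only [hz, ha]; push_cast
      have := I_ne_zero
      field_simp
      ring
    have h1 : ∀ t : ℝ, 0 < t → (sqrt t * N : ℝ) * Θ t =
        N * (1 / a t ^ (1 / 2 : ℂ) * (1 / z t ^ (1 / 2 : ℂ) *
          ∑' n : ℤ, exp (-pi * (a t * I / (N * t)) * n ^ 2 +
            2 * pi * ((0 : ℝ) * I) * n))) := by
      intro t ht
      have hat0 := hane t ht
      have ht' : (t : ℂ) ≠ 0 := by exact_mod_cast ht.ne'
      have hzt0 : z t ≠ 0 := by
        simp only [hz]
        exact div_ne_zero (mul_ne_zero (neg_ne_zero.2 I_ne_zero) hNC) hat0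
      have e1 : Θ t = 1 / a t ^ (1 / 2 : ℂ) * ∑' n : ℤ, exp (-pi / a t * n ^ 2) := by
        have := Complex.tsum_exp_neg_quadratic (a := a t) (by rw [hare]; exact ht) 0
        simp only [mul_zero, zero_mul, add_zero] at this
        exact this
      have e2 : ∀ n : ℤ, exp (-pi / a t * n ^ 2) =
          exp (-pi * (t * z t) * n ^ 2) := by
        intro n
        rw [Complex.exp_eq_exp_iff_exists_int]
        refine ⟨- D * n ^ 2, ?_⟩
        simp only [hz]
        have : (t : ℂ) = a t + I / N := by simp only [ha]; ring
        rw [this]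
        have : I ^ 2 = -1 := I_sq
        field_simp
        push_cast
        ring_nf
        simp only [this]
        rw [hND]
        ring
      have hre : 0 < ((t : ℂ) * z t).re := by
        rw [re_ofReal_mul]
        refine mul_pos ht ?_
        have : z t = (N / Complex.normSq (a t) : ℝ) * (-I * (starRingEnd ℂ) (a t)) := by
          simp only [hz]
          rw [div_eq_mul_inv, Complex.inv_def]
          push_cast; ring
        rw [this, re_ofReal_mul]
        refine mul_pos (div_pos hN0 (Complex.normSq_pos.2 hat0)) ?_
        have hrw : -I * (starRingEnd ℂ) (a t) = ((1 / N : ℝ) : ℂ) + ((-t : ℝ) : ℂ) * I := by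
          simp only [ha, map_sub, map_div₀, conj_ofReal, conj_I]
          have : I ^ 2 = -1 := I_sq
          push_cast
          linear_combination (-1 / (N : ℂ)) * this
        rw [hrw]
        simp only [add_re, ofReal_re, re_ofReal_mul, I_re, mul_zero, add_zero]
        positivity
      have e3 := Complex.tsum_exp_neg_quadratic hre 0
      simp only [mul_zero, zero_mul, add_zero] at e3
      have e4 : ((t : ℂ) * z t) ^ (1 / 2 : ℂ) = (sqrt t : ℂ) * z t ^ (1 / 2 : ℂ) := by
        rw [cpow_def_of_ne_zero (mul_ne_zero ht' hzt0), cpow_def_of_ne_zero hzt0,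
          Complex.log_ofReal_mul ht hzt0, ← hsqrt t ht, cpow_def_of_ne_zero ht',
          ← exp_add, ofReal_log ht.le]
        congr 1; ring
      rw [e1]
      simp only [e2]
      rw [e3, e4]
      have hs0 : (sqrt t : ℂ) ≠ 0 := by exact_mod_cast (sqrt_pos.2 ht).ne'
      have e5 : ∀ n : ℤ, exp (-pi / (t * z t) * n ^ 2) =
          exp (-pi * (a t * I / (N * t)) * n ^ 2 +
            2 * pi * ((0 : ℝ) * I) * n) := by
        intro n
        congr 1
        simp only [hz]
        have hI : I ≠ 0 := I_ne_zero
        push_cast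
        field_simp
        rw [I_sq]; ring
      simp only [e5]
      push_cast
      field_simp
    have h2 : Tendsto (fun t : ℝ => N * (1 / a t ^ (1 / 2 : ℂ) * (1 / z t ^ (1 / 2 : ℂ) *
          ∑' n : ℤ, exp (-pi * (a t * I / (N * t)) * n ^ 2 +
            2 * pi * ((0 : ℝ) * I) * n)))) (𝓝[>] 0)
        (𝓝 (N * (1 / a 0 ^ (1 / 2 : ℂ) * (1 / z 0 ^ (1 / 2 : ℂ) * 1)))) := by
      have hsl : a 0 ∈ slitPlane := by
        right
        simp only [ha]
        simp [Complex.div_im, hN0.ne']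
      have hsl' : z 0 ∈ slitPlane := by
        rw [hz0]; left; rw [ofReal_re]; positivity
      have hzt : Tendsto z (𝓝[>] 0) (𝓝 (z 0)) := tendsto_const_nhds.div hat ha0
      have c1 : Tendsto (fun t => a t ^ (1 / 2 : ℂ)) (𝓝[>] 0) (𝓝 (a 0 ^ (1 / 2 : ℂ))) :=
        (continuousAt_cpow_const hsl).tendsto.comp hat
      have c2 : Tendsto (fun t => z t ^ (1 / 2 : ℂ)) (𝓝[>] 0) (𝓝 (z 0 ^ (1 / 2 : ℂ))) :=
        (continuousAt_cpow_const hsl').tendsto.comp hzt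
      have n1 : a 0 ^ (1 / 2 : ℂ) ≠ 0 := by
        rw [cpow_def_of_ne_zero ha0]; exact exp_ne_zero _
      have n2 : z 0 ^ (1 / 2 : ℂ) ≠ 0 := by
        rw [cpow_def_of_ne_zero (Complex.slitPlane_ne_zero hsl')]; exact exp_ne_zero _
      refine Tendsto.const_mul _ ((tendsto_const_nhds.div c1 n1).mul
        ((tendsto_const_nhds.div c2 n2).mul (tendsto_gauss_tsum ?_ _)))
      have : Tendsto (fun t : ℝ => t⁻¹) (𝓝[>] 0) atTop := tendsto_inv_nhdsGT_zero
      refine (this.atTop_mul_const (show 0 < 1 / N ^ 2 by positivity)).congr' ?_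
      filter_upwards [self_mem_nhdsWithin] with t ht
      have ht0 : t ≠ 0 := (show 0 < t from ht).ne'
      have : a t * I / (N * t) = ((1 / (N * t) : ℝ) : ℂ) * (((1 / N : ℝ) : ℂ) + (t : ℝ) * I) := by
        simp only [ha]
        have : I ^ 2 = -1 := I_sq
        have ht' : (t : ℂ) ≠ 0 := by exact_mod_cast ht0
        push_cast
        field_simp
        linear_combination -this
      rw [this, re_ofReal_mul]
      simp
      field_simp
    refine h2.congr' ?_
    filter_upwards [self_mem_nhdsWithin] with t ht
    exact (h1 t ht).symm
  have hfin := tendsto_nhds_unique hA hB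
  refine ⟨sqrt N, sqrt_pos.2 hN0, ?_⟩
  have hz0 : z 0 = ((N ^ 2 : ℝ) : ℂ) := by
    simp only [hz, ha]; push_cast
    have := I_ne_zero
    field_simp
    ring
  rw [hfin, hz0, hsqrt _ (by positivity), sqrt_sq hN0.le]
  have hI : (-I) ≠ 0 := neg_ne_zero.2 I_ne_zero
  have e1 : a 0 = ((1 / N : ℝ) : ℂ) * (-I) := by simp only [ha]; push_cast; ring
  have e2 : a 0 ^ (1 / 2 : ℂ) = ((sqrt (1 / N) : ℝ) : ℂ) * exp (-(pi * I / 4)) := by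
    have hp : 0 < 1 / N := by positivity
    have hpC : ((1 / N : ℝ) : ℂ) ≠ 0 := by exact_mod_cast hp.ne'
    rw [e1, cpow_def_of_ne_zero (mul_ne_zero hpC hI), Complex.log_ofReal_mul hp hI,
      ← hsqrt _ hp, cpow_def_of_ne_zero hpC, ← exp_add, ofReal_log hp.le,
      Complex.log_neg_I]
    congr 1; ring
  rw [e2, Real.sqrt_div zero_le_one, Real.sqrt_one, Complex.exp_neg]
  have hs0 : (sqrt N : ℂ) ≠ 0 := by exact_mod_cast (sqrt_pos.2 hN0).ne'
  have := exp_ne_zero (pi * I / 4)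
  push_cast
  field_simp

/-- The standard additive character of `ℚ/ℤ`. -/
def ee (t : ℚ) : ℂ := exp (2 * pi * I * t)

theorem ee_add (s t : ℚ) : ee (s + t) = ee s * ee t := by
  unfold ee; rw [← exp_add]; push_cast; ring_nf

theorem ee_int (k : ℤ) : ee k = 1 := by
  unfold ee
  rw [Complex.exp_eq_one_iff]
  exact ⟨k, by push_cast; ring⟩

theorem ee_eq_one_iff {t : ℚ} : ee t = 1 ↔ ∃ k : ℤ, t = k := by
  constructor
  · intro h
    unfold ee at h
    rw [Complex.exp_eq_one_iff] at h
    obtain ⟨k, hk⟩ := h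
    have h2 := Complex.two_pi_I_ne_zero
    refine ⟨k, ?_⟩
    have : (t : ℂ) = k := by
      apply mul_left_cancel₀ h2
      rw [hk]; ring
    exact_mod_cast this
  · rintro ⟨k, rfl⟩; exact ee_int k

theorem ee_add_int {s t : ℚ} (h : ∃ k : ℤ, s - t = k) : ee s = ee t := by
  obtain ⟨k, hk⟩ := h
  rw [show s = t + k by linarith, ee_add, ee_int, mul_one]

section gauss

variable {V : Type*} [AddCommGroup V] [Module ℚ V]

theorem IsReps.shift {M Λ : AddSubgroup V} {s : Finset V} (hs : IsReps M Λ s) {h : V} (hh : h ∈ M) :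
    IsReps M Λ (s.image fun x => x + h) := by
  constructor
  · intro r hr
    obtain ⟨x, hx, rfl⟩ := mem_image.1 hr
    exact M.add_mem (hs.1 x hx) hh
  · intro x hx
    obtain ⟨r, ⟨hr, hr'⟩, hu⟩ := hs.2 (x - h) (M.sub_mem hx hh)
    refine ⟨r + h, ⟨mem_image_of_mem _ hr, by rwa [add_comm r h, ← sub_sub]⟩, ?_⟩
    rintro y ⟨hy, hy'⟩
    obtain ⟨z, hz, rfl⟩ := mem_image.1 hy
    rw [hu z ⟨hz, by rw [sub_sub, add_comm h z]; exact hy'⟩]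

theorem IsReps.sum_shift {M Λ : AddSubgroup V} {s : Finset V} (hs : IsReps M Λ s) {h : V} (hh : h ∈ M)
    {φ : V → ℂ} (hφ : ∀ x ∈ M, ∀ y ∈ M, x - y ∈ Λ → φ x = φ y) :
    ∑ x ∈ s, φ (x + h) = ∑ x ∈ s, φ x := by
  rw [hs.sum_eq (hs.shift hh) hφ, sum_image]
  intro x _ y _ hxy
  exact add_right_cancel hxy

theorem IsReps.filter {M M' Λ : AddSubgroup V} {s : Finset V} (hs : IsReps M Λ s) (h : M' ≤ M) (hΛ : Λ ≤ M') :
    IsReps M' Λ (s.filter fun x => x ∈ M') := by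
  constructor
  · intro r hr; exact (mem_filter.1 hr).2
  · intro x hx
    obtain ⟨r, ⟨hr, hr'⟩, hu⟩ := hs.2 x (h hx)
    refine ⟨r, ⟨mem_filter.2 ⟨hr, ?_⟩, hr'⟩, fun y hy => hu y ⟨(mem_filter.1 hy.1).1, hy.2⟩⟩
    have := M'.sub_mem hx (hΛ hr')
    simpa using this

theorem IsReps.coarsen {M Λ Λ' : AddSubgroup V} {s : Finset V} (hs : IsReps M Λ s) (hΛ : Λ ≤ Λ') :
    ∃ t, IsReps M Λ' t := by
  have : Finite (M ⧸ Λ'.addSubgroupOf M) := by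
    refine Finite.of_surjective (fun r : s => (QuotientAddGroup.mk ⟨r.1, hs.1 r.1 r.2⟩ : M ⧸ Λ'.addSubgroupOf M)) ?_
    intro q
    induction q using induction_on with
    | H x =>
      obtain ⟨r, ⟨hr, hr'⟩, -⟩ := hs.2 x x.2
      refine ⟨⟨r, hr⟩, ?_⟩
      rw [QuotientAddGroup.eq, mem_addSubgroupOf]
      have := hΛ hr'
      simpa [neg_add_eq_sub] using this
  exact exists_isReps

theorem IsReps.sum_tower {M Λ Λ₀ : AddSubgroup V} {L H s : Finset V} (hL : IsReps M Λ L) (hH : IsReps Λ Λ₀ H)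
    (hs : IsReps M Λ₀ s) (h0 : Λ₀ ≤ Λ) (h1 : Λ ≤ M)
    {φ : V → ℂ} (hφ : ∀ x ∈ M, ∀ y ∈ M, x - y ∈ Λ → φ x = φ y) :
    ∑ x ∈ s, φ x = H.card * ∑ x ∈ L, φ x := by
  have hinj : ∀ p ∈ L ×ˢ H, ∀ p' ∈ L ×ˢ H, p.1 + p.2 - (p'.1 + p'.2) ∈ Λ₀ → p = p' := by
    rintro ⟨a, b⟩ hp ⟨a', b'⟩ hp' h
    rw [mem_product] at hp hp'
    simp only at *
    have e1 : a - a' ∈ Λ := by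
      have := Λ.sub_mem (h0 h) (Λ.sub_mem (hH.1 b hp.2) (hH.1 b' hp'.2))
      convert this using 1; abel
    have e2 := hL.inj hp.1 hp'.1 e1
    subst e2
    have e3 := hH.inj hp.2 hp'.2 (by convert h using 1; abel)
    rw [e3]
  have hr : IsReps M Λ₀ ((L ×ˢ H).image fun p => p.1 + p.2) := by
    constructor
    · intro r hr
      obtain ⟨p, hp, rfl⟩ := mem_image.1 hr
      rw [mem_product] at hp
      exact M.add_mem (hL.1 _ hp.1) (h1 (hH.1 _ hp.2))
    · intro x hx
      obtain ⟨l, ⟨hl, hl'⟩, -⟩ := hL.2 x hx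
      obtain ⟨h, ⟨hh, hh'⟩, -⟩ := hH.2 _ hl'
      refine ⟨l + h, ⟨mem_image.2 ⟨(l, h), mem_product.2 ⟨hl, hh⟩, rfl⟩, by rwa [← sub_sub]⟩, ?_⟩
      rintro y ⟨hy, hy'⟩
      obtain ⟨p, hp, rfl⟩ := mem_image.1 hy
      have := hinj p hp (l, h) (mem_product.2 ⟨hl, hh⟩) (by
        have := Λ₀.sub_mem hh' hy'
        convert this using 1; abel)
      rw [this]
  rw [hs.sum_eq hr (fun x hx y hy hxy => hφ x hx y hy (h0 hxy)), sum_image, sum_product, mul_sum]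
  · refine sum_congr rfl fun l hl => ?_
    rw [sum_congr rfl (fun h hh => hφ (l + h) (M.add_mem (hL.1 _ hl) (h1 (hH.1 _ hh))) l (hL.1 _ hl)
      (by simpa using hH.1 _ hh)), sum_const, nsmul_eq_mul]
  · intro p hp p' hp' h
    simp only at h
    exact hinj p hp p' hp' (by rw [h, sub_self]; exact Λ₀.zero_mem)

/-- The dual of a subgroup with respect to `2B`. -/
def dualSub (B : V →ₗ[ℚ] V →ₗ[ℚ] ℚ) (Λ : AddSubgroup V) : AddSubgroup V where
  carrier := {x | ∀ y ∈ Λ, ∃ k : ℤ, 2 * B x y = k}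
  zero_mem' := fun y _ => ⟨0, by simp⟩
  add_mem' := by
    intro a b ha hb y hy
    obtain ⟨k, hk⟩ := ha y hy
    obtain ⟨l, hl⟩ := hb y hy
    exact ⟨k + l, by rw [map_add, LinearMap.add_apply, mul_add, hk, hl]; push_cast; rfl⟩
  neg_mem' := by
    intro a ha y hy
    obtain ⟨k, hk⟩ := ha y hy
    exact ⟨-k, by rw [map_neg, LinearMap.neg_apply, mul_neg, hk]; push_cast; rfl⟩

theorem mem_dualSub {B : V →ₗ[ℚ] V →ₗ[ℚ] ℚ} {Λ : AddSubgroup V} {x : V} :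
    x ∈ dualSub B Λ ↔ ∀ y ∈ Λ, ∃ k : ℤ, 2 * B x y = k := Iff.rfl

variable {B : V →ₗ[ℚ] V →ₗ[ℚ] ℚ} {Λ Λ₀ : AddSubgroup V}

theorem B_add_self (hB : ∀ x y, B x y = B y x) (x h : V) :
    B (x + h) (x + h) = B x x + 2 * B x h + B h h := by
  simp only [map_add, LinearMap.add_apply]
  rw [hB h x]; ring

theorem le_dualSub (hB : ∀ x y, B x y = B y x) (hInt : ∀ x ∈ Λ, ∃ k : ℤ, B x x = k) : Λ ≤ dualSub B Λ := by
  intro x hx y hy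
  obtain ⟨a, ha⟩ := hInt x hx
  obtain ⟨b, hb⟩ := hInt y hy
  obtain ⟨c, hc⟩ := hInt _ (Λ.add_mem hx hy)
  refine ⟨c - a - b, ?_⟩
  rw [B_add_self hB] at hc
  push_cast
  linarith

theorem dualSub_anti (h : Λ₀ ≤ Λ) : dualSub B Λ ≤ dualSub B Λ₀ := fun _ hx y hy => hx y (h hy)

theorem ee_periodic (hB : ∀ x y, B x y = B y x) (hInt : ∀ x ∈ Λ, ∃ k : ℤ, B x x = k) :
    ∀ x ∈ dualSub B Λ, ∀ y ∈ dualSub B Λ, x - y ∈ Λ → ee (B x x) = ee (B y y) := by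
  intro x _ y hy h
  apply ee_add_int
  have h1 := B_add_self hB y (x - y)
  rw [add_sub_cancel] at h1
  obtain ⟨k, hk⟩ := hy _ h
  obtain ⟨l, hl⟩ := hInt _ h
  exact ⟨k + l, by rw [h1, hk, hl]; push_cast; ring⟩

/-- The quadratic Gauss sum of an even lattice. -/
def gaussLat (B : V →ₗ[ℚ] V →ₗ[ℚ] ℚ) (Λ : AddSubgroup V) : ℂ :=
  cosetSum (dualSub B Λ) Λ fun x => ee (B x x)

theorem gaussLat_sub (hB : ∀ x y, B x y = B y x) (hInt : ∀ x ∈ Λ, ∃ k : ℤ, B x x = k)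
    (hle : Λ₀ ≤ Λ) (hreps : ∃ s, IsReps (dualSub B Λ₀) Λ₀ s) :
    ∃ r : ℝ, 0 < r ∧ gaussLat B Λ₀ = r * gaussLat B Λ := by
  obtain ⟨R, hR⟩ := hreps
  have hInt0 : ∀ x ∈ Λ₀, ∃ k : ℤ, B x x = k := fun x hx => hInt x (hle hx)
  have hM := dualSub_anti (B := B) hle
  have hΛM := le_dualSub hB hInt
  have hΛM0 : Λ ≤ dualSub B Λ₀ := hΛM.trans hM
  have hH := hR.filter hΛM0 hle
  have hR1 := hR.filter hM (hle.trans hΛM)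
  set H := R.filter fun x => x ∈ Λ with hHdef
  obtain ⟨L, hL⟩ := hR1.coarsen hle
  have hHpos : 0 < H.card := by
    obtain ⟨r, ⟨hr, -⟩, -⟩ := hH.2 0 Λ.zero_mem
    exact Finset.card_pos.2 ⟨r, hr⟩
  have hHC : (H.card : ℂ) ≠ 0 := by exact_mod_cast hHpos.ne'
  have e1 : gaussLat B Λ₀ = ∑ x ∈ R, ee (B x x) := cosetSum_eq hR (ee_periodic hB hInt0)
  have e2 : gaussLat B Λ = ∑ x ∈ L, ee (B x x) := cosetSum_eq hL (ee_periodic hB hInt)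
  have e3 := hL.sum_tower hH hR1 hle hΛM (ee_periodic hB hInt)
  have e4 : ∀ h ∈ H, ∑ x ∈ R, ee (B x x) = ∑ x ∈ R, ee (B x x) * ee (2 * B x h) := by
    intro h hh
    have hhΛ := hH.1 h hh
    rw [← hR.sum_shift (hΛM0 hhΛ) (ee_periodic hB hInt0)]
    refine sum_congr rfl fun x _ => ?_
    obtain ⟨k, hk⟩ := hInt h hhΛ
    rw [B_add_self hB, ee_add, ee_add, hk, ee_int, mul_one]
  have e5 : ∀ x ∈ R, ∑ h ∈ H, ee (2 * B x h) = if x ∈ dualSub B Λ then (H.card : ℂ) else 0 := by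
    intro x hx
    split_ifs with hxM
    · rw [sum_congr rfl (fun h hh => ee_eq_one_iff.2 (hxM h (hH.1 h hh)))]
      simp
    · rw [mem_dualSub] at hxM
      push Not at hxM
      obtain ⟨y, hy, hxy⟩ := hxM
      have hne : ee (2 * B x y) ≠ 1 := fun h => by
        obtain ⟨k, hk⟩ := ee_eq_one_iff.1 h
        exact hxy k hk
      have hsh := hH.sum_shift (φ := fun h => ee (2 * B x h)) hy (by
        intro a _ b _ hab
        apply ee_add_int
        obtain ⟨k, hk⟩ := hR.1 x hx _ hab
        exact ⟨k, by rw [← hk, map_sub]; ring⟩)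
      simp only [map_add, mul_add, ee_add] at hsh
      rw [← sum_mul] at hsh
      by_contra h0
      exact hne (mul_left_cancel₀ h0 (by rw [hsh, mul_one]))
  have e6 : (H.card : ℂ) * gaussLat B Λ₀ = H.card * ∑ x ∈ R.filter (fun x => x ∈ dualSub B Λ), ee (B x x) := by
    rw [e1, ← nsmul_eq_mul, ← sum_const, sum_congr rfl e4, sum_comm, mul_sum,
      sum_filter]
    refine sum_congr rfl fun x hx => ?_
    rw [← mul_sum, e5 x hx]
    split_ifs <;> ring
  refine ⟨H.card, by exact_mod_cast hHpos, ?_⟩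
  rw [mul_left_cancel₀ hHC e6, e3, e2]
  push_cast; rfl

end gauss

section orth

variable {V ι : Type*} [AddCommGroup V] [Module ℚ V] [Fintype ι]

/-- The lattice spanned by a basis. -/
def orthLat (w : Basis ι ℚ V) : AddSubgroup V where
  carrier := {x | ∀ i, ∃ k : ℤ, w.repr x i = k}
  zero_mem' := fun i => ⟨0, by simp⟩
  add_mem' := by
    intro a b ha hb i
    obtain ⟨k, hk⟩ := ha i
    obtain ⟨l, hl⟩ := hb i
    exact ⟨k + l, by rw [map_add, Finsupp.add_apply, hk, hl]; push_cast; rfl⟩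
  neg_mem' := by
    intro a ha i
    obtain ⟨k, hk⟩ := ha i
    exact ⟨-k, by rw [map_neg, Finsupp.neg_apply, hk]; push_cast; rfl⟩

theorem B_orth {B : V →ₗ[ℚ] V →ₗ[ℚ] ℚ} {w : Basis ι ℚ V} (ho : B.IsOrthoᵢ w) (x y : V) :
    B x y = ∑ i, w.repr x i * w.repr y i * B (w i) (w i) := by
  conv_lhs => rw [← w.sum_repr x, ← w.sum_repr y]
  simp only [map_sum, LinearMap.sum_apply, map_smul, LinearMap.smul_apply, smul_eq_mul]
  refine sum_congr rfl fun i _ => ?_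
  rw [sum_eq_single i]
  · ring
  · intro j _ hj
    have h0 : B (w j) (w i) = 0 := ho hj
    rw [h0]; ring
  · simp

/-- The phase of a rank one Gauss sum. -/
def phase (p : Prop) : ℂ := if p then exp (pi * I / 4) else exp (-(pi * I / 4))

theorem phase_ne_zero (p : Prop) : phase p ≠ 0 := by
  unfold phase; split_ifs <;> exact exp_ne_zero _

theorem gauss_rank_one_signed (d : ℤ) (hd : d ≠ 0) : ∃ r : ℝ, 0 < r ∧
    ∑ k : Fin (2 * d.natAbs), ee (d * ((k : ℕ) / (2 * d.natAbs : ℕ)) ^ 2) = r * phase (0 < d) := by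
  have hD : 0 < d.natAbs := Int.natAbs_pos.2 hd
  obtain ⟨r, hr, h⟩ := gauss_rank_one d.natAbs hD
  refine ⟨r, hr, ?_⟩
  have hDC : (d.natAbs : ℂ) ≠ 0 := by exact_mod_cast hD.ne'
  unfold phase
  split_ifs with hpos
  · rw [← h]
    refine sum_congr rfl fun k _ => ?_
    unfold ee
    congr 1
    have : (d : ℂ) = (d.natAbs : ℂ) := by
      have : d = (d.natAbs : ℤ) := by omega
      conv_lhs => rw [this]
      rw [Int.cast_natCast]
    push_cast
    rw [this]
    field_simp
  · have h' := congrArg (starRingEnd ℂ) h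
    rw [map_mul, conj_ofReal, ← exp_conj, map_sum] at h'
    have e1 : (starRingEnd ℂ) (pi * I / 4) = -(pi * I / 4) := by
      rw [map_div₀, map_mul, conj_ofReal, conj_I, map_ofNat]
      ring
    rw [e1] at h'
    rw [← h']
    refine sum_congr rfl fun k _ => ?_
    unfold ee
    rw [← exp_conj]
    congr 1
    have : (d : ℂ) = -(d.natAbs : ℂ) := by
      have : d = -(d.natAbs : ℤ) := by omega
      conv_lhs => rw [this]
      rw [Int.cast_neg, Int.cast_natCast]
    simp only [map_div₀, map_mul, conj_ofReal, conj_I, map_pow, map_natCast, map_ofNat]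
    push_cast
    rw [this]
    field_simp

theorem gaussLat_orth {B : V →ₗ[ℚ] V →ₗ[ℚ] ℚ} {w : Basis ι ℚ V} (hB : ∀ x y, B x y = B y x)
    (ho : B.IsOrthoᵢ w) (d : ι → ℤ) (hd : ∀ i, d i ≠ 0) (hdB : ∀ i, B (w i) (w i) = d i) :
    (∃ s, IsReps (dualSub B (orthLat w)) (orthLat w) s) ∧
    ∃ r : ℝ, 0 < r ∧ gaussLat B (orthLat w) = r * ∏ i, phase (0 < d i) := by
  have hmem : ∀ x, x ∈ dualSub B (orthLat w) ↔ ∀ i, ∃ k : ℤ, 2 * d i * w.repr x i = k := by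
    intro x
    rw [mem_dualSub]
    constructor
    · intro h i
      obtain ⟨k, hk⟩ := h (w i) (fun j => ⟨if i = j then 1 else 0, by
        rw [w.repr_self, Finsupp.single_apply]; split_ifs <;> simp⟩)
      refine ⟨k, ?_⟩
      rw [B_orth ho, sum_eq_single i] at hk
      · rw [← hk, w.repr_self, Finsupp.single_eq_same, hdB]; ring
      · intro j _ hj
        rw [w.repr_self, Finsupp.single_eq_of_ne hj]; ring
      · simp
    · intro h y hy
      choose k hk using h
      choose l hl using hy
      refine ⟨∑ i, k i * l i, ?_⟩
      rw [B_orth ho, mul_sum]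
      push_cast
      refine sum_congr rfl fun i _ => ?_
      rw [hdB, ← hk, ← hl]; ring
  have hInt : ∀ x ∈ orthLat w, ∃ k : ℤ, B x x = k := by
    intro x hx
    choose k hk using hx
    refine ⟨∑ i, k i * k i * d i, ?_⟩
    rw [B_orth ho]
    push_cast
    refine sum_congr rfl fun i _ => ?_
    rw [hdB, hk]
  set m : ι → ℕ := fun i => 2 * (d i).natAbs with hm
  have hm0 : ∀ i, 0 < m i := fun i => by have := Int.natAbs_pos.2 (hd i); simp only [hm]; omega
  have hmQ : ∀ i, (m i : ℚ) ≠ 0 := fun i => by exact_mod_cast (hm0 i).ne'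
  set X : (∀ i, Fin (m i)) → V := fun k => ∑ i, (((k i : ℕ) : ℚ) / (m i : ℕ)) • w i with hX
  have hrepr : ∀ k i, w.repr (X k) i = ((k i : ℕ) : ℚ) / (m i : ℕ) := by
    intro k i
    simp only [hX, map_sum, map_smul, w.repr_self, Finsupp.smul_single, smul_eq_mul, mul_one]
    rw [Finsupp.finset_sum_apply, sum_eq_single i]
    · simp
    · intro j _ hj; rw [Finsupp.single_eq_of_ne hj.symm]
    · simp
  have hsgn : ∀ i, ∃ s : ℤ, (s = 1 ∨ s = -1) ∧ 2 * (d i : ℚ) = s * (m i : ℕ) := by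
    intro i
    rcases le_total 0 (d i) with h | h
    · refine ⟨1, Or.inl rfl, ?_⟩
      have : 2 * d i = 1 * (m i : ℤ) := by simp only [hm]; omega
      exact_mod_cast this
    · refine ⟨-1, Or.inr rfl, ?_⟩
      have : 2 * d i = -1 * (m i : ℤ) := by simp only [hm]; omega
      exact_mod_cast this
  have hXinj : ∀ k k', X k - X k' ∈ orthLat w → k = k' := by
    intro k k' h
    funext i
    obtain ⟨a, ha⟩ := h i
    rw [map_sub, Finsupp.sub_apply, hrepr, hrepr, ← sub_div, div_eq_iff (hmQ i)] at ha
    have ha' : ((k i : ℕ) : ℤ) - ((k' i : ℕ) : ℤ) = a * (m i : ℤ) := by exact_mod_cast ha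
    have h1 := (k i).2
    have h2 := (k' i).2
    have : a = 0 := by
      by_contra h0
      rcases lt_or_gt_of_ne h0 with h | h
      · nlinarith
      · nlinarith
    subst this
    apply Fin.ext
    omega
  have hreps : IsReps (dualSub B (orthLat w)) (orthLat w) (univ.image X) := by
    constructor
    · intro r hr
      obtain ⟨k, -, rfl⟩ := mem_image.1 hr
      rw [hmem]
      intro i
      obtain ⟨s, -, hs⟩ := hsgn i
      refine ⟨s * (k i : ℕ), ?_⟩
      rw [hrepr, hs, mul_assoc, mul_div_cancel₀ _ (hmQ i)]
      push_cast; rfl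
    · intro x hx
      rw [hmem] at hx
      have : ∀ i, ∃ e : ℤ, (m i : ℕ) * w.repr x i = e := by
        intro i
        obtain ⟨s, hs1, hs⟩ := hsgn i
        obtain ⟨k, hk⟩ := hx i
        refine ⟨s * k, ?_⟩
        rw [hs] at hk
        push_cast
        rw [← hk]
        rcases hs1 with rfl | rfl <;> push_cast <;> ring
      choose e he using this
      have hlt : ∀ i, (e i % (m i : ℤ)).toNat < m i := by
        intro i
        have h1 := Int.emod_lt_of_pos (e i) (show (0 : ℤ) < m i by exact_mod_cast hm0 i)
        have h2 := Int.emod_nonneg (e i) (show (m i : ℤ) ≠ 0 by exact_mod_cast (hm0 i).ne')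
        omega
      set k : ∀ i, Fin (m i) := fun i => ⟨(e i % (m i : ℤ)).toNat, hlt i⟩ with hk
      have hxk : x - X k ∈ orthLat w := by
        intro i
        refine ⟨e i / (m i : ℤ), ?_⟩
        rw [map_sub, Finsupp.sub_apply, hrepr]
        have h2 := Int.emod_nonneg (e i) (show (m i : ℤ) ≠ 0 by exact_mod_cast (hm0 i).ne')
        have h3 : (((e i % (m i : ℤ)).toNat : ℕ) : ℚ) = ((e i % (m i : ℤ) : ℤ) : ℚ) := by
          rw [← Int.cast_natCast, Int.toNat_of_nonneg h2]
        have h4 := Int.emod_add_mul_ediv (e i) (m i : ℤ)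
        have h5 : ((e i % (m i : ℤ) : ℤ) : ℚ) + (m i : ℕ) * ((e i / (m i : ℤ) : ℤ) : ℚ) = e i := by exact_mod_cast h4
        simp only [hk, h3]
        have := hmQ i
        rw [← he i] at h5
        field_simp
        linarith
      refine ⟨X k, ⟨mem_image_of_mem _ (mem_univ _), hxk⟩, ?_⟩
      rintro y ⟨hy, hy'⟩
      obtain ⟨k', -, rfl⟩ := mem_image.1 hy
      rw [hXinj k' k]
      have := (orthLat w).sub_mem hxk hy'
      simpa using this
  refine ⟨⟨_, hreps⟩, ?_⟩
  choose r hr hrs using fun i => gauss_rank_one_signed (d i) (hd i)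
  refine ⟨∏ i, r i, prod_pos fun i _ => hr i, ?_⟩
  push_cast
  rw [← prod_mul_distrib, ← prod_congr rfl (fun i _ => hrs i), Finset.prod_univ_sum,
    Fintype.piFinset_univ]
  rw [gaussLat, cosetSum_eq hreps (ee_periodic hB hInt), sum_image]
  · refine sum_congr rfl fun k _ => ?_
    rw [B_orth ho]
    have : ∀ (s : Finset ι) (f : ι → ℚ), ee (∑ i ∈ s, f i) = ∏ i ∈ s, ee (f i) := by
      intro s f
      induction s using Finset.induction_on with
      | empty => simpa using ee_int 0
      | insert a s ha ih => rw [Finset.sum_insert ha, Finset.prod_insert ha, ee_add, ih]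
    rw [this]
    refine prod_congr rfl fun i _ => ?_
    congr 1
    rw [hrepr, hdB]; ring
  · intro k _ k' _ h
    exact hXinj k k' (by rw [h, sub_self]; exact (orthLat w).zero_mem)

end orth

section milgram

open QuadraticMap

/-- The bilinear form `Tr(c x y)`. -/
def trForm (c : K) : K →ₗ[ℚ] K →ₗ[ℚ] ℚ := (Algebra.traceForm ℚ K) ∘ₗ LinearMap.mulLeft ℚ c

theorem trForm_apply (c x y : K) : trForm c x y = trace ℚ K (c * x * y) := rfl

theorem trForm_symm (c x y : K) : trForm c x y = trForm c y x := by
  rw [trForm_apply, trForm_apply]; ring_nf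

theorem trace_eq_sum_real [IsGalois ℚ K] (ι : K →+* ℝ) (x : K) :
    ((trace ℚ K x : ℚ) : ℝ) = ∑ τ : Gal(K/ℚ), ι (τ x) := by
  rw [← map_sum, ← trace_eq_sum_automorphisms]
  simp

theorem milgram [IsGalois ℚ K] (ι : K →+* ℝ) {c : K} (hc : c ≠ 0) {Λ : AddSubgroup K}
    (hΛ : ∀ x : K, ∃ N : ℕ, N ≠ 0 ∧ N • x ∈ Λ) (hInt : ∀ x ∈ Λ, ∃ k : ℤ, trace ℚ K (c * x * x) = k) :
    ∃ r : ℝ, 0 < r ∧ r * gaussLat (trForm c) Λ = phase True ^ (univ.filter fun τ : Gal(K/ℚ) => 0 < ι (τ c)).card *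
      phase False ^ (card (Gal(K/ℚ)) - (univ.filter fun τ : Gal(K/ℚ) => 0 < ι (τ c)).card) := by
  have hB := trForm_symm c
  have : Invertible (2 : ℚ) := invertibleOfNonzero two_ne_zero
  obtain ⟨v, hv⟩ := LinearMap.BilinForm.exists_orthogonal_basis (B := trForm c) ⟨fun x y => hB x y⟩
  choose N hN0 hN using fun i => hΛ (v i)
  have hN0' : ∀ i, ((N i : ℕ) : ℚ) ≠ 0 := fun i => by exact_mod_cast hN0 i
  set w := Basis.isUnitSMul v (w := fun i => ((N i : ℕ) : ℚ)) (fun i => (hN0' i).isUnit) with hw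
  have hwi : ∀ i, w i = N i • v i := fun i => by rw [hw, Basis.isUnitSMul_apply, Nat.cast_smul_eq_nsmul]
  have hwo : (trForm c).IsOrthoᵢ w := by
    intro i j hij
    have h0 : trForm c (v i) (v j) = 0 := hv hij
    change trForm c (w i) (w j) = 0
    rw [hwi, hwi, map_nsmul, map_nsmul, LinearMap.smul_apply, h0]; simp
  have hwΛ : ∀ i, w i ∈ Λ := fun i => by rw [hwi]; exact hN i
  choose d hd using fun i => hInt _ (hwΛ i)
  have hdB : ∀ i, trForm c (w i) (w i) = d i := hd
  have hd0 : ∀ i, d i ≠ 0 := by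
    intro i h0
    have h1 : ∀ y, trForm c (w i) y = 0 := by
      intro y
      rw [B_orth hwo]
      refine sum_eq_zero fun j _ => ?_
      rw [w.repr_self]
      by_cases hij : i = j
      · subst hij; rw [hdB, h0]; simp
      · rw [Finsupp.single_eq_of_ne (Ne.symm hij)]; simp
    have h2 := (traceForm_nondegenerate ℚ K).1 (c * w i) h1
    exact mul_ne_zero hc (w.ne_zero i) h2
  obtain ⟨hreps, r, hr, hG⟩ := gaussLat_orth hB hwo d hd0 hdB
  have hle : orthLat w ≤ Λ := by
    intro x hx
    choose k hk using hx
    rw [← w.sum_repr x]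
    refine Λ.sum_mem fun i _ => ?_
    rw [hk, Int.cast_smul_eq_zsmul]
    exact Λ.zsmul_mem (hwΛ i) _
  obtain ⟨r', hr', hG'⟩ := gaussLat_sub hB hInt hle hreps
  -- signature
  set p := (univ.filter fun τ : Gal(K/ℚ) => 0 < ι (τ c)).card with hp
  have hcardG : card (Gal(K/ℚ)) = finrank ℚ K := by
    rw [← Nat.card_eq_fintype_card, card_aut_eq_finrank]
  have hsig : (univ.filter fun i => 0 < d i).card = p := by
    let A : (Fin (finrank ℚ K) → ℝ) →ₗ[ℝ] ((Gal(K/ℚ)) → ℝ) :=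
      { toFun := fun a τ => ∑ i, a i * ι (τ (w i))
        map_add' := by intro a b; funext τ; simp [add_mul, sum_add_distrib]
        map_smul' := by intro r a; funext τ; simp [mul_sum, mul_assoc] }
    have hij : ∀ i j, ∑ τ : Gal(K/ℚ), ι (τ c) * ι (τ (w i)) * ι (τ (w j)) = if i = j then (d i : ℝ) else 0 := by
      intro i j
      have h1 := trace_eq_sum_real ι (c * w i * w j)
      simp only [map_mul] at h1
      rw [← h1, ← trForm_apply]
      split_ifs with h
      · subst h; rw [hdB]; simp
      · have : trForm c (w i) (w j) = 0 := hwo h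
        rw [this]; simp
    have hAj : ∀ a j, ∑ τ : Gal(K/ℚ), ι (τ c) * ι (τ (w j)) * A a τ = a j * d j := by
      intro a j
      simp only [A, LinearMap.coe_mk, AddHom.coe_mk, mul_sum]
      rw [sum_comm, sum_eq_single j]
      · have := hij j j
        rw [if_pos rfl] at this
        rw [← this, mul_sum]
        exact sum_congr rfl fun τ _ => by ring
      · intro i _ hi
        have := hij j i
        rw [if_neg hi.symm] at this
        rw [← mul_zero (a i), ← this, mul_sum]
        exact sum_congr rfl fun τ _ => by ring
      · simp
    have hinj : Function.Injective A := by
      rw [injective_iff_map_eq_zero]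
      intro a ha
      funext j
      have := hAj a j
      rw [ha] at this
      simp only [Pi.zero_apply, mul_zero, Finset.sum_const_zero] at this
      have h0 : (d j : ℝ) ≠ 0 := by exact_mod_cast hd0 j
      exact (mul_eq_zero.1 this.symm).resolve_right h0
    let E := LinearEquiv.ofInjectiveOfFinrankEq A hinj (by
      rw [Module.finrank_fintype_fun_eq_card, Module.finrank_fintype_fun_eq_card, hcardG, card_fin])
    have hequiv : Equivalent (weightedSumSquares ℝ fun i => (d i : ℝ)) (weightedSumSquares ℝ fun τ : Gal(K/ℚ) => ι (τ c)) := by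
      refine ⟨⟨E, fun a => ?_⟩⟩
      change weightedSumSquares ℝ (fun τ : Gal(K/ℚ) => ι (τ c)) (A a) = _
      rw [weightedSumSquares_apply, weightedSumSquares_apply]
      simp only [smul_eq_mul]
      calc ∑ τ : Gal(K/ℚ), ι (τ c) * (A a τ * A a τ) =
          ∑ τ : Gal(K/ℚ), ∑ j, a j * (ι (τ c) * ι (τ (w j)) * A a τ) := by
            refine sum_congr rfl fun τ _ => ?_
            conv_lhs => rw [← mul_assoc, mul_right_comm]
            nth_rewrite 2 [show A a τ = ∑ i, a i * ι (τ (w i)) from rfl]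
            rw [mul_sum]
            exact sum_congr rfl fun j _ => by ring
        _ = _ := by
            rw [sum_comm]
            refine sum_congr rfl fun j _ => ?_
            rw [← mul_sum, hAj]; ring
    have h1 := hequiv.sigPos_eq
    rw [QuadraticForm.sigPos_weightedSumSquares, QuadraticForm.sigPos_weightedSumSquares] at h1
    rw [hp, ← Set.ncard_coe_finset, ← Set.ncard_coe_finset]
    convert h1 using 2
    · ext i; simp
    · ext i; simp
  refine ⟨r'/r, div_pos hr' hr, ?_⟩
  have hrC : (r : ℂ) ≠ 0 := by exact_mod_cast hr.ne'
  rw [hG] at hG'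
  have hprod : ∏ i, phase (0 < d i) = phase True ^ p * phase False ^ (card (Gal(K/ℚ)) - p) := by
    have h1 : ∀ i, phase (0 < d i) = if 0 < d i then phase True else phase False := by
      intro i; split_ifs with h <;> simp [phase, h]
    simp only [h1]
    rw [Finset.prod_ite, prod_const, prod_const, hsig, hcardG, ← hsig]
    congr 2
    have := Finset.card_filter_add_card_filter_not (s := (univ : Finset (Fin (finrank ℚ K)))) (fun i => 0 < d i)
    rw [card_univ, card_fin] at this
    omega
  rw [← hprod]
  push_cast
  field_simp
  rw [← hG', mul_comm]

end milgram

section lattice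

open FractionalIdeal

variable (K) in
/-- Fractional ideals of the ring of integers. -/
abbrev FrId := FractionalIdeal (nonZeroDivisors OK) K

/-- The additive group underlying a fractional ideal. -/
def FractionalIdeal.grp (I : FrId K) : AddSubgroup K := (I : Submodule OK K).toAddSubgroup

theorem mem_grp {I : FrId K} {x : K} : x ∈ I.grp ↔ x ∈ I := Iff.rfl

variable (K) in
/-- The codifferent. -/
def codiff : FrId K := FractionalIdeal.dual ℤ ℚ 1

/-- The principal fractional ideal of an element. -/
abbrev frSpan (c : K) : FrId K := spanSingleton (nonZeroDivisors OK) c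

theorem codiff_ne_zero : codiff K ≠ 0 := dual_ne_zero ℤ ℚ one_ne_zero

theorem mem_codiff_mul_inv {I : FrId K} (hI : I ≠ 0) {x : K} :
    x ∈ codiff K * I⁻¹ ↔ ∀ a ∈ I, ∃ k : ℤ, trace ℚ K (x * a) = k := by
  unfold codiff
  rw [← dual_eq_mul_inv, mem_dual hI]
  refine forall₂_congr fun a _ => ?_
  rw [RingHom.mem_range]
  exact ⟨fun ⟨k, hk⟩ => ⟨k, hk.symm⟩, fun ⟨k, hk⟩ => ⟨k, hk.symm⟩⟩

theorem trace_of_mem_codiff {x : K} (hx : x ∈ codiff K) : ∃ k : ℤ, trace ℚ K x = k := by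
  have := (mem_codiff_mul_inv (I := (1 : FrId K)) one_ne_zero (x := x)).1 (by rwa [inv_one, mul_one]) 1
    (one_mem_one _)
  rwa [mul_one] at this

theorem mem_codiff_iff {x : K} : x ∈ codiff K ↔ ∀ a : OK, ∃ k : ℤ, trace ℚ K (x * a) = k := by
  have := (mem_codiff_mul_inv (I := (1 : FrId K)) one_ne_zero (x := x))
  rw [inv_one, mul_one] at this
  rw [this]
  constructor
  · intro h a
    exact h a ((mem_one_iff _).2 ⟨a, rfl⟩)
  · intro h a ha
    obtain ⟨b, rfl⟩ := (mem_one_iff _).1 ha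
    exact h b

theorem exists_nsmul_le {M Λ : FrId K} (hΛ : Λ ≠ 0) : ∃ N : ℕ, N ≠ 0 ∧ ∀ x ∈ M, N • x ∈ Λ := by
  obtain ⟨a, I, ha, hI⟩ := exists_eq_spanSingleton_mul (M * Λ⁻¹)
  refine ⟨Ideal.absNorm (span {a}), ?_, ?_⟩
  · rw [Ne, Ideal.absNorm_eq_zero_iff, span_singleton_eq_bot]; exact ha
  · intro x hx
    obtain ⟨b, hb⟩ := mem_span_singleton.1 (absNorm_mem (span {a}))
    have h1 : frSpan ((a : OK) : K) * (M * Λ⁻¹) ≤ 1 := by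
      have ha' : ((a : OK) : K) ≠ 0 := by exact_mod_cast ha
      rw [hI, ← mul_assoc, spanSingleton_mul_spanSingleton, mul_inv_cancel₀ ha', spanSingleton_one, one_mul]
      exact coeIdeal_le_one
    have h2 : frSpan ((a : OK) : K) * M ≤ Λ := by
      have : frSpan ((a : OK) : K) * (M * Λ⁻¹) * Λ ≤ 1 * Λ := by gcongr
      rwa [one_mul, mul_assoc, mul_assoc, inv_mul_cancel₀ hΛ, mul_one] at this
    have h3 : (a : K) * x ∈ Λ := h2 (FractionalIdeal.mul_mem_mul (mem_spanSingleton_self _ _) hx)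
    have h4 : (Ideal.absNorm (span {a})) • x = b • ((a : K) * x) := by
      rw [nsmul_eq_mul, smul_def]
      have : ((Ideal.absNorm (span {a}) : OK) : K) = ((a * b : OK) : K) := by rw [hb]
      push_cast at this
      rw [this]
      change (a : K) * b * x = b * (a * x)
      ring
    rw [h4]
    exact smul_mem (Λ : Submodule OK K) b h3

theorem exists_reps_frId (M : FrId K) {Λ : FrId K} (hΛ : Λ ≠ 0) : ∃ s, IsReps M.grp Λ.grp s := by
  obtain ⟨N, hN, h⟩ := exists_nsmul_le (M := M) hΛ
  have hfg : M.grp.FG := by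
    have : Module.Finite ℤ M := inferInstance
    have h2 : AddGroup.FG M := Module.Finite.iff_addGroup_fg.1 this
    exact (AddGroup.fg_iff_addSubgroup_fg M.grp).1 h2
  have := finite_quot_of_fg (Λ := Λ.grp) hfg N hN h
  exact exists_isReps

/-- The Gauss sum of `Tr(c x²)` over `M` modulo `Λ`. -/
def gaussW (c : K) (M Λ : FrId K) : ℂ := cosetSum M.grp Λ.grp fun x => ee (trForm c x x)

/-- Periodicity of `Tr(c x²)`. -/
theorem gaussW_periodic {c : K} {M Λ : FrId K} (h1 : frSpan (2 * c) * M * Λ ≤ codiff K)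
    (h2 : frSpan c * Λ * Λ ≤ codiff K) :
    ∀ x ∈ M.grp, ∀ y ∈ M.grp, x - y ∈ Λ.grp → ee (trForm c x x) = ee (trForm c y y) := by
  intro x _ y hy hxy
  apply ee_add_int
  have e1 : 2 * c * y * (x - y) ∈ codiff K :=
    h1 (FractionalIdeal.mul_mem_mul (FractionalIdeal.mul_mem_mul (mem_spanSingleton_self _ _) hy) hxy)
  have e2 : c * (x - y) * (x - y) ∈ codiff K :=
    h2 (FractionalIdeal.mul_mem_mul (FractionalIdeal.mul_mem_mul (mem_spanSingleton_self _ _) hxy) hxy)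
  obtain ⟨k, hk⟩ := trace_of_mem_codiff e1
  obtain ⟨l, hl⟩ := trace_of_mem_codiff e2
  refine ⟨k + l, ?_⟩
  push_cast
  rw [← hk, ← hl, trForm_apply, trForm_apply, ← map_sub, ← map_add]
  congr 1; ring

theorem coprime_split {𝔟 𝔰 : IK} (h : IsCoprime 𝔟 𝔰) :
    ∃ b ∈ 𝔟, ∃ s ∈ 𝔰, ∀ x : K, (b : K) * x + (s : K) * x = x := by
  obtain ⟨b, hb, s, hs, hbs⟩ := isCoprime_iff_exists.1 h
  refine ⟨b, hb, s, hs, fun x => ?_⟩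
  have : ((b + s : OK) : K) = 1 := by rw [hbs]; rfl
  push_cast at this
  rw [← add_mul, this, one_mul]

theorem mul_mem_of_inv {𝔟 : IK} {Λ : FrId K} {b : OK} (hb : b ∈ 𝔟) (h0 : 𝔟 ≠ ⊥) {x : K}
    (hx : x ∈ (𝔟 : FrId K)⁻¹ * Λ) : (b : K) * x ∈ Λ := by
  have h0' : (𝔟 : FrId K) ≠ 0 := coeIdeal_ne_zero.2 h0
  have : (b : K) * x ∈ (𝔟 : FrId K) * ((𝔟 : FrId K)⁻¹ * Λ) :=
    FractionalIdeal.mul_mem_mul (mem_coeIdeal_of_mem _ hb) hx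
  rwa [← mul_assoc, mul_inv_cancel₀ h0', one_mul] at this

theorem le_inv_mul {𝔟 : IK} (h0 : 𝔟 ≠ ⊥) (Λ : FrId K) : Λ ≤ (𝔟 : FrId K)⁻¹ * Λ := by
  have h0' : (𝔟 : FrId K) ≠ 0 := coeIdeal_ne_zero.2 h0
  have : (1 : FrId K) ≤ (𝔟 : FrId K)⁻¹ := by
    rw [← inv_one]
    exact (FractionalIdeal.inv_le_inv_iff (one_ne_zero (α := FrId K)) h0').2 coeIdeal_le_one
  calc Λ = 1 * Λ := (one_mul _).symm
    _ ≤ _ := by gcongr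

theorem smul_frId {Λ : FrId K} (a : OK) {x : K} (hx : x ∈ Λ) : (a : K) * x ∈ Λ := by
  have := smul_mem (Λ : Submodule OK K) a hx
  rwa [smul_def] at this

theorem add_frId {Λ : FrId K} {x y : K} (hx : x ∈ Λ) (hy : y ∈ Λ) : x + y ∈ Λ :=
  Submodule.add_mem (Λ : Submodule OK K) hx hy

/-- Gauss sums modulo coprime ideals multiply. -/
theorem gaussW_mul {c : K} {𝔟 𝔟' : IK} {Λ : FrId K} (hb : 𝔟 ≠ ⊥) (hb' : 𝔟' ≠ ⊥) (hΛ : Λ ≠ 0)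
    (hco : IsCoprime 𝔟 𝔟') (h1 : frSpan (2 * c) * Λ * Λ ≤ (𝔟 : FrId K) * 𝔟' * codiff K)
    (h2 : frSpan c * Λ * Λ ≤ codiff K) :
    gaussW c ((𝔟 : FrId K)⁻¹ * ((𝔟' : FrId K)⁻¹ * Λ)) Λ =
      gaussW c ((𝔟 : FrId K)⁻¹ * Λ) Λ * gaussW c ((𝔟' : FrId K)⁻¹ * Λ) Λ := by
  have hbz : (𝔟 : FrId K) ≠ 0 := coeIdeal_ne_zero.2 hb
  have hbz' : (𝔟' : FrId K) ≠ 0 := coeIdeal_ne_zero.2 hb'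
  obtain ⟨b, hbm, b', hbm', hsum⟩ := coprime_split hco
  have h3 : frSpan (2 * c) * ((𝔟 : FrId K)⁻¹ * ((𝔟' : FrId K)⁻¹ * Λ)) * Λ ≤ codiff K := by
    calc _ = (𝔟 : FrId K)⁻¹ * (𝔟' : FrId K)⁻¹ * (frSpan (2 * c) * Λ * Λ) := by ring
      _ ≤ (𝔟 : FrId K)⁻¹ * (𝔟' : FrId K)⁻¹ * ((𝔟 : FrId K) * 𝔟' * codiff K) := by gcongr
      _ = codiff K := by field_simp
  refine cosetSum_prod (exists_reps_frId _ hΛ) (exists_reps_frId _ hΛ) (fun x hx => le_inv_mul hb Λ hx)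
    (fun x hx => le_inv_mul hb' Λ hx) ?_ ?_ ?_ ?_ (gaussW_periodic h3 h2) ?_
  · intro x hx
    rw [mul_left_comm]
    exact le_inv_mul hb' _ hx
  · intro x hx
    exact le_inv_mul hb _ hx
  · intro x hx hx'
    rw [mem_grp, ← hsum x]
    exact add_frId (mul_mem_of_inv hbm hb hx) (mul_mem_of_inv hbm' hb' hx')
  · intro x hx
    refine ⟨b' * x, ?_, b * x, mul_mem_of_inv hbm hb hx, ?_⟩
    · rw [mem_grp, mul_left_comm] at hx
      exact mul_mem_of_inv hbm' hb' hx
    · rw [add_comm]; exact (hsum x).symm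
  · intro x hx y hy
    rw [← ee_add]
    apply ee_add_int
    have : 2 * c * x * y ∈ codiff K := by
      have e : frSpan (2 * c) * ((𝔟 : FrId K)⁻¹ * Λ) * ((𝔟' : FrId K)⁻¹ * Λ) ≤ codiff K := by
        refine le_trans (le_of_eq ?_) h3
        ring
      exact e (FractionalIdeal.mul_mem_mul (FractionalIdeal.mul_mem_mul (mem_spanSingleton_self _ _) hx) hy)
    obtain ⟨k, hk⟩ := trace_of_mem_codiff this
    refine ⟨k, ?_⟩
    rw [← hk, trForm_apply, trForm_apply, trForm_apply, ← map_add, ← map_sub]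
    congr 1; ring

/-- Gauss sums do not change when the lattice is enlarged away from the modulus. -/
theorem gaussW_enlarge {c : K} {𝔟 𝔰 : IK} {Λ : FrId K} (hb : 𝔟 ≠ ⊥) (hs : 𝔰 ≠ ⊥) (hΛ : Λ ≠ 0)
    (hco : IsCoprime 𝔟 𝔰)
    (h1 : frSpan (2 * c) * ((𝔰 : FrId K)⁻¹ * Λ) * ((𝔰 : FrId K)⁻¹ * Λ) ≤ (𝔟 : FrId K) * codiff K)
    (h2 : frSpan c * ((𝔰 : FrId K)⁻¹ * Λ) * ((𝔰 : FrId K)⁻¹ * Λ) ≤ codiff K) :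
    gaussW c ((𝔟 : FrId K)⁻¹ * Λ) Λ =
      gaussW c ((𝔟 : FrId K)⁻¹ * ((𝔰 : FrId K)⁻¹ * Λ)) ((𝔰 : FrId K)⁻¹ * Λ) := by
  have hbz : (𝔟 : FrId K) ≠ 0 := coeIdeal_ne_zero.2 hb
  obtain ⟨b, hbm, s, hsm, hsum⟩ := coprime_split hco
  have h3 : frSpan (2 * c) * ((𝔟 : FrId K)⁻¹ * ((𝔰 : FrId K)⁻¹ * Λ)) * ((𝔰 : FrId K)⁻¹ * Λ) ≤ codiff K := by
    calc _ = (𝔟 : FrId K)⁻¹ * (frSpan (2 * c) * ((𝔰 : FrId K)⁻¹ * Λ) * ((𝔰 : FrId K)⁻¹ * Λ)) := by ring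
      _ ≤ (𝔟 : FrId K)⁻¹ * ((𝔟 : FrId K) * codiff K) := by gcongr
      _ = codiff K := by field_simp
  refine cosetSum_change (exists_reps_frId _ hΛ) ?_ ?_ (fun x hx => le_inv_mul hs Λ hx) ?_ (gaussW_periodic h3 h2)
  · intro x hx
    rw [mem_grp, mul_left_comm]
    exact le_inv_mul hs _ hx
  · intro x hx hx'
    rw [mem_grp, ← hsum x]
    exact add_frId (mul_mem_of_inv hbm hb hx) (mul_mem_of_inv hsm hs hx')
  · intro x hx
    refine ⟨s * x, ?_, ?_⟩
    · rw [mem_grp, mul_left_comm] at hx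
      exact mul_mem_of_inv hsm hs hx
    · have : x - s * x = b * x := by nth_rewrite 1 [← hsum x]; ring
      rw [this]
      exact mul_mem_of_inv hbm hb hx

/-- Gauss sums of congruent multipliers agree. -/
theorem gaussW_congr {c c' : K} {M Λ : FrId K} (h : frSpan (c - c') * M * M ≤ codiff K) :
    gaussW c M Λ = gaussW c' M Λ := by
  refine cosetSum_congr fun x hx => ee_add_int ?_
  have : (c - c') * x * x ∈ codiff K :=
    h (FractionalIdeal.mul_mem_mul (FractionalIdeal.mul_mem_mul (mem_spanSingleton_self _ _) hx) hx)
  obtain ⟨k, hk⟩ := trace_of_mem_codiff this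
  refine ⟨k, ?_⟩
  rw [← hk, trForm_apply, trForm_apply, ← map_sub]
  congr 1; ring

/-- The Gauss sum of a lattice over its dual. -/
theorem gaussLat_eq_gaussW {c : K} (hc : c ≠ 0) {Λ M : FrId K} (hΛ : Λ ≠ 0)
    (hM : frSpan (2 * c) * M * Λ = codiff K) : gaussLat (trForm c) Λ.grp = gaussW c M Λ := by
  unfold gaussLat gaussW
  congr 1
  have h2c : (2 * c : K) ≠ 0 := mul_ne_zero two_ne_zero hc
  ext x
  rw [mem_dualSub, mem_grp]
  have e1 : (∀ y ∈ Λ.grp, ∃ k : ℤ, 2 * trForm c x y = k) ↔ 2 * c * x ∈ codiff K * Λ⁻¹ := by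
    rw [mem_codiff_mul_inv hΛ]
    refine forall₂_congr fun y _ => ?_
    have : 2 * trForm c x y = trace ℚ K (2 * c * x * y) := by
      rw [trForm_apply, two_mul, ← map_add]; congr 1; ring
    rw [this]
  rw [e1, ← hM, mul_assoc, mul_assoc, mul_inv_cancel₀ hΛ, mul_one]
  constructor
  · intro h
    obtain ⟨z, hz, hz'⟩ := mem_singleton_mul.1 h
    rwa [mul_left_cancel₀ h2c hz']
  · intro h
    exact FractionalIdeal.mul_mem_mul (mem_spanSingleton_self _ _) h

end lattice

section legendre

open FractionalIdeal

theorem sum_quadratic_char {k : Type*} [Field k] [Fintype k] (h2 : ringChar k ≠ 2) (f : k → ℂ)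
    (hf : ∑ t, f t = 0) {ρ : k} (hρ : ρ ≠ 0) :
    ∑ u, f (ρ * u ^ 2) = (quadraticChar k ρ : ℂ) * ∑ u, f (u ^ 2) := by
  have key : ∀ g : k → ℂ, ∑ t, g t = 0 → ∑ u, g (u ^ 2) = ∑ t, (quadraticChar k t : ℂ) * g t := by
    intro g hg
    rw [← Finset.sum_fiberwise (s := univ) (g := fun u : k => u ^ 2)]
    rw [← add_zero (∑ t, (quadraticChar k t : ℂ) * g t), ← hg, ← sum_add_distrib]
    refine sum_congr rfl fun t _ => ?_
    rw [sum_congr rfl (g := fun _ => g t) (fun u hu => by rw [(mem_filter.1 hu).2]),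
      sum_const, nsmul_eq_mul]
    have := quadraticChar_card_sqrts h2 t
    have h3 : {x : k | x ^ 2 = t}.toFinset = univ.filter fun u : k => u ^ 2 = t := by ext; simp
    rw [h3] at this
    have h4 : ((univ.filter fun u : k => u ^ 2 = t).card : ℂ) = (quadraticChar k t : ℂ) + 1 := by
      exact_mod_cast congrArg (Int.cast : ℤ → ℂ) this
    rw [h4]; ring
  have hbij : Function.Bijective fun t : k => ρ * t :=
    ⟨mul_right_injective₀ hρ, fun y => ⟨ρ⁻¹ * y, by simp [hρ]⟩⟩
  rw [key f hf, key (fun t => f (ρ * t)) (by rw [← hf]; exact hbij.sum_comp f), mul_sum,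
    ← hbij.sum_comp (fun t => (quadraticChar k ρ : ℂ) * ((quadraticChar k t : ℂ) * f t))]
  refine sum_congr rfl fun t _ => ?_
  rw [map_mul]
  have h1 : (quadraticChar k ρ : ℂ) * (quadraticChar k ρ : ℂ) = 1 := by
    have := quadraticChar_sq_one hρ
    rw [pow_two] at this
    exact_mod_cast this
  push_cast
  linear_combination (-(quadraticChar k t : ℂ) * f (ρ * t)) * h1

theorem add_le_frId {I J L : FrId K} (h1 : I ≤ L) (h2 : J ≤ L) : I + J ≤ L := by
  rw [← sup_eq_add]; exact sup_le h1 h2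

theorem frSpan_mul (a b : K) : frSpan (a * b) = frSpan a * frSpan b :=
  by rw [spanSingleton_mul_spanSingleton]

theorem gaussW_prime {c : K} {𝔭 : IK} {Λ : FrId K} (h0 : 𝔭 ≠ ⊥) (hp : 𝔭.IsPrime)
    (h2 : (2 : OK) ∉ 𝔭) (hΛ : Λ ≠ 0) (h1 : frSpan c * Λ * Λ ≤ (𝔭 : FrId K) * codiff K)
    (hnd : ¬ frSpan c * Λ * Λ ≤ (𝔭 : FrId K) * 𝔭 * codiff K) {ρ : OK} (hρ : ρ ∉ 𝔭) :
    gaussW (ρ * c) ((𝔭 : FrId K)⁻¹ * Λ) Λ = (legSym 𝔭 ρ : ℂ) * gaussW c ((𝔭 : FrId K)⁻¹ * Λ) Λ := by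
  have hpz : (𝔭 : FrId K) ≠ 0 := coeIdeal_ne_zero.2 h0
  have hmax := hp.isMaximal h0
  -- a generator of the quotient
  obtain ⟨l, hl, hlΛ⟩ : ∃ l ∈ (𝔭 : FrId K)⁻¹ * Λ, l ∉ Λ := by
    by_contra! h
    have h3 : (𝔭 : FrId K)⁻¹ * Λ ≤ Λ := h
    have h4 : (1 : FrId K) ≤ 𝔭 := by
      calc (1 : FrId K) = (𝔭 : FrId K)⁻¹ * Λ * (𝔭 * Λ⁻¹) := by field_simp
        _ ≤ Λ * (𝔭 * Λ⁻¹) := by gcongr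
        _ = 𝔭 := by field_simp
    rw [← coeIdeal_top, coeIdeal_le_coeIdeal] at h4
    exact hp.ne_top (top_le_iff.1 h4)
  have hspan : frSpan l + Λ = (𝔭 : FrId K)⁻¹ * Λ := by
    have h3 : (frSpan l + Λ) * (𝔭 * Λ⁻¹) ≤ 1 := by
      calc _ ≤ ((𝔭 : FrId K)⁻¹ * Λ) * (𝔭 * Λ⁻¹) := by
            gcongr
            exact add_le_frId (spanSingleton_le_iff_mem.2 hl) (fun x hx => le_inv_mul h0 Λ hx)
        _ = 1 := by field_simp
    obtain ⟨I, hI⟩ := le_one_iff_exists_coeIdeal.1 h3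
    have h4 : 𝔭 ≤ I := by
      rw [← coeIdeal_le_coeIdeal K, hI]
      calc (𝔭 : FrId K) = Λ * (𝔭 * Λ⁻¹) := by field_simp
        _ ≤ _ := by gcongr; rw [← sup_eq_add]; exact le_sup_right
    have h5 : I ≠ 𝔭 := by
      rintro rfl
      apply hlΛ
      have h6 : frSpan l + Λ = Λ := by
        calc frSpan l + Λ = (frSpan l + Λ) * ((I : FrId K) * Λ⁻¹) * ((I : FrId K)⁻¹ * Λ) := by field_simp
          _ = Λ := by rw [← hI]; field_simp
      rw [← spanSingleton_le_iff_mem, ← h6, ← sup_eq_add]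
      exact le_sup_left
    have h6 : I = ⊤ := by
      by_contra h7
      exact h5 (hmax.eq_of_le h7 h4).symm
    rw [h6, coeIdeal_top] at hI
    calc frSpan l + Λ = (frSpan l + Λ) * (𝔭 * Λ⁻¹) * ((𝔭 : FrId K)⁻¹ * Λ) := by field_simp
      _ = _ := by rw [← hI, one_mul]
  have hcM : frSpan c * ((𝔭 : FrId K)⁻¹ * Λ) * Λ ≤ codiff K := by
    calc _ = (𝔭 : FrId K)⁻¹ * (frSpan c * Λ * Λ) := by ring
      _ ≤ (𝔭 : FrId K)⁻¹ * ((𝔭 : FrId K) * codiff K) := by gcongr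
      _ = codiff K := by field_simp
  have hcΛ : frSpan c * Λ * Λ ≤ codiff K := by
    refine le_trans ?_ hcM
    gcongr
    exact le_inv_mul h0 Λ
  have hcl : c * l * l ∉ codiff K := by
    intro h
    apply hnd
    have e1 : frSpan c * (frSpan l + Λ) * (frSpan l + Λ) ≤ codiff K := by
      have e2 : frSpan c * (frSpan l + Λ) * (frSpan l + Λ) =
          frSpan c * frSpan l * frSpan l + (frSpan c * frSpan l * Λ + frSpan c * frSpan l * Λ) + frSpan c * Λ * Λ := by ring
      have e3 : frSpan c * frSpan l * Λ ≤ codiff K := by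
        refine le_trans ?_ hcM
        gcongr
        exact spanSingleton_le_iff_mem.2 hl
      rw [e2]
      refine add_le_frId (add_le_frId ?_ (add_le_frId e3 e3)) hcΛ
      rw [spanSingleton_mul_spanSingleton, spanSingleton_mul_spanSingleton]
      exact spanSingleton_le_iff_mem.2 h
    calc frSpan c * Λ * Λ = 𝔭 * 𝔭 * (frSpan c * (frSpan l + Λ) * (frSpan l + Λ)) := by rw [hspan]; field_simp
      _ ≤ _ := by gcongr
  let _ := field 𝔭
  have : Finite (OK ⧸ 𝔭) := finiteQuotientOfFreeOfNeBot 𝔭 h0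
  let _ := ofFinite (OK ⧸ 𝔭)
  set o : OK ⧸ 𝔭 → OK := Function.surjInv mk_surjective with ho
  have hmo : ∀ q, IQ 𝔭 (o q) = q := Function.surjInv_eq _
  have hlp : ∀ u : OK, (u : K) * l ∈ Λ ↔ u ∈ 𝔭 := by
    intro u
    constructor
    · intro h
      by_contra hu
      obtain ⟨v, p, hp', hv⟩ := hmax.exists_inv hu
      apply hlΛ
      have h3 : ((v * u + p : OK) : K) = 1 := by rw [hv]; rfl
      push_cast at h3
      have : l = v * (u * l) + p * l := by rw [← mul_assoc, ← add_mul, h3, one_mul]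
      rw [this]
      exact add_frId (smul_frId v h) (mul_mem_of_inv hp' h0 hl)
    · intro h
      exact mul_mem_of_inv h h0 hl
  set X : OK ⧸ 𝔭 → K := fun q => (o q : K) * l with hX
  have hXinj : ∀ q q', X q - X q' ∈ Λ → q = q' := by
    intro q q' h
    rw [← hmo q, ← hmo q', Ideal.Quotient.eq, ← hlp]
    push_cast
    rw [sub_mul]; exact h
  have hreps : IsReps ((𝔭 : FrId K)⁻¹ * Λ).grp Λ.grp (univ.image X) := by
    constructor
    · intro r hr
      obtain ⟨q, -, rfl⟩ := mem_image.1 hr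
      exact smul_frId _ hl
    · intro x hx
      rw [mem_grp, ← hspan, mem_add] at hx
      obtain ⟨a, ha, b, hb, rfl⟩ := hx
      obtain ⟨u, rfl⟩ := (mem_spanSingleton _).1 ha
      rw [smul_def]
      have hxk : (algebraMap OK K u * l + b) - X (IQ 𝔭 u) ∈ Λ.grp := by
        have : (algebraMap OK K u * l + b) - X (IQ 𝔭 u) =
            ((u - o (IQ 𝔭 u) : OK) : K) * l + b := by
          push_cast
          simp only [hX]
          change (u : K) * l + b - _ = _
          ring
        rw [this]
        exact add_frId ((hlp _).2 (Ideal.Quotient.eq.1 (hmo _).symm)) hb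
      refine ⟨_, ⟨mem_image_of_mem _ (mem_univ _), hxk⟩, ?_⟩
      rintro y ⟨hy, hy'⟩
      obtain ⟨q, -, rfl⟩ := mem_image.1 hy
      rw [hXinj q (IQ 𝔭 u)]
      have h7 := Λ.grp.sub_mem hxk hy'
      rw [sub_sub_sub_cancel_left] at h7
      exact h7
  set f : OK ⧸ 𝔭 → ℂ := fun q => ee (trace ℚ K (c * l * l * o q)) with hf
  have hfmk : ∀ u : OK, f (IQ 𝔭 u) = ee (trace ℚ K (c * l * l * u)) := by
    intro u
    apply ee_add_int
    rw [← map_sub, ← mul_sub]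
    have hmem : o (IQ 𝔭 u) - u ∈ 𝔭 := Ideal.Quotient.eq.1 (hmo _)
    have h3 : (((o (IQ 𝔭 u) - u : OK)) : K) * l ∈ Λ := mul_mem_of_inv hmem h0 hl
    have h4 := hcM (FractionalIdeal.mul_mem_mul (FractionalIdeal.mul_mem_mul (mem_spanSingleton_self _ _) hl) h3)
    obtain ⟨k, hk⟩ := trace_of_mem_codiff h4
    refine ⟨k, ?_⟩
    rw [← hk]
    push_cast
    congr 1; ring
  have hf0 : ∑ q, f q = 0 := by
    obtain ⟨a, ha⟩ : ∃ a : OK, ¬ ∃ k : ℤ, trace ℚ K (c * l * l * a) = k := by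
      by_contra! h
      exact hcl (mem_codiff_iff.2 h)
    have hne : f (IQ 𝔭 a) ≠ 1 := fun h => ha (ee_eq_one_iff.1 (by rw [← hfmk]; exact h))
    have hadd : ∀ q, f (q + IQ 𝔭 a) = f q * f (IQ 𝔭 a) := by
      intro q
      obtain ⟨u, rfl⟩ := mk_surjective q
      rw [← map_add, hfmk, hfmk, hfmk, ← ee_add, ← map_add]
      congr 2; push_cast; ring
    have hsh : ∑ q, f (q + IQ 𝔭 a) = ∑ q, f q := sum_equiv (Equiv.addRight _) _ _ fun _ => rfl
    simp only [hadd] at hsh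
    rw [← sum_mul] at hsh
    by_contra h0
    exact hne (mul_left_cancel₀ h0 (by rw [hsh, mul_one]))
  have h2c : ringChar (OK ⧸ 𝔭) ≠ 2 := by
    intro h
    apply h2
    rw [← eq_zero_iff_mem]
    have h7 : ((2 : ℕ) : OK ⧸ 𝔭) = 0 := by rw [← h]; exact ringChar.Nat.cast_ringChar
    rw [map_ofNat]; exact_mod_cast h7
  have hρ0 : IQ 𝔭 ρ ≠ 0 := fun h => hρ (eq_zero_iff_mem.1 h)
  have hval : ∀ r : OK, frSpan (2 * (r * c)) * ((𝔭 : FrId K)⁻¹ * Λ) * Λ ≤ codiff K ∧ frSpan (r * c) * Λ * Λ ≤ codiff K := by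
    intro r
    have hle1 : ∀ r : OK, frSpan (r : K) ≤ 1 := fun r => by
      exact spanSingleton_le_iff_mem.2 ((mem_one_iff _).2 ⟨r, rfl⟩)
    constructor
    · calc _ = frSpan ((2 * r : OK) : K) * (frSpan c * ((𝔭 : FrId K)⁻¹ * Λ) * Λ) := by
            have : (2 * (r * c) : K) = ((2 * r : OK) : K) * c := by
              rw [show ((2 * r : OK) : K) = 2 * r from rfl]; ring
            rw [this, frSpan_mul]; ring
        _ ≤ 1 * codiff K := mul_le_mul' (hle1 _) hcM
        _ = _ := one_mul _
    · calc _ = frSpan (r : K) * (frSpan c * Λ * Λ) := by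
            rw [frSpan_mul]; ring
        _ ≤ 1 * codiff K := mul_le_mul' (hle1 _) hcΛ
        _ = _ := one_mul _
  have hW : ∀ r : OK, gaussW (r * c) ((𝔭 : FrId K)⁻¹ * Λ) Λ = ∑ q, f (IQ 𝔭 r * q ^ 2) := by
    intro r
    rw [gaussW, cosetSum_eq hreps (gaussW_periodic (hval r).1 (hval r).2), sum_image]
    · refine sum_congr rfl fun q _ => ?_
      have hq : IQ 𝔭 r * q ^ 2 = IQ 𝔭 (r * o q ^ 2) := by
        rw [map_mul, map_pow, hmo]
      rw [hq, hfmk, trForm_apply]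
      congr 2
      simp only [hX]; push_cast; ring
    · intro q _ q' _ h
      exact hXinj q q' (by rw [h, sub_self]; exact Λ.grp.zero_mem)
  have hW1 := hW 1
  simp only [map_one, one_mul] at hW1
  rw [hW, sum_quadratic_char h2c f hf0 hρ0]
  have e1 : legSym 𝔭 ρ = quadraticChar (OK ⧸ 𝔭) (IQ 𝔭 ρ) := by
    rw [quadraticChar_apply, quadraticCharFun, legSym]
    congr
  rw [e1, ← hW1]

end legendre

section

open FractionalIdeal

theorem frSpan_int_le_one (r : OK) : frSpan (r : K) ≤ 1 :=
  spanSingleton_le_iff_mem.2 ((mem_one_iff _).2 ⟨r, rfl⟩)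

theorem frSpan_int_mul_le {c : K} (r : OK) {I J L : FrId K} (h : frSpan c * I * J ≤ L) :
    frSpan (r * c) * I * J ≤ L := by
  calc frSpan (r * c) * I * J = frSpan (r : K) * (frSpan c * I * J) := by rw [frSpan_mul]; ring
    _ ≤ 1 * L := mul_le_mul' (frSpan_int_le_one r) h
    _ = L := one_mul _

theorem frSpan_two_mul_le {c : K} {I J L : FrId K} (h : frSpan c * I * J ≤ L) :
    frSpan (2 * c) * I * J ≤ L := by
  have := frSpan_int_mul_le (2 : OK) h
  rwa [show ((2 : OK) : K) = 2 from rfl] at this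

theorem Ideal.notMem_of_isCoprime {𝔱 𝔭 : IK} (hp : 𝔭.IsPrime) (hle : 𝔱 ≤ 𝔭) {ρ : OK}
    (h : IsCoprime 𝔱 (span {ρ})) : ρ ∉ 𝔭 := by
  intro hρ
  refine hp.ne_top (top_le_iff.1 ?_)
  rw [← isCoprime_iff_sup_eq.1 h]
  exact sup_le hle ((span_singleton_le_iff_mem _).2 hρ)

theorem isCoprime_of_not_le {R : Type*} [CommRing R] {𝔭 𝔞 : Ideal R} (hp : 𝔭.IsMaximal) (h : ¬ 𝔞 ≤ 𝔭) :
    IsCoprime 𝔭 𝔞 :=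
  isCoprime_iff_sup_eq.2 (hp.1.2 _ (left_lt_sup.2 h))

theorem gaussW_squarefree {c : K} {Λ : FrId K} (hΛ : Λ ≠ 0) {ρ : OK} (𝔱 : IK) (h0 : 𝔱 ≠ ⊥)
    (hsq : Squarefree 𝔱) (h2 : IsCoprime 𝔱 (span {(2 : OK)}))
    (h1 : frSpan c * Λ * Λ ≤ (𝔱 : FrId K) * codiff K)
    (hnd : ∀ 𝔭 : IK, 𝔭 ≠ ⊥ → 𝔭.IsPrime → 𝔱 ≤ 𝔭 → ¬ frSpan c * Λ * Λ ≤ (𝔭 : FrId K) * 𝔭 * codiff K)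
    (hρ : IsCoprime 𝔱 (span {ρ})) :
    gaussW (ρ * c) ((𝔱 : FrId K)⁻¹ * Λ) Λ = (quadSym 𝔱 ρ : ℂ) * gaussW c ((𝔱 : FrId K)⁻¹ * Λ) Λ := by
  induction 𝔱 using UniqueFactorizationMonoid.induction_on_prime with
  | h₁ => exact absurd rfl h0
  | h₂ x hx =>
    rw [Ideal.isUnit_iff] at hx
    subst hx
    rw [quadSym_top, Int.cast_one, one_mul]
    refine gaussW_congr ?_
    rw [coeIdeal_top, inv_one, one_mul]
    have := frSpan_int_mul_le (ρ - 1) h1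
    rw [coeIdeal_top, one_mul] at this
    have e : (ρ * c - c : K) = ((ρ - 1 : OK) : K) * c := by
      rw [show ((ρ - 1 : OK) : K) = ρ - 1 from rfl]; ring
    rw [e]; exact this
  | h₃ a 𝔭 ha hp ih =>
    have hp0 : 𝔭 ≠ ⊥ := hp.ne_zero
    have hp' : 𝔭.IsPrime := isPrime_of_prime hp
    have ha0 : a ≠ ⊥ := ha
    have hco : IsCoprime 𝔭 a := by
      refine isCoprime_of_not_le (hp'.isMaximal hp0) fun h => ?_
      exact hp.not_unit (hsq 𝔭 (mul_dvd_mul_left 𝔭 (dvd_iff_le.2 h)))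
    have hle1 : 𝔭 * a ≤ 𝔭 := mul_le_left
    have hle2 : 𝔭 * a ≤ a := Ideal.mul_le_right
    have hc2 : IsCoprime 𝔭 (span {(2 : OK)}) ∧ IsCoprime a (span {(2 : OK)}) :=
      ⟨h2.of_mul_left_left, h2.of_mul_left_right⟩
    have h1p : frSpan c * Λ * Λ ≤ (𝔭 : FrId K) * codiff K :=
      h1.trans (by gcongr)
    have h1a : frSpan c * Λ * Λ ≤ (a : FrId K) * codiff K := h1.trans (by gcongr)
    have h1c : frSpan c * Λ * Λ ≤ codiff K := h1p.trans (by
      calc (𝔭 : FrId K) * codiff K ≤ 1 * codiff K := by gcongr; exact coeIdeal_le_one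
        _ = _ := one_mul _)
    have h1' : frSpan c * Λ * Λ ≤ (𝔭 : FrId K) * a * codiff K := by rwa [← coeIdeal_mul]
    have hsplit : ((𝔭 * a : IK) : FrId K)⁻¹ * Λ = (𝔭 : FrId K)⁻¹ * ((a : FrId K)⁻¹ * Λ) := by
      rw [coeIdeal_mul, mul_inv, mul_assoc]
    rw [hsplit, gaussW_mul hp0 ha0 hΛ hco (frSpan_two_mul_le h1') h1c,
      gaussW_mul hp0 ha0 hΛ hco (frSpan_two_mul_le (frSpan_int_mul_le ρ h1')) (frSpan_int_mul_le ρ h1c),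
      ih ha0 (hsq.of_mul_right) hc2.2 h1a (fun 𝔮 h h' h'' => hnd 𝔮 h h' (hle2.trans h''))
        hρ.of_mul_left_right,
      gaussW_prime hp0 hp' (Ideal.notMem_of_isCoprime hp' hle1 h2) hΛ h1p (hnd 𝔭 hp0 hp' hle1)
        (Ideal.notMem_of_isCoprime hp' hle1 hρ),
      quadSym_mul_left hp0 ha0, quadSym_of_prime hp0 hp']
    push_cast; ring

end

section

open FractionalIdeal

theorem le_of_eq_coeIdeal_mul {x y : FrId K} (I : IK) (h : x = I * y) : x ≤ y := by
  calc x = I * y := h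
    _ ≤ 1 * y := by gcongr; exact coeIdeal_le_one
    _ = y := one_mul y

variable (K) in
/-- The different, as an ideal of the ring of integers. -/
abbrev diffId : IK := differentIdeal ℤ OK

theorem codiff_eq_inv : codiff K = ((diffId K : IK) : FrId K)⁻¹ := by
  rw [diffId, coeIdeal_differentIdeal ℤ ℚ K, inv_inv, codiff]

theorem diffId_ne_bot : diffId K ≠ ⊥ := by
  intro h
  have := codiff_eq_inv (K := K)
  rw [h, coeIdeal_bot, inv_zero] at this
  exact codiff_ne_zero this

theorem coe_span_eq_frSpan (a : OK) : ((span {a} : IK) : FrId K) = frSpan (a : K) :=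
  coeIdeal_span_singleton a

theorem not_le_sq_of_squarefree {c : K} {Λ : FrId K} {𝔱 𝔵 : IK} (hsq : Squarefree 𝔱)
    (hco : IsCoprime 𝔱 (𝔵 * diffId K)) (h : frSpan c * Λ * Λ = (𝔱 : FrId K) * 𝔵) (𝔭 : IK)
    (hp0 : 𝔭 ≠ ⊥) (hp : 𝔭.IsPrime) (hle : 𝔱 ≤ 𝔭) :
    ¬ frSpan c * Λ * Λ ≤ (𝔭 : FrId K) * 𝔭 * codiff K := by
  intro h1
  have hD : ((diffId K : IK) : FrId K) ≠ 0 := coeIdeal_ne_zero.2 diffId_ne_bot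
  have h2 : ((𝔱 * (𝔵 * diffId K) : IK) : FrId K) ≤ ((𝔭 * 𝔭 : IK) : FrId K) := by
    rw [coeIdeal_mul, coeIdeal_mul, coeIdeal_mul]
    calc (𝔱 : FrId K) * (𝔵 * (diffId K : IK)) = (frSpan c * Λ * Λ) * (diffId K : IK) := by rw [h]; ring
      _ ≤ ((𝔭 : FrId K) * 𝔭 * codiff K) * (diffId K : IK) := by gcongr
      _ = _ := by rw [codiff_eq_inv]; field_simp
  rw [coeIdeal_le_coeIdeal] at h2
  have h3 : 𝔭 * 𝔭 ∣ 𝔱 * (𝔵 * diffId K) := dvd_iff_le.2 h2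
  have h4 : IsCoprime 𝔭 (𝔵 * diffId K) := hco.of_isCoprime_of_dvd_left (dvd_iff_le.2 hle)
  have h5 : 𝔭 * 𝔭 ∣ 𝔱 := (h4.mul_left h4).dvd_of_dvd_mul_right h3
  exact (prime_of_isPrime hp0 hp).not_unit (hsq 𝔭 h5)

theorem gaussLat_split {α γ : OK} (hα : α ≠ 0) (hγ : γ ≠ 0) {sg tc tF sa ta F : IK}
    (eγ : span {γ} = sg * sg * (tc * tF)) (eα : span {α} = sa * sa * ta)
    (hta : Squarefree ta) (htc : Squarefree tc) (hco : IsCoprime (span {α}) (span {γ}))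
    (hαF : IsCoprime (span {α}) F) (hcF : IsCoprime tc F)
    (hF : span {(2 : OK)} * diffId K ∣ F) (htF : tF ∣ F) :
    gaussLat (trForm ((γ : K) * α)) (((sg : FrId K)⁻¹ * (sa : FrId K)⁻¹)).grp =
      ((quadSym ta γ : ℂ) * gaussW (α : K) ((ta : FrId K)⁻¹ * (sa : FrId K)⁻¹) (sa : FrId K)⁻¹) *
      (((quadSym tc α : ℂ) * gaussW (γ : K) ((tc : FrId K)⁻¹ * (sg : FrId K)⁻¹) (sg : FrId K)⁻¹) *
      gaussW ((γ : K) * α)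
        (((span {(2 : OK)} * diffId K * tF : IK) : FrId K)⁻¹ * (sg : FrId K)⁻¹) (sg : FrId K)⁻¹) := by
  have hα' : (α : K) ≠ 0 := by exact_mod_cast hα
  have hγ' : (γ : K) ≠ 0 := by exact_mod_cast hγ
  have n1 : sg * sg * (tc * tF) ≠ ⊥ := by rw [← eγ, Ne, span_singleton_eq_bot]; exact hγ
  have n2 : sa * sa * ta ≠ ⊥ := by rw [← eα, Ne, span_singleton_eq_bot]; exact hα
  have nsg : sg ≠ ⊥ := fun h => n1 (by rw [h]; simp)
  have ntc : tc ≠ ⊥ := fun h => n1 (by rw [h]; simp)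
  have ntF : tF ≠ ⊥ := fun h => n1 (by rw [h]; simp)
  have nsa : sa ≠ ⊥ := fun h => n2 (by rw [h]; simp)
  have nta : ta ≠ ⊥ := fun h => n2 (by rw [h]; simp)
  have n22 : span {(2 : OK)} ≠ ⊥ := by rw [Ne, span_singleton_eq_bot]; exact two_ne_zero
  have dsg : sg ∣ span {γ} := ⟨sg * (tc * tF), by rw [eγ]; ring⟩
  have dtc : tc ∣ span {γ} := ⟨sg * sg * tF, by rw [eγ]; ring⟩
  have dsa : sa ∣ span {α} := ⟨sa * ta, by rw [eα]; ring⟩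
  have dta : ta ∣ span {α} := ⟨sa * sa, by rw [eα]; ring⟩
  set e : IK := span {(2 : OK)} * diffId K * tF with he
  have ne : e ≠ ⊥ := mul_ne_zero (mul_ne_zero n22 diffId_ne_bot) ntF
  have dee : e ∣ F * F := mul_dvd_mul hF htF
  have cαe : IsCoprime (span {α}) e := (hαF.mul_right hαF).of_isCoprime_of_dvd_right dee
  have ctce : IsCoprime tc e := (hcF.mul_right hcF).of_isCoprime_of_dvd_right dee
  have ctae : IsCoprime ta e := cαe.of_isCoprime_of_dvd_left dta
  have zsg : (sg : FrId K) ≠ 0 := coeIdeal_ne_zero.2 nsg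
  have ztc : (tc : FrId K) ≠ 0 := coeIdeal_ne_zero.2 ntc
  have ztF : (tF : FrId K) ≠ 0 := coeIdeal_ne_zero.2 ntF
  have zsa : (sa : FrId K) ≠ 0 := coeIdeal_ne_zero.2 nsa
  have zta : (ta : FrId K) ≠ 0 := coeIdeal_ne_zero.2 nta
  have zD : ((diffId K : IK) : FrId K) ≠ 0 := coeIdeal_ne_zero.2 diffId_ne_bot
  have fγ : frSpan (γ : K) = (sg : FrId K) * sg * (tc * tF) := by
    rw [← coe_span_eq_frSpan, eγ]; simp only [coeIdeal_mul]
  have fα : frSpan (α : K) = (sa : FrId K) * sa * ta := by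
    rw [← coe_span_eq_frSpan, eα]; simp only [coeIdeal_mul]
  have z2 : frSpan (2 : K) ≠ 0 := spanSingleton_ne_zero_iff.2 two_ne_zero
  have e2 : ((span {(2 : OK)} : IK) : FrId K) = frSpan (2 : K) := by
    rw [coe_span_eq_frSpan]; rfl
  have fe : (e : FrId K) = frSpan (2 : K) * (diffId K : IK) * tF := by
    rw [he, coeIdeal_mul, coeIdeal_mul, e2]
  have ze : (e : FrId K) ≠ 0 := coeIdeal_ne_zero.2 ne
  clear_value e
  set L : FrId K := (sg : FrId K)⁻¹ * (sa : FrId K)⁻¹ with hL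
  have zL : L ≠ 0 := mul_ne_zero (inv_ne_zero zsg) (inv_ne_zero zsa)
  have cLL : frSpan ((γ : K) * α) * L * L = (tc : FrId K) * tF * ta := by
    rw [frSpan_mul, fγ, fα, hL]; field_simp
  have c2LL : frSpan (2 * ((γ : K) * α)) * L * L = (ta : FrId K) * tc * e * codiff K := by
    rw [frSpan_mul, mul_assoc, mul_assoc, ← mul_assoc (frSpan ((γ : K) * α)), cLL, fe, codiff_eq_inv]; field_simp
  have b0 : frSpan ((γ : K) * α) * L * L ≤ codiff K := by
    rw [cLL, codiff_eq_inv]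
    exact le_of_eq_coeIdeal_mul (tc * tF * ta * diffId K) (by simp only [coeIdeal_mul]; field_simp)
  have s1 : gaussLat (trForm ((γ : K) * α)) L.grp =
      gaussW ((γ : K) * α) ((ta : FrId K)⁻¹ * (((tc * e : IK) : FrId K)⁻¹ * L)) L := by
    refine gaussLat_eq_gaussW (mul_ne_zero hγ' hα') zL ?_
    calc _ = (frSpan (2 * ((γ : K) * α)) * L * L) * ((ta : FrId K)⁻¹ * ((tc * e : IK) : FrId K)⁻¹) := by ring
      _ = _ := by rw [c2LL, coeIdeal_mul]; field_simp
  have s2 : ((tc * e : IK) : FrId K)⁻¹ * L = (tc : FrId K)⁻¹ * ((e : FrId K)⁻¹ * L) := by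
    rw [coeIdeal_mul, mul_inv, mul_assoc]
  have cta : IsCoprime ta (tc * e) :=
    ((hco.of_isCoprime_of_dvd_left dta).of_isCoprime_of_dvd_right dtc).mul_right ctae
  have b1 : frSpan (2 * ((γ : K) * α)) * L * L ≤ (ta : FrId K) * ((tc * e : IK) : FrId K) * codiff K := by
    rw [c2LL, coeIdeal_mul, mul_assoc (ta : FrId K)]
  have b2 : frSpan (2 * ((γ : K) * α)) * L * L ≤ (tc : FrId K) * e * codiff K := by
    rw [c2LL]; exact le_of_eq_coeIdeal_mul ta (by ring)
  have b3 : frSpan (2 * ((γ : K) * α)) * L * L ≤ (ta : FrId K) * codiff K := by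
    rw [c2LL]; exact le_of_eq_coeIdeal_mul (tc * e) (by rw [coeIdeal_mul]; ring)
  have b4 : frSpan (2 * ((γ : K) * α)) * L * L ≤ (tc : FrId K) * codiff K := by
    rw [c2LL]; exact le_of_eq_coeIdeal_mul (ta * e) (by rw [coeIdeal_mul]; ring)
  have b5 : frSpan (2 * ((γ : K) * α)) * L * L ≤ (e : FrId K) * codiff K := by
    rw [c2LL]; exact le_of_eq_coeIdeal_mul (ta * tc) (by rw [coeIdeal_mul]; ring)
  have hL' : L = (sa : FrId K)⁻¹ * (sg : FrId K)⁻¹ := mul_comm _ _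
  have zsa' := inv_ne_zero zsa
  have zsg' := inv_ne_zero zsg
  rw [s1, gaussW_mul nta (mul_ne_zero ntc ne) zL cta b1 b0, s2, gaussW_mul ntc ne zL ctce b2 b0]
  have t1 : gaussW ((γ : K) * α) ((ta : FrId K)⁻¹ * L) L =
      (quadSym ta γ : ℂ) * gaussW (α : K) ((ta : FrId K)⁻¹ * (sa : FrId K)⁻¹) (sa : FrId K)⁻¹ := by
    rw [hL, ← gaussW_enlarge nta nsg zsa'
      ((hco.of_isCoprime_of_dvd_left dta).of_isCoprime_of_dvd_right dsg) b3 b0]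
    have e1 : frSpan (α : K) * (sa : FrId K)⁻¹ * (sa : FrId K)⁻¹ = (ta : FrId K) * ((1 : IK) : FrId K) := by
      rw [fα, one_eq_top, coeIdeal_top]; field_simp
    refine gaussW_squarefree zsa' ta nta hta (hαF.of_isCoprime_of_dvd_left dta |>.of_isCoprime_of_dvd_right
      (dvd_trans (dvd_mul_right _ _) hF)) ?_ (not_le_sq_of_squarefree hta (𝔵 := 1) ?_ e1)
      (hco.of_isCoprime_of_dvd_left dta)
    · rw [e1, one_eq_top, coeIdeal_top, codiff_eq_inv]
      exact le_of_eq_coeIdeal_mul (diffId K) (by field_simp)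
    · rw [one_mul]
      exact hαF.of_isCoprime_of_dvd_left dta |>.of_isCoprime_of_dvd_right (dvd_trans (dvd_mul_left _ _) hF)
  have t2 : gaussW ((γ : K) * α) ((tc : FrId K)⁻¹ * L) L =
      (quadSym tc α : ℂ) * gaussW (γ : K) ((tc : FrId K)⁻¹ * (sg : FrId K)⁻¹) (sg : FrId K)⁻¹ := by
    rw [hL', ← gaussW_enlarge ntc nsa zsg'
      ((hco.of_isCoprime_of_dvd_left dsa).of_isCoprime_of_dvd_right dtc).symm (hL' ▸ b4) (hL' ▸ b0),
      mul_comm (γ : K)]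
    have e1 : frSpan (γ : K) * (sg : FrId K)⁻¹ * (sg : FrId K)⁻¹ = (tc : FrId K) * (tF : FrId K) := by
      rw [fγ]; field_simp
    refine gaussW_squarefree zsg' tc ntc htc (hcF.of_isCoprime_of_dvd_right
      (dvd_trans (dvd_mul_right _ _) hF)) ?_ (not_le_sq_of_squarefree htc (𝔵 := tF) ?_ e1)
      (hco.of_isCoprime_of_dvd_right dtc).symm
    · rw [e1, codiff_eq_inv]
      exact le_of_eq_coeIdeal_mul (tF * diffId K) (by rw [coeIdeal_mul]; field_simp)
    · exact (hcF.of_isCoprime_of_dvd_right htF).mul_right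
        (hcF.of_isCoprime_of_dvd_right (dvd_trans (dvd_mul_left _ _) hF))
  have t3 : gaussW ((γ : K) * α) ((e : FrId K)⁻¹ * L) L =
      gaussW ((γ : K) * α) ((e : FrId K)⁻¹ * (sg : FrId K)⁻¹) (sg : FrId K)⁻¹ := by
    rw [hL', ← gaussW_enlarge ne nsa zsg' (cαe.of_isCoprime_of_dvd_left dsa).symm (hL' ▸ b5) (hL' ▸ b0)]
  rw [t1, t2, t3]

end

theorem exists_sq_mul_squarefree_ideal (I : IK) (hI : I ≠ ⊥) :
    ∃ s t, I = s * s * t ∧ Squarefree t := by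
  induction I using UniqueFactorizationMonoid.induction_on_prime with
  | h₁ => exact absurd rfl hI
  | h₂ x hx => exact ⟨1, x, by simp, hx.squarefree⟩
  | h₃ a 𝔭 ha hp ih =>
    obtain ⟨s, t, rfl, ht⟩ := ih ha
    by_cases h : 𝔭 ∣ t
    · obtain ⟨t', rfl⟩ := h
      exact ⟨s * 𝔭, t', by ring, ht.of_mul_right⟩
    · refine ⟨s, 𝔭 * t, by ring, ?_⟩
      rw [squarefree_mul_iff]
      exact ⟨hp.irreducible.isRelPrime_iff_not_dvd.2 h, hp.irreducible.squarefree, ht⟩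

theorem dvd_of_squarefree_of_primes {t F : IK} (ht0 : t ≠ ⊥) (ht : Squarefree t)
    (h : ∀ 𝔭, Prime 𝔭 → 𝔭 ∣ t → 𝔭 ∣ F) : t ∣ F := by
  by_cases hF : F = ⊥
  · rw [hF]; exact dvd_zero _
  rw [dvd_iff_normalizedFactors_le_normalizedFactors ht0 hF,
    le_iff_subset ((squarefree_iff_nodup_normalizedFactors ht0).1 ht)]
  intro 𝔭 hp
  have hp' := prime_of_normalized_factor 𝔭 hp
  have := h 𝔭 hp' (dvd_of_mem_normalizedFactors hp)
  rw [Ideal.mem_normalizedFactors_iff hF]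
  exact ⟨isPrime_of_prime hp', Ideal.le_of_dvd this⟩

section

open FractionalIdeal

theorem gaussLat_ratio [IsGalois ℚ K] (ι : K →+* ℝ) {c c' : K} (hc : c ≠ 0) (hc' : c' ≠ 0)
    (hs : ∀ τ : Gal(K/ℚ), 0 < ι (τ c) ↔ 0 < ι (τ c')) {I I' : FrId K} (hI : I ≠ 0) (hI' : I' ≠ 0)
    (h : frSpan c * I * I ≤ codiff K) (h' : frSpan c' * I' * I' ≤ codiff K) :
    gaussLat (trForm c') I'.grp ≠ 0 ∧
    ∃ r : ℝ, 0 < r ∧ gaussLat (trForm c) I.grp = r * gaussLat (trForm c') I'.grp := by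
  have key : ∀ {c : K} {I : FrId K}, c ≠ 0 → I ≠ 0 → frSpan c * I * I ≤ codiff K →
      ∃ r : ℝ, 0 < r ∧ r * gaussLat (trForm c) I.grp =
      phase True ^ (univ.filter fun τ : Gal(K/ℚ) => 0 < ι (τ c)).card *
      phase False ^ (card (Gal(K/ℚ)) - (univ.filter fun τ : Gal(K/ℚ) => 0 < ι (τ c)).card) := by
    intro c I hc hI h
    refine milgram ι hc (fun x => ?_) (fun x hx => ?_)
    · obtain ⟨N, hN, hN'⟩ := exists_nsmul_le (M := frSpan x) hI
      exact ⟨N, hN, hN' x (mem_spanSingleton_self _ _)⟩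
    · exact trace_of_mem_codiff (h (FractionalIdeal.mul_mem_mul
        (FractionalIdeal.mul_mem_mul (mem_spanSingleton_self _ _) hx) hx))
  obtain ⟨r, hr, e⟩ := key hc hI h
  obtain ⟨r', hr', e'⟩ := key hc' hI' h'
  have hr0 : (r : ℂ) ≠ 0 := by exact_mod_cast hr.ne'
  have hfilt : (univ.filter fun τ : Gal(K/ℚ) => 0 < ι (τ c)) =
      univ.filter fun τ : Gal(K/ℚ) => 0 < ι (τ c') := Finset.filter_congr fun τ _ => hs τ
  rw [hfilt, ← e'] at e
  constructor
  · intro h0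
    rw [h0, mul_zero] at e'
    exact mul_ne_zero (pow_ne_zero _ (phase_ne_zero _)) (pow_ne_zero _ (phase_ne_zero _)) e'.symm
  · refine ⟨r' / r, div_pos hr' hr, ?_⟩
    push_cast
    field_simp
    linear_combination e

theorem quadSym_sq_mul {s t : IK} {a : OK} (h0 : s * s * t ≠ ⊥)
    (h : IsCoprime (span {a}) (s * s * t)) : quadSym (s * s * t) a = quadSym t a := by
  have hs : s ≠ ⊥ := fun h' => h0 (by rw [h']; simp)
  have ht : t ≠ ⊥ := fun h' => h0 (by rw [h']; simp)
  rw [quadSym_mul_left (mul_ne_zero hs hs) ht, quadSym_mul_left hs hs, quadSym_sq, one_mul]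
  exact (quadSym_ne_zero_iff hs).2 (h.of_isCoprime_of_dvd_right ⟨s * t, by ring⟩)

theorem quadSym_isUnit {b : IK} {a : OK} (h0 : b ≠ ⊥) (h : IsCoprime (span {a}) b) :
    quadSym b a = 1 ∨ quadSym b a = -1 := by
  rcases quadSym_trichotomy b a with h1 | h1
  · exact absurd h1 ((quadSym_ne_zero_iff h0).2 h)
  · exact h1

/-- **Quadratic reciprocity**: dependence on residue classes only. -/
theorem quadSym_reciprocity [IsGalois ℚ K] (ι : K →+* ℝ) {F : IK}
    (hF : span {(2 : OK)} * span {(2 : OK)} * diffId K ∣ F) {γ α α' : OK} (hγ : γ ≠ 0)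
    (hα : α ≠ 0) (hα' : α' ≠ 0) {𝔠 𝔣 : IK} (eγ : span {γ} = 𝔠 * 𝔣) (hc : IsCoprime 𝔠 F)
    (hf : ∀ 𝔭, Prime 𝔭 → 𝔭 ∣ 𝔣 → 𝔭 ∣ F) (hs : ∀ τ : Gal(K/ℚ), 0 < ι (τ α))
    (hs' : ∀ τ : Gal(K/ℚ), 0 < ι (τ α')) (hαγ : IsCoprime (span {α}) (span {γ}))
    (hαγ' : IsCoprime (span {α'}) (span {γ})) (hαF : IsCoprime (span {α}) F)
    (hαF' : IsCoprime (span {α'}) F) (hcong : α - α' ∈ F * F) :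
    quadSym (span {α}) γ * quadSym 𝔠 α = quadSym (span {α'}) γ * quadSym 𝔠 α' := by
  have n0 : 𝔠 * 𝔣 ≠ ⊥ := by rw [← eγ, Ne, span_singleton_eq_bot]; exact hγ
  have nc : 𝔠 ≠ ⊥ := fun h => n0 (by rw [h]; simp)
  have nf : 𝔣 ≠ ⊥ := fun h => n0 (by rw [h]; simp)
  have na : span {α} ≠ ⊥ := by rw [Ne, span_singleton_eq_bot]; exact hα
  have na' : span {α'} ≠ ⊥ := by rw [Ne, span_singleton_eq_bot]; exact hα'
  obtain ⟨s1, tc, ec, htc⟩ := exists_sq_mul_squarefree_ideal 𝔠 nc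
  obtain ⟨s2, tF, ef, htF⟩ := exists_sq_mul_squarefree_ideal 𝔣 nf
  obtain ⟨sa, ta, ea, hta⟩ := exists_sq_mul_squarefree_ideal _ na
  obtain ⟨sa', ta', ea', hta'⟩ := exists_sq_mul_squarefree_ideal _ na'
  have ntF : tF ≠ ⊥ := fun h => nf (by rw [ef, h]; simp)
  have hF' : span {(2 : OK)} * diffId K ∣ F := dvd_trans ⟨span {(2 : OK)}, by ring⟩ hF
  have htFF : tF ∣ F := dvd_of_squarefree_of_primes ntF htF fun 𝔭 hp h =>
    hf 𝔭 hp (h.trans ⟨s2 * s2, by rw [ef]; ring⟩)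
  have eγ' : span {γ} = (s1 * s2) * (s1 * s2) * (tc * tF) := by rw [eγ, ec, ef]; ring
  have e1 : span {(1 : OK)} = 1 * 1 * ((1 : IK) * 1) := by
    simp
  have hcF : IsCoprime tc F := hc.of_isCoprime_of_dvd_left ⟨s1 * s1, by rw [ec]; ring⟩
  have co1 : ∀ I : IK, IsCoprime I (span {(1 : OK)}) := fun I => by
    rw [span_singleton_one, ← one_eq_top]; exact isCoprime_one_right
  have nsg : s1 * s2 ≠ ⊥ := by
    intro h
    rw [h] at eγ'
    rw [Submodule.bot_mul, Submodule.bot_mul, span_singleton_eq_bot] at eγ'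
    exact hγ eγ'
  have nsa : sa ≠ ⊥ := fun h => na (by rw [ea, h]; simp)
  have nsa' : sa' ≠ ⊥ := fun h => na' (by rw [ea', h]; simp)
  have hγK : (γ : K) ≠ 0 := by exact_mod_cast hγ
  have hαK : (α : K) ≠ 0 := by exact_mod_cast hα
  have hαK' : (α' : K) ≠ 0 := by exact_mod_cast hα'
  have T1 := gaussLat_split hα hγ eγ' ea hta htc hαγ hαF hcF hF' htFF
  have T1' := gaussLat_split hα' hγ eγ' ea' hta' htc hαγ' hαF' hcF hF' htFF
  have T0 := gaussLat_split hα one_ne_zero e1 ea hta squarefree_one (co1 _) hαF isCoprime_one_left hF' (one_dvd _)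
  have T0' := gaussLat_split hα' one_ne_zero e1 ea' hta' squarefree_one (co1 _) hαF' isCoprime_one_left hF' (one_dvd _)
  -- the dyadic factor
  have hcong' : frSpan ((α : K) - α') ≤ ((F * F : IK) : FrId K) :=
    spanSingleton_le_iff_mem.2 (mem_coeIdeal_of_mem _ hcong)
  have hC : ∀ (g : OK) (s t x : IK), g ≠ 0 → span {g} = s * s * (t * x) → x ∣ F →
      gaussW ((g : K) * α) (((span {(2 : OK)} * diffId K * x : IK) : FrId K)⁻¹ * (s : FrId K)⁻¹)
        (s : FrId K)⁻¹ =
      gaussW ((g : K) * α') (((span {(2 : OK)} * diffId K * x : IK) : FrId K)⁻¹ * (s : FrId K)⁻¹)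
        (s : FrId K)⁻¹ := by
    intro g s t x hg eg hx
    have n0 : s * s * (t * x) ≠ ⊥ := by rw [← eg, Ne, span_singleton_eq_bot]; exact hg
    have zs : (s : FrId K) ≠ 0 := coeIdeal_ne_zero.2 fun h => n0 (by rw [h]; simp)
    have zt : (t : FrId K) ≠ 0 := coeIdeal_ne_zero.2 fun h => n0 (by rw [h]; simp)
    have zx : (x : FrId K) ≠ 0 := coeIdeal_ne_zero.2 fun h => n0 (by rw [h]; simp)
    have zD : ((diffId K : IK) : FrId K) ≠ 0 := coeIdeal_ne_zero.2 diffId_ne_bot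
    have z2 : ((span {(2 : OK)} : IK) : FrId K) ≠ 0 := coeIdeal_ne_zero.2 (by
      rw [Ne, span_singleton_eq_bot]; exact two_ne_zero)
    have fg : frSpan (g : K) = (s : FrId K) * s * (t * x) := by
      rw [← coe_span_eq_frSpan, eg]; simp only [coeIdeal_mul]
    refine gaussW_congr ?_
    rw [← mul_sub, frSpan_mul, fg]
    have hle : frSpan ((α : K) - α') ≤
        ((span {(2 : OK)} * span {(2 : OK)} * diffId K * x : IK) : FrId K) :=
      hcong'.trans ((coeIdeal_le_coeIdeal K).2 (Ideal.le_of_dvd (mul_dvd_mul hF hx)))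
    calc _ = (t : FrId K) * (frSpan ((α : K) - α') * (x *
          (((span {(2 : OK)} * diffId K * x : IK) : FrId K)⁻¹ *
          ((span {(2 : OK)} * diffId K * x : IK) : FrId K)⁻¹))) := by field_simp
      _ ≤ 1 * (((span {(2 : OK)} * span {(2 : OK)} * diffId K * x : IK) : FrId K) * (x *
          (((span {(2 : OK)} * diffId K * x : IK) : FrId K)⁻¹ *
          ((span {(2 : OK)} * diffId K * x : IK) : FrId K)⁻¹))) := by
            gcongr
            exact coeIdeal_le_one
      _ = codiff K := by
        rw [codiff_eq_inv]
        simp only [coeIdeal_mul]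
        field_simp
  have hC1 := hC γ _ _ _ hγ eγ' htFF
  have hC0 := hC 1 _ _ _ one_ne_zero e1 (one_dvd _)
  have hInt : ∀ (g a : OK) (s t x s' t' : IK), s ≠ ⊥ → s' ≠ ⊥ → span {g} = s * s * (t * x) →
      span {a} = s' * s' * t' →
      frSpan ((g : K) * a) * ((s : FrId K)⁻¹ * (s' : FrId K)⁻¹) * ((s : FrId K)⁻¹ * (s' : FrId K)⁻¹) ≤ codiff K := by
    intro g a s t x s' t' hs hs' eg ea
    have zs : (s : FrId K) ≠ 0 := coeIdeal_ne_zero.2 hs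
    have zs' : (s' : FrId K) ≠ 0 := coeIdeal_ne_zero.2 hs'
    have zD : ((diffId K : IK) : FrId K) ≠ 0 := coeIdeal_ne_zero.2 diffId_ne_bot
    rw [codiff_eq_inv, frSpan_mul, ← coe_span_eq_frSpan, ← coe_span_eq_frSpan, eg, ea]
    exact le_of_eq_coeIdeal_mul (t * x * t' * diffId K) (by simp only [coeIdeal_mul]; field_simp)
  have zI : ∀ {s s' : IK}, s ≠ ⊥ → s' ≠ ⊥ → (s : FrId K)⁻¹ * (s' : FrId K)⁻¹ ≠ 0 := fun h h' =>
    mul_ne_zero (inv_ne_zero (coeIdeal_ne_zero.2 h)) (inv_ne_zero (coeIdeal_ne_zero.2 h'))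
  have n1 : (1 : IK) ≠ ⊥ := one_ne_zero
  have h1K : ((1 : OK) : K) = 1 := rfl
  obtain ⟨z1, r, hr, R1⟩ := gaussLat_ratio ι (mul_ne_zero hγK hαK) (mul_ne_zero hγK hαK')
    (fun τ => by
      rw [map_mul, map_mul, map_mul, map_mul, mul_pos_iff_of_pos_right (hs τ), mul_pos_iff_of_pos_right (hs' τ)])
    (zI nsg nsa) (zI nsg nsa') (hInt _ _ _ _ _ _ _ nsg nsa eγ' ea) (hInt _ _ _ _ _ _ _ nsg nsa' eγ' ea')
  obtain ⟨z0, r0, hr0, R0⟩ := gaussLat_ratio ι (c := ((1 : OK) : K) * α) (c' := ((1 : OK) : K) * α')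
    (by rw [h1K, one_mul]; exact hαK) (by rw [h1K, one_mul]; exact hαK')
    (fun τ => by rw [h1K, one_mul, one_mul]; simp only [hs τ, hs' τ])
    (zI n1 nsa) (zI n1 nsa') (hInt _ _ _ _ _ _ _ n1 nsa e1 ea) (hInt _ _ _ _ _ _ _ n1 nsa' e1 ea')
  rw [T1, T1', hC1] at R1
  rw [T1'] at z1
  rw [T0, T0', hC0] at R0
  rw [T0'] at z0
  have q1 : ∀ I : IK, quadSym I 1 = 1 := fun I => by
    unfold quadSym
    refine Multiset.prod_eq_one fun x hx => ?_
    obtain ⟨𝔭, hp, rfl⟩ := Multiset.mem_map.1 hx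
    obtain ⟨h0, h1, h2⟩ := mem_normalizedFactors_ideal hp
    rw [legSym, map_one, if_neg, if_pos IsSquare.one]
    have := h1.ne_top
    have : Nontrivial (OK ⧸ 𝔭) := Ideal.Quotient.nontrivial_iff.2 h1.ne_top
    exact one_ne_zero
  have qt : ∀ a : OK, quadSym 1 a = 1 := fun a => by rw [one_eq_top]; exact quadSym_top a
  simp only [q1, qt, Int.cast_one, one_mul] at R0 z0
  have ea1 : quadSym (span {α}) γ = quadSym ta γ := by
    rw [ea]; exact quadSym_sq_mul (ea ▸ na) (ea ▸ hαγ.symm)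
  have ea1' : quadSym (span {α'}) γ = quadSym ta' γ := by
    rw [ea']; exact quadSym_sq_mul (ea' ▸ na') (ea' ▸ hαγ'.symm)
  have dc : 𝔠 ∣ span {γ} := ⟨𝔣, eγ⟩
  have hαc := hαγ.of_isCoprime_of_dvd_right dc
  have hαc' := hαγ'.of_isCoprime_of_dvd_right dc
  have ec1 : quadSym 𝔠 α = quadSym tc α := by
    rw [ec]; exact quadSym_sq_mul (ec ▸ nc) (ec ▸ hαc)
  have ec1' : quadSym 𝔠 α' = quadSym tc α' := by
    rw [ec]; exact quadSym_sq_mul (ec ▸ nc) (ec ▸ hαc')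
  have u1 := quadSym_isUnit na hαγ.symm
  have u1' := quadSym_isUnit na' hαγ'.symm
  have u2 := quadSym_isUnit nc hαc
  have u2' := quadSym_isUnit nc hαc'
  rw [← ea1, ← ec1, ← ea1', ← ec1'] at R1
  rw [← ea1', ← ec1'] at z1
  clear hC1 hC0 hC T1 T1' T0 T0'
  generalize gaussW (α : K) _ _ = A at *
  generalize gaussW (α' : K) _ _ = A' at *
  generalize gaussW (γ : K) _ _ = B at *
  generalize gaussW ((γ : K) * _) _ _ = C at *
  have hA : A = r0 * A' := by
    have : A' ≠ 0 := left_ne_zero_of_mul z0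
    have h3 := right_ne_zero_of_mul z0
    apply mul_right_cancel₀ h3
    rw [R0]; ring
  have hz : A' * B * C ≠ 0 := by
    intro h
    apply z1
    linear_combination (quadSym (span {α'}) γ * quadSym 𝔠 α' : ℂ) * h
  have hfin : (r0 * (quadSym (span {α}) γ * quadSym 𝔠 α) : ℂ) =
      r * (quadSym (span {α'}) γ * quadSym 𝔠 α') := by
    apply mul_right_cancel₀ hz
    rw [hA] at R1
    linear_combination R1
  have hfin' : r0 * ((quadSym (span {α}) γ * quadSym 𝔠 α : ℤ) : ℝ) =
      r * ((quadSym (span {α'}) γ * quadSym 𝔠 α' : ℤ) : ℝ) := by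
    push_cast; exact_mod_cast hfin
  rcases u1 with h1 | h1 <;> rcases u1' with h2 | h2 <;> rcases u2 with h3 | h3 <;>
    rcases u2' with h4 | h4 <;> rw [h1, h2, h3, h4] at hfin' ⊢ <;> norm_num at hfin' ⊢ <;> linarith

end

/-- The conjugate of an integer under `τ`, in a fixed real embedding. -/
def cj (ι : K →+* ℝ) (τ : Gal(K/ℚ)) : OK →+* ℝ :=
  (ι.comp (τ : K →+* K)).comp (algebraMap OK K)

theorem cj_apply (ι : K →+* ℝ) (τ : Gal(K/ℚ)) (a : OK) : cj ι τ a = ι (τ (a : K)) := rfl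

theorem cj_gal (ι : K →+* ℝ) (τ τ' : Gal(K/ℚ)) (a : OK) : cj ι τ (gal τ' a) = cj ι (τ * τ') a := rfl

theorem cj_injective (ι : K →+* ℝ) (τ : Gal(K/ℚ)) : Function.Injective (cj ι τ) := by
  intro a b h
  exact RingOfIntegers.ext (τ.injective (ι.injective h))

theorem exists_eq_comp [IsGalois ℚ K] (ι v : K →+* ℝ) : ∃ τ : Gal(K/ℚ), ∀ x, v x = ι (τ x) := by
  let _ := ι.toAlgebra
  refine ⟨AlgEquiv.ofBijective ((v.toRatAlgHom).restrictNormal K)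
    (AlgHom.normal_bijective ℚ K K _), fun x => ?_⟩
  exact (AlgHom.restrictNormal_commutes v.toRatAlgHom K x).symm

theorem totPos_iff [IsGalois ℚ K] (ι : K →+* ℝ) (a : OK) : TotPos a ↔ ∀ τ, 0 < cj ι τ a := by
  constructor
  · intro h τ; exact h (ι.comp (τ : K →+* K))
  · intro h v
    obtain ⟨τ, hτ⟩ := exists_eq_comp ι v
    rw [hτ]; exact h τ

theorem norm_eq_prod_cj [IsGalois ℚ K] (ι : K →+* ℝ) (a : OK) :
    ((Algebra.norm ℤ a : ℤ) : ℝ) = ∏ τ, cj ι τ a := by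
  have h := Algebra.norm_eq_prod_automorphisms ℚ (a : K)
  have h2 : Algebra.norm ℚ (a : K) = ((Algebra.norm ℤ a : ℤ) : ℚ) := by
    rw [coe_norm_int]
  rw [h2] at h
  have := congrArg ι h
  rw [map_prod] at this
  simpa [cj_apply] using this

theorem absNorm_span_eq [IsGalois ℚ K] (ι : K →+* ℝ) (a : OK) :
    (absNorm (span {a}) : ℝ) = |∏ τ, cj ι τ a| := by
  rw [Ideal.absNorm_span_singleton, ← norm_eq_prod_cj, Nat.cast_natAbs, Int.cast_abs]

theorem TotPos.ne_zero (ι : K →+* ℝ) {a : OK} (h : TotPos a) : a ≠ 0 := by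
  rintro rfl
  have := h ι
  simp at this

theorem TotPos.mul {a b : OK} (ha : TotPos a) (hb : TotPos b) : TotPos (a * b) := fun v => by
  rw [show ((a * b : OK) : K) = a * b from rfl, map_mul]; exact mul_pos (ha v) (hb v)

theorem TotPos.gal {a : OK} (ha : TotPos a) (τ : Gal(K/ℚ)) : TotPos (gal τ a) :=
  fun v => ha (v.comp (τ : K →+* K))

theorem totPos_sq (ι : K →+* ℝ) {a : OK} (ha : a ≠ 0) : TotPos (a * a) := fun v => by
  rw [show ((a * a : OK) : K) = a * a from rfl, map_mul]
  have : v (a : K) ≠ 0 := (map_ne_zero v).2 (by exact_mod_cast ha)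
  exact mul_self_pos.2 this

theorem exists_totPos_add [IsGalois ℚ K] (ι : K →+* ℝ) (a : OK) :
    ∃ N : ℕ, ∀ k : ℕ, N ≤ k → TotPos (a + (k : OK)) := by
  obtain ⟨N, hN⟩ := exists_nat_gt (∑ τ : Gal(K/ℚ), |cj ι τ a|)
  refine ⟨N, fun k hk => (totPos_iff ι _).2 fun τ => ?_⟩
  rw [map_add, map_natCast]
  have h1 : |cj ι τ a| ≤ ∑ τ : Gal(K/ℚ), |cj ι τ a| :=
    single_le_sum (f := fun τ => |cj ι τ a|) (fun _ _ => abs_nonneg _) (mem_univ τ)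
  have h2 : (N : ℝ) ≤ k := by exact_mod_cast hk
  have := neg_abs_le (cj ι τ a)
  linarith

theorem exists_totPos_congr [IsGalois ℚ K] (ι : K →+* ℝ) {I : IK} (hI : I ≠ ⊥) (a : OK) :
    ∃ b, TotPos b ∧ b - a ∈ I := by
  obtain ⟨N, hN⟩ := exists_totPos_add ι a
  have h0 : 0 < absNorm I := Nat.pos_of_ne_zero (by rwa [Ne, Ideal.absNorm_eq_zero_iff])
  refine ⟨a + ((N * absNorm I : ℕ) : OK), hN _ (Nat.le_mul_of_pos_right _ h0), ?_⟩
  rw [add_sub_cancel_left, cast_mul]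
  exact I.mul_mem_left _ (absNorm_mem I)

theorem exists_congr_congr {I J : IK} (h : IsCoprime I J) (a b : OK) :
    ∃ c, c - a ∈ I ∧ c - b ∈ J := by
  obtain ⟨x, hx, y, hy, hxy⟩ := isCoprime_iff_exists.1 h
  refine ⟨x * b + y * a, ?_, ?_⟩
  · have : x * b + y * a - a = x * (b - a) := by linear_combination a * hxy
    rw [this]; exact I.mul_mem_right _ hx
  · have : x * b + y * a - b = y * (a - b) := by linear_combination b * hxy
    rw [this]; exact J.mul_mem_right _ hy

theorem isCoprime_span_of_sub_mem {I : IK} {a b : OK} (h : a - b ∈ I)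
    (hb : IsCoprime (span {b}) I) : IsCoprime (span {a}) I := by
  rw [isCoprime_iff_exists] at hb ⊢
  obtain ⟨x, hx, y, hy, hxy⟩ := hb
  obtain ⟨r, rfl⟩ := Ideal.mem_span_singleton'.1 hx
  refine ⟨r * a, Ideal.mem_span_singleton'.2 ⟨r, rfl⟩, y - r * (a - b), I.sub_mem hy (I.mul_mem_left _ h), ?_⟩
  linear_combination hxy

variable (K) in
/-- The dyadic and ramified modulus entering quadratic reciprocity. -/
def recMod : IK :=
  span {(2 : OK)} * span {(2 : OK)} * diffId K

theorem recMod_ne_bot : recMod K ≠ ⊥ := by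
  have h2 : span {(2 : OK)} ≠ ⊥ := by rw [Ne, span_singleton_eq_bot]; exact two_ne_zero
  exact mul_ne_zero (mul_ne_zero h2 h2) diffId_ne_bot

/-- The symbol `(α/β)(β/α)` depends only on residue classes. -/
theorem quadSym_reciprocity_symm [IsGalois ℚ K] (ι : K →+* ℝ) {F : IK} (hF0 : F ≠ ⊥)
    (hF : recMod K ∣ F) {α β α' β' : OK} (hα : TotPos α) (hβ : TotPos β) (hα' : TotPos α') (hβ' : TotPos β')
    (cα : IsCoprime (span {α}) F) (cβ : IsCoprime (span {β}) F)
    (h : IsCoprime (span {α}) (span {β})) (h' : IsCoprime (span {α'}) (span {β'}))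
    (eα : α - α' ∈ F * F) (eβ : β - β' ∈ F * F) :
    quadSym (span {β}) α * quadSym (span {α}) β =
      quadSym (span {β'}) α' * quadSym (span {α'}) β' := by
  have key : ∀ {α α' β : OK}, TotPos α → TotPos α' → TotPos β → IsCoprime (span {α}) F →
      IsCoprime (span {α'}) F → IsCoprime (span {β}) F →
      IsCoprime (span {α}) (span {β}) → IsCoprime (span {α'}) (span {β}) →
      α - α' ∈ F * F → quadSym (span {β}) α * quadSym (span {α}) β =
        quadSym (span {β}) α' * quadSym (span {α'}) β := by
    intro α α' β hα hα' hβ cα cα' cβ h h' e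
    have := quadSym_reciprocity ι hF (hβ.ne_zero ι) (hα.ne_zero ι) (hα'.ne_zero ι)
      (mul_one (span {β})).symm cβ (fun 𝔭 hp h => absurd (isUnit_of_dvd_one h) hp.not_unit)
      ((totPos_iff ι α).1 hα) ((totPos_iff ι α').1 hα') h h' cα cα' e
    linarith
  have cFF : ∀ {x y : OK}, x - y ∈ F * F → IsCoprime (span {x}) F → IsCoprime (span {y}) F := by
    intro x y hxy hx
    refine isCoprime_span_of_sub_mem ?_ hx
    rw [← neg_sub]
    exact F.neg_mem (mul_le_left hxy)
  have cα' := cFF eα cα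
  have cβ' := cFF eβ cβ
  have nβ : span {β} ≠ ⊥ := by rw [Ne, span_singleton_eq_bot]; exact hβ.ne_zero ι
  have nβ' : span {β'} ≠ ⊥ := by rw [Ne, span_singleton_eq_bot]; exact hβ'.ne_zero ι
  have cc : IsCoprime (F * F) (span {β} * span {β'}) :=
    ((cβ.symm.mul_left cβ.symm).mul_right (cβ'.symm.mul_left cβ'.symm))
  obtain ⟨c, c1, c2⟩ := exists_congr_congr cc α 1
  obtain ⟨α2, p2, e2⟩ := exists_totPos_congr ι (mul_ne_zero (mul_ne_zero hF0 hF0) (mul_ne_zero nβ nβ')) c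
  have a1 : α2 - α ∈ F * F := by
    have := (F * F).add_mem (mul_le_left (J := span {β} * span {β'}) e2) c1
    rwa [sub_add_sub_cancel] at this
  have a2 : α2 - 1 ∈ span {β} * span {β'} := by
    have := (span {β} * span {β'}).add_mem (Ideal.mul_le_right (I := F * F) e2) c2
    rwa [sub_add_sub_cancel] at this
  have a3 : IsCoprime (span {α2}) (span {β} * span {β'}) :=
    isCoprime_span_of_sub_mem a2 (by rw [span_singleton_one, ← one_eq_top]; exact isCoprime_one_left)
  have a1' : α - α2 ∈ F * F := by rw [← neg_sub]; exact (F * F).neg_mem a1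
  have c2 := cFF a1' cα
  have a4 : α2 - α' ∈ F * F := by
    have := (F * F).add_mem a1 eα
    rwa [sub_add_sub_cancel] at this
  rw [key hα p2 hβ cα c2 cβ h a3.of_mul_right_left a1',
    ← key p2 hα' hβ' c2 cα' cβ' a3.of_mul_right_right h' a4, mul_comm, mul_comm (quadSym (span {β'}) α2)]
  exact key hβ hβ' p2 cβ cβ' c2 a3.of_mul_right_left.symm a3.of_mul_right_right.symm eβ

/-- A quadratic symbol to an odd non-square modulus takes the value `-1`. -/
theorem exists_quadSym_eq_neg_one {𝔟 : IK} (h0 : 𝔟 ≠ ⊥) (h2 : IsCoprime 𝔟 (span {(2 : OK)}))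
    (hsq : ∀ s, 𝔟 ≠ s * s) : ∃ t, quadSym 𝔟 t = -1 := by
  obtain ⟨s, t, e, ht⟩ := exists_sq_mul_squarefree_ideal 𝔟 h0
  have hs0 : s ≠ ⊥ := fun h => h0 (by rw [e, h]; simp)
  have ht0 : t ≠ ⊥ := fun h => h0 (by rw [e, h]; simp)
  have ht1 : ¬ IsUnit t := fun h => by
    rw [Ideal.isUnit_iff] at h
    exact hsq s (by rw [e, h, ← one_eq_top, mul_one])
  obtain ⟨𝔭, hp, t', rfl⟩ := WfDvdMonoid.exists_irreducible_factor ht1 ht0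
  have hp' := hp.prime
  have hP : 𝔭.IsPrime := isPrime_of_prime hp'
  have hp0 : 𝔭 ≠ ⊥ := hp'.ne_zero
  have hmax := hP.isMaximal hp0
  obtain ⟨j, s', hs', rfl⟩ := WfDvdMonoid.max_power_factor hs0 hp
  have hpt' : ¬ 𝔭 ∣ t' := fun h => hp.not_isUnit (ht 𝔭 (mul_dvd_mul_left 𝔭 h))
  have hm : ¬ 𝔭 ∣ s' * s' * t' := fun h => by
    rcases hp'.dvd_or_dvd h with h | h
    · rcases hp'.dvd_or_dvd h with h | h <;> exact hs' h
    · exact hpt' h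
  have hco : IsCoprime 𝔭 (s' * s' * t') := isCoprime_of_not_le hmax fun h => hm (dvd_iff_le.2 h)
  have hm0 : s' * s' * t' ≠ ⊥ := fun h => hm (by rw [h]; exact dvd_zero _)
  have e' : 𝔟 = 𝔭 ^ (2 * j + 1) * (s' * s' * t') := by rw [e]; ring
  have h2p : (2 : OK) ∉ 𝔭 := Ideal.notMem_of_isCoprime hP
    (Ideal.le_of_dvd (dvd_trans (dvd_pow_self 𝔭 (by omega)) ⟨_, e'⟩)) h2
  let _ := field 𝔭
  have : Finite (OK ⧸ 𝔭) := finiteQuotientOfFreeOfNeBot 𝔭 hp0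
  have hch : ringChar (OK ⧸ 𝔭) ≠ 2 := by
    intro h
    apply h2p
    rw [← eq_zero_iff_mem]
    have h7 : ((2 : ℕ) : OK ⧸ 𝔭) = 0 := by rw [← h]; exact ringChar.Nat.cast_ringChar
    rw [map_ofNat]; exact_mod_cast h7
  obtain ⟨a, ha⟩ := FiniteField.exists_nonsquare hch
  obtain ⟨x, rfl⟩ := mk_surjective a
  obtain ⟨y, y1, y2⟩ := exists_congr_congr hco x 1
  refine ⟨y, ?_⟩
  have l1 : legSym 𝔭 y = -1 := by
    rw [legSym_congr y1, legSym, if_neg, if_neg ha]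
    intro h; rw [h] at ha; exact ha (by simp)
  have hpow : ∀ k, quadSym (𝔭 ^ k) y = (legSym 𝔭 y) ^ k := by
    intro k
    induction k with
    | zero => rw [pow_zero, pow_zero, one_eq_top, quadSym_top]
    | succ k ih => rw [pow_succ, quadSym_mul_left (pow_ne_zero k hp0) hp0, ih, quadSym_of_prime hp0 hP, pow_succ]
  have q1 : quadSym (s' * s' * t') y = 1 := by
    rw [quadSym_congr y2]
    have := quadSym_mul_right (s' * s' * t') 1 1
    rw [mul_one] at this
    have h3 : quadSym (s' * s' * t') 1 ≠ 0 := (quadSym_ne_zero_iff hm0).2 (by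
      rw [span_singleton_one, ← one_eq_top]; exact isCoprime_one_left)
    exact mul_left_cancel₀ h3 (by rw [← this, mul_one])
  rw [e', quadSym_mul_left (pow_ne_zero _ hp0) hm0, hpow, q1, l1, mul_one]
  exact Odd.neg_one_pow ⟨j, rfl⟩

theorem one_le_prod_real {ι : Type*} (s : Finset ι) {f : ι → ℝ} (h : ∀ i ∈ s, 1 ≤ f i) : 1 ≤ ∏ i ∈ s, f i := by
  calc (1 : ℝ) = ∏ i ∈ s, (1 : ℝ) := by simp
    _ ≤ _ := Finset.prod_le_prod (fun _ _ => zero_le_one) h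

variable (K) in
/-- The nonzero ideals of norm at most `T`. -/
def idl (T : ℝ) : Finset IK :=
  (Ideal.finite_setOfPred_absNorm_le (S := OK) ⌊T⌋₊).toFinset.filter fun 𝔞 => 𝔞 ≠ ⊥ ∧ (absNorm 𝔞 : ℝ) ≤ T

theorem mem_idl {T : ℝ} {𝔞 : IK} : 𝔞 ∈ idl K T ↔ 𝔞 ≠ ⊥ ∧ (absNorm 𝔞 : ℝ) ≤ T := by
  unfold idl
  rw [mem_filter, Set.Finite.mem_toFinset]
  exact ⟨fun h => h.2, fun h => ⟨le_floor h.2, h⟩⟩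

theorem absNorm_pos {𝔞 : IK} (h : 𝔞 ≠ ⊥) : 1 ≤ absNorm 𝔞 :=
  one_le_iff_ne_zero.2 (by rwa [Ne, Ideal.absNorm_eq_zero_iff])

theorem one_le_absNorm {𝔞 : IK} (h : 𝔞 ≠ ⊥) : (1 : ℝ) ≤ absNorm 𝔞 := by
  exact_mod_cast absNorm_pos h

theorem absNorm_le_of_dvd {𝔞 𝔟 : IK} (hb : 𝔟 ≠ ⊥) (h : 𝔞 ∣ 𝔟) :
    (absNorm 𝔞 : ℝ) ≤ absNorm 𝔟 := by
  exact_mod_cast Nat.le_of_dvd (absNorm_pos hb) (absNorm_dvd_absNorm_of_le (Ideal.le_of_dvd h))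

/-- The divisors of a nonzero ideal. -/
def divs (𝔞 : IK) : Finset IK := (idl K (absNorm 𝔞)).filter fun 𝔡 => 𝔡 ∣ 𝔞

theorem mem_divs {𝔞 𝔡 : IK} (h : 𝔞 ≠ ⊥) : 𝔡 ∈ divs 𝔞 ↔ 𝔡 ∣ 𝔞 := by
  unfold divs
  rw [mem_filter, mem_idl]
  exact ⟨fun h => h.2, fun h' => ⟨⟨ne_zero_of_dvd_ne_zero h h', absNorm_le_of_dvd h h'⟩, h'⟩⟩

theorem card_divs_mul {𝔞 𝔟 : IK} (ha : 𝔞 ≠ ⊥) (hb : 𝔟 ≠ ⊥) :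
    (divs (𝔞 * 𝔟)).card ≤ (divs 𝔞).card * (divs 𝔟).card := by
  rw [← card_product]
  refine (card_le_card ?_).trans (card_image_le (f := fun p : IK × IK => p.1 * p.2))
  intro 𝔡 h
  rw [mem_divs (mul_ne_zero ha hb)] at h
  obtain ⟨d1, d2, h1, h2, rfl⟩ := exists_dvd_and_dvd_of_dvd_mul h
  exact mem_image.2 ⟨(d1, d2), mem_product.2 ⟨(mem_divs ha).2 h1, (mem_divs hb).2 h2⟩, rfl⟩

theorem card_divs_prime_pow {𝔭 : IK} (hp : Prime 𝔭) (k : ℕ) : (divs (𝔭 ^ k)).card ≤ k + 1 := by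
  have : divs (𝔭 ^ k) ⊆ (range (k + 1)).image fun i => 𝔭 ^ i := by
    intro 𝔡 h
    rw [mem_divs (pow_ne_zero k hp.ne_zero), dvd_prime_pow hp] at h
    obtain ⟨i, hi, h⟩ := h
    exact mem_image.2 ⟨i, mem_range.2 (by omega), (associated_iff_eq.1 h).symm⟩
  exact (card_le_card this).trans (card_image_le.trans (by simp))

theorem exists_succ_le_rpow {ε : ℝ} (hε : 0 < ε) : ∃ C : ℝ, 1 ≤ C ∧ ∀ k : ℕ, (k + 1 : ℝ) ≤ C * ((2 : ℝ) ^ k) ^ ε := by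
  have hl : 0 < ε * log 2 := mul_pos hε (Real.log_pos (by norm_num))
  refine ⟨1 + (ε * log 2)⁻¹, by linarith [inv_pos.2 hl], fun k => ?_⟩
  have h1 : ((2 : ℝ) ^ k) ^ ε = Real.exp (k * (ε * log 2)) := by
    rw [← rpow_natCast, ← rpow_mul (by norm_num), Real.rpow_def_of_pos (by norm_num)]
    congr 1; ring
  rw [h1]
  have h2 := Real.add_one_le_exp (k * (ε * log 2))
  have h3 : 1 ≤ Real.exp (k * (ε * log 2)) := Real.one_le_exp (by positivity)
  have h4 : (k : ℝ) ≤ (ε * log 2)⁻¹ * Real.exp (k * (ε * log 2)) := by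
    rw [inv_mul_eq_div, le_div_iff₀ hl]; linarith
  linarith

theorem absNorm_prime_ge_two {𝔭 : IK} (hp : Prime 𝔭) : 2 ≤ absNorm 𝔭 := by
  have h1 := absNorm_pos hp.ne_zero
  have h2 : absNorm 𝔭 ≠ 1 := fun h => hp.not_unit (Ideal.isUnit_iff.2 (Ideal.absNorm_eq_one_iff.1 h))
  omega

/-- The divisor bound for ideals. -/
theorem card_divs_le {ε : ℝ} (hε : 0 < ε) : ∃ C : ℝ, 1 ≤ C ∧ ∀ 𝔞 : IK, 𝔞 ≠ ⊥ →
    ((divs 𝔞).card : ℝ) ≤ C * (absNorm 𝔞 : ℝ) ^ ε := by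
  obtain ⟨C, hC1, hC⟩ := exists_succ_le_rpow hε
  set B : ℝ := (2 : ℝ) ^ (1 / ε) with hB
  set S := idl K B with hS
  have key : ∀ 𝔞 : IK, 𝔞 ≠ ⊥ → ((divs 𝔞).card : ℝ) ≤
      (∏ 𝔭 ∈ S, if 𝔭 ∣ 𝔞 ∧ ¬ IsUnit 𝔭 then C else 1) * (absNorm 𝔞 : ℝ) ^ ε := by
    intro 𝔞
    induction 𝔞 using UniqueFactorizationMonoid.induction_on_coprime with
    | h0 => exact fun h => absurd rfl h
    | h1 hx =>
      rename_i x
      intro _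
      rw [Ideal.isUnit_iff] at hx
      subst hx
      rw [Finset.prod_eq_one, absNorm_top, cast_one, Real.one_rpow, one_mul]
      · have : divs (⊤ : IK) ⊆ {⊤} := fun x hx => by
          rw [mem_divs (by exact top_ne_bot), ← one_eq_top] at hx
          rw [mem_singleton]
          exact Ideal.isUnit_iff.1 (isUnit_of_dvd_one hx)
        exact_mod_cast (card_le_card this).trans (by simp)
      · intro 𝔭 _
        rw [if_neg]
        rintro ⟨h, h'⟩
        exact h' (isUnit_of_dvd_one (by rwa [one_eq_top]))
    | hpr k hp =>
      rename_i 𝔭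
      intro _
      have hN : (2 : ℝ) ≤ absNorm 𝔭 := by exact_mod_cast absNorm_prime_ge_two hp
      have hprod1 : 1 ≤ ∏ 𝔮 ∈ S, if 𝔮 ∣ 𝔭 ^ k ∧ ¬ IsUnit 𝔮 then C else 1 :=
        one_le_prod_real _ fun i _ => by split_ifs; exacts [hC1, le_rfl]
      have hc : ((divs (𝔭 ^ k)).card : ℝ) ≤ k + 1 := by exact_mod_cast card_divs_prime_pow hp k
      rw [map_pow, cast_pow]
      rcases Nat.eq_zero_or_pos k with rfl | hk
      · simp only [pow_zero, Real.one_rpow, mul_one]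
        simp only [Nat.cast_zero, zero_add, pow_zero] at hc hprod1
        exact hc.trans hprod1
      by_cases hpS : 𝔭 ∈ S
      · have h1 : C ≤ ∏ 𝔮 ∈ S, if 𝔮 ∣ 𝔭 ^ k ∧ ¬ IsUnit 𝔮 then C else 1 := by
          rw [← mul_prod_erase _ _ hpS, if_pos ⟨dvd_pow_self 𝔭 (by omega), hp.not_unit⟩]
          exact le_mul_of_one_le_right (by linarith) (one_le_prod_real _ fun i _ => by split_ifs; exacts [hC1, le_rfl])
        calc _ ≤ (k + 1 : ℝ) := hc
          _ ≤ C * ((2 : ℝ) ^ k) ^ ε := hC k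
          _ ≤ _ := by gcongr
      · have h1 : B < absNorm 𝔭 := by
          by_contra h
          exact hpS (mem_idl.2 ⟨hp.ne_zero, not_lt.1 h⟩)
        have h2 : (2 : ℝ) ≤ (absNorm 𝔭 : ℝ) ^ ε := by
          calc (2 : ℝ) = B ^ ε := by rw [hB, ← rpow_mul (by norm_num), one_div_mul_cancel hε.ne', rpow_one]
            _ ≤ _ := by gcongr
        have h3 : (k + 1 : ℝ) ≤ 2 ^ k := by exact_mod_cast Nat.lt_two_pow_self
        calc _ ≤ (k + 1 : ℝ) := hc
          _ ≤ 2 ^ k := h3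
          _ ≤ ((absNorm 𝔭 : ℝ) ^ ε) ^ k := by gcongr
          _ = ((absNorm 𝔭 : ℝ) ^ k) ^ ε := by rw [← rpow_natCast, ← rpow_natCast, ← rpow_mul (by positivity), ← rpow_mul (by positivity), mul_comm]
          _ ≤ _ := le_mul_of_one_le_left (by positivity) hprod1
    | hcp hco ihx ihy =>
      rename_i a b
      intro h
      have ha : a ≠ ⊥ := fun h' => h (by rw [h']; simp)
      have hb : b ≠ ⊥ := fun h' => h (by rw [h']; simp)
      rw [map_mul, cast_mul, mul_rpow (by positivity) (by positivity)]
      have h1 : ((divs (a * b)).card : ℝ) ≤ (divs a).card * (divs b).card := by exact_mod_cast card_divs_mul ha hb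
      have h2 : (∏ 𝔭 ∈ S, if 𝔭 ∣ a ∧ ¬ IsUnit 𝔭 then C else 1) * (∏ 𝔭 ∈ S, if 𝔭 ∣ b ∧ ¬ IsUnit 𝔭 then C else 1) ≤
          ∏ 𝔭 ∈ S, if 𝔭 ∣ a * b ∧ ¬ IsUnit 𝔭 then C else 1 := by
        rw [← prod_mul_distrib]
        refine Finset.prod_le_prod (fun i _ => ?_) fun i _ => ?_
        · refine mul_nonneg ?_ ?_ <;> split_ifs <;> linarith
        · by_cases hu : IsUnit i
          · rw [if_neg (fun h => h.2 hu), if_neg (fun h => h.2 hu), if_neg (fun h => h.2 hu), one_mul]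
          · simp only [hu, not_false_eq_true, and_true]
            by_cases hia : i ∣ a
            · have hib : ¬ i ∣ b := fun hib => hu (hco hia hib)
              rw [if_pos hia, if_neg hib, if_pos (hia.mul_right b), mul_one]
            · rw [if_neg hia, one_mul]
              by_cases hib : i ∣ b
              · rw [if_pos hib, if_pos (hib.mul_left a)]
              · rw [if_neg hib]; split_ifs <;> linarith
      have nn : ∀ c : IK, 0 ≤ ∏ 𝔭 ∈ S, if 𝔭 ∣ c ∧ ¬ IsUnit 𝔭 then C else 1 := fun c =>
        Finset.prod_nonneg fun i _ => by split_ifs <;> linarith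
      calc _ ≤ ((divs a).card * (divs b).card : ℝ) := h1
        _ ≤ _ := mul_le_mul (ihx ha) (ihy hb) (by positivity) (mul_nonneg (nn a) (by positivity))
        _ = ((∏ 𝔭 ∈ S, if 𝔭 ∣ a ∧ ¬ IsUnit 𝔭 then C else 1) * (∏ 𝔭 ∈ S, if 𝔭 ∣ b ∧ ¬ IsUnit 𝔭 then C else 1)) *
            ((absNorm a : ℝ) ^ ε * (absNorm b : ℝ) ^ ε) := by ring
        _ ≤ _ := by gcongr
  refine ⟨C ^ S.card, one_le_pow₀ hC1, fun 𝔞 h => (key 𝔞 h).trans ?_⟩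
  gcongr
  rw [← prod_const]
  exact Finset.prod_le_prod (fun i _ => by split_ifs <;> linarith) fun i _ => by split_ifs; exacts [le_rfl, hC1]

/-- Few ideals have a given norm. -/
theorem card_norm_eq_le {ε : ℝ} (hε : 0 < ε) : ∃ C : ℝ, 1 ≤ C ∧ ∀ (m : ℕ) (s : Finset IK), m ≠ 0 →
    (∀ 𝔞 ∈ s, absNorm 𝔞 = m) → (s.card : ℝ) ≤ C * (m : ℝ) ^ ε := by
  set n := finrank ℚ K with hn
  have hn0 : 0 < n := finrank_pos
  have hn0' : (0 : ℝ) < n := by exact_mod_cast hn0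
  obtain ⟨C, hC1, hC⟩ := card_divs_le (K := K) (ε := ε / n) (by positivity)
  refine ⟨C, hC1, fun m s hm hs => ?_⟩
  have hm0 : span {(m : OK)} ≠ ⊥ := by rw [Ne, span_singleton_eq_bot]; exact_mod_cast hm
  have h1 : s ⊆ divs (span {(m : OK)}) := fun 𝔞 h => by
    rw [mem_divs hm0, dvd_span_singleton, ← hs 𝔞 h]
    exact absNorm_mem 𝔞
  have h2 : (s.card : ℝ) ≤ (divs (span {(m : OK)})).card := by exact_mod_cast card_le_card h1
  refine (h2.trans (hC _ hm0)).trans (le_of_eq ?_)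
  rw [Ideal.absNorm_span_singleton]
  have : Algebra.norm ℤ (m : OK) = (m : ℤ) ^ n := by
    have := Algebra.norm_algebraMap (R := ℤ) (S := OK) (m : ℤ)
    rw [hn, ← RingOfIntegers.rank K, ← this]; simp
  rw [this, Int.natAbs_pow, Int.natAbs_natCast, cast_pow, ← rpow_natCast, ← rpow_mul (by positivity)]
  congr 2; field_simp

theorem card_idl_le {ε : ℝ} (hε : 0 < ε) : ∃ C : ℝ, 1 ≤ C ∧ ∀ T : ℝ, 1 ≤ T →
    ((idl K T).card : ℝ) ≤ C * T ^ (1 + ε) := by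
  obtain ⟨C, hC1, hC⟩ := card_norm_eq_le (K := K) hε
  refine ⟨C, hC1, fun T hT => ?_⟩
  have h1 : (idl K T).card = ∑ m ∈ Icc 1 ⌊T⌋₊, ((idl K T).filter fun 𝔞 => absNorm 𝔞 = m).card := by
    refine Finset.card_eq_sum_card_fiberwise fun 𝔞 h => ?_
    have h := mem_idl.1 h
    exact Finset.mem_coe.2 (mem_Icc.2 ⟨absNorm_pos h.1, le_floor h.2⟩)
  rw [h1, Nat.cast_sum]
  calc _ ≤ ∑ m ∈ Icc 1 ⌊T⌋₊, C * T ^ ε := by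
        refine sum_le_sum fun m hm => ?_
        rw [mem_Icc] at hm
        refine (hC m _ (by omega) fun 𝔞 h => (mem_filter.1 h).2).trans ?_
        gcongr
        exact (Nat.le_floor_iff (by linarith)).1 hm.2
    _ = ⌊T⌋₊ * (C * T ^ ε) := by rw [sum_const, Nat.card_Icc, nsmul_eq_mul]; simp
    _ ≤ T * (C * T ^ ε) := by gcongr; exact floor_le (by linarith)
    _ = _ := by rw [rpow_add (by linarith), rpow_one]; ring

/-- A bilinear form bounded for all bounded coefficients stays bounded, up to a logarithmic factor,
when restricted to pairs with `u i < t j`. -/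
theorem bilinear_truncation {α β : Type*} (I : Finset α) (J : Finset β) {Φ : ℝ} (B : ℕ) :
    ∀ (k : α → β → ℝ), (∀ (v : α → ℝ) (w : β → ℝ), (∀ i, |v i| ≤ 1) → (∀ j, |w j| ≤ 1) →
      |∑ i ∈ I, ∑ j ∈ J, v i * w j * k i j| ≤ Φ) →
    ∀ (u : α → ℕ) (t : β → ℕ), (∀ i, u i < 2 ^ B) → (∀ j, t j < 2 ^ B) →
    ∀ (v : α → ℝ) (w : β → ℝ), (∀ i, |v i| ≤ 1) → (∀ j, |w j| ≤ 1) →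
      |∑ i ∈ I, ∑ j ∈ J, v i * w j * (if u i < t j then k i j else 0)| ≤ B * Φ := by
  induction B with
  | zero =>
    intro k hk u t hu ht v w hv hw
    have : ∀ i j, ¬ u i < t j := fun i j => by have := hu i; have := ht j; simp at *; omega
    simp [this]
  | succ B ih =>
    intro k hk u t hu ht v w hv hw
    set si : α → ℝ := fun i => if u i < 2 ^ B then 1 else -1 with hsi
    set sj : β → ℝ := fun j => if t j < 2 ^ B then 1 else -1 with hsj
    have hsi1 : ∀ i, |si i| ≤ 1 := fun i => by simp only [hsi]; split_ifs <;> simp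
    have hsj1 : ∀ i, |sj i| ≤ 1 := fun i => by simp only [hsj]; split_ifs <;> simp
    have key := ih (fun i j => (1 + si i * sj j) / 2 * k i j) (fun v w hv hw => by
      have h1 := hk v w hv hw
      have h2 := hk (fun i => v i * si i) (fun j => w j * sj j)
        (fun i => by rw [abs_mul]; exact mul_le_one₀ (hv i) (abs_nonneg _) (hsi1 i))
        (fun i => by rw [abs_mul]; exact mul_le_one₀ (hw i) (abs_nonneg _) (hsj1 i))
      have e : ∑ i ∈ I, ∑ j ∈ J, v i * w j * ((1 + si i * sj j) / 2 * k i j) =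
          (∑ i ∈ I, ∑ j ∈ J, v i * w j * k i j) / 2 + (∑ i ∈ I, ∑ j ∈ J, v i * si i * (w j * sj j) * k i j) / 2 := by
        rw [sum_div, sum_div, ← sum_add_distrib]
        refine sum_congr rfl fun i _ => ?_
        rw [sum_div, sum_div, ← sum_add_distrib]
        exact sum_congr rfl fun j _ => by ring
      rw [e]
      rw [abs_le] at *
      constructor <;> linarith) (fun i => u i % 2 ^ B) (fun j => t j % 2 ^ B)
      (fun i => mod_lt _ (by positivity)) (fun i => mod_lt _ (by positivity)) v w hv hw
    have h3 := hk (fun i => if u i < 2 ^ B then v i else 0) (fun j => if t j < 2 ^ B then 0 else w j)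
      (fun i => by split_ifs; exacts [hv i, by simp]) (fun i => by split_ifs; exacts [by simp, hw i])
    have e : ∑ i ∈ I, ∑ j ∈ J, v i * w j * (if u i < t j then k i j else 0) =
        (∑ i ∈ I, ∑ j ∈ J, v i * w j * (if u i % 2 ^ B < t j % 2 ^ B then (1 + si i * sj j) / 2 * k i j else 0)) +
        ∑ i ∈ I, ∑ j ∈ J, (if u i < 2 ^ B then v i else 0) * (if t j < 2 ^ B then 0 else w j) * k i j := by
      rw [← sum_add_distrib]
      refine sum_congr rfl fun i _ => ?_
      rw [← sum_add_distrib]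
      refine sum_congr rfl fun j _ => ?_
      have hu' := hu i
      have ht' := ht j
      rw [pow_succ] at hu' ht'
      have hmod : ∀ a : ℕ, ¬ a < 2 ^ B → a < 2 ^ B * 2 → a % 2 ^ B = a - 2 ^ B := fun a h1 h2 => by
        rw [Nat.mod_eq_sub_mod (by omega), mod_eq_of_lt (by omega)]
      simp only [hsi, hsj]
      by_cases h1 : u i < 2 ^ B
      · by_cases h2 : t j < 2 ^ B
        · rw [mod_eq_of_lt h1, mod_eq_of_lt h2, if_pos h1, if_pos h2]
          simp only [h1, h2, if_true]; norm_num
        · have h3 : u i < t j := by omega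
          simp only [h1, h2, h3, if_true, if_false]; norm_num
      · by_cases h2 : t j < 2 ^ B
        · have h3 : ¬ u i < t j := by omega
          simp only [h1, h2, h3, if_true, if_false]; norm_num
        · rw [hmod _ h1 hu', hmod _ h2 ht']
          simp only [h1, h2, if_false]
          have h3 : u i - 2 ^ B < t j - 2 ^ B ↔ u i < t j := by omega
          simp only [h3]; norm_num
    rw [e]
    refine (abs_add_le _ _).trans ?_
    push_cast
    linarith

/-- Abel's inequality for increasing nonnegative weights. -/
theorem abel_mono (c w : ℕ → ℝ) {M : ℝ} (hw : Monotone w) (hw0 : 0 ≤ w 0) (N : ℕ)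
    (h : ∀ m ≤ N, |∑ i ∈ range m, c i| ≤ M) : |∑ i ∈ range N, w i * c i| ≤ 2 * w N * M := by
  have hM : 0 ≤ M := (abs_nonneg _).trans (h 0 (by omega))
  have e : ∀ m, ∑ i ∈ range m, w i * c i = w m * ∑ i ∈ range m, c i -
      ∑ i ∈ range m, (w (i + 1) - w i) * ∑ j ∈ range (i + 1), c j := by
    intro m
    induction m with
    | zero => simp
    | succ m ih => rw [sum_range_succ, ih, sum_range_succ (fun i => _ * ∑ j ∈ range (i + 1), c j) m, sum_range_succ c m]; ring
  rw [e]
  have hwn : ∀ m, 0 ≤ w m := fun m => hw0.trans (hw (Nat.zero_le m))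
  have h1 : |w N * ∑ i ∈ range N, c i| ≤ w N * M := by
    rw [abs_mul, abs_of_nonneg (hwn N)]; exact mul_le_mul_of_nonneg_left (h N le_rfl) (hwn N)
  have h2 : |∑ i ∈ range N, (w (i + 1) - w i) * ∑ j ∈ range (i + 1), c j| ≤ (w N - w 0) * M := by
    refine (abs_sum_le_sum_abs _ _).trans ?_
    rw [← Finset.sum_range_sub, sum_mul]
    refine sum_le_sum fun i hi => ?_
    rw [abs_mul, abs_of_nonneg (sub_nonneg.2 (hw (le_succ i)))]
    exact mul_le_mul_of_nonneg_left (h _ (mem_range.1 hi)) (sub_nonneg.2 (hw (le_succ i)))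
  refine (abs_sub _ _).trans ?_
  nlinarith [mul_nonneg hw0 hM]

/-- Abel's inequality for decreasing nonnegative weights. -/
theorem abel_anti (c w : ℕ → ℝ) {M : ℝ} (hw : Antitone w) (hw0 : ∀ m, 0 ≤ w m) (N : ℕ)
    (h : ∀ m ≤ N, |∑ i ∈ range m, c i| ≤ M) : |∑ i ∈ range N, w i * c i| ≤ w 0 * M := by
  have hM : 0 ≤ M := (abs_nonneg _).trans (h 0 (by omega))
  have e : ∀ m, ∑ i ∈ range m, w i * c i = w m * ∑ i ∈ range m, c i +
      ∑ i ∈ range m, (w i - w (i + 1)) * ∑ j ∈ range (i + 1), c j := by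
    intro m
    induction m with
    | zero => simp
    | succ m ih => rw [sum_range_succ, ih, sum_range_succ (fun i => _ * ∑ j ∈ range (i + 1), c j) m, sum_range_succ c m]; ring
  rw [e]
  have h1 : |w N * ∑ i ∈ range N, c i| ≤ w N * M := by
    rw [abs_mul, abs_of_nonneg (hw0 N)]; exact mul_le_mul_of_nonneg_left (h N le_rfl) (hw0 N)
  have h2 : |∑ i ∈ range N, (w i - w (i + 1)) * ∑ j ∈ range (i + 1), c j| ≤ (w 0 - w N) * M := by
    refine (abs_sum_le_sum_abs _ _).trans ?_
    rw [← Finset.sum_range_sub', sum_mul]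
    refine sum_le_sum fun i hi => ?_
    rw [abs_mul, abs_of_nonneg (sub_nonneg.2 (hw (le_succ i)))]
    exact mul_le_mul_of_nonneg_left (h _ (mem_range.1 hi)) (sub_nonneg.2 (hw (le_succ i)))
  refine (abs_add_le _ _).trans ?_
  linarith

/-- The Möbius function on ideals. -/
def moeb (𝔟 : IK) : ℝ := if Squarefree 𝔟 then (-1) ^ (normalizedFactors 𝔟).card else 0

theorem abs_moeb_le (𝔟 : IK) : |moeb 𝔟| ≤ 1 := by
  unfold moeb; split_ifs <;> simp

/-- The von Mangoldt function on ideals. -/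
def mang (𝔠 : IK) : ℝ :=
  if h : ∃ 𝔭, Prime 𝔭 ∧ ∃ k, 𝔠 = 𝔭 ^ (k + 1) then log (absNorm h.choose) else 0

theorem mang_prime_pow {𝔭 : IK} (hp : Prime 𝔭) (k : ℕ) : mang (𝔭 ^ (k + 1)) = log (absNorm 𝔭) := by
  have h : ∃ 𝔮, Prime 𝔮 ∧ ∃ j, 𝔭 ^ (k + 1) = 𝔮 ^ (j + 1) := ⟨𝔭, hp, k, rfl⟩
  have key : ∀ 𝔮 : IK, (Prime 𝔮 ∧ ∃ j, 𝔭 ^ (k + 1) = 𝔮 ^ (j + 1)) → 𝔮 = 𝔭 := by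
    rintro 𝔮 ⟨hq, j, e⟩
    have h1 : 𝔮 ∣ 𝔭 := hq.dvd_of_dvd_pow (e.symm ▸ dvd_pow_self 𝔮 (succ_ne_zero j))
    exact associated_iff_eq.1 ((hq.dvd_prime_iff_associated hp).1 h1)
  have h2 : h.choose = 𝔭 := key _ h.choose_spec
  have h3 : mang (𝔭 ^ (k + 1)) = log (absNorm h.choose) := dif_pos h
  rw [h3, h2]

theorem mang_eq_zero {𝔠 : IK} (h : ¬ ∃ 𝔭, Prime 𝔭 ∧ ∃ k, 𝔠 = 𝔭 ^ (k + 1)) : mang 𝔠 = 0 := by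
  unfold mang; rw [dif_neg h]

theorem mang_nonneg (𝔠 : IK) : 0 ≤ mang 𝔠 := by
  unfold mang; split_ifs with h
  · exact Real.log_natCast_nonneg _
  · exact le_rfl

theorem divs_top : divs (⊤ : IK) = {⊤} := by
  ext x
  rw [mem_divs top_ne_bot, ← one_eq_top, mem_singleton]
  exact ⟨fun h => by rw [one_eq_top]; exact Ideal.isUnit_iff.1 (isUnit_of_dvd_one h), fun h => h ▸ dvd_rfl⟩

theorem sum_moeb {𝔢 : IK} (he : 𝔢 ≠ ⊥) : ∑ 𝔟 ∈ divs 𝔢, moeb 𝔟 = if 𝔢 = ⊤ then 1 else 0 := by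
  have hpr : ∀ T ⊆ (normalizedFactors 𝔢).toFinset, ∀ 𝔭 ∈ T.val, Prime 𝔭 := fun T hT 𝔭 h =>
    prime_of_normalized_factor _ (mem_toFinset.1 (hT h))
  have h1 : ∑ 𝔟 ∈ divs 𝔢, moeb 𝔟 = ∑ T ∈ (normalizedFactors 𝔢).toFinset.powerset, (-1 : ℝ) ^ T.card := by
    rw [← Finset.sum_filter_of_ne (p := fun 𝔟 : IK => Squarefree 𝔟)]
    · refine sum_nbij' (fun 𝔟 => (normalizedFactors 𝔟).toFinset) (fun T => T.val.prod) ?_ ?_ ?_ ?_ ?_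
      · intro 𝔟 hb
        rw [mem_filter, mem_divs he] at hb
        rw [mem_powerset]
        intro 𝔭 hp
        rw [mem_toFinset] at *
        exact Multiset.mem_of_le ((dvd_iff_normalizedFactors_le_normalizedFactors (ne_zero_of_dvd_ne_zero he hb.1) he).1 hb.1) hp
      · intro T hT
        rw [mem_powerset] at hT
        have hne : T.val.prod ≠ 0 := Multiset.prod_ne_zero fun h => (hpr T hT 0 h).ne_zero rfl
        have hf : normalizedFactors T.val.prod = T.val := normalizedFactors_prod_of_prime (hpr T hT)
        rw [mem_filter, mem_divs he, squarefree_iff_nodup_normalizedFactors hne, hf]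
        refine ⟨?_, T.nodup⟩
        rw [dvd_iff_normalizedFactors_le_normalizedFactors hne he, hf, le_iff_subset T.nodup]
        exact fun 𝔭 hp => mem_toFinset.1 (hT hp)
      · intro 𝔟 hb
        rw [mem_filter, mem_divs he] at hb
        have hb0 : 𝔟 ≠ 0 := ne_zero_of_dvd_ne_zero he hb.1
        rw [toFinset_val, ((squarefree_iff_nodup_normalizedFactors hb0).1 hb.2).dedup]
        exact associated_iff_eq.1 (prod_normalizedFactors hb0)
      · intro T hT
        rw [mem_powerset] at hT
        rw [normalizedFactors_prod_of_prime (hpr T hT)]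
        exact Finset.val_toFinset T
      · intro 𝔟 hb
        rw [mem_filter, mem_divs he] at hb
        have hb0 : 𝔟 ≠ 0 := ne_zero_of_dvd_ne_zero he hb.1
        unfold moeb
        rw [if_pos hb.2, Finset.card_def, toFinset_val, ((squarefree_iff_nodup_normalizedFactors hb0).1 hb.2).dedup]
    · intro 𝔟 _ h
      by_contra h'
      exact h (by unfold moeb; rw [if_neg h'])
  have h2 := Finset.sum_powerset_neg_one_pow_card (x := (normalizedFactors 𝔢).toFinset)
  have h3 : (normalizedFactors 𝔢).toFinset = ∅ ↔ 𝔢 = ⊤ := by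
    rw [Multiset.toFinset_eq_empty]
    constructor
    · intro h
      have := associated_iff_eq.1 (prod_normalizedFactors (a := 𝔢) he)
      rw [h, Multiset.prod_zero] at this
      rw [← this, one_eq_top]
    · rintro rfl
      rw [← one_eq_top, normalizedFactors_one]
  rw [h1]
  simp only [h3] at h2
  exact_mod_cast h2

theorem sum_mang (𝔢 : IK) : 𝔢 ≠ ⊥ → ∑ 𝔠 ∈ divs 𝔢, mang 𝔠 = log (absNorm 𝔢) := by
  induction 𝔢 using UniqueFactorizationMonoid.induction_on_coprime with
  | h0 => exact fun h => absurd rfl h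
  | h1 hx =>
    rename_i x
    intro _
    rw [Ideal.isUnit_iff] at hx
    subst hx
    rw [divs_top, Finset.sum_singleton, absNorm_top, cast_one, Real.log_one]
    refine mang_eq_zero ?_
    rintro ⟨𝔭, hp, k, e⟩
    rw [← one_eq_top] at e
    exact hp.not_unit (isUnit_of_dvd_one (e ▸ dvd_pow_self _ (succ_ne_zero k)))
  | hpr k hp =>
    rename_i 𝔭
    intro _
    have hd : divs (𝔭 ^ k) = (range (k + 1)).image fun i => 𝔭 ^ i := by
      ext 𝔡
      rw [mem_divs (pow_ne_zero k hp.ne_zero), dvd_prime_pow hp, mem_image]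
      constructor
      · rintro ⟨i, hi, h⟩
        exact ⟨i, mem_range.2 (by omega), (associated_iff_eq.1 h).symm⟩
      · rintro ⟨i, hi, h⟩
        exact ⟨i, by have := mem_range.1 hi; omega, associated_iff_eq.2 h.symm⟩
    have hinj : Function.Injective fun i : ℕ => 𝔭 ^ i := pow_injective_of_not_isUnit hp.not_unit hp.ne_zero
    rw [hd, sum_image fun a _ b _ h => hinj h, Finset.sum_range_succ']
    have h0 : mang (𝔭 ^ 0) = 0 := by
      refine mang_eq_zero ?_
      rintro ⟨𝔮, hq, k, e⟩
      rw [pow_zero] at e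
      exact hq.not_unit (isUnit_of_dvd_one (e ▸ dvd_pow_self _ (succ_ne_zero k)))
    rw [h0, add_zero, sum_congr rfl fun i _ => mang_prime_pow hp i, sum_const, card_range, map_pow,
      cast_pow, Real.log_pow, nsmul_eq_mul]
  | hcp hco ihx ihy =>
    rename_i a b
    intro h
    have ha : a ≠ ⊥ := fun h' => h (by rw [h']; simp)
    have hb : b ≠ ⊥ := fun h' => h (by rw [h']; simp)
    have hab : a * b ≠ ⊥ := h
    rw [map_mul, cast_mul, Real.log_mul (by linarith [one_le_absNorm ha]) (by linarith [one_le_absNorm hb]), ← ihx ha, ← ihy hb]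
    have hsub : ∀ c : IK, c ≠ ⊥ → c ∣ a * b → divs c = (divs (a * b)).filter fun d => d ∣ c := fun c hc hcd => by
      ext d
      rw [mem_filter, mem_divs hc, mem_divs hab]
      exact ⟨fun h => ⟨h.trans hcd, h⟩, fun h => h.2⟩
    rw [hsub a ha (dvd_mul_right a b), hsub b hb (dvd_mul_left b a), sum_filter, sum_filter, ← sum_add_distrib]
    refine sum_congr rfl fun c hc => ?_
    rw [mem_divs hab] at hc
    by_cases hpp : ∃ 𝔭, Prime 𝔭 ∧ ∃ k, c = 𝔭 ^ (k + 1)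
    · obtain ⟨𝔭, hp, k, rfl⟩ := hpp
      have hdp : 𝔭 ∣ 𝔭 ^ (k + 1) := dvd_pow_self _ (succ_ne_zero k)
      by_cases hpa : 𝔭 ∣ a
      · have hpb : ¬ 𝔭 ∣ b := fun h => hp.not_unit (hco hpa h)
        rw [if_pos (hp.pow_dvd_of_dvd_mul_right _ hpb hc), if_neg fun h => hpb (hdp.trans h), add_zero]
      · rw [if_neg fun h => hpa (hdp.trans h), if_pos (hp.pow_dvd_of_dvd_mul_left _ hpa hc), zero_add]
    · rw [mang_eq_zero hpp]; simp

theorem mul_mem_idl_iff {x : ℝ} {b d : IK} (h : b * d ∈ idl K x) : b ∈ idl K x ∧ d ∈ idl K x := by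
  rw [mem_idl] at h
  have hb : b ≠ ⊥ := fun h' => h.1 (by rw [h', Ideal.bot_mul])
  have hd : d ≠ ⊥ := fun h' => h.1 (by rw [h', Ideal.mul_bot])
  exact ⟨mem_idl.2 ⟨hb, (absNorm_le_of_dvd h.1 (dvd_mul_right b d)).trans h.2⟩,
    mem_idl.2 ⟨hd, (absNorm_le_of_dvd h.1 (dvd_mul_left d b)).trans h.2⟩⟩

theorem sum_mul_left {x : ℝ} {F : IK → ℝ} (hF : ∀ e, F e ≠ 0 → e ∈ idl K x) {b : IK} (hb : b ≠ ⊥) :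
    ∑ d ∈ idl K x, F (b * d) = ∑ e ∈ (idl K x).filter (fun e => b ∣ e), F e := by
  refine Finset.sum_bij_ne_zero (fun d _ _ => b * d) ?_ ?_ ?_ ?_
  · exact fun d _ h => mem_filter.2 ⟨hF _ h, dvd_mul_right b d⟩
  · exact fun d _ _ d' _ _ h => mul_left_cancel₀ hb h
  · intro e he h
    obtain ⟨d, rfl⟩ := (mem_filter.1 he).2
    exact ⟨d, (mul_mem_idl_iff (mem_filter.1 he).1).2, h, rfl⟩
  · exact fun _ _ _ => rfl

/-- Regrouping a double sum over ideals by the product. -/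
theorem sum_conv {x : ℝ} {F : IK → ℝ} (hF : ∀ e, F e ≠ 0 → e ∈ idl K x) (f : IK → ℝ) :
    ∑ b ∈ idl K x, f b * ∑ d ∈ idl K x, F (b * d) = ∑ e ∈ idl K x, (∑ b ∈ divs e, f b) * F e := by
  have h1 : ∀ b ∈ idl K x, f b * ∑ d ∈ idl K x, F (b * d) = ∑ e ∈ idl K x, if b ∣ e then f b * F e else 0 := by
    intro b hb
    rw [sum_mul_left hF (mem_idl.1 hb).1, mul_sum, sum_filter]
  rw [sum_congr rfl h1, sum_comm]
  refine sum_congr rfl fun e he => ?_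
  rw [sum_mul, ← sum_filter]
  refine sum_congr ?_ fun _ _ => rfl
  ext b
  rw [mem_filter, mem_divs (mem_idl.1 he).1]
  exact ⟨fun h => h.2, fun h => ⟨by obtain ⟨d, rfl⟩ := h; exact (mul_mem_idl_iff he).1, h⟩⟩

/-- The type II weight in Vaughan's identity. -/
def vwt (y : ℝ) (e : IK) : ℝ := ∑ c ∈ divs e, if y < absNorm c then mang c else 0

theorem vwt_nonneg (y : ℝ) (e : IK) : 0 ≤ vwt y e :=
  sum_nonneg fun c _ => by split_ifs; exacts [mang_nonneg c, le_rfl]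

theorem vwt_le (y : ℝ) {e : IK} (he : e ≠ ⊥) : vwt y e ≤ log (absNorm e) := by
  rw [← sum_mang e he]
  exact sum_le_sum fun c _ => by split_ifs; exacts [le_rfl, mang_nonneg c]

theorem vwt_eq_zero {y : ℝ} {e : IK} (he : e ≠ ⊥) (h : (absNorm e : ℝ) ≤ y) : vwt y e = 0 :=
  sum_eq_zero fun c hc => if_neg (not_lt.2 ((absNorm_le_of_dvd he ((mem_divs he).1 hc)).trans h))

/-- Vaughan's identity over ideals. -/
theorem vaughan {x : ℝ} (hx : 1 ≤ x) (y : ℝ) {A : IK → ℝ} (hA : ∀ e, A e ≠ 0 → e ∈ idl K x) :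
    ∑ c ∈ idl K x, (if y < absNorm c then mang c else 0) * A c =
      (∑ b ∈ idl K x, ∑ e ∈ idl K x, (if y < absNorm b then moeb b else 0) * vwt y e * A (b * e)) +
      (∑ b ∈ idl K x, (if y < absNorm b then 0 else moeb b) *
        ∑ e ∈ idl K x, log (absNorm e) * A (b * e)) -
      ∑ b ∈ idl K x, (if y < absNorm b then 0 else moeb b) *
        ∑ c ∈ idl K x, (if y < absNorm c then 0 else mang c) * ∑ d ∈ idl K x, A (b * (c * d)) := by
  have htop : (⊤ : IK) ∈ idl K x := mem_idl.2 ⟨top_ne_bot, by rw [absNorm_top]; simpa using hx⟩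
  have hAl : ∀ b e, A (b * e) ≠ 0 → e ∈ idl K x := fun b e h => (mul_mem_idl_iff (hA _ h)).2
  have h1 : ∀ c, A c = ∑ b ∈ idl K x, moeb b * ∑ d ∈ idl K x, A (c * (b * d)) := by
    intro c
    rw [sum_conv (F := fun e => A (c * e)) (hAl c) moeb]
    rw [Finset.sum_eq_single_of_mem _ htop fun e he hne => by rw [sum_moeb (mem_idl.1 he).1, if_neg hne, zero_mul]]
    rw [sum_moeb top_ne_bot, if_pos rfl, one_mul, ← one_eq_top, mul_one]
  have h2 : ∑ c ∈ idl K x, (if y < absNorm c then mang c else 0) * A c =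
      ∑ b ∈ idl K x, moeb b * ∑ e ∈ idl K x, vwt y e * A (b * e) := by
    have : ∀ b ∈ idl K x, moeb b * ∑ e ∈ idl K x, vwt y e * A (b * e) =
        ∑ c ∈ idl K x, (if y < absNorm c then mang c else 0) * (moeb b * ∑ d ∈ idl K x, A (c * (b * d))) := by
      intro b _
      have := sum_conv (F := fun e => A (b * e)) (hAl b) (fun c => if y < absNorm c then mang c else 0)
      unfold vwt
      rw [← this, mul_sum]
      refine sum_congr rfl fun c _ => ?_
      simp only [mul_left_comm c b]; ring
    rw [sum_congr rfl this, sum_comm]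
    refine sum_congr rfl fun c _ => ?_
    rw [← mul_sum, ← h1]
  have h3 : ∀ b, ∑ e ∈ idl K x, vwt y e * A (b * e) = ∑ e ∈ idl K x, log (absNorm e) * A (b * e) -
      ∑ c ∈ idl K x, (if y < absNorm c then 0 else mang c) * ∑ d ∈ idl K x, A (b * (c * d)) := by
    intro b
    rw [sum_conv (F := fun e => A (b * e)) (hAl b), ← sum_sub_distrib]
    refine sum_congr rfl fun e he => ?_
    rw [← sub_mul, ← sum_mang e (mem_idl.1 he).1, ← sum_sub_distrib]
    congr 1
    exact sum_congr rfl fun c _ => by split_ifs <;> ring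
  rw [h2, ← sub_eq_zero]
  rw [← sum_add_distrib, ← sum_sub_distrib, ← sum_sub_distrib]
  refine sum_eq_zero fun b _ => ?_
  by_cases hb : y < absNorm b
  · simp only [hb, if_true, mul_assoc, ← mul_sum]; ring
  · simp only [hb, if_false, zero_mul, Finset.sum_const_zero]
    rw [h3]; ring

/-- Conjugates control the coordinates in the integral basis. -/
theorem exists_repr_le [IsGalois ℚ K] (ι : K →+* ℝ) : ∃ C : ℝ, 0 < C ∧ ∀ (a : OK) (T : ℝ), (∀ τ, |cj ι τ a| ≤ T) →
    ∀ j, |((basis K).repr a j : ℝ)| ≤ C * T := by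
  have h0 : ∃ c : ℝ, ∀ (a : OK) (i : K →+* ℂ), ‖(((integralBasis K).reindex (equivReindex K).symm).repr a i : ℂ)‖ ≤
      c * house (algebraMap OK K a) := ⟨_, house.basis_repr_norm_le_const_mul_house K⟩
  obtain ⟨c, hc⟩ := h0
  refine ⟨|c| + 1, by positivity, fun a T hT j => ?_⟩
  have hT0 : 0 ≤ T := (abs_nonneg _).trans (hT 1)
  have h1 := hc a ((equivReindex K).symm j)
  simp only [Basis.repr_reindex, Finsupp.mapDomain_equiv_apply, Equiv.symm_symm] at h1
  have h2 : house (algebraMap OK K a) ≤ T := by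
    rw [house, pi_norm_le_iff_of_nonneg hT0]
    intro φ
    let _ := (ofRealHom.comp ι).toAlgebra
    have e := AlgHom.restrictNormal_commutes φ.toRatAlgHom K (a : K)
    have e2 : φ (a : K) = ((cj ι (AlgEquiv.ofBijective ((φ.toRatAlgHom).restrictNormal K)
      (AlgHom.normal_bijective ℚ K K _)) a : ℝ) : ℂ) := e.symm
    have e3 : canonicalEmbedding K (algebraMap OK K a) φ = φ (a : K) := rfl
    rw [e3, e2, norm_real]
    exact hT _
  have h3 : ‖((integralBasis K).repr (algebraMap OK K a) j : ℂ)‖ = |((basis K).repr a j : ℝ)| := by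
    rw [integralBasis_repr_apply]; simp
  have h4 : equivReindex K ((equivReindex K).symm j) = j := Equiv.apply_symm_apply _ _
  rw [← h3]
  calc _ ≤ c * house (algebraMap OK K a) := by
        simpa using h1
    _ ≤ |c| * T := mul_le_mul (le_abs_self c) h2 (house_nonneg _) (abs_nonneg c)
    _ ≤ _ := by nlinarith

/-- The point of the integral lattice with coordinates `c` starting from `s`. -/
def latPt (s : OK) (c : Module.Free.ChooseBasisIndex ℤ OK → ℕ) : OK :=
  s + ∑ j, (c j : OK) * basis K j

variable (K) in
/-- The coordinate box of side `L`. -/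
def cbox (L : ℕ) : Finset (Module.Free.ChooseBasisIndex ℤ OK → ℕ) :=
  piFinset fun _ => range L

theorem card_cbox (L : ℕ) : (cbox K L).card = L ^ finrank ℚ K := by
  unfold cbox
  rw [card_piFinset, prod_const, card_range, card_univ, ← Module.finrank_eq_card_chooseBasisIndex, RingOfIntegers.rank]

theorem latPt_injective (s : OK) : Function.Injective (latPt s) := by
  intro c c' h
  have h1 : ∑ j, (c j : ℤ) • basis K j = ∑ j, (c' j : ℤ) • basis K j := by
    have := add_left_cancel h
    simpa [zsmul_eq_mul] using this
  funext j
  have h2 := congrArg (fun a => (basis K).repr a j) h1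
  simp only [(basis K).repr_sum_self] at h2
  exact_mod_cast h2

/-- A function on `𝓞/𝔟` anti-invariant under multiplication by a unit sums to zero over a box of side `P ∈ 𝔟`. -/
theorem sum_cbox_eq_zero {P : ℕ} (hP0 : P ≠ 0) {𝔟 : IK} (hP : (P : OK) ∈ 𝔟) {g : OK → ℤ}
    (hg : ∀ a a', a - a' ∈ 𝔟 → g a = g a') {t : OK} (ht : IsCoprime (span {t}) 𝔟) (hgt : ∀ a, g (t * a) = - g a)
    (s0 : OK) : ∑ c ∈ cbox K P, g (latPt s0 c) = 0 := by
  have : NeZero P := ⟨hP0⟩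
  have hb : 𝔟 ≠ ⊥ := fun h => hP0 (by rw [h, Ideal.mem_bot] at hP; exact_mod_cast hP)
  have hfin : Finite (OK ⧸ 𝔟) := Ring.HasFiniteQuotients.finiteQuotient hb
  let _ : Fintype (OK ⧸ 𝔟) := ofFinite _
  set G : OK ⧸ 𝔟 → ℤ := Quotient.lift g (fun a a' h => hg a a' (by
    rw [← Submodule.quotientRel_def]; exact h)) with hG
  have hGm : ∀ a, G (IQ 𝔟 a) = g a := fun a => rfl
  have hG0 : ∑ s, G s = 0 := by
    have hu : IsUnit (IQ 𝔟 t) := by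
      obtain ⟨x, hx, y, hy, hxy⟩ := Submodule.mem_sup.1 ((Ideal.eq_top_iff_one _).1 (isCoprime_iff_sup_eq.1 ht))
      obtain ⟨z, rfl⟩ := mem_span_singleton.1 hx
      refine IsUnit.of_mul_eq_one (IQ 𝔟 z) ?_
      rw [← map_mul, ← map_one (IQ 𝔟), Ideal.Quotient.eq, ← hxy]
      simpa using 𝔟.neg_mem hy
    obtain ⟨u, hu⟩ := hu
    have h1 : ∑ s, G s = ∑ s, G ((u : OK ⧸ 𝔟) * s) := (Equiv.sum_comp (Units.mulLeft u) G).symm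
    have h2 : ∀ s, G ((u : OK ⧸ 𝔟) * s) = - G s := by
      intro s
      obtain ⟨a, rfl⟩ := mk_surjective s
      rw [hu, ← map_mul, hGm, hGm, hgt]
    simp only [h2, Finset.sum_neg_distrib] at h1
    linarith
  set ψ1 : Module.Free.ChooseBasisIndex ℤ OK → (ZMod P →+ OK ⧸ 𝔟) := fun j =>
    ZMod.lift P ⟨(AddMonoidHom.mulRight (IQ 𝔟 (basis K j))).comp
      (Int.castAddHom (OK ⧸ 𝔟)), by
        have : ((P : ℕ) : OK ⧸ 𝔟) = 0 := by
          rw [← map_natCast (IQ 𝔟)]; exact eq_zero_iff_mem.2 hP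
        simp [this]⟩ with hψ1
  have hψ1c : ∀ j (m : ℤ), ψ1 j (m : ZMod P) = IQ 𝔟 ((m : OK) * basis K j) := by
    intro j m
    rw [hψ1]
    simp only [ZMod.lift_coe]
    simp
  set ψ : (Module.Free.ChooseBasisIndex ℤ OK → ZMod P) → OK ⧸ 𝔟 := fun z => ∑ j, ψ1 j (z j) with hψ
  have hψadd : ∀ z w, ψ (z + w) = ψ z + ψ w := fun z w => by
    simp only [hψ, Pi.add_apply, map_add, sum_add_distrib]
  have hψsurj : Function.Surjective ψ := by
    intro s
    obtain ⟨a, rfl⟩ := mk_surjective s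
    refine ⟨fun j => ((basis K).repr a j : ZMod P), ?_⟩
    simp only [hψ, hψ1c]
    rw [← map_sum]
    congr 1
    conv_rhs => rw [← (basis K).sum_repr a]
    exact sum_congr rfl fun j _ => by rw [zsmul_eq_mul]
  have hS : ∀ s, ∑ z, G (s + ψ z) = ∑ z, G (ψ z) := by
    intro s
    obtain ⟨w, rfl⟩ := hψsurj s
    rw [← Equiv.sum_comp (Equiv.addLeft w) fun z => G (ψ z)]
    exact sum_congr rfl fun z _ => by simp [hψadd]
  have hS0 : ∑ z, G (ψ z) = 0 := by
    have h1 : ∑ s : OK ⧸ 𝔟, ∑ z, G (s + ψ z) = 0 := by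
      rw [sum_comm]
      refine sum_eq_zero fun z _ => ?_
      rw [← hG0]
      exact Equiv.sum_comp (Equiv.addRight (ψ z)) G
    simp only [hS, sum_const, nsmul_eq_mul, mul_eq_zero] at h1
    rcases h1 with h1 | h1
    · simp at h1
    · exact h1
  rw [← hS0, ← hS (IQ 𝔟 s0)]
  refine sum_nbij' (fun c j => (c j : ZMod P)) (fun z j => (z j).val) (fun _ _ => mem_univ _) ?_ ?_ ?_ ?_
  · exact fun z _ => mem_piFinset.2 fun j => mem_range.2 (ZMod.val_lt _)
  · intro c hc
    funext j
    exact ZMod.val_cast_of_lt (mem_range.1 (mem_piFinset.1 hc j))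
  · intro z _
    funext j
    exact ZMod.natCast_zmod_val _
  · intro c _
    rw [← hGm]
    congr 1
    unfold latPt
    rw [map_add, map_sum]
    congr 1
    refine sum_congr rfl fun j _ => ?_
    have := hψ1c j (c j : ℤ)
    push_cast at this
    exact this.symm

theorem pow_sub_pow_le_mul {L P : ℝ} (hP : 0 ≤ P) (hPL : P ≤ L) (n : ℕ) : L ^ (n + 1) - P ^ (n + 1) ≤ (n + 1) * (L - P) * L ^ n := by
  induction n with
  | zero => simp
  | succ n ih =>
    have hL : 0 ≤ L := hP.trans hPL
    have h1 : P ^ (n + 1) ≤ L ^ (n + 1) := by gcongr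
    have h2 : L ^ (n + 2) - P ^ (n + 2) = L * (L ^ (n + 1) - P ^ (n + 1)) + (L - P) * P ^ (n + 1) := by ring
    rw [h2]
    have h3 := mul_le_mul_of_nonneg_left ih hL
    have h4 := mul_le_mul_of_nonneg_left h1 (sub_nonneg.2 hPL)
    push_cast
    calc _ ≤ L * ((n + 1) * (L - P) * L ^ n) + (L - P) * L ^ (n + 1) := add_le_add h3 h4
      _ = _ := by ring

theorem abs_sum_cbox_le {p : ℕ} (hp0 : p ≠ 0) {𝔟 : IK} (hp : (p : OK) ∈ 𝔟) {g : OK → ℤ}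
    (hg : ∀ a a', a - a' ∈ 𝔟 → g a = g a') {t : OK} (ht : IsCoprime (span {t}) 𝔟) (hgt : ∀ a, g (t * a) = - g a)
    (hg1 : ∀ a, |g a| ≤ 1) (s0 : OK) (L : ℕ) : |((∑ c ∈ cbox K L, g (latPt s0 c) : ℤ) : ℝ)| ≤
      finrank ℚ K * p * (L : ℝ) ^ (finrank ℚ K - 1) := by
  set P := p * (L / p) with hP
  have hPL : P ≤ L := Nat.mul_div_le L p
  have hLP : L - P ≤ p := by
    have := Nat.div_add_mod L p
    have := mod_lt L (Nat.pos_of_ne_zero hp0)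
    omega
  have hsub : cbox K P ⊆ cbox K L := Fintype.piFinset_subset _ _ fun _ => Finset.range_subset_range.2 hPL
  have hn0 : 0 < finrank ℚ K := finrank_pos
  obtain ⟨n, hn⟩ := Nat.exists_eq_succ_of_ne_zero hn0.ne'
  have h0 : ∑ c ∈ cbox K P, g (latPt s0 c) = 0 := by
    rcases Nat.eq_zero_or_pos P with h | h
    · have hz : cbox K P = ∅ := by
        rw [← Finset.card_eq_zero, card_cbox, h, zero_pow hn0.ne']
      rw [hz, Finset.sum_empty]
    · exact sum_cbox_eq_zero h.ne' (by rw [hP, cast_mul]; exact 𝔟.mul_mem_right _ hp) hg ht hgt s0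
  rw [← Finset.sum_sdiff hsub, h0, add_zero]
  have h1 : |((∑ c ∈ cbox K L \ cbox K P, g (latPt s0 c) : ℤ) : ℝ)| ≤ (cbox K L \ cbox K P).card := by
    have : |∑ c ∈ cbox K L \ cbox K P, g (latPt s0 c)| ≤ (cbox K L \ cbox K P).card := by
      refine (abs_sum_le_sum_abs _ _).trans ((sum_le_sum fun c _ => hg1 _).trans ?_)
      simp
    exact_mod_cast this
  refine h1.trans ?_
  have h2 := Finset.card_sdiff_add_card_eq_card hsub
  rw [card_cbox, card_cbox] at h2
  have h3 : ((cbox K L \ cbox K P).card : ℝ) = (L : ℝ) ^ (n + 1) - (P : ℝ) ^ (n + 1) := by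
    rw [eq_sub_iff_add_eq, ← Nat.succ_eq_add_one, ← hn]; exact_mod_cast h2
  rw [h3, hn, Nat.succ_eq_add_one, Nat.add_sub_cancel]
  refine (pow_sub_pow_le_mul (cast_nonneg P) (by exact_mod_cast hPL) n).trans ?_
  have h4 : (L : ℝ) - P ≤ p := by
    rw [← Nat.cast_sub hPL]; exact_mod_cast hLP
  push_cast
  gcongr

/-- Multiplying by the square of a unit, all conjugates can be made as small as the norm allows. -/
theorem exists_balanced [IsGalois ℚ K] (ι : K →+* ℝ) : ∃ C : ℝ, 0 < C ∧ ∀ a : OK, a ≠ 0 → ∃ u : OKˣ, ∀ τ,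
    |cj ι τ ((u : OK) * u * a)| ≤ C * (absNorm (span {a}) : ℝ) ^ (1 / (finrank ℚ K : ℝ)) := by
  obtain ⟨R, hR0, hR⟩ := (mixedEmbedding.fundamentalCone.isBounded_normLeOne K).exists_pos_norm_le
  have hn0 : (0 : ℝ) < finrank ℚ K := by exact_mod_cast finrank_pos
  refine ⟨R * R, by positivity, fun a ha => ?_⟩
  have haK : (a : K) ≠ 0 := by exact_mod_cast ha
  set x : mixedEmbedding.mixedSpace K := (fun w => sqrt (w.1 (a : K)), fun w => ((sqrt (w.1 (a : K)) : ℝ) : ℂ)) with hx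
  have hxw : ∀ w : InfinitePlace K, mixedEmbedding.normAtPlace w x = sqrt (w (a : K)) := by
    intro w
    rcases w.isReal_or_isComplex with hw | hw
    · rw [mixedEmbedding.normAtPlace_apply_of_isReal hw, hx]
      simp [abs_of_nonneg (sqrt_nonneg _)]
    · rw [mixedEmbedding.normAtPlace_apply_of_isComplex hw, hx]
      simp [abs_of_nonneg (sqrt_nonneg _)]
  set N : ℝ := ((absNorm (span {a}) : ℕ) : ℝ) with hN
  have hN1 : 1 ≤ N := one_le_absNorm (by rwa [Ne, span_singleton_eq_bot])
  have hNprod : ∏ w : InfinitePlace K, w (a : K) ^ w.mult = N := by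
    rw [InfinitePlace.prod_eq_abs_norm, ← coe_norm_int, hN, Ideal.absNorm_span_singleton]
    rw [Nat.cast_natAbs]; push_cast; rfl
  have hnx : mixedEmbedding.norm x = sqrt N := by
    rw [mixedEmbedding.norm_apply]
    have h1 : (∏ w, mixedEmbedding.normAtPlace w x ^ w.mult) * (∏ w, mixedEmbedding.normAtPlace w x ^ w.mult) = N := by
      rw [← hNprod, ← prod_mul_distrib]
      refine prod_congr rfl fun w _ => ?_
      rw [hxw, ← mul_pow, Real.mul_self_sqrt (apply_nonneg w _)]
    rw [← h1, Real.sqrt_mul_self]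
    exact Finset.prod_nonneg fun w _ => pow_nonneg (mixedEmbedding.normAtPlace_nonneg w x) _
  have hnx0 : mixedEmbedding.norm x ≠ 0 := by rw [hnx]; positivity
  obtain ⟨u, hu⟩ := mixedEmbedding.fundamentalCone.exists_unit_smul_mem hnx0
  set c : ℝ := N ^ (-(1 / (2 * (finrank ℚ K : ℝ)))) with hc
  have hc0 : 0 < c := by positivity
  have hmem : c • (u • x) ∈ mixedEmbedding.fundamentalCone.normLeOne K := by
    rw [mixedEmbedding.fundamentalCone.mem_normLeOne]
    refine ⟨mixedEmbedding.fundamentalCone.smul_mem_of_mem hu hc0.ne', ?_⟩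
    rw [mixedEmbedding.norm_smul, mixedEmbedding.norm_unit_smul, hnx, abs_of_pos hc0, hc, ← rpow_natCast,
      ← rpow_mul (by linarith), sqrt_eq_rpow, ← rpow_add (by linarith)]
    refine le_of_eq ?_
    rw [show -(1 / (2 * (finrank ℚ K : ℝ))) * (finrank ℚ K : ℝ) + 1 / 2 = 0 by field_simp; ring, Real.rpow_zero]
  have hb := hR _ hmem
  refine ⟨u, fun τ => ?_⟩
  set w : InfinitePlace K := InfinitePlace.mk (ofRealHom.comp (ι.comp (τ : K →+* K))) with hw
  have hwa : ∀ b : OK, |cj ι τ b| = w (b : K) := by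
    intro b
    rw [hw, InfinitePlace.apply, RingHom.comp_apply, Complex.ofRealHom_eq_coe, norm_real, Real.norm_eq_abs]
    rfl
  have h1 : mixedEmbedding.normAtPlace w (c • (u • x)) ≤ R := by
    refine le_trans ?_ hb
    rw [mixedEmbedding.norm_eq_sup'_normAtPlace]
    exact Finset.le_sup' (fun w => mixedEmbedding.normAtPlace w (c • (u • x))) (mem_univ w)
  rw [mixedEmbedding.normAtPlace_smul, mixedEmbedding.unitSMul_smul, map_mul, hxw, abs_of_pos hc0] at h1
  have h2 : mixedEmbedding.normAtPlace w (mixedEmbedding K ((u : OK) : K)) = w ((u : OK) : K) := mixedEmbedding.normAtPlace_apply w _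
  rw [h2] at h1
  have h3 : |cj ι τ ((u : OK) * u * a)| = (w ((u : OK) : K) * sqrt (w (a : K))) * (w ((u : OK) : K) * sqrt (w (a : K))) := by
    rw [map_mul, map_mul, abs_mul, abs_mul, hwa, hwa, mul_mul_mul_comm, Real.mul_self_sqrt (apply_nonneg w _)]
  have h4 : w ((u : OK) : K) * sqrt (w (a : K)) ≤ R * N ^ (1 / (2 * (finrank ℚ K : ℝ))) := by
    have : c * N ^ (1 / (2 * (finrank ℚ K : ℝ))) = 1 := by
      rw [hc, ← rpow_add (by linarith), neg_add_cancel, Real.rpow_zero]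
    have h5 : 0 < N ^ (1 / (2 * (finrank ℚ K : ℝ))) := by positivity
    calc _ = (c * (w ((u : OK) : K) * sqrt (w (a : K)))) * N ^ (1 / (2 * (finrank ℚ K : ℝ))) := by
          rw [mul_right_comm, this, one_mul]
      _ ≤ _ := by gcongr
  have h6 : 0 ≤ w ((u : OK) : K) * sqrt (w (a : K)) := mul_nonneg (apply_nonneg w _) (sqrt_nonneg _)
  rw [h3]
  refine (mul_le_mul h4 h4 h6 (h6.trans h4)).trans (le_of_eq ?_)
  rw [mul_mul_mul_comm, ← rpow_add (by linarith)]
  congr 2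
  field_simp; norm_num

/-- Finitely many ideals coprime to `F` suffice to make every ideal coprime to `F` principal with
totally positive generator. -/
theorem exists_partners [IsGalois ℚ K] (ι : K →+* ℝ) (F : IK) : ∃ B : Finset IK,
    (∀ 𝔟 ∈ B, 𝔟 ≠ ⊥ ∧ IsCoprime 𝔟 F) ∧
    ∀ 𝔪 : IK, 𝔪 ≠ ⊥ → IsCoprime 𝔪 F → ∃ 𝔟 ∈ B, ∃ m, TotPos m ∧ span {m} = 𝔪 * 𝔟 := by
  set P := {𝔪 : IK // 𝔪 ≠ ⊥ ∧ IsCoprime 𝔪 F} with hP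
  let cl : P → ClassGroup OK := fun 𝔪 => ClassGroup.mk0 ⟨𝔪.1, mem_nonZeroDivisors_of_ne_zero 𝔪.2.1⟩
  -- a representative of each ideal class
  obtain ⟨W, hW⟩ : ∃ W : ClassGroup OK → nonZeroDivisors (IK), ∀ c, ClassGroup.mk0 (W c) = c :=
    ⟨_, fun c => (ClassGroup.mk0_surjective c).choose_spec⟩
  have hxy : ∀ 𝔪 : P, ∃ x y : OK, x ≠ 0 ∧ y ≠ 0 ∧ span {x} * 𝔪.1 = span {y} * (W (cl 𝔪)).1 := by
    intro 𝔪
    obtain ⟨x, y, hx, hy, h⟩ := ClassGroup.mk0_eq_mk0_iff.1 (hW (cl 𝔪)).symm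
    exact ⟨x, y, hx, hy, h⟩
  choose x y hx hy hxy using hxy
  let lab : P → ClassGroup OK × ((Gal(K/ℚ)) → Bool) := fun 𝔪 => (cl 𝔪, fun τ => decide (0 < cj ι τ (x 𝔪 * y 𝔪)))
  set h := card (ClassGroup OK) with hh
  have hh0 : 0 < h := card_pos
  have hwit : ∀ l : Set.range lab, ∃ 𝔪 : P, lab 𝔪 = l := fun l => l.2
  choose wit hwit using hwit
  refine ⟨univ.image fun l => (wit l).1 ^ (2 * h - 1), ?_, ?_⟩
  · intro 𝔟 hb
    obtain ⟨l, _, rfl⟩ := mem_image.1 hb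
    exact ⟨pow_ne_zero _ (wit l).2.1, (wit l).2.2.pow_left⟩
  · intro 𝔪 hm hmF
    set m : P := ⟨𝔪, hm, hmF⟩ with hmdef
    set l : Set.range lab := ⟨lab m, m, rfl⟩ with hl
    set m' := wit l with hm'
    have hlab : lab m' = lab m := hwit l
    refine ⟨_, mem_image.2 ⟨l, mem_univ _, rfl⟩, ?_⟩
    have hcl : cl m' = cl m := congrArg Prod.fst hlab
    have hsg : ∀ τ, (0 < cj ι τ (x m' * y m') ↔ 0 < cj ι τ (x m * y m)) := fun τ => by
      have := congrFun (congrArg Prod.snd hlab) τ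
      simpa [lab] using this
    -- a generator of the power of the witness
    obtain ⟨g, hg⟩ : ∃ g : OK, span {g} = m'.1 ^ h := by
      have h1 : (cl m') ^ h = 1 := pow_card_eq_one
      have h2 : ClassGroup.mk0 (⟨m'.1, mem_nonZeroDivisors_of_ne_zero m'.2.1⟩ ^ h) = 1 := by rw [map_pow]; exact h1
      rw [ClassGroup.mk0_eq_one_iff] at h2
      obtain ⟨g, hg⟩ := h2
      exact ⟨g, hg.symm⟩
    have hg0 : g ≠ 0 := by
      rintro rfl
      rw [span_singleton_eq_bot.2 rfl] at hg
      exact pow_ne_zero h m'.2.1 hg.symm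
    have e1 : span {x m * y m'} * 𝔪 = span {y m * x m'} * m'.1 := by
      rw [← span_singleton_mul_span_singleton, ← span_singleton_mul_span_singleton, mul_right_comm, hxy m,
        mul_assoc (span {y m}) (span {x m'}), hxy m', hcl]
      ring
    have e2 : span {x m * y m'} * (𝔪 * m'.1 ^ (2 * h - 1)) = span {y m * x m' * (g * g)} := by
      rw [← mul_assoc, e1, mul_assoc, ← pow_succ', Nat.sub_add_cancel (by omega), two_mul, pow_add, ← hg,
        span_singleton_mul_span_singleton, span_singleton_mul_span_singleton]
    obtain ⟨z, hz⟩ : x m * y m' ∣ y m * x m' * (g * g) := by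
      rw [← Ideal.span_singleton_le_span_singleton, ← e2]
      exact mul_le_left
    have hd0 : x m * y m' ≠ 0 := mul_ne_zero (hx m) (hy m')
    refine ⟨z, ?_, ?_⟩
    · rw [totPos_iff ι]
      intro τ
      have h1 := congrArg (cj ι τ) hz
      have h3 : ∀ b : OK, b ≠ 0 → cj ι τ b ≠ 0 := fun b hb => (map_ne_zero_iff _ (cj_injective ι τ)).2 hb
      have hgg : 0 < cj ι τ g * cj ι τ g := mul_self_pos.2 (h3 g hg0)
      have hd2 : 0 < cj ι τ (x m * y m') * cj ι τ (x m * y m') := mul_self_pos.2 (h3 _ hd0)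
      have hs := hsg τ
      have hp1 := h3 _ (mul_ne_zero (hx m) (hy m))
      have hp2 := h3 _ (mul_ne_zero (hx m') (hy m'))
      have h5 : 0 < cj ι τ (x m * y m) * cj ι τ (x m' * y m') := by
        rcases lt_or_gt_of_ne hp1 with h | h
        · have : cj ι τ (x m' * y m') < 0 := lt_of_le_of_ne (not_lt.1 fun h' => (lt_asymm h (hs.1 h'))) hp2
          exact mul_pos_of_neg_of_neg h this
        · exact mul_pos h (hs.2 h)
      have h6 : cj ι τ (x m * y m') * cj ι τ (x m * y m') * cj ι τ z =
          cj ι τ (x m * y m) * cj ι τ (x m' * y m') * (cj ι τ g * cj ι τ g) := by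
        simp only [map_mul] at h1 ⊢
        linear_combination (-(cj ι τ (x m) * cj ι τ (y m'))) * h1
      have h7 := mul_pos h5 hgg
      rw [← h6] at h7
      exact (pos_iff_pos_of_mul_pos h7).1 hd2
    · have h1 : span {x m * y m'} * span {z} = span {x m * y m'} * (𝔪 * m'.1 ^ (2 * h - 1)) := by
        rw [e2, span_singleton_mul_span_singleton, hz]
      exact mul_left_cancel₀ (by rwa [Ne, zero_eq_bot, span_singleton_eq_bot]) h1

theorem absNorm_galMap (τ : Gal(K/ℚ)) (𝔞 : IK) : absNorm (galMap τ 𝔞) = absNorm 𝔞 := by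
  rw [absNorm_apply, absNorm_apply, cardQuot_apply, cardQuot_apply]
  exact (Nat.card_congr (Ideal.quotientEquiv 𝔞 (galMap τ 𝔞) (gal τ) (galMap_eq τ 𝔞)).toEquiv).symm

theorem galMap_prime {τ : Gal(K/ℚ)} {𝔭 : IK} (h : Prime 𝔭) : Prime (galMap τ 𝔭) :=
  (MulEquiv.prime_iff (galIdeal τ)).2 h

theorem galMap_dvd {τ : Gal(K/ℚ)} {𝔞 𝔟 : IK} : galMap τ 𝔞 ∣ galMap τ 𝔟 ↔ 𝔞 ∣ 𝔟 :=
  map_dvd_iff (galIdeal τ)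

/-- The ideal `σ𝔫 · σ⁻¹𝔫`. -/
def twist (σ : Gal(K/ℚ)) (𝔫 : IK) : IK := galMap σ 𝔫 * galMap σ⁻¹ 𝔫

theorem twist_mul (σ : Gal(K/ℚ)) (𝔪 𝔫 : IK) : twist σ (𝔪 * 𝔫) = twist σ 𝔪 * twist σ 𝔫 := by
  unfold twist
  rw [galMap_mul_ideal, galMap_mul_ideal, mul_mul_mul_comm]

theorem twist_ne_bot {σ : Gal(K/ℚ)} {𝔫 : IK} (h : 𝔫 ≠ ⊥) : twist σ 𝔫 ≠ ⊥ :=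
  mul_ne_zero (galMap_ne_bot h) (galMap_ne_bot h)

/-- An ideal of prime norm meeting every congruence class of integers. -/
theorem exists_int_sub_mem {𝔭 : IK} {p : ℕ} (hp : p.Prime) (h : absNorm 𝔭 = p) (x : OK) :
    ∃ a : ℤ, x - (a : OK) ∈ 𝔭 := by
  have : Fact p.Prime := ⟨hp⟩
  have hc : Nat.card (OK ⧸ 𝔭) = p := by rw [← h, absNorm_apply, cardQuot_apply]
  have hs : zmultiples (1 : OK ⧸ 𝔭) = ⊤ := by
    have h1 : (1 : OK ⧸ 𝔭) ≠ 0 := by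
      intro h1
      have : Subsingleton (OK ⧸ 𝔭) := subsingleton_of_zero_eq_one h1.symm
      have h2 : Nat.card (OK ⧸ 𝔭) ≤ 1 := Finite.card_le_one_iff_subsingleton.2 this
      have := hp.two_le
      omega
    exact zmultiples_eq_top_of_prime_card hc h1
  have hx : (IQ 𝔭 x) ∈ zmultiples (1 : OK ⧸ 𝔭) := by rw [hs]; trivial
  obtain ⟨a, ha⟩ := AddSubgroup.mem_zmultiples_iff.1 hx
  refine ⟨a, ?_⟩
  rw [← eq_zero_iff_mem, map_sub, map_intCast, ← ha]
  simp

/-- If the twist of `𝔞` is a square then the norm of `𝔞` is squarefull. -/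
theorem sq_dvd_absNorm_of_twist_eq_sq {σ : Gal(K/ℚ)} {F 𝔞 s : IK} {x0 : OK}
    (hF : span {gal (σ * σ) x0 - x0} ∣ F) (h0 : 𝔞 ≠ ⊥) (hc : IsCoprime 𝔞 F) (hs : twist σ 𝔞 = s * s)
    {p : ℕ} (hp : p.Prime) (hd : p ∣ absNorm 𝔞) : p ^ 2 ∣ absNorm 𝔞 := by
  by_contra hcon
  obtain ⟨𝔭, hm, hdvd, hu⟩ := Ideal.exists_isMaximal_dvd_of_dvd_absNorm' hp 𝔞 hd
  have hpm : (p : OK) ∈ 𝔭 := by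
    have : (p : ℤ) ∈ 𝔭.under ℤ := by rw [hdvd]; exact mem_span_singleton_self _
    simpa [Ideal.mem_comap] using this
  have hp0 : 𝔭 ≠ ⊥ := ne_zero_of_dvd_ne_zero h0 hu
  have hpp : Prime 𝔭 := prime_of_isPrime hp0 hm.isPrime
  obtain ⟨𝔞', rfl⟩ := hu
  rw [map_mul] at hd hcon
  have hpN : ∀ 𝔮 : IK, Prime 𝔮 → (p : OK) ∈ 𝔮 → p ∣ absNorm 𝔮 := by
    intro 𝔮 hq hmem
    have h1 : absNorm 𝔮 ∣ p ^ finrank ℚ K := by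
      have := absNorm_dvd_absNorm_of_le ((span_singleton_le_iff_mem _).2 hmem)
      rwa [Ideal.absNorm_span_singleton, ← map_natCast (algebraMap ℤ OK) p, Algebra.norm_algebraMap, Int.natAbs_pow,
        Int.natAbs_natCast, RingOfIntegers.rank] at this
    obtain ⟨k, -, hk⟩ := (Nat.dvd_prime_pow hp).1 h1
    have h2 := absNorm_prime_ge_two hq
    rw [hk]
    refine dvd_pow_self p ?_
    rintro rfl
    rw [pow_zero] at hk
    rw [hk] at h2
    exact absurd h2 (by norm_num)
  have hpp1 : p ∣ absNorm 𝔭 := hpN 𝔭 hpp hpm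
  have ha' : ¬ p ∣ absNorm 𝔞' := fun h => hcon (by rw [pow_two]; exact mul_dvd_mul hpp1 h)
  have hNp : absNorm 𝔭 = p := by
    have h1 : absNorm 𝔭 ∣ p ^ finrank ℚ K := by
      have := absNorm_dvd_absNorm_of_le ((span_singleton_le_iff_mem _).2 hpm)
      rwa [Ideal.absNorm_span_singleton, ← map_natCast (algebraMap ℤ OK) p, Algebra.norm_algebraMap, Int.natAbs_pow,
        Int.natAbs_natCast, RingOfIntegers.rank] at this
    obtain ⟨k, -, hk⟩ := (Nat.dvd_prime_pow hp).1 h1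
    have h2 := absNorm_prime_ge_two hpp
    rcases k with _ | _ | k
    · rw [hk, pow_zero] at h2
      exact absurd h2 (by norm_num)
    · simpa using hk
    · exact absurd (Dvd.dvd.mul_right (by rw [hk]; exact pow_dvd_pow p (by lia)) _) hcon
  have hne : galMap (σ * σ) 𝔭 ≠ 𝔭 := by
    intro he
    obtain ⟨a, ha⟩ := exists_int_sub_mem hp hNp x0
    have h1 : gal (σ * σ) (x0 - a) ∈ 𝔭 := by
      have := gal_mem_galMap (τ := σ * σ).2 ha
      rwa [he] at this
    rw [map_sub, map_intCast] at h1
    have h2 : gal (σ * σ) x0 - x0 ∈ 𝔭 := by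
      have := 𝔭.sub_mem h1 ha
      rwa [sub_sub_sub_cancel_right] at this
    have h3 : 𝔭 ∣ F := (dvd_iff_le.2 ((span_singleton_le_iff_mem _).2 h2)).trans hF
    exact hpp.not_unit (hc.isUnit_of_dvd' (Dvd.intro _ rfl) h3)
  have hσp : Prime (galMap σ 𝔭) := galMap_prime hpp
  have h1 : galMap σ 𝔭 ^ 2 ∣ galMap σ (𝔭 * 𝔞') * galMap σ⁻¹ (𝔭 * 𝔞') := by
    have h2 : galMap σ 𝔭 ∣ s * s := by
      rw [← hs]
      exact Dvd.dvd.mul_right (galMap_dvd.2 (Dvd.intro _ rfl)) _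
    have h3 : galMap σ 𝔭 ∣ s := (hσp.dvd_or_dvd h2).elim id id
    change _ ∣ twist σ (𝔭 * 𝔞')
    rw [hs, pow_two]
    exact mul_dvd_mul h3 h3
  have h2 : ¬ galMap σ 𝔭 ∣ galMap σ⁻¹ (𝔭 * 𝔞') := by
    intro h
    have h3 : galMap (σ * σ) 𝔭 ∣ 𝔭 * 𝔞' := by
      have := galMap_dvd (τ := σ).2 h
      rwa [galMap_apply_inv, ← galMap_mul] at this
    have hσσ : Prime (galMap (σ * σ) 𝔭) := galMap_prime hpp
    rcases hσσ.dvd_or_dvd h3 with h4 | h4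
    · have := Ideal.le_of_dvd h4
      exact hne (hm.eq_of_le (isPrime_of_prime hσσ).ne_top this).symm
    · refine ha' (dvd_trans ?_ (absNorm_dvd_absNorm_of_le (Ideal.le_of_dvd h4)))
      rw [absNorm_galMap, hNp]
  have h3 := hσp.pow_dvd_of_dvd_mul_right 2 h2 h1
  have h4 : 𝔭 ^ 2 ∣ 𝔭 * 𝔞' := by
    rw [pow_two, ← galMap_mul_ideal] at h3
    rw [pow_two]
    exact galMap_dvd.1 h3
  rw [pow_two, mul_dvd_mul_iff_left hp0] at h4
  exact ha' (hpp1.trans (absNorm_dvd_absNorm_of_le (Ideal.le_of_dvd h4)))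

/-- A squarefull number is `a³c²`. -/
theorem exists_cube_mul_sq {m : ℕ} (h : ∀ p : ℕ, p.Prime → p ∣ m → p ^ 2 ∣ m) :
    ∃ a c : ℕ, m = a ^ 3 * c ^ 2 := by
  obtain ⟨a, b, hab, hsf⟩ := Nat.sq_mul_squarefree m
  have hdvd : a ∣ b := by
    rw [← Nat.prod_primeFactors_of_squarefree hsf]
    refine Finset.prod_primes_dvd _ (fun p hp => (Nat.prime_of_mem_primeFactors hp).prime) fun p hp => ?_
    have hpp := Nat.prime_of_mem_primeFactors hp
    by_contra hpb
    have h1 : p ^ 2 ∣ b ^ 2 * a := by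
      rw [hab]
      exact h p hpp (by rw [← hab]; exact Dvd.dvd.mul_left (Nat.dvd_of_mem_primeFactors hp) _)
    have h2 : p ^ 2 ∣ a := (Nat.Coprime.pow 2 2 ((Nat.Prime.coprime_iff_not_dvd hpp).2 hpb)).dvd_of_dvd_mul_left h1
    rw [pow_two] at h2
    exact hpp.one_lt.ne' (Nat.isUnit_iff.1 (hsf p h2))
  obtain ⟨c, rfl⟩ := hdvd
  exact ⟨a, c, by rw [← hab]; ring⟩

/-- There are `O(√T)` numbers of the form `a³c²` up to `T`. -/
theorem card_cube_mul_sq_le : ∃ C : ℝ, 1 ≤ C ∧ ∀ (T : ℝ) (s : Finset ℕ), 1 ≤ T →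
    (∀ m ∈ s, m ≠ 0 ∧ (m : ℝ) ≤ T ∧ ∃ a c : ℕ, m = a ^ 3 * c ^ 2) → (s.card : ℝ) ≤ C * T ^ (1 / 2 : ℝ) := by
  have hsum : Summable fun a : ℕ => 1 / (a : ℝ) ^ (3 / 2 : ℝ) := Real.summable_one_div_nat_rpow.2 (by norm_num)
  refine ⟨1 + ∑' a : ℕ, 1 / (a : ℝ) ^ (3 / 2 : ℝ), ?_, fun T s hT h => ?_⟩
  · have : 0 ≤ ∑' a : ℕ, 1 / (a : ℝ) ^ (3 / 2 : ℝ) := tsum_nonneg fun a => by positivity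
    linarith
  have h1 : s ⊆ (Icc 1 ⌊T⌋₊).biUnion fun a => (Icc 1 ⌊(T / (a : ℝ) ^ 3) ^ (1 / 2 : ℝ)⌋₊).image fun c => a ^ 3 * c ^ 2 := by
    intro m hm
    obtain ⟨h0, hT', a, c, rfl⟩ := h m hm
    have ha : a ≠ 0 := by rintro rfl; simp at h0
    have hc : c ≠ 0 := by rintro rfl; simp at h0
    have ha1 : (1 : ℝ) ≤ a := by exact_mod_cast one_le_iff_ne_zero.2 ha
    have hc1 : (1 : ℝ) ≤ c := by exact_mod_cast one_le_iff_ne_zero.2 hc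
    push_cast at hT'
    refine Finset.mem_biUnion.2 ⟨a, mem_Icc.2 ⟨one_le_iff_ne_zero.2 ha, le_floor ?_⟩, mem_image.2 ⟨c, mem_Icc.2 ⟨one_le_iff_ne_zero.2 hc, le_floor ?_⟩, rfl⟩⟩
    · calc (a : ℝ) ≤ a ^ 3 := le_self_pow₀ ha1 (by norm_num)
        _ ≤ a ^ 3 * c ^ 2 := le_mul_of_one_le_right (by positivity) (one_le_pow₀ hc1)
        _ ≤ T := hT'
    · rw [← sqrt_eq_rpow]
      refine Real.le_sqrt_of_sq_le ?_
      rw [le_div_iff₀ (by positivity), mul_comm]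
      exact hT'
  have h2 : (s.card : ℝ) ≤ ∑ a ∈ Icc 1 ⌊T⌋₊, (T / (a : ℝ) ^ 3) ^ (1 / 2 : ℝ) := by
    refine (cast_le.2 ((card_le_card h1).trans Finset.card_biUnion_le)).trans ?_
    push_cast
    refine sum_le_sum fun a _ => ?_
    refine (cast_le.2 card_image_le).trans ?_
    rw [Nat.card_Icc, Nat.add_sub_cancel]
    exact floor_le (by positivity)
  refine h2.trans ?_
  have h3 : ∀ a : ℕ, (T / (a : ℝ) ^ 3) ^ (1 / 2 : ℝ) = 1 / (a : ℝ) ^ (3 / 2 : ℝ) * T ^ (1 / 2 : ℝ) := by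
    intro a
    rw [Real.div_rpow (by linarith) (by positivity), ← rpow_natCast, ← rpow_mul (by positivity)]
    norm_num
    ring
  simp_rw [h3]
  rw [← sum_mul]
  refine mul_le_mul_of_nonneg_right ?_ (by positivity)
  have := hsum.sum_le_tsum (Icc 1 ⌊T⌋₊) (fun a _ => by positivity)
  linarith

/-- Few pairs of ideals have square twisted product. -/
theorem card_square_pairs_le {ε : ℝ} (hε : 0 < ε) : ∃ C : ℝ, 1 ≤ C ∧ ∀ (σ : Gal(K/ℚ)) (F : IK) (x0 : OK),
    span {gal (σ * σ) x0 - x0} ∣ F → ∀ (N : ℝ) (J : Finset IK), 1 ≤ N →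
    (∀ 𝔫 ∈ J, 𝔫 ∈ idl K N ∧ IsCoprime 𝔫 F) →
    (((J ×ˢ J).filter fun p => ∃ s, twist σ (p.1 * p.2) = s * s).card : ℝ) ≤ C * N ^ (1 + ε) := by
  obtain ⟨C1, hC1, h1⟩ := card_norm_eq_le (K := K) (ε := ε / 4) (by positivity)
  obtain ⟨C2, hC2, h2⟩ := card_divs_le (K := K) (ε := ε / 4) (by positivity)
  obtain ⟨C3, hC3, h3⟩ := card_cube_mul_sq_le
  refine ⟨C3 * (C1 * C2), one_le_mul_of_one_le_of_one_le hC3 (one_le_mul_of_one_le_of_one_le hC1 hC2), ?_⟩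
  intro σ F x0 hF N J hN hJ
  have hN0 : 0 < N := by linarith
  set P := (J ×ˢ J).filter fun p => ∃ s, twist σ (p.1 * p.2) = s * s with hP
  have hmem : ∀ p ∈ P, p.1 ≠ ⊥ ∧ p.2 ≠ ⊥ ∧ p.1 * p.2 ≠ ⊥ ∧ (absNorm (p.1 * p.2) : ℝ) ≤ N ^ 2 ∧ IsCoprime (p.1 * p.2) F := by
    intro p hp
    rw [hP, mem_filter, mem_product] at hp
    obtain ⟨⟨ha, hb⟩, -⟩ := hp
    have ha' := mem_idl.1 (hJ _ ha).1
    have hb' := mem_idl.1 (hJ _ hb).1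
    refine ⟨ha'.1, hb'.1, mul_ne_zero ha'.1 hb'.1, ?_, (hJ _ ha).2.mul_left (hJ _ hb).2⟩
    rw [map_mul, cast_mul, pow_two]
    exact mul_le_mul ha'.2 hb'.2 (by positivity) hN0.le
  set f : IK × IK → ℕ := fun p => absNorm (p.1 * p.2) with hf
  have hcard : P.card = ∑ m ∈ P.image f, (P.filter fun p => f p = m).card :=
    Finset.card_eq_sum_card_image f P
  have him : ((P.image f).card : ℝ) ≤ C3 * N := by
    have := h3 (N ^ 2) (P.image f) (one_le_pow₀ hN) ?_
    · rwa [← rpow_natCast, ← rpow_mul hN0.le, show ((2 : ℕ) : ℝ) * (1 / 2) = 1 by norm_num, rpow_one] at this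
    intro m hm
    obtain ⟨p, hp, rfl⟩ := mem_image.1 hm
    obtain ⟨-, -, h0, hle, hc⟩ := hmem p hp
    refine ⟨by have := absNorm_pos h0; simp only [hf]; omega, hle, exists_cube_mul_sq fun q hq hd => ?_⟩
    obtain ⟨s, hs⟩ := (mem_filter.1 hp).2
    exact sq_dvd_absNorm_of_twist_eq_sq hF h0 hc hs hq hd
  have hfib : ∀ m ∈ P.image f, ((P.filter fun p => f p = m).card : ℝ) ≤ C1 * C2 * N ^ ε := by
    intro m hm
    obtain ⟨p0, hp0, hm0⟩ := mem_image.1 hm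
    have hm1 : (1 : ℝ) ≤ m := by
      rw [← hm0]
      exact one_le_absNorm (hmem p0 hp0).2.2.1
    have hmN : (m : ℝ) ≤ N ^ 2 := by
      rw [← hm0]
      exact (hmem p0 hp0).2.2.2.1
    set A := (idl K (N ^ 2)).filter fun 𝔞 => absNorm 𝔞 = m with hA
    have hA1 : (A.card : ℝ) ≤ C1 * (m : ℝ) ^ (ε / 4) :=
      h1 m A (by rintro rfl; norm_num at hm1) fun 𝔞 h => (mem_filter.1 h).2
    have hle : (P.filter fun p => f p = m).card ≤ (A.sigma fun 𝔞 => divs 𝔞).card := by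
      refine card_le_card_of_injOn (fun p => (⟨p.1 * p.2, p.1⟩ : (_ : IK) × IK)) ?_ ?_
      · intro p hp
        obtain ⟨hp1, hp2⟩ := mem_filter.1 hp
        obtain ⟨-, -, h0, hle, -⟩ := hmem p hp1
        exact Finset.mem_sigma.2 ⟨mem_filter.2 ⟨mem_idl.2 ⟨h0, hle⟩, hp2⟩, (mem_divs h0).2 (Dvd.intro _ rfl)⟩
      · intro p hp p' hp' he
        obtain ⟨h1, -, -⟩ := hmem p (mem_filter.1 hp).1
        have e1 : p.1 * p.2 = p'.1 * p'.2 := congrArg (fun z => z.1) he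
        have e2 : p.1 = p'.1 := congrArg (fun z => z.2) he
        rw [← e2] at e1
        exact Prod.ext e2 (mul_left_cancel₀ h1 e1)
    have hmε : (m : ℝ) ^ (ε / 4) * (m : ℝ) ^ (ε / 4) ≤ N ^ ε := by
      rw [← rpow_add (by linarith)]
      calc (m : ℝ) ^ (ε / 4 + ε / 4) ≤ (N ^ 2) ^ (ε / 4 + ε / 4) := by gcongr
        _ = N ^ ε := by
          rw [← rpow_natCast, ← rpow_mul hN0.le]
          congr 1
          push_cast; ring
    calc ((P.filter fun p => f p = m).card : ℝ) ≤ ((A.sigma fun 𝔞 => divs 𝔞).card : ℝ) := by exact_mod_cast hle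
      _ = ∑ 𝔞 ∈ A, ((divs 𝔞).card : ℝ) := by rw [Finset.card_sigma]; push_cast; rfl
      _ ≤ ∑ 𝔞 ∈ A, C2 * (m : ℝ) ^ (ε / 4) := by
          refine sum_le_sum fun 𝔞 h => ?_
          obtain ⟨h, h'⟩ := mem_filter.1 h
          rw [← h']
          exact h2 𝔞 (mem_idl.1 h).1
      _ = A.card * (C2 * (m : ℝ) ^ (ε / 4)) := by rw [sum_const, nsmul_eq_mul]
      _ ≤ C1 * (m : ℝ) ^ (ε / 4) * (C2 * (m : ℝ) ^ (ε / 4)) := by gcongr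
      _ = C1 * C2 * ((m : ℝ) ^ (ε / 4) * (m : ℝ) ^ (ε / 4)) := by ring
      _ ≤ _ := by gcongr
  calc (P.card : ℝ) = ∑ m ∈ P.image f, ((P.filter fun p => f p = m).card : ℝ) := by rw [hcard]; push_cast; rfl
    _ ≤ ∑ m ∈ P.image f, C1 * C2 * N ^ ε := sum_le_sum hfib
    _ = (P.image f).card * (C1 * C2 * N ^ ε) := by rw [sum_const, nsmul_eq_mul]
    _ ≤ C3 * N * (C1 * C2 * N ^ ε) := by gcongr
    _ = _ := by rw [rpow_add hN0, rpow_one]; ring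

/-- Products of `k` elements from a family with distinct principal ideals take each value rarely. -/
theorem card_prod_fiber_le {ε : ℝ} (hε : 0 < ε) (k : ℕ) : ∃ C : ℝ, 1 ≤ C ∧ ∀ (I : Finset IK) (m : IK → OK) (𝔟 : IK),
    𝔟 ≠ ⊥ → (∀ 𝔪 ∈ I, 𝔪 ≠ ⊥ ∧ span {m 𝔪} = 𝔪 * 𝔟) → ∀ w : OK, w ≠ 0 →
    (((piFinset fun _ : Fin k => I).filter fun c => ∏ i, m (c i) = w).card : ℝ) ≤ C * (absNorm (span {w}) : ℝ) ^ ε := by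
  have hk : (0 : ℝ) < (k : ℝ) + 1 := by positivity
  obtain ⟨C2, hC2, h2⟩ := card_divs_le (K := K) (ε := ε / (k + 1)) (by positivity)
  refine ⟨C2 ^ k, one_le_pow₀ hC2, fun I m 𝔟 hb hI w hw => ?_⟩
  have hw0 : span {w} ≠ ⊥ := by rwa [Ne, span_singleton_eq_bot]
  have hle : ((piFinset fun _ : Fin k => I).filter fun c => ∏ i, m (c i) = w).card ≤
      (piFinset fun _ : Fin k => divs (span {w})).card := by
    refine card_le_card_of_injOn (fun c i => span {m (c i)}) ?_ ?_
    · intro c hc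
      obtain ⟨hc1, hc2⟩ := mem_filter.1 hc
      refine mem_piFinset.2 fun i => (mem_divs hw0).2 ?_
      rw [← hc2, ← Ideal.prod_span_singleton]
      exact dvd_prod_of_mem _ (mem_univ i)
    · intro c hc c' hc' he
      have h1 := mem_piFinset.1 (mem_filter.1 hc).1
      have h1' := mem_piFinset.1 (mem_filter.1 hc').1
      funext i
      have := congrFun he i
      simp only [(hI _ (h1 i)).2, (hI _ (h1' i)).2] at this
      exact mul_right_cancel₀ hb this
  have hN := one_le_absNorm hw0
  calc _ ≤ ((piFinset fun _ : Fin k => divs (span {w})).card : ℝ) := by exact_mod_cast hle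
    _ = ((divs (span {w})).card : ℝ) ^ k := by rw [card_piFinset]; simp
    _ ≤ (C2 * (absNorm (span {w}) : ℝ) ^ (ε / (k + 1))) ^ k := by gcongr; exact h2 _ hw0
    _ = C2 ^ k * ((absNorm (span {w}) : ℝ) ^ (ε / (k + 1) * k)) := by
        rw [mul_pow, ← rpow_natCast, ← rpow_natCast, ← rpow_mul (by linarith)]
    _ ≤ _ := by
        gcongr
        rw [div_mul_eq_mul_div, div_le_iff₀ hk]; nlinarith

theorem abs_quadSym_real_le (𝔟 : IK) (a : OK) : |(quadSym 𝔟 a : ℝ)| ≤ 1 := by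
  exact_mod_cast abs_quadSym_le 𝔟 a

theorem natCast_mem_galMap {τ : Gal(K/ℚ)} {𝔞 : IK} {p : ℕ} (h : (p : OK) ∈ 𝔞) : (p : OK) ∈ galMap τ 𝔞 := by
  have := gal_mem_galMap (τ := τ).2 h
  rwa [map_natCast] at this

theorem isCoprime_galMap_two {τ : Gal(K/ℚ)} {𝔞 : IK} (h : IsCoprime 𝔞 (span {(2 : OK)})) :
    IsCoprime (galMap τ 𝔞) (span {(2 : OK)}) := by
  have h1 : IsCoprime (galMap τ 𝔞) (galMap τ (span {(2 : OK)})) := h.map (mapHom (gal τ : OK →+* OK))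
  rwa [galMap_span, map_ofNat] at h1

/-- Cancellation in a box for symbols whose modulus is not a square. -/
theorem abs_sum_twist_cbox_le (σ : Gal(K/ℚ)) {𝔞 : IK} (h0 : 𝔞 ≠ ⊥)
    (h2 : IsCoprime 𝔞 (span {(2 : OK)})) (hs : ¬ ∃ s, twist σ 𝔞 = s * s) (s0 : OK) (L : ℕ) :
    |∑ c ∈ cbox K L, (quadSym (twist σ 𝔞) (latPt s0 c) : ℝ)| ≤
      finrank ℚ K * absNorm 𝔞 * (L : ℝ) ^ (finrank ℚ K - 1) := by
  push Not at hs
  obtain ⟨t, ht⟩ := exists_quadSym_eq_neg_one (twist_ne_bot h0)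
    ((isCoprime_galMap_two h2).mul_left (isCoprime_galMap_two h2)) hs
  have hc : IsCoprime (span {t}) (twist σ 𝔞) := (quadSym_ne_zero_iff (twist_ne_bot h0)).1 (by rw [ht]; norm_num)
  have hle : twist σ 𝔞 ≤ galMap σ 𝔞 ⊓ galMap σ⁻¹ 𝔞 := Ideal.mul_le_inf
  have := abs_sum_cbox_le (p := absNorm 𝔞) (by have := absNorm_pos h0; omega) (𝔟 := galMap σ 𝔞 ⊓ galMap σ⁻¹ 𝔞)
    ⟨natCast_mem_galMap (absNorm_mem 𝔞), natCast_mem_galMap (absNorm_mem 𝔞)⟩ (g := quadSym (twist σ 𝔞)) ?_ (t := t) ?_ ?_ (abs_quadSym_le _) s0 L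
  · push_cast at this
    exact this
  · intro a a' h
    unfold twist
    rw [quadSym_mul_left (galMap_ne_bot h0) (galMap_ne_bot h0), quadSym_mul_left (galMap_ne_bot h0) (galMap_ne_bot h0),
      quadSym_congr h.1, quadSym_congr h.2]
  · rw [isCoprime_iff_sup_eq] at hc ⊢
    exact top_le_iff.1 (hc ▸ sup_le_sup_left hle _)
  · intro a
    rw [quadSym_mul_right, ht, neg_one_mul]

/-- Second moment over a box of sums of symbols. -/
theorem box_moment {ε : ℝ} (hε : 0 < ε) : ∃ C : ℝ, 1 ≤ C ∧ ∀ (σ : Gal(K/ℚ)) (F : IK) (x0 : OK),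
    span {gal (σ * σ) x0 - x0} ∣ F → span {(2 : OK)} ∣ F → ∀ (N : ℝ) (J : Finset IK), 1 ≤ N →
    (∀ 𝔫 ∈ J, 𝔫 ∈ idl K N ∧ IsCoprime 𝔫 F) → ∀ s : IK → ℝ, (∀ 𝔫, |s 𝔫| ≤ 1) → ∀ (s0 : OK) (L : ℕ), N ^ 3 ≤ L →
    ∑ c ∈ cbox K L, (∑ 𝔫 ∈ J, s 𝔫 * quadSym (twist σ 𝔫) (latPt s0 c)) ^ 2 ≤ C * N ^ (1 + ε) * (L : ℝ) ^ finrank ℚ K := by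
  obtain ⟨C1, hC1, h1⟩ := card_square_pairs_le (K := K) hε
  obtain ⟨C2, hC2, h2⟩ := card_idl_le (K := K) (ε := ε / 2) (by positivity)
  set r := finrank ℚ K with hr
  have hr0 : 0 < r := finrank_pos
  refine ⟨C1 + C2 ^ 2 * r, le_add_of_le_of_nonneg hC1 (by positivity), ?_⟩
  intro σ F x0 hF hF2 N J hN hJ s hs s0 L hL
  have hN0 : 0 < N := by linarith
  have hJ' : ∀ p ∈ J ×ˢ J, p.1 ≠ ⊥ ∧ p.2 ≠ ⊥ ∧ p.1 * p.2 ≠ ⊥ ∧ (absNorm (p.1 * p.2) : ℝ) ≤ N ^ 2 ∧ IsCoprime (p.1 * p.2) (span {(2 : OK)}) := by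
    intro p hp
    rw [mem_product] at hp
    have ha' := mem_idl.1 (hJ _ hp.1).1
    have hb' := mem_idl.1 (hJ _ hp.2).1
    refine ⟨ha'.1, hb'.1, mul_ne_zero ha'.1 hb'.1, ?_, ((hJ _ hp.1).2.mul_left (hJ _ hp.2).2).of_isCoprime_of_dvd_right hF2⟩
    rw [map_mul, cast_mul, pow_two]
    exact mul_le_mul ha'.2 hb'.2 (by positivity) hN0.le
  have hexp : ∑ c ∈ cbox K L, (∑ 𝔫 ∈ J, s 𝔫 * quadSym (twist σ 𝔫) (latPt s0 c)) ^ 2 =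
      ∑ p ∈ J ×ˢ J, s p.1 * s p.2 * ∑ c ∈ cbox K L, (quadSym (twist σ (p.1 * p.2)) (latPt s0 c) : ℝ) := by
    simp_rw [mul_sum]
    rw [sum_comm]
    refine sum_congr rfl fun c _ => ?_
    rw [pow_two, sum_mul_sum, ← Finset.sum_product']
    refine sum_congr rfl fun p hp => ?_
    obtain ⟨ha, hb, -⟩ := hJ' p hp
    rw [twist_mul, quadSym_mul_left (twist_ne_bot ha) (twist_ne_bot hb)]
    push_cast; ring
  have hterm : ∀ p ∈ J ×ˢ J, s p.1 * s p.2 * ∑ c ∈ cbox K L, (quadSym (twist σ (p.1 * p.2)) (latPt s0 c) : ℝ) ≤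
      (if ∃ s, twist σ (p.1 * p.2) = s * s then (L : ℝ) ^ r else 0) + r * N ^ 2 * (L : ℝ) ^ (r - 1) := by
    intro p hp
    obtain ⟨ha, hb, h0, hle, hc⟩ := hJ' p hp
    refine (le_abs_self _).trans ?_
    rw [abs_mul, abs_mul]
    refine (mul_le_of_le_one_left (abs_nonneg _) (mul_le_one₀ (hs _) (abs_nonneg _) (hs _))).trans ?_
    split_ifs with hsq
    · refine le_add_of_le_of_nonneg ((abs_sum_le_sum_abs _ _).trans ?_) (by positivity)
      refine (sum_le_sum fun c _ => abs_quadSym_real_le _ _).trans ?_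
      rw [sum_const, card_cbox]; simp [hr]
    · rw [zero_add]
      refine (abs_sum_twist_cbox_le σ h0 hc hsq s0 L).trans ?_
      gcongr
  rw [hexp]
  refine (sum_le_sum hterm).trans ?_
  rw [sum_add_distrib, ← sum_filter, sum_const, sum_const, nsmul_eq_mul, nsmul_eq_mul, card_product]
  have hP := h1 σ F x0 hF N J hN hJ
  have hJc : (J.card : ℝ) ≤ C2 * N ^ (1 + ε / 2) :=
    (cast_le.2 (card_le_card fun 𝔫 h => (hJ 𝔫 h).1)).trans (h2 N hN)
  have hL1 : (L : ℝ) ^ r = (L : ℝ) ^ (r - 1) * L := by rw [← pow_succ, Nat.sub_add_cancel hr0]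
  have e1 : (N ^ (1 + ε / 2)) ^ 2 = N ^ (1 + ε) * N := by
    rw [← rpow_natCast, ← rpow_mul hN0.le]
    nth_rewrite 3 [← rpow_one N]
    rw [← rpow_add hN0]
    congr 1; push_cast; ring
  push_cast
  calc _ ≤ C1 * N ^ (1 + ε) * (L : ℝ) ^ r + (C2 * N ^ (1 + ε / 2)) * (C2 * N ^ (1 + ε / 2)) * (r * N ^ 2 * (L : ℝ) ^ (r - 1)) := by gcongr
    _ = C1 * N ^ (1 + ε) * (L : ℝ) ^ r + C2 ^ 2 * r * ((N ^ (1 + ε / 2)) ^ 2) * (N ^ 2 * (L : ℝ) ^ (r - 1)) := by ring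
    _ = C1 * N ^ (1 + ε) * (L : ℝ) ^ r + C2 ^ 2 * r * N ^ (1 + ε) * ((L : ℝ) ^ (r - 1) * N ^ 3) := by rw [e1]; ring
    _ ≤ C1 * N ^ (1 + ε) * (L : ℝ) ^ r + C2 ^ 2 * r * N ^ (1 + ε) * ((L : ℝ) ^ (r - 1) * L) := by gcongr
    _ = _ := by rw [hL1]; ring

/-- Integers with small conjugates lie in a coordinate box. -/
theorem exists_latPt_eq {A : ℕ} {w : OK} (h : ∀ j, |((basis K).repr w j : ℝ)| ≤ A) :
    ∃ c ∈ cbox K (2 * A + 1), latPt (-∑ j, (A : OK) * basis K j) c = w := by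
  have h1 : ∀ j, |(basis K).repr w j| ≤ (A : ℤ) := fun j => by exact_mod_cast h j
  refine ⟨fun j => ((basis K).repr w j + A).toNat, mem_piFinset.2 fun j => ?_, ?_⟩
  · have := abs_le.1 (h1 j)
    rw [mem_range]
    omega
  · unfold latPt
    rw [neg_add_eq_sub, ← sum_sub_distrib]
    conv_rhs => rw [← (basis K).sum_repr w]
    refine sum_congr rfl fun j _ => ?_
    have h2 := abs_le.1 (h1 j)
    have h3 : ((((basis K).repr w j + A).toNat : ℕ) : OK) = (((basis K).repr w j : ℤ) : OK) + A := by
      rw [← Int.cast_natCast, Int.toNat_of_nonneg (by omega)]; push_cast; rfl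
    rw [h3, zsmul_eq_mul]
    ring

/-- Hölder's inequality and expansion of the power of a bilinear form. -/
theorem bilinear_pow_le {α : Type*} [DecidableEq α] (I J : Finset IK) (m : IK → α) [CommMonoid α] (f : IK → α → ℝ)
    (hf : ∀ 𝔫 {k : ℕ} (a : Fin k → α), f 𝔫 (∏ i, a i) = ∏ i, f 𝔫 (a i)) (v w : IK → ℝ) (hv : ∀ 𝔪, |v 𝔪| ≤ 1) (hw : ∀ 𝔫, |w 𝔫| ≤ 1) (k : ℕ) :
    ∃ s : IK → ℝ, (∀ 𝔫, |s 𝔫| ≤ 1) ∧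
      |∑ 𝔪 ∈ I, ∑ 𝔫 ∈ J, v 𝔪 * w 𝔫 * f 𝔫 (m 𝔪)| ^ (k + 1) ≤
        (J.card : ℝ) ^ k * ∑ c ∈ piFinset fun _ : Fin (k + 1) => I, |∑ 𝔫 ∈ J, s 𝔫 * f 𝔫 (∏ i, m (c i))| := by
  set T : IK → ℝ := fun 𝔫 => ∑ 𝔪 ∈ I, v 𝔪 * f 𝔫 (m 𝔪) with hT
  refine ⟨fun 𝔫 => if 0 ≤ T 𝔫 ^ (k + 1) then 1 else -1, fun 𝔫 => by dsimp only; split_ifs <;> simp, ?_⟩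
  have h1 : |∑ 𝔪 ∈ I, ∑ 𝔫 ∈ J, v 𝔪 * w 𝔫 * f 𝔫 (m 𝔪)| ≤ ∑ 𝔫 ∈ J, |T 𝔫| := by
    rw [sum_comm]
    refine (abs_sum_le_sum_abs _ _).trans (sum_le_sum fun 𝔫 _ => ?_)
    rw [show ∑ 𝔪 ∈ I, v 𝔪 * w 𝔫 * f 𝔫 (m 𝔪) = w 𝔫 * T 𝔫 by
      rw [hT, mul_sum]; exact sum_congr rfl fun _ _ => by ring, abs_mul]
    exact mul_le_of_le_one_left (abs_nonneg _) (hw _)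
  have h2 : (∑ 𝔫 ∈ J, |T 𝔫|) ^ (k + 1) ≤ (J.card : ℝ) ^ k * ∑ 𝔫 ∈ J, |T 𝔫| ^ (k + 1) := by
    rcases J.eq_empty_or_nonempty with rfl | hJ
    · simp
    · have := pow_sum_div_card_le_sum_pow (s := J) (f := fun 𝔫 => |T 𝔫|) (fun _ _ => abs_nonneg _) k
      rwa [div_le_iff₀' (by have := hJ.card_pos; positivity)] at this
  have h3 : ∑ 𝔫 ∈ J, |T 𝔫| ^ (k + 1) = ∑ c ∈ piFinset fun _ : Fin (k + 1) => I,
      (∏ i, v (c i)) * ∑ 𝔫 ∈ J, (if 0 ≤ T 𝔫 ^ (k + 1) then 1 else -1) * f 𝔫 (∏ i, m (c i)) := by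
    simp_rw [mul_sum]
    rw [sum_comm]
    refine sum_congr rfl fun 𝔫 _ => ?_
    have : |T 𝔫| ^ (k + 1) = (if 0 ≤ T 𝔫 ^ (k + 1) then 1 else -1) * T 𝔫 ^ (k + 1) := by
      rw [← abs_pow]
      split_ifs with h
      · rw [abs_of_nonneg h, one_mul]
      · rw [abs_of_neg (not_le.1 h), neg_one_mul]
    have h4 : T 𝔫 ^ (k + 1) = ∑ c ∈ piFinset fun _ : Fin (k + 1) => I, ∏ i, v (c i) * f 𝔫 (m (c i)) := Finset.sum_pow' ..
    rw [this]
    generalize (if 0 ≤ T 𝔫 ^ (k + 1) then (1 : ℝ) else -1) = sg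
    rw [h4, mul_sum]
    refine sum_congr rfl fun c _ => ?_
    rw [hf, prod_mul_distrib]
    ring
  refine (pow_le_pow_left₀ (abs_nonneg _) h1 _).trans (h2.trans (mul_le_mul_of_nonneg_left ?_ (by positivity)))
  rw [h3]
  refine sum_le_sum fun c _ => (le_abs_self _).trans ?_
  rw [abs_mul]
  refine mul_le_of_le_one_left (abs_nonneg _) ?_
  rw [abs_prod]
  exact Finset.prod_le_one (fun _ _ => abs_nonneg _) fun _ _ => hv _

theorem quadSym_one (𝔟 : IK) : quadSym 𝔟 1 = 1 := by
  by_cases hb : 𝔟 = ⊥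
  · rw [hb, quadSym, ← zero_eq_bot, UniqueFactorizationMonoid.normalizedFactors_zero, Multiset.map_zero, Multiset.prod_zero]
  · have h0 : quadSym 𝔟 1 ≠ 0 := (quadSym_ne_zero_iff hb).2 (by simp [span_singleton_one, ← one_eq_top, isCoprime_one_left])
    have h1 := quadSym_mul_right 𝔟 1 1
    rw [mul_one] at h1
    exact mul_right_cancel₀ h0 (by rw [← h1, one_mul])

/-- The bilinear estimate: cancellation in sums of the symbol `(m_𝔪 / σ𝔫 σ⁻¹𝔫)`. -/
theorem bilinear_core [IsGalois ℚ K] (ι : K →+* ℝ) {ε : ℝ} (hε : 0 < ε) (k : ℕ) (hk : 1 ≤ k) {C0 : ℝ} (hC0 : 1 ≤ C0)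
    {𝔟 : IK} (hb : 𝔟 ≠ ⊥) :
    ∃ C : ℝ, 1 ≤ C ∧ ∀ (σ : Gal(K/ℚ)) (F : IK) (x0 : OK),
    span {gal (σ * σ) x0 - x0} ∣ F → span {(2 : OK)} ∣ F → ∀ (M N : ℝ) (I J : Finset IK) (m : IK → OK),
    1 ≤ M → 1 ≤ N → N ^ (3 * finrank ℚ K) ≤ M ^ k →
    (∀ 𝔪 ∈ I, 𝔪 ∈ idl K M ∧ span {m 𝔪} = 𝔪 * 𝔟 ∧ ∀ τ, |cj ι τ (m 𝔪)| ≤ C0 * M ^ (1 / (finrank ℚ K : ℝ))) →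
    (∀ 𝔫 ∈ J, 𝔫 ∈ idl K N ∧ IsCoprime 𝔫 F) → ∀ v w : IK → ℝ, (∀ 𝔪, |v 𝔪| ≤ 1) → (∀ 𝔫, |w 𝔫| ≤ 1) →
    |∑ 𝔪 ∈ I, ∑ 𝔫 ∈ J, v 𝔪 * w 𝔫 * quadSym (twist σ 𝔫) (m 𝔪)| ≤ C * (M * N ^ (1 - 1 / (2 * k : ℝ))) * (M * N) ^ ε := by
  obtain ⟨k, rfl⟩ : ∃ k', k = k' + 1 := ⟨k - 1, by omega⟩
  obtain ⟨C1, hC1, h1⟩ := box_moment (K := K) hε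
  obtain ⟨C2, hC2, h2⟩ := card_idl_le (K := K) hε
  obtain ⟨C3, hC3, h3⟩ := card_prod_fiber_le (K := K) hε (k + 1)
  obtain ⟨C4, hC4, h4⟩ := exists_repr_le ι
  set r := finrank ℚ K with hr
  have hr0 : 0 < r := finrank_pos
  have hrR : (0 : ℝ) < r := by exact_mod_cast hr0
  set B : ℝ := ((absNorm 𝔟 : ℕ) : ℝ) with hB
  have hB1 : 1 ≤ B := one_le_absNorm hb
  set C5 : ℝ := max C4 1 with hC5
  have hC51 : 1 ≤ C5 := le_max_right _ _
  set D : ℝ := (5 * (C5 * C0 ^ (k + 1))) ^ r with hD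
  have hD1 : 1 ≤ D := one_le_pow₀ (by
    have : 1 ≤ C5 * C0 ^ (k + 1) := one_le_mul_of_one_le_of_one_le hC51 (one_le_pow₀ hC0)
    linarith)
  set E : ℝ := C2 ^ (2 * k) * C2 ^ (k + 1) * (C3 * (B ^ (k + 1)) ^ ε) * C1 * D with hE
  have hE1 : 1 ≤ E := by
    rw [hE]
    have hB2 : 1 ≤ (B ^ (k + 1)) ^ ε := one_le_rpow (one_le_pow₀ hB1) hε.le
    refine one_le_mul_of_one_le_of_one_le (one_le_mul_of_one_le_of_one_le (one_le_mul_of_one_le_of_one_le (one_le_mul_of_one_le_of_one_le ?_ ?_) ?_) hC1) hD1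
    · exact one_le_pow₀ hC2
    · exact one_le_pow₀ hC2
    · exact one_le_mul_of_one_le_of_one_le hC3 hB2
  refine ⟨E, hE1, ?_⟩
  intro σ F x0 hF hF2 M N I J m hM hN hMN hI hJ v w hv hw
  have hM0 : 0 < M := by linarith
  have hN0 : 0 < N := by linarith
  have hJb : ∀ 𝔫 ∈ J, 𝔫 ≠ ⊥ := fun 𝔫 h => (mem_idl.1 (hJ 𝔫 h).1).1
  have hIb : ∀ 𝔪 ∈ I, 𝔪 ≠ ⊥ := fun 𝔪 h => (mem_idl.1 (hI 𝔪 h).1).1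
  obtain ⟨s, hs, hpow⟩ := bilinear_pow_le I J m (fun 𝔫 a => (quadSym (twist σ 𝔫) a : ℝ)) (by
    intro 𝔫 k a
    have h := map_prod (⟨⟨quadSym (twist σ 𝔫), ?_⟩, quadSym_mul_right (twist σ 𝔫)⟩ : OK →* ℤ) a univ
    · have h' : quadSym (twist σ 𝔫) (∏ i, a i) = ∏ i, quadSym (twist σ 𝔫) (a i) := h
      rw [h']; push_cast; rfl
    · exact quadSym_one _) v w hv hw k
  set U : OK → ℝ := fun a => ∑ 𝔫 ∈ J, s 𝔫 * quadSym (twist σ 𝔫) a with hU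
  set S := |∑ 𝔪 ∈ I, ∑ 𝔫 ∈ J, v 𝔪 * w 𝔫 * quadSym (twist σ 𝔫) (m 𝔪)| with hS
  set P := piFinset fun _ : Fin (k + 1) => I with hP
  have hPI : ∀ c ∈ P, ∀ i, c i ∈ I := fun c hc => mem_piFinset.1 hc
  -- the box
  set T : ℝ := C0 ^ (k + 1) * (M ^ (k + 1)) ^ (1 / (r : ℝ)) with hT
  have hMr : (M ^ (k + 1)) ^ (1 / (r : ℝ)) = (M ^ (1 / (r : ℝ))) ^ (k + 1) := by
    rw [← rpow_natCast, ← rpow_natCast, ← rpow_mul hM0.le, ← rpow_mul hM0.le, mul_comm]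
  have hMr1 : 1 ≤ (M ^ (k + 1)) ^ (1 / (r : ℝ)) := one_le_rpow (one_le_pow₀ hM) (by positivity)
  have hN3 : N ^ 3 ≤ (M ^ (k + 1)) ^ (1 / (r : ℝ)) := by
    have := rpow_le_rpow (by positivity) hMN (by positivity : 0 ≤ 1 / (r : ℝ))
    rwa [pow_mul, ← rpow_natCast (N ^ 3), ← rpow_mul (by positivity), mul_one_div_cancel hrR.ne', rpow_one] at this
  have hT1 : (M ^ (k + 1)) ^ (1 / (r : ℝ)) ≤ T := le_mul_of_one_le_left (by positivity) (one_le_pow₀ hC0)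
  set A : ℕ := ⌈C5 * T⌉₊ with hA
  have hT0 : 0 < T := by linarith
  have hAT : T ≤ A := (le_mul_of_one_le_left hT0.le hC51).trans (Nat.le_ceil _)
  have hL3 : N ^ 3 ≤ ((2 * A + 1 : ℕ) : ℝ) := by push_cast; linarith
  have hLD : ((2 * A + 1 : ℕ) : ℝ) ^ r ≤ D * M ^ (k + 1) := by
    have h5 : (A : ℝ) ≤ C5 * T + 1 := (Nat.ceil_lt_add_one (by positivity)).le
    have h6 : 1 ≤ C5 * T := one_le_mul_of_one_le_of_one_le hC51 (by linarith)
    have h7 : ((2 * A + 1 : ℕ) : ℝ) ≤ 5 * (C5 * C0 ^ (k + 1)) * (M ^ (k + 1)) ^ (1 / (r : ℝ)) := by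
      have : 5 * (C5 * C0 ^ (k + 1)) * (M ^ (k + 1)) ^ (1 / (r : ℝ)) = 5 * (C5 * T) := by rw [hT]; ring
      rw [this]; push_cast; linarith
    refine (pow_le_pow_left₀ (by positivity) h7 r).trans (le_of_eq ?_)
    rw [mul_pow, ← rpow_natCast ((M ^ (k + 1)) ^ (1 / (r : ℝ))), ← rpow_mul (by positivity), one_div_mul_cancel hrR.ne', rpow_one]
  set s0 : OK := -∑ j, (A : OK) * basis K j with hs0
  have hbox := h1 σ F x0 hF hF2 N J hN hJ s hs s0 (2 * A + 1) hL3
  -- the products lie in the box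
  have hprod : ∀ c ∈ P, ∏ i, m (c i) ≠ 0 ∧ (absNorm (span {∏ i, m (c i)}) : ℝ) ≤ (M * B) ^ (k + 1) ∧
      ∃ d ∈ cbox K (2 * A + 1), latPt s0 d = ∏ i, m (c i) := by
    intro c hc
    have hcI := hPI c hc
    refine ⟨Finset.prod_ne_zero_iff.2 fun i _ h0 => ?_, ?_, exists_latPt_eq fun j => ?_⟩
    · have := (hI _ (hcI i)).2.1
      rw [h0, span_singleton_eq_bot.2 rfl] at this
      exact mul_ne_zero (hIb _ (hcI i)) hb this.symm
    · rw [← Ideal.prod_span_singleton, map_prod, Nat.cast_prod]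
      calc _ ≤ ∏ i : Fin (k + 1), M * B := by
            refine Finset.prod_le_prod (fun _ _ => by positivity) fun i _ => ?_
            rw [(hI _ (hcI i)).2.1, map_mul, cast_mul]
            exact mul_le_mul_of_nonneg_right (mem_idl.1 (hI _ (hcI i)).1).2 (by positivity)
        _ = _ := by simp
    · refine (h4 _ T (fun τ => ?_) j).trans ((mul_le_mul_of_nonneg_right (le_max_left _ _) hT0.le).trans (Nat.le_ceil _))
      rw [map_prod, abs_prod]
      calc _ ≤ ∏ i : Fin (k + 1), C0 * M ^ (1 / (r : ℝ)) :=
            Finset.prod_le_prod (fun _ _ => abs_nonneg _) fun i _ => (hI _ (hcI i)).2.2 τ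
        _ = T := by rw [hT, hMr]; simp [mul_pow]
  have hfib : ∑ c ∈ P, U (∏ i, m (c i)) ^ 2 ≤ C3 * ((M * B) ^ (k + 1)) ^ ε * (C1 * N ^ (1 + ε) * (D * M ^ (k + 1))) := by
    rw [← sum_fiberwise_of_maps_to (g := fun c => ∏ i, m (c i)) (t := P.image fun c => ∏ i, m (c i)) fun c hc => mem_image_of_mem _ hc]
    have h5 : ∀ a ∈ P.image (fun c => ∏ i, m (c i)), ∑ c ∈ P with ∏ i, m (c i) = a, U (∏ i, m (c i)) ^ 2 ≤ C3 * ((M * B) ^ (k + 1)) ^ ε * U a ^ 2 := by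
      intro a ha
      obtain ⟨c, hc, rfl⟩ := mem_image.1 ha
      obtain ⟨hne, hle, -⟩ := hprod c hc
      rw [sum_congr rfl fun c' hc' => by rw [(mem_filter.1 hc').2], sum_const, nsmul_eq_mul]
      refine mul_le_mul_of_nonneg_right ((h3 I m 𝔟 hb (fun 𝔪 h => ⟨hIb 𝔪 h, (hI 𝔪 h).2.1⟩) _ hne).trans ?_) (sq_nonneg _)
      gcongr
    refine (sum_le_sum h5).trans ?_
    rw [← mul_sum]
    refine mul_le_mul_of_nonneg_left ?_ (by positivity)
    calc _ ≤ ∑ a ∈ (cbox K (2 * A + 1)).image (latPt s0), U a ^ 2 := by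
          refine Finset.sum_le_sum_of_subset_of_nonneg (fun a ha => ?_) fun _ _ _ => sq_nonneg _
          obtain ⟨c, hc, rfl⟩ := mem_image.1 ha
          obtain ⟨d, hd, hd'⟩ := (hprod c hc).2.2
          exact mem_image.2 ⟨d, hd, hd'⟩
      _ = ∑ c ∈ cbox K (2 * A + 1), U (latPt s0 c) ^ 2 := sum_image fun a _ b _ h => latPt_injective s0 h
      _ ≤ C1 * N ^ (1 + ε) * ((2 * A + 1 : ℕ) : ℝ) ^ r := hbox
      _ ≤ _ := by gcongr
  have hJc : (J.card : ℝ) ≤ C2 * N ^ (1 + ε) :=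
    (cast_le.2 (card_le_card fun 𝔫 h => (hJ 𝔫 h).1)).trans (h2 N hN)
  have hIc : (I.card : ℝ) ≤ C2 * M ^ (1 + ε) :=
    (cast_le.2 (card_le_card fun 𝔫 h => (hI 𝔫 h).1)).trans (h2 M hM)
  have hPc : (P.card : ℝ) = (I.card : ℝ) ^ (k + 1) := by rw [hP, card_piFinset]; simp
  have hmain : S ^ (2 * (k + 1)) ≤ (C2 * N ^ (1 + ε)) ^ (2 * k) * ((C2 * M ^ (1 + ε)) ^ (k + 1) *
      (C3 * ((M * B) ^ (k + 1)) ^ ε * (C1 * N ^ (1 + ε) * (D * M ^ (k + 1))))) := by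
    calc S ^ (2 * (k + 1)) = (S ^ (k + 1)) ^ 2 := by rw [mul_comm 2, pow_mul]
      _ ≤ ((J.card : ℝ) ^ k * ∑ c ∈ P, |U (∏ i, m (c i))|) ^ 2 := pow_le_pow_left₀ (pow_nonneg (abs_nonneg _) _) hpow 2
      _ = (J.card : ℝ) ^ (2 * k) * (∑ c ∈ P, |U (∏ i, m (c i))|) ^ 2 := by rw [mul_pow, ← pow_mul, mul_comm k 2]
      _ ≤ (J.card : ℝ) ^ (2 * k) * (P.card * ∑ c ∈ P, |U (∏ i, m (c i))| ^ 2) := by gcongr; exact sq_sum_le_card_mul_sum_sq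
      _ = (J.card : ℝ) ^ (2 * k) * ((I.card : ℝ) ^ (k + 1) * ∑ c ∈ P, U (∏ i, m (c i)) ^ 2) := by simp_rw [sq_abs, hPc]
      _ ≤ _ := by
        gcongr
  have hfinal : (C2 * N ^ (1 + ε)) ^ (2 * k) * ((C2 * M ^ (1 + ε)) ^ (k + 1) *
      (C3 * ((M * B) ^ (k + 1)) ^ ε * (C1 * N ^ (1 + ε) * (D * M ^ (k + 1))))) ≤
      (E * (M * N ^ (1 - 1 / (2 * ((k + 1 : ℕ) : ℝ)))) * (M * N) ^ ε) ^ (2 * (k + 1)) := by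
    have e1 : ((M * B) ^ (k + 1)) ^ ε = (M ^ ε) ^ (k + 1) * (B ^ (k + 1)) ^ ε := by
      rw [mul_pow, mul_rpow (by positivity) (by positivity), ← rpow_natCast M, ← rpow_mul hM0.le, mul_comm _ ε, rpow_mul hM0.le, rpow_natCast]
    have e2 : (N ^ (1 - 1 / (2 * ((k + 1 : ℕ) : ℝ)))) ^ (2 * (k + 1)) = N ^ (2 * k + 1) := by
      rw [← rpow_natCast, ← rpow_mul hN0.le, ← rpow_natCast]
      congr 1
      push_cast
      field_simp
      ring
    have e3 : (C2 * N ^ (1 + ε)) ^ (2 * k) * ((C2 * M ^ (1 + ε)) ^ (k + 1) *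
      (C3 * ((M * B) ^ (k + 1)) ^ ε * (C1 * N ^ (1 + ε) * (D * M ^ (k + 1))))) =
        E * (M ^ (2 * (k + 1)) * N ^ (2 * k + 1)) * ((M ^ ε) ^ (2 * (k + 1)) * (N ^ ε) ^ (2 * k + 1)) := by
      rw [e1, rpow_add hM0, rpow_add hN0, rpow_one, rpow_one, hE]
      ring
    rw [e3, mul_pow (E * _), mul_pow E, mul_pow M, e2, mul_rpow hM0.le hN0.le]
    have hNε : 1 ≤ N ^ ε := one_le_rpow hN hε.le
    have e4 : (M ^ ε) ^ (2 * (k + 1)) * (N ^ ε) ^ (2 * k + 1) ≤ (M ^ ε * N ^ ε) ^ (2 * (k + 1)) := by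
      rw [mul_pow]
      exact mul_le_mul_of_nonneg_left (pow_le_pow_right₀ hNε (by omega)) (by positivity)
    exact mul_le_mul (mul_le_mul_of_nonneg_right (le_self_pow₀ hE1 (by omega)) (by positivity)) e4 (by positivity) (by positivity)
  exact (pow_le_pow_iff_left₀ (abs_nonneg _) (by positivity) (by omega)).1 (hmain.trans hfinal)

/-- Two totally positive generators of an ideal differ by the square of a unit. -/
theorem exists_unit_sq_mul (ι : K →+* ℝ) (hunits : UnitsSq K) {a b : OK}
    (h : span {a} = span {b}) (ha : TotPos a) (hb : TotPos b) : ∃ w : OKˣ, b = w * w * a := by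
  obtain ⟨u, hu⟩ := Ideal.span_singleton_eq_span_singleton.1 h
  obtain ⟨w, rfl⟩ := hunits u fun v => by
    have h1 := hb v
    rw [← hu, show ((a * u : OK) : K) = a * (u : OK) from rfl, map_mul] at h1
    exact (pos_iff_pos_of_mul_pos h1).1 (ha v)
  exact ⟨w, by rw [← hu]; push_cast; ring⟩

theorem quadSym_unit_sq_mul {𝔟 : IK} (w : OKˣ) (a : OK) : quadSym 𝔟 (w * w * a) = quadSym 𝔟 a := by
  by_cases hb : 𝔟 = ⊥
  · subst hb
    simp only [quadSym, ← zero_eq_bot, UniqueFactorizationMonoid.normalizedFactors_zero, Multiset.map_zero]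
  · rw [quadSym_mul_right, quadSym_mul_right, quadSym_sq, one_mul]
    rw [quadSym_ne_zero_iff hb, Ideal.span_singleton_eq_top.2 w.isUnit, ← one_eq_top]
    exact isCoprime_one_left

theorem spin_eq_quadSym (ι : K →+* ℝ) (hunits : UnitsSq K) (σ : Gal(K/ℚ))
    {𝔞 : IK} {α : OK} (h : span {α} = 𝔞) (hα : TotPos α) : spin σ 𝔞 = quadSym (galMap σ 𝔞) α := by
  have hex : ∃ α : OK, span {α} = 𝔞 ∧ TotPos α := ⟨α, h, hα⟩
  rw [spin, dif_pos hex]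
  obtain ⟨w, hw⟩ := exists_unit_sq_mul ι hunits (hex.choose_spec.1.trans h.symm) hex.choose_spec.2 hα
  conv_rhs => rw [hw, quadSym_unit_sq_mul]

/-- The spin of an ideal, restricted to ideals with a totally positive generator congruent to `μ` modulo `𝔐`. -/
def spinTerm (σ : Gal(K/ℚ)) (𝔐 : IK) (μ : OK) (𝔞 : IK) : ℝ :=
  if ∃ α : OK, span {α} = 𝔞 ∧ TotPos α ∧ α - μ ∈ 𝔐 then (spin σ 𝔞 : ℝ) else 0

theorem exists_reciprocity_sign [IsGalois ℚ K] (ι : K →+* ℝ) {F : IK} (hF0 : F ≠ ⊥) (hF : recMod K ∣ F) (c c' : OK ⧸ (F * F)) :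
    ∃ e : ℤ, (e = 1 ∨ e = -1) ∧ ∀ m n : OK, TotPos m → TotPos n → IsCoprime (span {m}) F → IsCoprime (span {n}) F →
      IQ (F * F) m = c → IQ (F * F) n = c' →
      quadSym (span {m}) n = e * quadSym (span {n}) m := by
  have hz : ∀ m n : OK, m ≠ 0 → n ≠ 0 → ¬ IsCoprime (span {m}) (span {n}) →
      quadSym (span {m}) n = 0 ∧ quadSym (span {n}) m = 0 := fun m n hm hn h =>
    ⟨(quadSym_eq_zero_iff (by simpa using hm)).2 fun h1 => h h1.symm, (quadSym_eq_zero_iff (by simpa using hn)).2 fun h1 => h h1⟩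
  have hnz : ∀ m n : OK, m ≠ 0 → n ≠ 0 → IsCoprime (span {m}) (span {n}) →
      quadSym (span {m}) n ≠ 0 ∧ quadSym (span {n}) m ≠ 0 := fun m n hm hn h =>
    ⟨(quadSym_ne_zero_iff (by simpa using hm)).2 h.symm, (quadSym_ne_zero_iff (by simpa using hn)).2 h⟩
  by_cases hex : ∃ m n : OK, TotPos m ∧ TotPos n ∧ IsCoprime (span {m}) F ∧ IsCoprime (span {n}) F ∧
      IQ (F * F) m = c ∧ IQ (F * F) n = c' ∧ IsCoprime (span {m}) (span {n})
  · obtain ⟨m1, n1, hm1, hn1, cm1, cn1, em1, en1, h1⟩ := hex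
    have h2 := hnz m1 n1 (hm1.ne_zero ι) (hn1.ne_zero ι) h1
    refine ⟨quadSym (span {n1}) m1 * quadSym (span {m1}) n1, ?_, ?_⟩
    · rcases quadSym_trichotomy (span {n1}) m1 with h | h | h <;> rcases quadSym_trichotomy (span {m1}) n1 with h' | h' | h' <;>
        simp_all
    · intro m n hm hn cm cn em en
      by_cases h : IsCoprime (span {m}) (span {n})
      · rw [← quadSym_reciprocity_symm ι hF0 hF hm hn hm1 hn1 cm cn h h1 (Ideal.Quotient.eq.1 (em.trans em1.symm)) (Ideal.Quotient.eq.1 (en.trans en1.symm))]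
        have h3 := quadSym_sq (hnz m n (hm.ne_zero ι) (hn.ne_zero ι) h).2
        linear_combination (-quadSym (span {m}) n) * h3
      · rw [(hz m n (hm.ne_zero ι) (hn.ne_zero ι) h).1, (hz m n (hm.ne_zero ι) (hn.ne_zero ι) h).2, mul_zero]
  · refine ⟨1, Or.inl rfl, fun m n hm hn cm cn em en => ?_⟩
    by_cases h : IsCoprime (span {m}) (span {n})
    · exact absurd ⟨m, n, hm, hn, cm, cn, em, en, h⟩ hex
    · rw [(hz m n (hm.ne_zero ι) (hn.ne_zero ι) h).1, (hz m n (hm.ne_zero ι) (hn.ne_zero ι) h).2, mul_zero]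

theorem gal_mk_eq {σ : Gal(K/ℚ)} {I : IK} (hI : galMap σ I = I) {a b : OK}
    (h : IQ I a = IQ I b) : IQ I (gal σ a) = IQ I (gal σ b) := by
  rw [Ideal.Quotient.eq, ← map_sub]
  have := gal_mem_galMap (τ := σ).2 (Ideal.Quotient.eq.1 h)
  rwa [hI] at this

theorem isCoprime_galMap {τ : Gal(K/ℚ)} {𝔞 𝔟 : IK} (h : IsCoprime 𝔞 𝔟) : IsCoprime (galMap τ 𝔞) (galMap τ 𝔟) :=
  h.map (mapHom (gal τ : OK →+* OK))

/-- Separation of variables in the spin of a product of two ideals. -/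
theorem spinTerm_mul_eq [IsGalois ℚ K] (ι : K →+* ℝ) (hunits : UnitsSq K)
    (σ : Gal(K/ℚ)) (𝔐 : IK) (μ : OK) {F : IK} (hF0 : F ≠ ⊥) (hF : recMod K ∣ F) (hFM : 𝔐 ∣ F)
    (hFσ : galMap σ F = F) {𝔟 𝔟' : IK} (hb : 𝔟 ≠ ⊥) (hb' : 𝔟' ≠ ⊥) (cb : IsCoprime 𝔟 F) (cb' : IsCoprime 𝔟' F)
    (cbb : IsCoprime 𝔟' (galMap σ 𝔟)) (c c' : OK ⧸ (F * F)) (m n : IK → OK) :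
    ∃ A B : IK → ℝ, (∀ 𝔪, |A 𝔪| ≤ 1) ∧ (∀ 𝔫, |B 𝔫| ≤ 1) ∧ ∀ 𝔪 𝔫, 𝔪 ≠ ⊥ → 𝔫 ≠ ⊥ → IsCoprime 𝔪 F → IsCoprime 𝔫 F →
      IsCoprime (galMap σ 𝔪) (𝔟 * 𝔟') → IsCoprime (galMap σ 𝔫) (𝔟 * 𝔟') → IsCoprime 𝔫 (galMap σ 𝔟) →
      IsCoprime 𝔟' (galMap σ 𝔪) → TotPos (m 𝔪) → TotPos (n 𝔫) →
      span {m 𝔪} = 𝔪 * 𝔟 → span {n 𝔫} = 𝔫 * 𝔟' → IQ (F * F) (m 𝔪) = c → IQ (F * F) (n 𝔫) = c' →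
      spinTerm σ 𝔐 μ (𝔪 * 𝔫) = A 𝔪 * B 𝔫 * quadSym (twist σ 𝔫) (m 𝔪) := by
  by_cases hbb : ∃ b, span {b} = 𝔟 * 𝔟' ∧ TotPos b
  swap
  · refine ⟨0, 0, by simp, by simp, ?_⟩
    intro 𝔪 𝔫 h𝔪 h𝔫 _ _ _ _ _ _ hm hn sm sn _ _
    rw [spinTerm, if_neg]
    · simp
    · rintro ⟨α, hα, hα', -⟩
      apply hbb
      have h1 : span {m 𝔪 * n 𝔫} = span {α} * (𝔟 * 𝔟') := by
        rw [← span_singleton_mul_span_singleton, sm, sn, hα]; ring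
      obtain ⟨b, hb1⟩ : α ∣ m 𝔪 * n 𝔫 := by
        rw [← Ideal.span_singleton_le_span_singleton, h1]
        exact Ideal.le_of_dvd (dvd_mul_right _ _)
      refine ⟨b, ?_, fun v => ?_⟩
      · have : span {α} * span {b} = span {α} * (𝔟 * 𝔟') := by
          rw [span_singleton_mul_span_singleton, ← hb1, h1]
        exact mul_left_cancel₀ (by simpa using hα'.ne_zero ι) this
      · have h2 := (hm.mul hn) v
        rw [hb1, show ((α * b : OK) : K) = α * b from rfl, map_mul] at h2
        exact (pos_iff_pos_of_mul_pos h2).1 (hα' v)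
  obtain ⟨b, hbs, hbp⟩ := hbb
  obtain ⟨m0, hm0⟩ := mk_surjective c
  obtain ⟨n0, hn0⟩ := mk_surjective c'
  obtain ⟨e, he, hrec⟩ := exists_reciprocity_sign ι hF0 hF (IQ (F * F) (gal σ m0)) c'
  set κ : ℝ := if ∃ w : OKˣ, (w : OK) * w * (m0 * n0) - μ * b ∈ 𝔐 then e else 0 with hκ
  have hκ1 : |κ| ≤ 1 := by
    rw [hκ]; rcases he with rfl | rfl <;> split_ifs <;> simp
  have hq := fun (𝔞 : IK) x => abs_quadSym_real_le 𝔞 x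
  have hmul : ∀ {s t : ℝ}, |s| ≤ 1 → |t| ≤ 1 → |s * t| ≤ 1 := fun hs ht => by
    rw [abs_mul]; exact mul_le_one₀ hs (abs_nonneg _) ht
  refine ⟨fun 𝔪 => κ * quadSym (galMap σ 𝔪) b * quadSym (galMap σ 𝔪) (m 𝔪) * quadSym 𝔟' (gal σ (m 𝔪)),
    fun 𝔫 => quadSym (galMap σ 𝔫) b * quadSym (galMap σ 𝔫) (n 𝔫) * quadSym (galMap σ 𝔟) (n 𝔫),
    fun 𝔪 => hmul (hmul (hmul hκ1 (hq _ _)) (hq _ _)) (hq _ _), fun 𝔫 => hmul (hmul (hq _ _) (hq _ _)) (hq _ _), ?_⟩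
  intro 𝔪 𝔫 h𝔪 h𝔫 c𝔪 c𝔫 cσ𝔪 cσ𝔫 c𝔫𝔟 cb'𝔪 hm hn sm sn em en
  have hFF : galMap σ (F * F) = F * F := by rw [galMap_mul_ideal, hFσ]
  have hMF : F * F ≤ 𝔐 := Ideal.le_of_dvd (hFM.trans (dvd_mul_left F F))
  have hmn0 : m 𝔪 * n 𝔫 - m0 * n0 ∈ 𝔐 := hMF <| Ideal.Quotient.eq.1 <| by rw [map_mul, map_mul, em, en, hm0, hn0]
  have hcbM : IsCoprime (span {b}) 𝔐 := by
    rw [hbs]; exact (IsCoprime.mul_left cb cb').of_isCoprime_of_dvd_right hFM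
  have hsp : ∀ α w : OK, α * b = w * w * (m 𝔪 * n 𝔫) → (α - μ ∈ 𝔐 ↔ w * w * (m0 * n0) - μ * b ∈ 𝔐) := by
    intro α w hw
    have h1 : (α - μ) * b - (w * w * (m0 * n0) - μ * b) ∈ 𝔐 := by
      have : (α - μ) * b - (w * w * (m0 * n0) - μ * b) = w * w * (m 𝔪 * n 𝔫 - m0 * n0) := by linear_combination hw
      rw [this]; exact 𝔐.mul_mem_left _ hmn0
    have h2 : (α - μ) * b ∈ 𝔐 ↔ α - μ ∈ 𝔐 := by
      refine ⟨fun h => ?_, fun h => 𝔐.mul_mem_right _ h⟩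
      obtain ⟨x, hx, y, hy, hxy⟩ := isCoprime_iff_exists.1 hcbM
      obtain ⟨z, rfl⟩ := mem_span_singleton.1 hx
      have : α - μ = (α - μ) * b * z + (α - μ) * y := by linear_combination (-(α - μ)) * hxy
      rw [this]
      exact 𝔐.add_mem (𝔐.mul_mem_right _ h) (𝔐.mul_mem_left _ hy)
    rw [← h2]
    exact ⟨fun h => by simpa using 𝔐.sub_mem h h1, fun h => by simpa using 𝔐.add_mem h h1⟩
  have hgen : span {m 𝔪 * n 𝔫} = 𝔪 * 𝔫 * span {b} := by
    rw [← span_singleton_mul_span_singleton, sm, sn, hbs]; ring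
  by_cases hw : ∃ w : OKˣ, (w : OK) * w * (m0 * n0) - μ * b ∈ 𝔐
  · obtain ⟨w, hw⟩ := hw
    have hκe : κ = e := if_pos ⟨w, hw⟩
    have hbd : b ∣ w * w * (m 𝔪 * n 𝔫) := by
      refine dvd_mul_of_dvd_right ?_ _
      rw [← Ideal.span_singleton_le_span_singleton, hgen]
      exact Ideal.le_of_dvd (dvd_mul_left _ _)
    obtain ⟨α, hα⟩ := hbd
    have hαb : α * b = w * w * (m 𝔪 * n 𝔫) := by rw [hα, mul_comm]
    have hb0 : b ≠ 0 := hbp.ne_zero ι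
    have hαs : span {α} = 𝔪 * 𝔫 := by
      have h1 : span {α} * span {b} = 𝔪 * 𝔫 * span {b} := by
        rw [← hgen, span_singleton_mul_span_singleton, hαb, Ideal.span_singleton_eq_span_singleton]
        exact ⟨(w * w)⁻¹, by rw [mul_comm ((w : OK) * w), mul_assoc, ← Units.val_mul, ← Units.val_mul, mul_inv_cancel]; simp⟩
      exact mul_right_cancel₀ (by simpa using hb0) h1
    have hαp : TotPos α := fun v => by
      have h2 := ((totPos_sq ι w.ne_zero).mul (hm.mul hn)) v
      rw [← hαb, show ((α * b : OK) : K) = α * b from rfl, map_mul] at h2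
      exact (pos_iff_pos_of_mul_pos h2).2 (hbp v)
    rw [spinTerm, if_pos ⟨α, hαs, hαp, (hsp α w hαb).2 hw⟩, spin_eq_quadSym ι hunits σ hαs hαp, galMap_mul_ideal,
      quadSym_mul_left (galMap_ne_bot h𝔪) (galMap_ne_bot h𝔫)]
    have hexp : ∀ 𝔠 : IK, 𝔠 ≠ ⊥ → IsCoprime 𝔠 (𝔟 * 𝔟') → quadSym 𝔠 α = quadSym 𝔠 b * (quadSym 𝔠 (m 𝔪) * quadSym 𝔠 (n 𝔫)) := by
      intro 𝔠 h0 hc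
      have h1 := quadSym_sq ((quadSym_ne_zero_iff h0).2 (by rw [hbs]; exact hc.symm) : quadSym 𝔠 b ≠ 0)
      have h2 : quadSym 𝔠 α * quadSym 𝔠 b = quadSym 𝔠 (m 𝔪) * quadSym 𝔠 (n 𝔫) := by
        rw [← quadSym_mul_right, hαb, quadSym_unit_sq_mul, quadSym_mul_right]
      linear_combination (quadSym 𝔠 b) * h2 - quadSym 𝔠 α * h1
    have hr1 := hrec (gal σ (m 𝔪)) (n 𝔫) (hm.gal σ) hn ?_ ?_ (gal_mk_eq hFF (em.trans hm0.symm)) en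
    · have hσm : span {gal σ (m 𝔪)} = galMap σ 𝔪 * galMap σ 𝔟 := by rw [← galMap_span, sm, galMap_mul_ideal]
      have h𝔫 : quadSym 𝔫 (gal σ (m 𝔪)) = quadSym (galMap σ⁻¹ 𝔫) (m 𝔪) := by
        rw [← quadSym_galMap σ⁻¹ 𝔫, gal_inv_apply]
      have hsq : quadSym (galMap σ 𝔟) (n 𝔫) * quadSym (galMap σ 𝔟) (n 𝔫) = 1 :=
        quadSym_sq ((quadSym_ne_zero_iff (galMap_ne_bot hb)).2 (by rw [sn]; exact c𝔫𝔟.mul_left cbb))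
      rw [hσm, sn, quadSym_mul_left (galMap_ne_bot h𝔪) (galMap_ne_bot hb), quadSym_mul_left ‹𝔫 ≠ ⊥› hb', h𝔫] at hr1
      have hr2 : quadSym (galMap σ 𝔪) (n 𝔫) = e * quadSym (galMap σ⁻¹ 𝔫) (m 𝔪) * quadSym 𝔟' (gal σ (m 𝔪)) * quadSym (galMap σ 𝔟) (n 𝔫) := by
        linear_combination (quadSym (galMap σ 𝔟) (n 𝔫)) * hr1 - quadSym (galMap σ 𝔪) (n 𝔫) * hsq
      rw [hexp _ (galMap_ne_bot h𝔪) cσ𝔪, hexp _ (galMap_ne_bot ‹𝔫 ≠ ⊥›) cσ𝔫, hr2, hκe, twist, quadSym_mul_left (galMap_ne_bot ‹𝔫 ≠ ⊥›) (galMap_ne_bot ‹𝔫 ≠ ⊥›)]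
      push_cast
      ring
    · rw [← galMap_span, sm, ← hFσ]
      exact isCoprime_galMap (c𝔪.mul_left cb)
    · rw [sn]
      exact c𝔫.mul_left cb'
  · have hκe : κ = 0 := if_neg hw
    rw [spinTerm, if_neg]
    · simp [hκe]
    · rintro ⟨α, hαs, hαp, hαμ⟩
      obtain ⟨w, hw'⟩ := exists_unit_sq_mul ι hunits (a := m 𝔪 * n 𝔫) (b := α * b)
        (by rw [hgen, ← span_singleton_mul_span_singleton, hαs]) (hm.mul hn) (hαp.mul hbp)
      exact hw ⟨w, (hsp α w hw').1 hαμ⟩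

theorem galMap_span_natCast (σ : Gal(K/ℚ)) (f : ℕ) : galMap σ (span {(f : OK)}) = span {(f : OK)} := by
  rw [galMap_span, map_natCast]

theorem dvd_span_absNorm (𝔟 : IK) : 𝔟 ∣ span {((absNorm 𝔟 : ℕ) : OK)} :=
  dvd_span_singleton.2 (absNorm_mem 𝔟)

theorem span_natCast_dvd {a b : ℕ} (h : a ∣ b) : span {(a : OK)} ∣ span {(b : OK)} := by
  rw [dvd_span_singleton, mem_span_singleton]
  exact_mod_cast Nat.cast_dvd_cast (α := OK) h

theorem span_natCast_ne_bot {a : ℕ} (h : a ≠ 0) : span {(a : OK)} ≠ ⊥ := by simpa using h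

/-- The bilinear estimate for spins of products of two ideals. -/
theorem spinTerm_bilinear [IsGalois ℚ K] (ι : K →+* ℝ) (hunits : UnitsSq K)
    (σ : Gal(K/ℚ)) (𝔐 : IK) (μ : OK) {f0 : ℕ} (hf0 : f0 ≠ 0) (hF : recMod K ∣ span {(f0 : OK)})
    (hFM : 𝔐 ∣ span {(f0 : OK)}) (hF2 : span {(2 : OK)} ∣ span {(f0 : OK)}) {x0 : OK}
    (hx0 : span {gal (σ * σ) x0 - x0} ∣ span {(f0 : OK)}) :
    ∃ f : ℕ, f ≠ 0 ∧ f0 ∣ f ∧ ∀ ε : ℝ, 0 < ε → ∀ k : ℕ, 1 ≤ k → ∃ C : ℝ, 1 ≤ C ∧ ∀ (M N : ℝ) (I J : Finset IK),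
      1 ≤ M → 1 ≤ N → N ^ (3 * finrank ℚ K) ≤ M ^ k →
      (∀ 𝔪 ∈ I, 𝔪 ∈ idl K M ∧ IsCoprime 𝔪 (span {(f : OK)})) → (∀ 𝔫 ∈ J, 𝔫 ∈ idl K N ∧ IsCoprime 𝔫 (span {(f : OK)})) →
      ∀ v w : IK → ℝ, (∀ 𝔪, |v 𝔪| ≤ 1) → (∀ 𝔫, |w 𝔫| ≤ 1) →
      |∑ 𝔪 ∈ I, ∑ 𝔫 ∈ J, v 𝔪 * w 𝔫 * spinTerm σ 𝔐 μ (𝔪 * 𝔫)| ≤ C * (M * N ^ (1 - 1 / (2 * k : ℝ))) * (M * N) ^ ε := by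
  set F : IK := span {(f0 : OK)} with hFdef
  have hF0 : F ≠ ⊥ := span_natCast_ne_bot hf0
  set r := finrank ℚ K with hr
  have hr0 : (0 : ℝ) < r := by exact_mod_cast (finrank_pos : 0 < finrank ℚ K)
  obtain ⟨Cb, hCb, hbal⟩ := exists_balanced ι
  obtain ⟨B, hB, hBp⟩ := exists_partners ι F
  have hN0 : ∀ B : Finset IK, (∀ 𝔟 ∈ B, 𝔟 ≠ ⊥) → ∏ 𝔟 ∈ B, absNorm 𝔟 ≠ 0 := fun B h =>
    Finset.prod_ne_zero_iff.2 fun 𝔟 hb => one_le_iff_ne_zero.1 (absNorm_pos (h 𝔟 hb))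
  set P := ∏ 𝔟 ∈ B, absNorm 𝔟 with hP
  have hP0 : P ≠ 0 := hN0 B fun 𝔟 hb => (hB 𝔟 hb).1
  set f1 := f0 * P with hf1
  obtain ⟨B', hB', hBp'⟩ := exists_partners ι (span {(f1 : OK)})
  set P' := ∏ 𝔟 ∈ B', absNorm 𝔟 with hP'
  have hP0' : P' ≠ 0 := hN0 B' fun 𝔟 hb => (hB' 𝔟 hb).1
  have hff1 : f0 ∣ f1 := Dvd.intro _ rfl
  refine ⟨f1 * P', mul_ne_zero (mul_ne_zero hf0 hP0) hP0', hff1.mul_right _, ?_⟩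
  intro ε hε k hk
  set Ff : IK := span {((f1 * P' : ℕ) : OK)} with hFf
  have hf1F : span {(f1 : OK)} ∣ Ff := span_natCast_dvd (Dvd.intro _ rfl)
  have hFFf : F ∣ Ff := (span_natCast_dvd hff1).trans hf1F
  have hPF : ∀ 𝔟 ∈ B, span {((absNorm 𝔟 : ℕ) : OK)} ∣ span {(f1 : OK)} := fun 𝔟 hb =>
    span_natCast_dvd ((dvd_prod_of_mem _ hb).trans (Dvd.intro_left _ rfl))
  -- representatives
  set C0 : ℝ := max 1 (Cb * P) with hC0
  have hC01 : 1 ≤ C0 := le_max_left _ _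
  have hrep : ∀ 𝔪 : IK, ∃ (𝔟 : IK) (m : OK), 𝔪 ≠ ⊥ → IsCoprime 𝔪 Ff → 𝔟 ∈ B ∧ TotPos m ∧ span {m} = 𝔪 * 𝔟 ∧
      ∀ τ, |cj ι τ m| ≤ C0 * (absNorm 𝔪 : ℝ) ^ (1 / (r : ℝ)) := by
    intro 𝔪
    by_cases h : 𝔪 ≠ ⊥ ∧ IsCoprime 𝔪 Ff
    · obtain ⟨𝔟, hb, m, hm, hs⟩ := hBp 𝔪 h.1 (h.2.of_isCoprime_of_dvd_right hFFf)
      obtain ⟨u, hu⟩ := hbal m (hm.ne_zero ι)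
      refine ⟨𝔟, u * u * m, fun _ _ => ⟨hb, (totPos_sq ι u.ne_zero).mul hm, ?_, fun τ => (hu τ).trans ?_⟩⟩
      · rw [← hs, ← Units.val_mul, Ideal.span_singleton_mul_left_unit (u * u).isUnit]
      · rw [hs, map_mul, cast_mul, mul_rpow (by positivity) (by positivity), ← mul_assoc, mul_right_comm]
        refine mul_le_mul_of_nonneg_right ((mul_le_mul_of_nonneg_left ?_ hCb.le).trans (le_max_right _ _)) (by positivity)
        have h1 : 1 ≤ (absNorm 𝔟 : ℝ) := one_le_absNorm (hB 𝔟 hb).1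
        calc (absNorm 𝔟 : ℝ) ^ (1 / (r : ℝ)) ≤ (absNorm 𝔟 : ℝ) ^ (1 : ℝ) := by
              refine rpow_le_rpow_of_exponent_le h1 ?_
              rw [div_le_one hr0]
              exact_mod_cast (finrank_pos : 0 < finrank ℚ K)
          _ ≤ (P : ℝ) := by
              rw [rpow_one]
              exact_mod_cast Nat.le_of_dvd (Nat.pos_of_ne_zero hP0) (dvd_prod_of_mem _ hb)
    · exact ⟨⊥, 0, fun h1 h2 => absurd ⟨h1, h2⟩ h⟩
  choose bb m hm using hrep
  have hrep' : ∀ 𝔫 : IK, ∃ (𝔟 : IK) (n : OK), 𝔫 ≠ ⊥ → IsCoprime 𝔫 Ff → 𝔟 ∈ B' ∧ TotPos n ∧ span {n} = 𝔫 * 𝔟 := by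
    intro 𝔫
    by_cases h : 𝔫 ≠ ⊥ ∧ IsCoprime 𝔫 Ff
    · obtain ⟨𝔟, hb, n, hn, hs⟩ := hBp' 𝔫 h.1 (h.2.of_isCoprime_of_dvd_right hf1F)
      exact ⟨𝔟, n, fun _ _ => ⟨hb, hn, hs⟩⟩
    · exact ⟨⊥, 0, fun h1 h2 => absurd ⟨h1, h2⟩ h⟩
  choose bb' n hn using hrep'
  have : Finite (OK ⧸ (F * F)) := finiteQuotientOfFreeOfNeBot _ (mul_ne_zero hF0 hF0)
  let _ : Fintype (OK ⧸ (F * F)) := ofFinite _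
  set lam : IK → IK × (OK ⧸ (F * F)) := fun 𝔪 => (bb 𝔪, IQ (F * F) (m 𝔪)) with hlam
  set lam' : IK → IK × (OK ⧸ (F * F)) := fun 𝔫 => (bb' 𝔫, IQ (F * F) (n 𝔫)) with hlam'
  set L : Finset (IK × (OK ⧸ (F * F))) := B ×ˢ univ with hL
  set L' : Finset (IK × (OK ⧸ (F * F))) := B' ×ˢ univ with hL'
  have hcore : ∀ 𝔟 : IK, ∃ C : ℝ, 1 ≤ C ∧ (𝔟 ≠ ⊥ → _) := fun 𝔟 => by
    by_cases h : 𝔟 ≠ ⊥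
    · obtain ⟨C, hC, h1⟩ := bilinear_core ι hε k hk hC01 h
      exact ⟨C, hC, fun _ => h1⟩
    · exact ⟨1, le_rfl, fun h' => absurd h' h⟩
  choose Cc hCc1 hCc using hcore
  refine ⟨1 + ∑ l ∈ L, ∑ l' ∈ L', Cc l.1, le_add_of_nonneg_right (sum_nonneg fun l _ => sum_nonneg fun _ _ => by have := hCc1 l.1; linarith), ?_⟩
  intro M N I J hM hN hMN hI hJ v w hv hw
  have hM0 : 0 < M := by linarith
  have hN0 : 0 < N := by linarith
  have hI' : ∀ 𝔪 ∈ I, 𝔪 ≠ ⊥ := fun 𝔪 h => (mem_idl.1 (hI 𝔪 h).1).1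
  have hJ' : ∀ 𝔫 ∈ J, 𝔫 ≠ ⊥ := fun 𝔫 h => (mem_idl.1 (hJ 𝔫 h).1).1
  have hmapI : ∀ 𝔪 ∈ I, lam 𝔪 ∈ L := fun 𝔪 h => mem_product.2 ⟨(hm 𝔪 (hI' 𝔪 h) (hI 𝔪 h).2).1, mem_univ _⟩
  have hmapJ : ∀ 𝔫 ∈ J, lam' 𝔫 ∈ L' := fun 𝔫 h => mem_product.2 ⟨(hn 𝔫 (hJ' 𝔫 h) (hJ 𝔫 h).2).1, mem_univ _⟩
  have hsplit : ∑ 𝔪 ∈ I, ∑ 𝔫 ∈ J, v 𝔪 * w 𝔫 * spinTerm σ 𝔐 μ (𝔪 * 𝔫) =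
      ∑ l ∈ L, ∑ l' ∈ L', ∑ 𝔪 ∈ I with lam 𝔪 = l, ∑ 𝔫 ∈ J with lam' 𝔫 = l', v 𝔪 * w 𝔫 * spinTerm σ 𝔐 μ (𝔪 * 𝔫) := by
    rw [← sum_fiberwise_of_maps_to hmapI]
    refine sum_congr rfl fun l _ => ?_
    conv_rhs => rw [sum_comm]
    refine sum_congr rfl fun 𝔪 _ => ?_
    rw [sum_fiberwise_of_maps_to hmapJ]
  rw [hsplit]
  refine (abs_sum_le_sum_abs _ _).trans ?_
  have hX0 : 0 ≤ (M * N ^ (1 - 1 / (2 * k : ℝ))) * (M * N) ^ ε := by positivity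
  have hpair : ∀ l ∈ L, ∀ l' ∈ L', |∑ 𝔪 ∈ I with lam 𝔪 = l, ∑ 𝔫 ∈ J with lam' 𝔫 = l', v 𝔪 * w 𝔫 * spinTerm σ 𝔐 μ (𝔪 * 𝔫)| ≤
      Cc l.1 * ((M * N ^ (1 - 1 / (2 * k : ℝ))) * (M * N) ^ ε) := by
    intro l hl l' hl'
    obtain ⟨hlB, -⟩ := mem_product.1 hl
    obtain ⟨hlB', -⟩ := mem_product.1 hl'
    have hb := hB _ hlB
    have hb' := hB' _ hlB'
    have hd1 : l.1 ∣ span {(f1 : OK)} := (dvd_span_absNorm _).trans (hPF _ hlB)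
    have hd1σ : galMap σ l.1 ∣ span {(f1 : OK)} := by
      have := galMap_dvd (τ := σ) (𝔞 := l.1) (𝔟 := span {(f1 : OK)})
      rw [galMap_span_natCast] at this
      exact this.2 hd1
    have hd2 : l.1 * l'.1 ∣ Ff := by
      rw [hFf, cast_mul, ← span_singleton_mul_span_singleton]
      exact mul_dvd_mul hd1 ((dvd_span_absNorm _).trans (span_natCast_dvd (dvd_prod_of_mem _ hlB')))
    obtain ⟨A, B1, hA, hB1, hAB⟩ := spinTerm_mul_eq ι hunits σ 𝔐 μ hF0 hF hFM (galMap_span_natCast σ f0) hb.1 hb'.1 hb.2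
      (hb'.2.of_isCoprime_of_dvd_right (span_natCast_dvd hff1)) (hb'.2.of_isCoprime_of_dvd_right hd1σ) l.2 l'.2 m n
    have hσc : ∀ 𝔞 : IK, IsCoprime 𝔞 Ff → IsCoprime (galMap σ 𝔞) Ff := fun 𝔞 h => by
      have := isCoprime_galMap (τ := σ) h
      rwa [galMap_span_natCast] at this
    have heq : ∑ 𝔪 ∈ I with lam 𝔪 = l, ∑ 𝔫 ∈ J with lam' 𝔫 = l', v 𝔪 * w 𝔫 * spinTerm σ 𝔐 μ (𝔪 * 𝔫) =
        ∑ 𝔪 ∈ I with lam 𝔪 = l, ∑ 𝔫 ∈ J with lam' 𝔫 = l', (v 𝔪 * A 𝔪) * (w 𝔫 * B1 𝔫) * quadSym (twist σ 𝔫) (m 𝔪) := by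
      refine sum_congr rfl fun 𝔪 h => sum_congr rfl fun 𝔫 h' => ?_
      obtain ⟨hi, rfl⟩ := mem_filter.1 h
      obtain ⟨hj, rfl⟩ := mem_filter.1 h'
      have hm1 := hm 𝔪 (hI' 𝔪 hi) (hI 𝔪 hi).2
      have hn1 := hn 𝔫 (hJ' 𝔫 hj) (hJ 𝔫 hj).2
      have ci := (hI 𝔪 hi).2
      have cj' := (hJ 𝔫 hj).2
      rw [hAB 𝔪 𝔫 (hI' 𝔪 hi) (hJ' 𝔫 hj) (ci.of_isCoprime_of_dvd_right hFFf) (cj'.of_isCoprime_of_dvd_right hFFf)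
        ((hσc _ ci).of_isCoprime_of_dvd_right hd2) ((hσc _ cj').of_isCoprime_of_dvd_right hd2)
        (cj'.of_isCoprime_of_dvd_right (hd1σ.trans hf1F)) ((hσc _ ci).of_isCoprime_of_dvd_right ((dvd_mul_left _ _).trans hd2)).symm
        hm1.2.1 hn1.2.1 hm1.2.2.1 hn1.2.2 rfl rfl]
      ring
    rw [heq, ← mul_assoc]
    refine hCc l.1 hb.1 σ Ff x0 (hx0.trans hFFf) (hF2.trans hFFf) M N _ _ m hM hN hMN ?_ ?_ _ _ ?_ ?_
    · intro 𝔪 h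
      obtain ⟨hi, rfl⟩ := mem_filter.1 h
      have hm1 := hm 𝔪 (hI' 𝔪 hi) (hI 𝔪 hi).2
      refine ⟨(hI 𝔪 hi).1, hm1.2.2.1, fun τ => (hm1.2.2.2 τ).trans ?_⟩
      have := (mem_idl.1 (hI 𝔪 hi).1).2
      gcongr
    · exact fun 𝔫 h => hJ 𝔫 (mem_filter.1 h).1
    · intro 𝔪; rw [abs_mul]; exact mul_le_one₀ (hv _) (abs_nonneg _) (hA _)
    · intro 𝔫; rw [abs_mul]; exact mul_le_one₀ (hw _) (abs_nonneg _) (hB1 _)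
  calc ∑ l ∈ L, |∑ l' ∈ L', ∑ 𝔪 ∈ I with lam 𝔪 = l, ∑ 𝔫 ∈ J with lam' 𝔫 = l', v 𝔪 * w 𝔫 * spinTerm σ 𝔐 μ (𝔪 * 𝔫)| ≤
      ∑ l ∈ L, ∑ l' ∈ L', Cc l.1 * ((M * N ^ (1 - 1 / (2 * k : ℝ))) * (M * N) ^ ε) :=
        sum_le_sum fun l hl => (abs_sum_le_sum_abs _ _).trans (sum_le_sum fun l' hl' => hpair l hl l' hl')
    _ = (∑ l ∈ L, ∑ l' ∈ L', Cc l.1) * ((M * N ^ (1 - 1 / (2 * k : ℝ))) * (M * N) ^ ε) := by simp_rw [sum_mul]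
    _ ≤ _ := by
      rw [mul_assoc (1 + _)]
      exact mul_le_mul_of_nonneg_right (by linarith) hX0

/-- `T` satisfies the bilinear estimates for ideals coprime to `F`. -/
def BilinearBound (F : IK) (T : IK → ℝ) : Prop :=
  ∀ ε : ℝ, 0 < ε → ∀ k : ℕ, 1 ≤ k → ∃ C : ℝ, 1 ≤ C ∧ ∀ (M N : ℝ) (I J : Finset IK),
    1 ≤ M → 1 ≤ N → N ^ (3 * finrank ℚ K) ≤ M ^ k →
    (∀ 𝔪 ∈ I, 𝔪 ∈ idl K M ∧ IsCoprime 𝔪 F) → (∀ 𝔫 ∈ J, 𝔫 ∈ idl K N ∧ IsCoprime 𝔫 F) →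
    ∀ v w : IK → ℝ, (∀ 𝔪, |v 𝔪| ≤ 1) → (∀ 𝔫, |w 𝔫| ≤ 1) →
    |∑ 𝔪 ∈ I, ∑ 𝔫 ∈ J, v 𝔪 * w 𝔫 * T (𝔪 * 𝔫)| ≤ C * (M * N ^ (1 - 1 / (2 * k : ℝ))) * (M * N) ^ ε

theorem BilinearBound.symmetric {F : IK} {T : IK → ℝ} (h : BilinearBound F T) {ε : ℝ} (hε : 0 < ε) :
    ∃ C : ℝ, 1 ≤ C ∧ ∀ (M N y : ℝ) (I J : Finset IK), 1 ≤ y → y ≤ M → y ≤ N →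
    (∀ 𝔪 ∈ I, 𝔪 ∈ idl K M ∧ IsCoprime 𝔪 F) → (∀ 𝔫 ∈ J, 𝔫 ∈ idl K N ∧ IsCoprime 𝔫 F) →
    ∀ v w : IK → ℝ, (∀ 𝔪, |v 𝔪| ≤ 1) → (∀ 𝔫, |w 𝔫| ≤ 1) →
    |∑ 𝔪 ∈ I, ∑ 𝔫 ∈ J, v 𝔪 * w 𝔫 * T (𝔪 * 𝔫)| ≤
      C * (M * N) ^ (1 + ε) * (y ^ (-(1 / 2) : ℝ) + (M * N) ^ (-(1 / (36 * (finrank ℚ K : ℝ) ^ 2)))) := by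
  set r := finrank ℚ K with hr
  have hr0 : 0 < r := finrank_pos
  have hrR : (0 : ℝ) < r := by exact_mod_cast hr0
  obtain ⟨C1, hC1, h1⟩ := h ε hε 1 le_rfl
  obtain ⟨C2, hC2, h2⟩ := h ε hε (9 * r ^ 2) (by nlinarith [one_le_iff_ne_zero.2 hr0.ne'])
  have key : ∀ (M N y : ℝ) (I J : Finset IK), 1 ≤ y → y ≤ M → y ≤ N → N ≤ M →
      (∀ 𝔪 ∈ I, 𝔪 ∈ idl K M ∧ IsCoprime 𝔪 F) → (∀ 𝔫 ∈ J, 𝔫 ∈ idl K N ∧ IsCoprime 𝔫 F) →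
      ∀ v w : IK → ℝ, (∀ 𝔪, |v 𝔪| ≤ 1) → (∀ 𝔫, |w 𝔫| ≤ 1) →
      |∑ 𝔪 ∈ I, ∑ 𝔫 ∈ J, v 𝔪 * w 𝔫 * T (𝔪 * 𝔫)| ≤
      (C1 + C2) * (M * N) ^ (1 + ε) * (y ^ (-(1 / 2) : ℝ) + (M * N) ^ (-(1 / (36 * (r : ℝ) ^ 2)))) := by
    intro M N y I J hy hM hN hNM hI hJ v w hv hw
    have hM0 : 0 < M := by linarith
    have hN0 : 0 < N := by linarith
    have hMN : 0 < M * N := by positivity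
    have hsp : (M * N) ^ (1 + ε) = M * N * (M * N) ^ ε := by rw [rpow_add hMN, rpow_one]
    by_cases hc : N ^ (3 * r) ≤ M ^ 1
    · refine (h1 M N I J (by linarith) (by linarith) hc hI hJ v w hv hw).trans ?_
      have e1 : N ^ (1 - 1 / (2 * ((1 : ℕ) : ℝ))) ≤ N * y ^ (-(1 / 2) : ℝ) := by
        rw [show (1 - 1 / (2 * ((1 : ℕ) : ℝ)) : ℝ) = 1 + (-(1 / 2)) by norm_num, rpow_add hN0, rpow_one]
        exact mul_le_mul_of_nonneg_left (Real.rpow_le_rpow_of_nonpos (by linarith) hN (by norm_num)) hN0.le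
      calc _ ≤ C1 * (M * (N * y ^ (-(1 / 2) : ℝ))) * (M * N) ^ ε := by gcongr
        _ = C1 * (M * N) ^ (1 + ε) * y ^ (-(1 / 2) : ℝ) := by rw [hsp]; ring
        _ ≤ _ := by
          gcongr
          · linarith
          · have : 0 ≤ (M * N) ^ (-(1 / (36 * (r : ℝ) ^ 2))) := by positivity
            linarith
    · push Not at hc
      have hc' : M ^ (3 * r) ≤ N ^ (9 * r ^ 2) := by
        rw [show 9 * r ^ 2 = 3 * r * (3 * r) by ring, pow_mul N]
        exact pow_le_pow_left₀ hM0.le (by simpa using hc.le) _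
      have h3 := h2 N M J I (by linarith) (by linarith) hc' hJ hI w v hw hv
      rw [sum_comm, mul_comm N M] at h3
      refine le_trans (le_of_eq ?_) (h3.trans ?_)
      · congr 1
        exact sum_congr rfl fun _ _ => sum_congr rfl fun _ _ => by rw [mul_comm (v _), mul_comm (_ : IK)]
      · have e1 : M ^ (1 - 1 / (2 * ((9 * r ^ 2 : ℕ) : ℝ))) ≤ M * (M * N) ^ (-(1 / (36 * (r : ℝ) ^ 2))) := by
          have e2 : M ^ (1 - 1 / (2 * ((9 * r ^ 2 : ℕ) : ℝ))) = M * (M * M) ^ (-(1 / (36 * (r : ℝ) ^ 2))) := by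
            rw [mul_rpow hM0.le hM0.le, ← rpow_add hM0]
            nth_rewrite 2 [← rpow_one M]
            rw [← rpow_add hM0]
            congr 1
            push_cast
            field_simp
            ring
          rw [e2]
          refine mul_le_mul_of_nonneg_left (Real.rpow_le_rpow_of_nonpos hMN (by gcongr) ?_) hM0.le
          rw [neg_nonpos]; positivity
        calc _ ≤ C2 * (N * (M * (M * N) ^ (-(1 / (36 * (r : ℝ) ^ 2))))) * (M * N) ^ ε := by gcongr
          _ = C2 * (M * N) ^ (1 + ε) * (M * N) ^ (-(1 / (36 * (r : ℝ) ^ 2))) := by rw [hsp]; ring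
          _ ≤ _ := by
            gcongr
            · linarith
            · have : 0 ≤ y ^ (-(1 / 2) : ℝ) := by positivity
              linarith
  refine ⟨C1 + C2, by linarith, ?_⟩
  intro M N y I J hy hM hN hI hJ v w hv hw
  rcases le_total N M with hNM | hNM
  · exact key M N y I J hy hM hN hNM hI hJ v w hv hw
  · have := key N M y J I hy hN hM hNM hJ hI w v hw hv
    rw [sum_comm, mul_comm N M] at this
    refine le_trans (le_of_eq ?_) this
    congr 1
    exact sum_congr rfl fun _ _ => sum_congr rfl fun _ _ => by rw [mul_comm (v _), mul_comm (_ : IK)]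

theorem exists_dyadic {x y : ℝ} (hy : 1 ≤ y) {B : ℕ} (hB : x ≤ 2 ^ B) {m : ℝ} (h1 : y < m) (h2 : m ≤ x) :
    ∃ i < B, 2 ^ i * y < m ∧ m ≤ 2 ^ (i + 1) * y := by
  have hex : ∃ i : ℕ, m ≤ 2 ^ i * y := ⟨B, by
    have : (0 : ℝ) < 2 ^ B := by positivity
    nlinarith⟩
  have hs := Nat.find_spec hex
  have h0 : Nat.find hex ≠ 0 := fun h => by rw [h] at hs; simp at hs; linarith
  obtain ⟨i, hi⟩ := Nat.exists_eq_succ_of_ne_zero h0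
  have h3 : ¬ m ≤ 2 ^ i * y := Nat.find_min hex (by omega)
  push Not at h3
  refine ⟨i, ?_, h3, by rwa [hi] at hs⟩
  by_contra! h
  have : (2 : ℝ) ^ B ≤ 2 ^ i := pow_le_pow_right₀ (by norm_num) h
  nlinarith

/-- The bilinear part of Vaughan's identity. -/
theorem BilinearBound.typeII {F : IK} {T : IK → ℝ} (h : BilinearBound F T) {ε : ℝ} (hε : 0 < ε) :
    ∃ C : ℝ, 1 ≤ C ∧ ∀ (x y : ℝ) (v w : IK → ℝ), 1 ≤ x → 1 ≤ y → (∀ b, |v b| ≤ 1) → (∀ e, |w e| ≤ 1) →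
    (∀ b, (absNorm b : ℝ) ≤ y → v b = 0) → (∀ b, (absNorm b : ℝ) ≤ y → w b = 0) →
    |∑ b ∈ idl K x, ∑ e ∈ idl K x, v b * w e * (if b * e ∈ idl K x ∧ IsCoprime (b * e) F then T (b * e) else 0)| ≤
      C * x ^ (1 + ε) * (y ^ (-(1 / 2) : ℝ) + x ^ (-(1 / (36 * (finrank ℚ K : ℝ) ^ 2)))) := by
  set r := finrank ℚ K with hr
  obtain ⟨C1, hC1, h1⟩ := h.symmetric (ε := ε / 3) (by positivity)
  obtain ⟨C2, hC2, h2⟩ := exists_succ_le_rpow (ε := ε / 3) (by positivity)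
  refine ⟨(C2 * 2 ^ (ε / 3)) ^ 2 * (C1 * 2 ^ (1 + ε / 3)), ?_, ?_⟩
  · have e1 : (1 : ℝ) ≤ 2 ^ (ε / 3) := one_le_rpow (by norm_num) (by positivity)
    have e2 : (1 : ℝ) ≤ 2 ^ (1 + ε / 3) := one_le_rpow (by norm_num) (by positivity)
    exact one_le_mul_of_one_le_of_one_le (one_le_pow₀ (one_le_mul_of_one_le_of_one_le hC2 e1)) (one_le_mul_of_one_le_of_one_le hC1 e2)
  intro x y v w hx hy hv hw hv0 hw0
  have hx0 : 0 < x := by linarith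
  set X := ⌊x⌋₊ with hX
  have hX1 : 1 ≤ X := le_floor (by simpa using hx)
  have hXx : (X : ℝ) ≤ x := floor_le hx0.le
  set B := Nat.log 2 (X + 1) + 1 with hB
  have hB1 : X + 1 < 2 ^ B := Nat.lt_pow_succ_log_self (by norm_num) _
  have hBx : x ≤ 2 ^ B := by
    have h3 : x < X + 1 := Nat.lt_floor_add_one x
    have h4 : ((X + 1 : ℕ) : ℝ) < ((2 ^ B : ℕ) : ℝ) := by exact_mod_cast hB1
    push_cast at h4
    linarith
  have hBle : (B : ℝ) ≤ C2 * 2 ^ (ε / 3) * x ^ (ε / 3) := by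
    have h3 := h2 (Nat.log 2 (X + 1))
    have h4 : ((2 : ℝ) ^ Nat.log 2 (X + 1)) ≤ 2 * x := by
      have h5 : 2 ^ Nat.log 2 (X + 1) ≤ X + 1 := Nat.pow_log_le_self 2 (by omega)
      have h6 : (((2 ^ Nat.log 2 (X + 1) : ℕ)) : ℝ) ≤ ((X + 1 : ℕ) : ℝ) := by exact_mod_cast h5
      push_cast at h6
      linarith
    rw [hB, mul_assoc, ← mul_rpow (by norm_num) hx0.le]
    push_cast
    refine h3.trans ?_
    gcongr
  set Z : ℝ := C1 * (2 * x) ^ (1 + ε / 3) * (y ^ (-(1 / 2) : ℝ) + x ^ (-(1 / (36 * (r : ℝ) ^ 2)))) with hZ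
  have hZ0 : 0 ≤ Z := by positivity
  have hmain : |∑ b ∈ idl K x, ∑ e ∈ idl K x, v b * w e * (if b * e ∈ idl K x ∧ IsCoprime (b * e) F then T (b * e) else 0)| ≤ B * (B * Z) := by
    have hd : ∀ b : IK, ∃ i : ℕ, b ∈ idl K x → y < absNorm b → i < B ∧ 2 ^ i * y < absNorm b ∧ (absNorm b : ℝ) ≤ 2 ^ (i + 1) * y := by
      intro b
      by_cases hb : b ∈ idl K x ∧ y < absNorm b
      · obtain ⟨i, hi⟩ := exists_dyadic hy hBx hb.2 (mem_idl.1 hb.1).2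
        exact ⟨i, fun _ _ => hi⟩
      · exact ⟨0, fun h3 h4 => absurd ⟨h3, h4⟩ hb⟩
    choose d hd using hd
    set I := (idl K x).filter fun b => y < absNorm b ∧ IsCoprime b F with hI
    have hIsub : ∀ b ∈ I, b ∈ idl K x ∧ y < absNorm b ∧ IsCoprime b F := fun b hb => mem_filter.1 hb
    have hred : ∑ b ∈ idl K x, ∑ e ∈ idl K x, v b * w e * (if b * e ∈ idl K x ∧ IsCoprime (b * e) F then T (b * e) else 0) =
        ∑ i ∈ range B, ∑ b ∈ I with d b = i, ∑ e ∈ I with (absNorm e : ℝ) ≤ 2 * x / (2 ^ (i + 1) * y),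
          v b * w e * (if min (absNorm e) X < X / absNorm b + 1 then T (b * e) else 0) := by
      rw [← Finset.sum_filter_add_sum_filter_not (idl K x) (fun b => y < absNorm b ∧ IsCoprime b F)]
      rw [sum_eq_zero (s := Finset.filter (fun b => ¬ _) _), add_zero, ← hI]
      swap
      · intro b hb
        obtain ⟨hb1, hb2⟩ := mem_filter.1 hb
        refine sum_eq_zero fun e _ => ?_
        by_cases hby : y < absNorm b
        · rw [if_neg fun h3 => hb2 ⟨hby, (IsCoprime.mul_left_iff.1 h3.2).1⟩, mul_zero]
        · rw [hv0 b (not_lt.1 hby)]; ring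
      rw [← sum_fiberwise_of_maps_to (g := d) (t := range B) fun b hb => mem_range.2 (hd b (hIsub b hb).1 (hIsub b hb).2.1).1]
      refine sum_congr rfl fun i hi => sum_congr rfl fun b hb => ?_
      obtain ⟨hbI, rfl⟩ := mem_filter.1 hb
      obtain ⟨hb1, hb2, hb3⟩ := hIsub b hbI
      obtain ⟨-, hd1, hd2⟩ := hd b hb1 hb2
      have hbn := absNorm_pos (mem_idl.1 hb1).1
      symm
      rw [hI, Finset.filter_filter]
      have hcond : ∀ e ∈ idl K x, b * e ∈ idl K x ↔ min (absNorm e) X < X / absNorm b + 1 := by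
        intro e he
        obtain ⟨he0, hex⟩ := mem_idl.1 he
        have heX : absNorm e ≤ X := le_floor hex
        rw [min_eq_left heX, Nat.lt_succ_iff, Nat.le_div_iff_mul_le hbn, mem_idl, map_mul, mul_comm (absNorm e)]
        refine ⟨fun h3 => le_floor h3.2, fun h3 => ⟨mul_ne_zero (mem_idl.1 hb1).1 he0, ?_⟩⟩
        exact (cast_le.2 h3).trans hXx
      rw [sum_filter]
      refine sum_congr rfl fun e he => ?_
      obtain ⟨he0, hex⟩ := mem_idl.1 he
      by_cases p1 : (y < absNorm e ∧ IsCoprime e F) ∧ (absNorm e : ℝ) ≤ 2 * x / (2 ^ (d b + 1) * y)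
      · rw [if_pos p1]
        by_cases p2 : b * e ∈ idl K x
        · rw [if_pos ((hcond e he).1 p2), if_pos ⟨p2, hb3.mul_left p1.1.2⟩]
        · rw [if_neg fun h3 => p2 ((hcond e he).2 h3), if_neg fun h3 => p2 h3.1]
      · rw [if_neg p1]
        by_cases p3 : b * e ∈ idl K x ∧ IsCoprime (b * e) F
        · by_cases hey : y < absNorm e
          · refine absurd ⟨⟨hey, (IsCoprime.mul_left_iff.1 p3.2).2⟩, ?_⟩ p1
            have h3 := (mem_idl.1 p3.1).2
            rw [map_mul, cast_mul] at h3
            have hy0 : 0 < y := by linarith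
            rw [le_div_iff₀ (by positivity), pow_succ]
            have h4 : (0 : ℝ) ≤ absNorm e := by positivity
            nlinarith
          · rw [hw0 e (not_lt.1 hey)]; ring
        · rw [if_neg p3]; ring
    rw [hred]
    refine (abs_sum_le_sum_abs _ _).trans ((sum_le_card_nsmul _ _ (B * Z) fun i hi => ?_).trans (by rw [card_range, nsmul_eq_mul]))
    set N := 2 * x / (2 ^ (i + 1) * y) with hN
    have hy0 : 0 < y := by linarith
    have hNx : 2 ^ (i + 1) * y * N = 2 * x := by rw [hN]; field_simp
    by_cases hyN : y ≤ N
    swap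
    · push Not at hyN
      rw [sum_eq_zero, abs_zero]
      · positivity
      · intro b _
        refine sum_eq_zero fun e he => ?_
        obtain ⟨he1, he2⟩ := mem_filter.1 he
        have := (hIsub e he1).2.1
        linarith
    have hM : y ≤ 2 ^ (i + 1) * y := le_mul_of_one_le_left hy0.le (one_le_pow₀ (by norm_num))
    rw [sum_comm]
    have htr := bilinear_truncation (I.filter fun e => (absNorm e : ℝ) ≤ N) (I.filter fun b => d b = i) (Φ := Z) B (fun e b => T (b * e)) ?_
      (fun e => min (absNorm e) X) (fun b => X / absNorm b + 1) (fun e => (min_le_right _ _).trans_lt (by omega))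
      (fun b => lt_of_le_of_lt (Nat.add_le_add_right (Nat.div_le_self _ _) 1) hB1) w v hw hv
    · refine le_trans (le_of_eq ?_) htr
      congr 1
      exact sum_congr rfl fun _ _ => sum_congr rfl fun _ _ => by rw [mul_comm (v _)]
    · intro w' v' hw' hv'
      have h3 := h1 (2 ^ (i + 1) * y) N y (I.filter fun b => d b = i) (I.filter fun e => (absNorm e : ℝ) ≤ N) hy hM hyN ?_ ?_ v' w' hv' hw'
      · rw [sum_comm, hNx] at h3
        refine le_trans (le_of_eq ?_) (h3.trans ?_)
        · congr 1
          exact sum_congr rfl fun _ _ => sum_congr rfl fun _ _ => by rw [mul_comm (v' _)]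
        · refine mul_le_mul_of_nonneg_left (add_le_add_right (Real.rpow_le_rpow_of_nonpos hx0 (by linarith) ?_) _) (by positivity)
          rw [neg_nonpos]; positivity
      · intro b hb
        obtain ⟨hbI, rfl⟩ := mem_filter.1 hb
        obtain ⟨hb1, hb2, hb3⟩ := hIsub b hbI
        exact ⟨mem_idl.2 ⟨(mem_idl.1 hb1).1, (hd b hb1 hb2).2.2⟩, hb3⟩
      · intro e he
        obtain ⟨he, he2⟩ := mem_filter.1 he
        obtain ⟨he1, -, he3⟩ := hIsub e he
        exact ⟨mem_idl.2 ⟨(mem_idl.1 he1).1, he2⟩, he3⟩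
  refine hmain.trans ?_
  have h5 : (B : ℝ) * (B * Z) ≤ (C2 * 2 ^ (ε / 3) * x ^ (ε / 3)) * ((C2 * 2 ^ (ε / 3) * x ^ (ε / 3)) * Z) := by gcongr
  refine h5.trans (le_of_eq ?_)
  have h6 : x ^ (1 + ε) = x ^ (ε / 3) * (x ^ (ε / 3) * x ^ (1 + ε / 3)) := by
    rw [← rpow_add hx0, ← rpow_add hx0]
    congr 1
    ring
  rw [hZ, mul_rpow (by norm_num) hx0.le, h6]
  generalize x ^ (ε / 3) = t1
  generalize x ^ (1 + ε / 3) = t2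
  generalize (2 : ℝ) ^ (ε / 3) = t3
  generalize (2 : ℝ) ^ (1 + ε / 3) = t4
  ring

/-- The trace as a sum of real conjugates. -/
def trSum (ι : K →+* ℝ) (a : OK) : ℝ := ∑ τ : Gal(K/ℚ), cj ι τ a

theorem trSum_add (ι : K →+* ℝ) (a b : OK) : trSum ι (a + b) = trSum ι a + trSum ι b := by
  simp [trSum, sum_add_distrib]

theorem cj_le_trSum [IsGalois ℚ K] (ι : K →+* ℝ) {a : OK} (ha : TotPos a) (τ : Gal(K/ℚ)) : cj ι τ a ≤ trSum ι a :=
  single_le_sum (f := fun τ => cj ι τ a) (fun τ _ => ((totPos_iff ι a).1 ha τ).le) (mem_univ τ)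

theorem trSum_one_lt [IsGalois ℚ K] (ι : K →+* ℝ) {u : OKˣ} (hu : TotPos (u : OK)) (h1 : u ≠ 1) :
    trSum ι 1 < trSum ι (u : OK) := by
  have hpos := (totPos_iff ι _).1 hu
  have hne : ∀ τ, cj ι τ (u : OK) ≠ 1 := fun τ h => h1 (Units.ext (cj_injective ι τ (by rw [h, Units.val_one, map_one])))
  have hprod : ∏ τ, cj ι τ (u : OK) = 1 := by
    have h2 := absNorm_span_eq ι (u : OK)
    rw [Ideal.span_singleton_eq_top.2 u.isUnit, absNorm_top, abs_of_pos (prod_pos fun τ _ => hpos τ)] at h2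
    simpa using h2.symm
  have h2 : ∑ τ, log (cj ι τ (u : OK)) = 0 := by
    rw [← Real.log_prod fun τ _ => (hpos τ).ne', hprod, Real.log_one]
  have h3 : ∑ τ, log (cj ι τ (u : OK)) < ∑ τ, (cj ι τ (u : OK) - 1) :=
    Finset.sum_lt_sum_of_nonempty univ_nonempty fun τ _ => Real.log_lt_sub_one_of_pos (hpos τ) (hne τ)
  rw [h2, sum_sub_distrib] at h3
  simp only [trSum, map_one]
  linarith

/-- Totally positive elements that minimise the trace in their class modulo totally positive units, with
ties resolved by the embedding `ι`. -/
def IsMinimalGen (ι : K →+* ℝ) (a : OK) : Prop :=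
  TotPos a ∧ ∀ u : OKˣ, TotPos (u : OK) → toLex (trSum ι a, cj ι 1 a) ≤ toLex (trSum ι (u * a), cj ι 1 (u * a))

theorem TotPos.add_natCast [IsGalois ℚ K] (ι : K →+* ℝ) {a : OK} (ha : TotPos a) (k : ℕ) : TotPos (a + (k : OK)) := by
  rw [totPos_iff ι] at ha ⊢
  intro τ
  have := ha τ
  rw [map_add, map_natCast]
  positivity

theorem IsMinimalGen.add_natCast [IsGalois ℚ K] (ι : K →+* ℝ) {a : OK} (ha : IsMinimalGen ι a) (k : ℕ) :
    IsMinimalGen ι (a + (k : OK)) := by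
  rcases Nat.eq_zero_or_pos k with rfl | hk
  · simpa using ha
  refine ⟨ha.1.add_natCast ι k, fun u hu => ?_⟩
  by_cases h1 : u = 1
  · simp [h1]
  have h2 := ha.2 u hu
  have h3 := trSum_one_lt ι hu h1
  rw [Prod.Lex.toLex_le_toLex] at h2 ⊢
  have h4 : trSum ι a ≤ trSum ι (u * a) := by
    rcases h2 with h2 | h2
    · exact h2.le
    · exact h2.1.le
  have h5 : ∀ b : OK, trSum ι (b * (k : OK)) = k * trSum ι b := by
    intro b
    simp only [trSum, map_mul, map_natCast, mul_sum]
    exact sum_congr rfl fun _ _ => mul_comm _ _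
  left
  simp only [mul_add, trSum_add]
  rw [h5, show (k : OK) = 1 * (k : OK) by rw [one_mul], h5]
  have : (0 : ℝ) < k := by exact_mod_cast hk
  nlinarith

theorem IsMinimalGen.eq_of_span_eq [IsGalois ℚ K] (ι : K →+* ℝ) {a b : OK} (ha : IsMinimalGen ι a) (hb : IsMinimalGen ι b)
    (h : span {a} = span {b}) : a = b := by
  have key : ∀ a b : OK, IsMinimalGen ι a → IsMinimalGen ι b → Associated a b →
      toLex (trSum ι a, cj ι 1 a) ≤ toLex (trSum ι b, cj ι 1 b) := by
    rintro a b ha hb ⟨u, rfl⟩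
    rw [mul_comm]
    refine ha.2 u fun v => ?_
    have h1 := hb.1 v
    rw [show ((a * u : OK) : K) = a * (u : OK) from rfl, map_mul] at h1
    exact (pos_iff_pos_of_mul_pos h1).1 (ha.1 v)
  have h1 := Ideal.span_singleton_eq_span_singleton.1 h
  have h2 := le_antisymm (key a b ha hb h1) (key b a hb ha h1.symm)
  exact cj_injective ι 1 (Prod.ext_iff.1 (toLex.injective h2)).2

theorem finite_cj_le [IsGalois ℚ K] (ι : K →+* ℝ) (B : ℝ) : {a : OK | ∀ τ, |cj ι τ a| ≤ B}.Finite := by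
  obtain ⟨C, hC, h⟩ := exists_repr_le ι
  refine Set.Finite.of_finite_image (f := fun a => fun j => (basis K).repr a j)
    ((Set.Finite.pi fun _ => Set.finite_Icc (-⌈C * B⌉) ⌈C * B⌉).subset ?_) fun a _ b _ hab => ?_
  · rintro _ ⟨a, ha, rfl⟩ j -
    have h1 := abs_le.1 (h a B ha j)
    have h2 := Int.le_ceil (C * B)
    constructor
    · have : ((-⌈C * B⌉ : ℤ) : ℝ) ≤ ((basis K).repr a j : ℝ) := by push_cast; linarith
      exact_mod_cast this
    · have : ((basis K).repr a j : ℝ) ≤ (⌈C * B⌉ : ℤ) := by linarith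
      exact_mod_cast this
  · exact (basis K).repr.injective (Finsupp.ext fun j => congrFun hab j)

theorem exists_isMinimalGen [IsGalois ℚ K] (ι : K →+* ℝ) {a : OK} (ha : TotPos a) :
    ∃ b, IsMinimalGen ι b ∧ span {b} = span {a} := by
  set S : Set OK := {b | (TotPos b ∧ Associated a b) ∧ trSum ι b ≤ trSum ι a} with hS
  have hfin : S.Finite := (finite_cj_le ι (trSum ι a)).subset fun b hb τ => by
    rw [abs_of_pos ((totPos_iff ι b).1 hb.1.1 τ)]
    exact (cj_le_trSum ι hb.1.1 τ).trans hb.2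
  have haS : a ∈ S := ⟨⟨ha, Associated.refl a⟩, le_rfl⟩
  obtain ⟨b, hb, hmin⟩ := hfin.exists_minimalFor (fun b => toLex (trSum ι b, cj ι 1 b)) S ⟨a, haS⟩
  refine ⟨b, ⟨hb.1.1, fun u hu => ?_⟩, (Ideal.span_singleton_eq_span_singleton.2 hb.1.2).symm⟩
  by_contra! hlt
  have hub : (u : OK) * b ∈ S := by
    refine ⟨⟨hu.mul hb.1.1, hb.1.2.trans ⟨u, mul_comm _ _⟩⟩, ?_⟩
    rw [Prod.Lex.toLex_lt_toLex] at hlt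
    rcases hlt with h | h
    · exact h.le.trans hb.2
    · exact h.1.le.trans hb.2
  exact (hmin hub hlt.le).not_gt hlt

theorem IsMinimalGen.exists_cj_le [IsGalois ℚ K] (ι : K →+* ℝ) : ∃ C : ℝ, 1 ≤ C ∧ ∀ a : OK, IsMinimalGen ι a → ∀ τ,
    |cj ι τ a| ≤ C * (absNorm (span {a}) : ℝ) ^ (1 / (finrank ℚ K : ℝ)) := by
  obtain ⟨C, hC, h⟩ := exists_balanced ι
  refine ⟨card (Gal(K/ℚ)) * C + 1, le_add_of_nonneg_left (by positivity), fun a ha τ => ?_⟩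
  obtain ⟨u, hu⟩ := h a (ha.1.ne_zero ι)
  have h1 := ha.2 (u * u) (by simpa using totPos_sq ι u.ne_zero)
  rw [Prod.Lex.toLex_le_toLex] at h1
  have h4 : trSum ι a ≤ trSum ι (u * u * a) := by
    rcases h1 with h2 | h2
    · exact h2.le
    · exact h2.1.le
  rw [abs_of_pos ((totPos_iff ι a).1 ha.1 τ)]
  refine (cj_le_trSum ι ha.1 τ).trans (h4.trans ?_)
  have h5 : trSum ι (u * u * a) ≤ ∑ _τ : Gal(K/ℚ), C * (absNorm (span {a}) : ℝ) ^ (1 / (finrank ℚ K : ℝ)) :=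
    sum_le_sum fun τ _ => (le_abs_self _).trans (hu τ)
  rw [sum_const, card_univ, nsmul_eq_mul] at h5
  have : 0 ≤ (absNorm (span {a}) : ℝ) ^ (1 / (finrank ℚ K : ℝ)) := by positivity
  linarith

theorem absNorm_span_add_natCast_le [IsGalois ℚ K] (ι : K →+* ℝ) {a : OK} (ha : TotPos a) {k l : ℕ} (h : k ≤ l) :
    absNorm (span {a + (k : OK)}) ≤ absNorm (span {a + (l : OK)}) := by
  have h1 := (totPos_iff ι _).1 (ha.add_natCast ι k)
  have h2 := (totPos_iff ι _).1 (ha.add_natCast ι l)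
  rw [← cast_le (α := ℝ), absNorm_span_eq ι, absNorm_span_eq ι, abs_of_pos (prod_pos fun τ _ => h1 τ),
    abs_of_pos (prod_pos fun τ _ => h2 τ)]
  refine Finset.prod_le_prod (fun τ _ => (h1 τ).le) fun τ _ => ?_
  simp only [map_add, map_natCast]
  gcongr

theorem ConjectureC.progression {n : ℕ} {δ : ℝ} (h : ConjectureC n δ) {ε : ℝ} (hε : 0 < ε) : ∃ C : ℝ, 0 < C ∧
    ∀ Q : ℝ, 3 ≤ Q → ∀ q : ℕ, 0 < q → (q : ℝ) ≤ Q → ∀ χ : DirichletCharacter ℤ q, χ ≠ 1 → ∀ r : ℕ, r.Coprime q →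
    ∀ (b : ℤ) (J : ℕ), (J : ℝ) ≤ Q ^ ((1 : ℝ) / n) →
    |∑ j ∈ range J, ((χ ((b + r * j : ℤ) : ZMod q) : ℤ) : ℝ)| ≤ C * Q ^ ((1 - δ) / n + ε) := by
  obtain ⟨C, hC, h1⟩ := h ε hε
  refine ⟨C, hC, fun Q hQ q hq hqQ χ hχ r hr b J hJ => ?_⟩
  have : NeZero q := ⟨hq.ne'⟩
  rcases Nat.eq_zero_or_pos J with rfl | hJ0
  · simp; positivity
  set R := ZMod.unitOfCoprime r hr with hR
  set c : ZMod q := ((R⁻¹ : (ZMod q)ˣ) : ZMod q) * (b : ZMod q) with hc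
  set M := (c - 1).val with hM
  have hMc : ((M + 1 : ℕ) : ZMod q) = c := by
    rw [cast_add, hM, ZMod.natCast_val, ZMod.cast_id]
    simp
  have h2 := h1 Q hQ M (by positivity) J (by exact_mod_cast hJ0) hJ q hq hqQ χ hχ
  rw [← cast_add, Nat.floor_natCast, Nat.floor_natCast] at h2
  have e1 : ∀ j : ℕ, χ ((b + r * j : ℤ) : ZMod q) = χ (R : ZMod q) * χ ((M + 1 + j : ℕ) : ZMod q) := by
    intro j
    rw [← map_mul]
    congr 1
    rw [cast_add, hMc, hc, mul_add, ← mul_assoc, Units.mul_inv, one_mul, hR, ZMod.coe_unitOfCoprime]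
    push_cast
    ring
  have e2 : Ioc M (M + J) = Ico (M + 1) (M + 1 + J) := by
    ext i; simp only [Finset.mem_Ioc, Finset.mem_Ico]; omega
  rw [e2, Finset.sum_Ico_eq_sum_range, Nat.add_sub_cancel_left] at h2
  have e3 : |((χ (R : ZMod q) : ℤ) : ℝ)| = 1 := by
    have h3 : IsUnit (χ (R : ZMod q)) := IsUnit.map χ R.isUnit
    rcases Int.isUnit_iff.1 h3 with h3 | h3 <;> rw [h3] <;> norm_num
  calc _ = |((χ (R : ZMod q) : ℤ) : ℝ) * ∑ j ∈ range J, ((χ ((M + 1 + j : ℕ) : ZMod q) : ℤ) : ℝ)| := by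
        rw [mul_sum]
        congr 1
        exact sum_congr rfl fun j _ => by rw [e1 j]; push_cast; ring
    _ ≤ _ := by rw [abs_mul, e3, one_mul]; exact h2

/-- The quadratic character attached to an ideal of squarefree norm. -/
theorem exists_dirichletCharacter {𝔮 : IK} {q : ℕ} (hN : absNorm 𝔮 = q) (hq : Squarefree q)
    (h2 : IsCoprime 𝔮 (span {2})) : ∃ χ : DirichletCharacter ℤ q, (∀ k : ℤ, χ (k : ZMod q) = quadSym 𝔮 (k : OK)) ∧
      (q ≠ 1 → χ ≠ 1) ∧ ∀ β : OK, ∃ b : ℤ, β - b ∈ 𝔮 := by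
  have hq0 : q ≠ 0 := hq.ne_zero
  have h0 : 𝔮 ≠ ⊥ := by rintro rfl; exact hq0 (by rw [← hN, Ideal.absNorm_bot])
  have : NeZero q := ⟨hq0⟩
  have hcard : Nat.card (OK ⧸ 𝔮) = q := by rw [← hN, absNorm_apply, cardQuot_apply]
  have : Finite (OK ⧸ 𝔮) := Nat.finite_of_card_ne_zero (by rw [hcard]; exact hq0)
  let _ := ofFinite (OK ⧸ 𝔮)
  rw [Nat.card_eq_fintype_card] at hcard
  have hqm : ((q : ℕ) : OK) ∈ 𝔮 := by rw [← hN]; exact absNorm_mem 𝔮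
  have hchar : CharP (OK ⧸ 𝔮) q := by
    have h3 : ringChar (OK ⧸ 𝔮) = q := by
      refine Nat.dvd_antisymm (ringChar.dvd (by rw [← map_natCast (IQ 𝔮)]; exact eq_zero_iff_mem.2 hqm)) ?_
      have hne : ringChar (OK ⧸ 𝔮) ≠ 0 := CharP.ringChar_ne_zero_of_finite _
      rw [← Nat.factorization_le_iff_dvd hq0 hne]
      intro p
      by_cases hp : p.Prime ∧ p ∣ q
      · have : Fact p.Prime := ⟨hp.1⟩
        have h4 := (prime_dvd_char_iff_dvd_card (R := OK ⧸ 𝔮) p).2 (hcard ▸ hp.2)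
        exact (hq.natFactorization_le_one p).trans ((hp.1.dvd_iff_one_le_factorization hne).1 h4)
      · have h4 : q.factorization p = 0 := by
          rw [Nat.factorization_eq_zero_iff]
          tauto
        rw [h4]
        exact Nat.zero_le _
    exact h3 ▸ ringChar.charP _
  have hbij := ZMod.castHom_bijective (n := q) (OK ⧸ 𝔮) hcard
  have hval : ∀ z w : ℤ, (z : ZMod q) = w → (z : OK) - w ∈ 𝔮 := by
    intro z w hzw
    have h3 := (ZMod.intCast_eq_intCast_iff_dvd_sub z w q).1 hzw
    obtain ⟨c, hc⟩ := h3
    have : (z : OK) - w = -((q : OK) * (c : OK)) := by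
      have := congrArg (Int.cast : ℤ → OK) hc
      push_cast at this
      rw [← this]; ring
    rw [this]
    exact 𝔮.neg_mem (𝔮.mul_mem_right _ hqm)
  have hrepr : ∀ z : ZMod q, IQ 𝔮 (z.val : OK) = ZMod.castHom (dvd_refl q) (OK ⧸ 𝔮) z := by
    intro z
    conv_rhs => rw [← ZMod.natCast_zmod_val z]
    rw [map_natCast, map_natCast]
  let χ : DirichletCharacter ℤ q :=
    { toFun := fun z => quadSym 𝔮 ((z.val : ℤ) : OK)
      map_one' := by
        have : quadSym 𝔮 (((1 : ZMod q).val : ℤ) : OK) = quadSym 𝔮 ((1 : ℤ) : OK) := quadSym_congr (hval _ _ (by simp))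
        rw [this, Int.cast_one, quadSym_one]
      map_mul' := fun z w => by
        rw [← quadSym_mul_right]
        have := hval ((z * w).val : ℤ) ((z.val : ℤ) * (w.val : ℤ)) (by simp)
        rw [Int.cast_mul] at this
        exact quadSym_congr this
      map_nonunit' := fun z hz => by
        by_contra h3
        apply hz
        obtain ⟨i, hi, j, hj, hij⟩ := isCoprime_iff_exists.1 ((quadSym_ne_zero_iff h0).1 h3)
        obtain ⟨c, rfl⟩ := Ideal.mem_span_singleton'.1 hi
        have h4 : IsUnit (IQ 𝔮 (z.val : OK)) := by
          refine IsUnit.of_mul_eq_one (IQ 𝔮 c) ?_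
          rw [← map_mul, mul_comm, ← map_one (IQ 𝔮), Ideal.Quotient.eq, ← hij, Int.cast_natCast]
          simpa using hj
        rw [hrepr] at h4
        have h5 := h4.map (RingEquiv.ofBijective _ hbij).symm
        rwa [show ZMod.castHom (dvd_refl q) (OK ⧸ 𝔮) z = RingEquiv.ofBijective _ hbij z from rfl, RingEquiv.symm_apply_apply] at h5 }
  have hχ : ∀ k : ℤ, χ (k : ZMod q) = quadSym 𝔮 (k : OK) := fun k => quadSym_congr (hval _ _ (by simp))
  have hrep : ∀ β : OK, ∃ b : ℤ, β - b ∈ 𝔮 := by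
    intro β
    obtain ⟨z, hz⟩ := hbij.2 (IQ 𝔮 β)
    refine ⟨(z.val : ℤ), Ideal.Quotient.eq.1 ?_⟩
    rw [← hz, Int.cast_natCast, hrepr]
  refine ⟨χ, hχ, fun h1 hχ1 => ?_, hrep⟩
  have hsq : ∀ s, 𝔮 ≠ s * s := fun s hs => by
    rw [hs, map_mul] at hN
    have h4 := hq (absNorm s) ⟨1, by rw [hN, mul_one]⟩
    rw [Nat.isUnit_iff.1 h4] at hN
    exact h1 (by simpa using hN.symm)
  obtain ⟨t, ht⟩ := exists_quadSym_eq_neg_one h0 h2 hsq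
  obtain ⟨b, hb⟩ := hrep t
  have h3 : χ (b : ZMod q) = -1 := by rw [hχ, ← quadSym_congr hb, ht]
  rw [hχ1] at h3
  by_cases hu : IsUnit (b : ZMod q)
  · rw [MulChar.one_apply hu] at h3; norm_num at h3
  · rw [MulChar.map_nonunit _ hu] at h3; norm_num at h3

theorem abs_sum_range_mod_le {r : ℕ} (hr : 0 < r) (h : ℕ → ℝ) (L : ℕ) {B : ℝ}
    (hB : ∀ ρ < r, ∀ J ≤ L, |∑ j ∈ range J, h (ρ + r * j)| ≤ B) : |∑ a ∈ range L, h a| ≤ r * B := by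
  rw [← sum_fiberwise_of_maps_to (g := fun a => a % r) (t := range r) fun a _ => mem_range.2 (mod_lt a hr)]
  refine (abs_sum_le_sum_abs _ _).trans ((sum_le_card_nsmul _ _ B fun ρ hρ => ?_).trans (by rw [card_range, nsmul_eq_mul]))
  have hρ' := mem_range.1 hρ
  set J := (L + r - 1 - ρ) / r with hJ
  have hlt : ∀ j, j < J ↔ ρ + r * j < L := by
    intro j
    rw [← Nat.succ_le_iff, hJ, Nat.le_div_iff_mul_le hr, Nat.succ_mul, mul_comm]
    omega
  have e : (range L).filter (fun a => a % r = ρ) = (range J).image fun j => ρ + r * j := by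
    ext a
    simp only [mem_filter, mem_range, mem_image]
    constructor
    · rintro ⟨h1, rfl⟩
      exact ⟨a / r, (hlt _).2 (by rw [Nat.mod_add_div]; exact h1), Nat.mod_add_div a r⟩
    · rintro ⟨j, h1, rfl⟩
      exact ⟨(hlt j).1 h1, by rw [Nat.add_mul_mod_self_left, mod_eq_of_lt hρ']⟩
  rw [e, sum_image fun i _ j _ hij => Nat.eq_of_mul_eq_mul_left hr (Nat.add_left_cancel hij)]
  refine hB ρ hρ' J ?_
  by_contra! h1
  have := (hlt L).1 h1
  nlinarith

theorem exists_coprime_ideal_factors {𝔞 : IK} {q u : ℕ} (h : absNorm 𝔞 = q * u) (hq : q ≠ 0) (hu : u ≠ 0) (hc : q.Coprime u) :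
    ∃ 𝔮 𝔳, 𝔞 = 𝔮 * 𝔳 ∧ absNorm 𝔮 = q ∧ absNorm 𝔳 = u := by
  set 𝔮 := 𝔞 ⊔ span {(q : OK)} with h𝔮
  set 𝔳 := 𝔞 ⊔ span {(u : OK)} with h𝔳
  have hqu : IsCoprime (span {(q : OK)}) (span {(u : OK)}) := by
    rw [Ideal.isCoprime_span_singleton_iff]
    simpa using (Nat.isCoprime_iff_coprime.2 hc).map (Int.castRingHom OK)
  have hcop : IsCoprime 𝔮 𝔳 := by
    rw [isCoprime_iff_sup_eq, eq_top_iff, ← isCoprime_iff_sup_eq.1 hqu]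
    exact sup_le_sup le_sup_right le_sup_right
  have hqu𝔞 : span {(q : OK)} * span {(u : OK)} ≤ 𝔞 := by
    rw [span_singleton_mul_span_singleton, span_singleton_le_iff_mem, ← cast_mul, ← h]
    exact absNorm_mem 𝔞
  have e : 𝔞 = 𝔮 * 𝔳 := by
    refine le_antisymm ?_ ?_
    · rw [← Ideal.inf_eq_mul_of_isCoprime hcop]
      exact le_inf le_sup_left le_sup_left
    · rw [h𝔮, h𝔳, Ideal.sup_mul, Ideal.mul_sup, Ideal.mul_sup]
      exact sup_le (sup_le (Ideal.le_of_dvd (dvd_mul_left _ _)) (Ideal.le_of_dvd (dvd_mul_right _ _))) (sup_le (Ideal.le_of_dvd (dvd_mul_left _ _)) hqu𝔞)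
  have hdq : ∀ (𝔟 : IK) (k : ℕ), absNorm (𝔟 ⊔ span {(k : OK)}) ∣ k ^ finrank ℚ K := by
    intro 𝔟 k
    have h1 := absNorm_dvd_absNorm_of_le (le_sup_right : span {(k : OK)} ≤ 𝔟 ⊔ span {(k : OK)})
    rwa [Ideal.absNorm_span_natCast, RingOfIntegers.rank] at h1
  have hN : absNorm 𝔮 * absNorm 𝔳 = q * u := by rw [← map_mul, ← e, h]
  have h1 : (absNorm 𝔮).Coprime u := (hc.pow_left _).coprime_dvd_left (hdq 𝔞 q)
  have h2 : (absNorm 𝔳).Coprime q := (hc.symm.pow_left _).coprime_dvd_left (hdq 𝔞 u)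
  have h3 : absNorm 𝔮 ∣ q := h1.dvd_of_dvd_mul_right ⟨_, hN.symm⟩
  have h4 : absNorm 𝔳 ∣ u := h2.dvd_of_dvd_mul_left ⟨_, by rw [mul_comm] at hN; exact hN.symm⟩
  have h5 := Nat.le_of_dvd (Nat.pos_of_ne_zero hq) h3
  have h6 := Nat.le_of_dvd (Nat.pos_of_ne_zero hu) h4
  refine ⟨𝔮, 𝔳, e, h5.antisymm ?_, h6.antisymm ?_⟩
  · by_contra! h7
    have := Nat.mul_lt_mul_of_lt_of_le h7 h6 (Nat.pos_of_ne_zero hu)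
    omega
  · by_contra! h7
    have := Nat.mul_lt_mul_of_le_of_lt h5 h7 (Nat.pos_of_ne_zero hq)
    omega

theorem exists_part_isCoprime (F : IK) {𝔳 : IK} (h : 𝔳 ≠ ⊥) :
    ∃ 𝔠 𝔣, 𝔳 = 𝔠 * 𝔣 ∧ IsCoprime 𝔠 F ∧ ∀ 𝔭, Prime 𝔭 → 𝔭 ∣ 𝔣 → 𝔭 ∣ F := by
  induction 𝔳 using UniqueFactorizationMonoid.induction_on_prime with
  | h₁ => exact absurd rfl h
  | h₂ x hx =>
    refine ⟨1, x, by rw [one_mul], isCoprime_one_left, fun 𝔭 hp hd => absurd (isUnit_of_dvd_unit hd hx) hp.not_unit⟩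
  | h₃ a p ha hp ih =>
    obtain ⟨𝔠, 𝔣, rfl, h1, h2⟩ := ih ha
    by_cases hpF : p ∣ F
    · refine ⟨𝔠, p * 𝔣, by ring, h1, fun 𝔭 hp' hd => ?_⟩
      rcases hp'.dvd_or_dvd hd with h3 | h3
      · exact ((Prime.associated_of_dvd hp' hp h3).dvd_iff_dvd_left).2 hpF
      · exact h2 𝔭 hp' h3
    · refine ⟨p * 𝔠, 𝔣, by ring, ?_, h2⟩
      refine IsCoprime.mul_left (isCoprime_of_not_le ((isPrime_of_prime hp).isMaximal hp.ne_zero) fun h3 => hpF (dvd_iff_le.2 h3)) h1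

/-- Splitting off the primes that divide `m` exactly once and are coprime to `D`. -/
theorem exists_squarefree_part {D : ℕ} (m : ℕ) (hm : m ≠ 0) : ∃ q u g b c : ℕ, m = q * u ∧ Squarefree q ∧ q.Coprime u ∧ q.Coprime D ∧
    u = g * (b ^ 3 * c ^ 2) ∧ g ∣ D := by
  induction m using Nat.recOnPosPrimePosCoprime with
  | zero => exact absurd rfl hm
  | one => exact ⟨1, 1, 1, 1, 1, by simp⟩
  | prime_pow p k hp hk =>
    by_cases h1 : k = 1
    · subst h1
      by_cases hD : p ∣ D
      · exact ⟨1, p, p, 1, 1, by simp [hD]⟩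
      · exact ⟨p ^ 1, 1, 1, 1, 1, by simp, by rw [pow_one]; exact hp.prime.squarefree, by simp,
          by rw [pow_one]; exact hp.coprime_iff_not_dvd.2 hD, by simp, one_dvd _⟩
    · rcases Nat.even_or_odd k with ⟨l, hl⟩ | ⟨l, hl⟩
      · exact ⟨1, p ^ k, 1, 1, p ^ l, by simp [← pow_mul, hl, mul_two]⟩
      · refine ⟨1, p ^ k, 1, p, p ^ (l - 1), by simp, by simp, by simp, by simp, ?_, one_dvd _⟩
        rw [one_mul, ← pow_mul, ← pow_add]
        congr 1
        omega
  | coprime x y hx hy hxy ihx ihy =>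
    obtain ⟨q, u, g, b, c, e1, e2, e3, e4, e5, e6⟩ := ihx (by omega)
    obtain ⟨q', u', g', b', c', f1, f2, f3, f4, f5, f6⟩ := ihy (by omega)
    have dq : q ∣ x := ⟨u, e1⟩
    have du : u ∣ x := ⟨q, by rw [e1, mul_comm]⟩
    have dq' : q' ∣ y := ⟨u', f1⟩
    have du' : u' ∣ y := ⟨q', by rw [f1, mul_comm]⟩
    have dg : g ∣ x := (Dvd.intro _ e5.symm).trans du
    have dg' : g' ∣ y := (Dvd.intro _ f5.symm).trans du'
    refine ⟨q * q', u * u', g * g', b * b', c * c', by rw [e1, f1]; ring, ?_, ?_, Nat.Coprime.mul_left e4 f4, by rw [e5, f5]; ring, ?_⟩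
    · exact (Nat.squarefree_mul (Nat.Coprime.of_dvd dq dq' hxy)).2 ⟨e2, f2⟩
    · exact Nat.Coprime.mul_left (Nat.Coprime.mul_right e3 (Nat.Coprime.of_dvd dq du' hxy))
        (Nat.Coprime.mul_right (Nat.Coprime.of_dvd dq' du hxy.symm) f3)
    · exact Nat.Coprime.mul_dvd_of_dvd_of_dvd (Nat.Coprime.of_dvd dg dg' hxy) e6 f6

theorem spinTerm_span (ι : K →+* ℝ) (hunits : UnitsSq K)
    (σ : Gal(K/ℚ)) (𝔐 : IK) (μ : OK) {α : OK} (hα : TotPos α) : spinTerm σ 𝔐 μ (span {α}) =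
      if ∃ w : OKˣ, (w : OK) * w * α - μ ∈ 𝔐 then (quadSym (span {gal σ α}) α : ℝ) else 0 := by
  rw [spinTerm, spin_eq_quadSym ι hunits σ rfl hα, galMap_span]
  refine if_congr ⟨?_, ?_⟩ rfl rfl
  · rintro ⟨α', h1, h2, h3⟩
    obtain ⟨w, rfl⟩ := exists_unit_sq_mul ι hunits h1.symm hα h2
    exact ⟨w, h3⟩
  · rintro ⟨w, h⟩
    refine ⟨w * w * α, ?_, fun v => ?_, h⟩
    · rw [Ideal.span_singleton_eq_span_singleton]
      exact Associated.symm ⟨w * w, by push_cast; ring⟩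
    · have h1 : v (((w : OK) * w * α : OK) : K) = v ((w : OK) : K) * v ((w : OK) : K) * v (α : K) := by
        rw [← map_mul, ← map_mul]; rfl
      have h2 : v ((w : OK) : K) ≠ 0 := by
        rw [Ne, map_eq_zero]
        exact_mod_cast w.ne_zero
      rw [h1]
      exact mul_pos (mul_self_pos.2 h2) (hα v)

/-- The summand of the congruence sums. -/
def congTerm (σ : Gal(K/ℚ)) (𝔐 : IK) (μ : OK) (f : ℕ) (𝔡 𝔠 : IK) : ℝ :=
  if 𝔡 ∣ 𝔠 ∧ IsCoprime 𝔠 (span {(f : OK)}) then spinTerm σ 𝔐 μ 𝔠 else 0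

theorem abs_spinTerm_le (σ : Gal(K/ℚ)) (𝔐 : IK) (μ : OK) (𝔠 : IK) : |spinTerm σ 𝔐 μ 𝔠| ≤ 1 := by
  rw [spinTerm]
  split_ifs
  · rw [spin]
    split_ifs with h
    · exact abs_quadSym_real_le _ _
    · simp
  · simp

theorem abs_congTerm_le (σ : Gal(K/ℚ)) (𝔐 : IK) (μ : OK) (f : ℕ) (𝔡 𝔠 : IK) :
    |congTerm σ 𝔐 μ f 𝔡 𝔠| ≤ 1 := by
  rw [congTerm]
  split_ifs
  · exact abs_spinTerm_le _ _ _ _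
  · simp

theorem congTerm_class [IsGalois ℚ K] (ι : K →+* ℝ) (hunits : UnitsSq K)
    {σ : Gal(K/ℚ)} {𝔐 : IK} {μ : OK} {f : ℕ} (hF : recMod K ∣ span {(f : OK)})
    (hFM : 𝔐 ∣ span {(f : OK)}) {𝔡 : IK} {α α' γ : OK} (hα : TotPos α) (hα' : TotPos α')
    (eα : α - gal σ α = γ) (eα' : α' - gal σ α' = γ) (hγ : γ ≠ 0) {𝔮 𝔳 : IK} (hqv : span {γ} = 𝔮 * 𝔳)
    (hq : IsCoprime 𝔮 (span {(f : OK)})) {z : OK}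
    (hz : α - α' = ((f * f * absNorm 𝔡 * absNorm 𝔳 : ℕ) : OK) * z)
    (h : congTerm σ 𝔐 μ f 𝔡 (span {α'}) ≠ 0) :
    congTerm σ 𝔐 μ f 𝔡 (span {α}) =
      congTerm σ 𝔐 μ f 𝔡 (span {α'}) * quadSym 𝔮 (gal σ α') * quadSym 𝔮 (gal σ α) := by
  set F := span {(f : OK)} with hFdef
  have n0 : 𝔮 * 𝔳 ≠ ⊥ := by rw [← hqv, Ne, span_singleton_eq_bot]; exact hγ
  have nq : 𝔮 ≠ ⊥ := fun h => n0 (by rw [h]; simp)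
  have nv : 𝔳 ≠ ⊥ := fun h => n0 (by rw [h]; simp)
  have ediff : gal σ α - gal σ α' = α - α' := by rw [← eα'] at eα; linear_combination -eα
  have hmem : ∀ (I : IK) (c : ℕ), (c : OK) ∈ I → c ∣ f * f * absNorm 𝔡 * absNorm 𝔳 → α - α' ∈ I := by
    intro I c hc hd
    rw [hz]
    obtain ⟨e, he⟩ := hd
    rw [he, cast_mul, mul_assoc]
    exact I.mul_mem_right _ hc
  have hF1 : α - α' ∈ F := hmem F f (mem_span_singleton_self _) ⟨f * absNorm 𝔡 * absNorm 𝔳, by ring⟩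
  have hFF : gal σ α - gal σ α' ∈ F * F := by
    rw [ediff]
    refine hmem _ (f * f) ?_ ⟨absNorm 𝔡 * absNorm 𝔳, by ring⟩
    rw [cast_mul]
    exact Ideal.mul_mem_mul (mem_span_singleton_self _) (mem_span_singleton_self _)
  have hd1 : α - α' ∈ 𝔡 := hmem 𝔡 _ (absNorm_mem 𝔡) ⟨f * f * absNorm 𝔳, by ring⟩
  have hv1 : gal σ α - gal σ α' ∈ 𝔳 := by
    rw [ediff]
    exact hmem 𝔳 _ (absNorm_mem 𝔳) ⟨f * f * absNorm 𝔡, by ring⟩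
  have hM1 : α - α' ∈ 𝔐 := Ideal.le_of_dvd hFM hF1
  rw [congTerm, spinTerm_span ι hunits σ 𝔐 μ hα'] at h
  rw [congTerm, congTerm, spinTerm_span ι hunits σ 𝔐 μ hα, spinTerm_span ι hunits σ 𝔐 μ hα']
  have c1 : 𝔡 ∣ span {α} ∧ IsCoprime (span {α}) F := by
    have h1 : 𝔡 ∣ span {α'} ∧ IsCoprime (span {α'}) F := by by_contra h1; rw [if_neg h1] at h; exact h rfl
    refine ⟨dvd_span_singleton.2 ?_, isCoprime_span_of_sub_mem hF1 h1.2⟩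
    exact (Submodule.sub_mem_iff_left _ (dvd_span_singleton.1 h1.1)).1 hd1
  have c1' : 𝔡 ∣ span {α'} ∧ IsCoprime (span {α'}) F := by by_contra h1; rw [if_neg h1] at h; exact h rfl
  have c2' : ∃ w : OKˣ, (w : OK) * w * α' - μ ∈ 𝔐 := by by_contra h1; rw [if_pos c1', if_neg h1] at h; exact h rfl
  have c2 : ∃ w : OKˣ, (w : OK) * w * α - μ ∈ 𝔐 := by
    obtain ⟨w, hw⟩ := c2'
    refine ⟨w, ?_⟩
    have : (w : OK) * w * α - μ = (w : OK) * w * (α - α') + ((w : OK) * w * α' - μ) := by ring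
    rw [this]
    exact 𝔐.add_mem (𝔐.mul_mem_left _ hM1) hw
  rw [if_pos c1', if_pos c2'] at h
  rw [if_pos c1', if_pos c2', if_pos c1, if_pos c2]
  have hγα : ∀ a : OK, a - gal σ a = γ → quadSym (span {gal σ a}) a = quadSym (span {gal σ a}) γ := fun a ha =>
    quadSym_congr (by rw [← ha, sub_sub_cancel]; exact mem_span_singleton_self _)
  rw [hγα α' eα'] at h ⊢
  rw [hγα α eα]
  obtain ⟨𝔠, 𝔣, e𝔳, hc, hf⟩ := exists_part_isCoprime F nv
  have nc : 𝔠 ≠ ⊥ := fun h => nv (by rw [e𝔳, h]; simp)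
  have hcF : IsCoprime (𝔮 * 𝔠) F := hq.mul_left hc
  have nqc : 𝔮 * 𝔠 ≠ ⊥ := mul_ne_zero nq nc
  have eγ : span {γ} = (𝔮 * 𝔠) * 𝔣 := by rw [hqv, e𝔳]; ring
  have galF : ∀ a : OK, IsCoprime (span {a}) F → IsCoprime (span {gal σ a}) F := by
    intro a ha
    have := isCoprime_galMap (τ := σ) ha
    rwa [galMap_span, hFdef, galMap_span_natCast] at this
  have gpos := hα.gal σ
  have gpos' := hα'.gal σ
  have g0 := gpos.ne_zero ι
  have g0' := gpos'.ne_zero ι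
  have hcop' : IsCoprime (span {gal σ α'}) (span {γ}) := by
    have : quadSym (span {gal σ α'}) γ ≠ 0 := by exact_mod_cast h
    exact ((quadSym_ne_zero_iff (by simpa using g0')).1 this).symm
  have hV : quadSym 𝔠 (gal σ α) = quadSym 𝔠 (gal σ α') := quadSym_congr (Ideal.le_of_dvd ⟨𝔣, e𝔳⟩ hv1)
  have hcq' : IsCoprime (span {gal σ α'}) (𝔮 * 𝔠) := hcop'.of_isCoprime_of_dvd_right ⟨𝔣, eγ⟩
  have hV' : quadSym 𝔠 (gal σ α') ≠ 0 := (quadSym_ne_zero_iff nc).2 (hcq'.of_isCoprime_of_dvd_right ⟨𝔮, mul_comm _ _⟩)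
  have hQ' : quadSym 𝔮 (gal σ α') ≠ 0 := (quadSym_ne_zero_iff nq).2 (hcq'.of_isCoprime_of_dvd_right ⟨𝔠, rfl⟩)
  have hInt : quadSym (span {gal σ α}) γ = quadSym (span {gal σ α'}) γ * quadSym 𝔮 (gal σ α') * quadSym 𝔮 (gal σ α) := by
    by_cases hcop : IsCoprime (span {gal σ α}) (span {γ})
    · have h1 := quadSym_reciprocity ι hF hγ g0 g0' eγ hcF hf ((totPos_iff ι _).1 gpos) ((totPos_iff ι _).1 gpos') hcop hcop'
        (galF _ c1.2) (galF _ c1'.2) hFF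
      rw [quadSym_mul_left nq nc, quadSym_mul_left nq nc, hV] at h1
      have hcq : IsCoprime (span {gal σ α}) (𝔮 * 𝔠) := hcop.of_isCoprime_of_dvd_right ⟨𝔣, eγ⟩
      have hQ := quadSym_sq ((quadSym_ne_zero_iff nq).2 (hcq.of_isCoprime_of_dvd_right ⟨𝔠, rfl⟩))
      have h2 : quadSym (span {gal σ α}) γ * quadSym 𝔮 (gal σ α) = quadSym (span {gal σ α'}) γ * quadSym 𝔮 (gal σ α') :=
        mul_right_cancel₀ hV' (by linear_combination h1)
      linear_combination quadSym 𝔮 (gal σ α) * h2 - quadSym (span {gal σ α}) γ * hQ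
    · rw [(quadSym_eq_zero_iff (by simpa using g0)).2 fun h1 => hcop h1.symm]
      have : quadSym 𝔮 (gal σ α) = 0 := by
        by_contra h1
        apply hcop
        rw [eγ]
        have h2 : IsCoprime (span {gal σ α}) 𝔮 := (quadSym_ne_zero_iff nq).1 h1
        have h3 : IsCoprime (span {gal σ α}) 𝔠 := (quadSym_ne_zero_iff nc).1 (by rw [hV]; exact hV')
        refine (h2.mul_right h3).mul_right ?_
        by_contra h4
        obtain ⟨𝔭, hp, hle⟩ := Ideal.exists_le_maximal _ fun h5 => h4 (isCoprime_iff_sup_eq.2 h5)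
        have hp0 : 𝔭 ≠ ⊥ := fun h5 => by
          have : gal σ α ∈ 𝔭 := hle (Ideal.mem_sup_left (mem_span_singleton_self _))
          rw [h5] at this
          exact g0 (by simpa using this)
        have h6 := hf 𝔭 (prime_of_isPrime hp0 hp.isPrime) (dvd_iff_le.2 (le_sup_right.trans hle))
        have h7 := isCoprime_iff_sup_eq.1 (galF _ c1.2)
        exact hp.ne_top (eq_top_iff.2 (h7 ▸ sup_le (le_sup_left.trans hle) (Ideal.le_of_dvd h6)))
      rw [this, mul_zero]
  rw [hInt]
  push_cast
  ring

/-- Cancellation along a coset of `ℤ`. -/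
theorem abs_sum_fibre_le [IsGalois ℚ K] (ι : K →+* ℝ) (hunits : UnitsSq K)
    {σ : Gal(K/ℚ)} {𝔐 : IK} {μ : OK} {f : ℕ} (hf0 : f ≠ 0) (hF : recMod K ∣ span {(f : OK)})
    (hFM : 𝔐 ∣ span {(f : OK)}) (hF2 : span {(2 : OK)} ∣ span {(f : OK)}) {𝔡 : IK} (h𝔡 : 𝔡 ≠ ⊥)
    {α γ : OK} (hα : TotPos α) (eα : α - gal σ α = γ) (hγ : γ ≠ 0) {q u : ℕ} (hqu : absNorm (span {γ}) = q * u)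
    (hq : Squarefree q) (hcop : q.Coprime u) (hqD : q.Coprime (f * absNorm 𝔡)) (hq1 : q ≠ 1) (L : ℕ) {B : ℝ}
    (hB : ∀ χ : DirichletCharacter ℤ q, χ ≠ 1 → ∀ r : ℕ, r.Coprime q → ∀ (b : ℤ), ∀ J ≤ L,
      |∑ j ∈ range J, ((χ ((b + r * j : ℤ) : ZMod q) : ℤ) : ℝ)| ≤ B) :
    |∑ a ∈ range L, congTerm σ 𝔐 μ f 𝔡 (span {α + (a : OK)})| ≤ (f * f * absNorm 𝔡 * u : ℕ) * B := by
  have hu0 : u ≠ 0 := by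
    rintro rfl
    rw [mul_zero, Ideal.absNorm_eq_zero_iff, span_singleton_eq_bot] at hqu
    exact hγ hqu
  obtain ⟨𝔮, 𝔳, e, hNq, hNv⟩ := exists_coprime_ideal_factors hqu hq.ne_zero hu0 hcop
  have hqF : IsCoprime 𝔮 (span {(f : OK)}) := by
    have h1 : IsCoprime (span {(q : OK)}) (span {(f : OK)}) := by
      rw [Ideal.isCoprime_span_singleton_iff]
      simpa using (Nat.isCoprime_iff_coprime.2 (hqD.coprime_dvd_right ⟨_, rfl⟩)).map (Int.castRingHom OK)
    exact (h1.symm.of_isCoprime_of_dvd_right (hNq ▸ dvd_span_absNorm 𝔮)).symm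
  obtain ⟨χ, hχ, hχ1, hrep⟩ := exists_dirichletCharacter hNq hq (hqF.of_isCoprime_of_dvd_right hF2)
  obtain ⟨b, hb⟩ := hrep (gal σ α)
  set r := f * f * absNorm 𝔡 * u with hr
  have hr0 : 0 < r := by
    have := absNorm_pos h𝔡
    have := Nat.pos_of_ne_zero hf0
    have := Nat.pos_of_ne_zero hu0
    positivity
  have hrq : r.Coprime q := by
    have h1 := (Nat.Coprime.coprime_dvd_right ⟨_, rfl⟩ hqD : q.Coprime f)
    have h2 := (Nat.Coprime.coprime_dvd_right (Dvd.intro_left _ rfl) hqD : q.Coprime (absNorm 𝔡))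
    exact (((h1.mul_right h1).mul_right h2).mul_right hcop).symm
  have hval : ∀ a : ℕ, quadSym 𝔮 (gal σ (α + (a : OK))) = χ ((b + a : ℤ) : ZMod q) := by
    intro a
    rw [hχ]
    refine quadSym_congr ?_
    rw [map_add, map_natCast]
    push_cast
    rwa [add_sub_add_right_eq_sub]
  refine abs_sum_range_mod_le hr0 _ L fun ρ hρ J hJ => ?_
  by_cases hex : ∃ j0 : ℕ, congTerm σ 𝔐 μ f 𝔡 (span {α + ((ρ + r * j0 : ℕ) : OK)}) ≠ 0
  swap
  · push Not at hex
    rw [sum_eq_zero fun j _ => hex j, abs_zero]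
    exact (abs_nonneg _).trans (hB χ (hχ1 hq1) r hrq 0 J hJ)
  obtain ⟨j0, hj0⟩ := hex
  have hshift : ∀ a : ℕ, (α + (a : OK)) - gal σ (α + (a : OK)) = γ := fun a => by rw [← eα, map_add, map_natCast]; ring
  have h1 : ∀ j : ℕ, congTerm σ 𝔐 μ f 𝔡 (span {α + ((ρ + r * j : ℕ) : OK)}) =
      congTerm σ 𝔐 μ f 𝔡 (span {α + ((ρ + r * j0 : ℕ) : OK)}) * quadSym 𝔮 (gal σ (α + ((ρ + r * j0 : ℕ) : OK))) *
        (χ (((b + ρ) + r * j : ℤ) : ZMod q) : ℤ) := by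
    intro j
    rw [congTerm_class ι hunits hF hFM (hα.add_natCast ι _) (hα.add_natCast ι _) (hshift _) (hshift _) hγ e hqF
      (z := (j : OK) - j0) ?_ hj0, hval (ρ + r * j)]
    · congr 4
      push_cast
      ring
    · rw [hNv, ← hr]
      push_cast
      ring
  rw [sum_congr rfl fun j _ => h1 j, ← mul_sum, abs_mul]
  refine (mul_le_of_le_one_left (abs_nonneg _) ?_).trans (hB χ (hχ1 hq1) r hrq (b + ρ) J hJ)
  rw [abs_mul]
  exact mul_le_one₀ (abs_congTerm_le _ _ _ _ _ _) (abs_nonneg _) (abs_quadSym_real_le _ _)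

theorem gal_fixed_eq_intCast [IsGalois ℚ K] {σ : Gal(K/ℚ)} (hσ : ∀ τ : Gal(K/ℚ), τ ∈ zpowers σ) {a : OK}
    (h : gal σ a = a) : ∃ k : ℤ, a = (k : OK) := by
  have h0 : σ (a : K) = a := by rw [← coe_gal, h]
  have h1 : (a : K) ∈ Set.range (algebraMap ℚ K) := by
    rw [IsGalois.mem_range_algebraMap_iff_fixed]
    intro τ
    have h2 : zpowers σ ≤ MulAction.stabilizer (Gal(K/ℚ)) (a : K) :=
      (Subgroup.zpowers_le).2 (MulAction.mem_stabilizer_iff.2 h0)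
    exact MulAction.mem_stabilizer_iff.1 (h2 (hσ τ))
  obtain ⟨r, hr⟩ := h1
  have h3 : IsIntegral ℤ r := by
    rw [← isIntegral_algebraMap_iff (algebraMap ℚ K).injective, hr]
    exact a.isIntegral_coe
  obtain ⟨k, hk⟩ := IsIntegrallyClosed.isIntegral_iff.1 h3
  refine ⟨k, RingOfIntegers.ext ?_⟩
  rw [← hr, ← hk]
  simp

/-- The sum over ideals of bounded norm splits into sums over translates by natural numbers. -/
theorem exists_fibres [IsGalois ℚ K] (ι : K →+* ℝ) {σ : Gal(K/ℚ)} (hσ : ∀ τ : Gal(K/ℚ), τ ∈ zpowers σ) :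
    ∃ C : ℝ, 1 ≤ C ∧ ∀ x t : ℝ, t ≤ x → ∃ (Γ : Finset OK) (A : OK → OK) (L : OK → ℕ),
      (∀ γ ∈ Γ, trSum ι γ = 0 ∧ (∀ τ, |cj ι τ γ| ≤ 2 * (C * x ^ (1 / (finrank ℚ K : ℝ)))) ∧ TotPos (A γ) ∧
        A γ - gal σ (A γ) = γ ∧ (L γ : ℝ) ≤ C * x ^ (1 / (finrank ℚ K : ℝ)) + 1) ∧
      ∀ T : IK → ℝ, (∀ 𝔠, T 𝔠 ≠ 0 → ∃ α, TotPos α ∧ span {α} = 𝔠) →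
        ∑ 𝔠 ∈ idl K t, T 𝔠 = ∑ γ ∈ Γ, ∑ a ∈ range (L γ), T (span {A γ + (a : OK)}) := by
  obtain ⟨C, hC, hcj⟩ := IsMinimalGen.exists_cj_le ι
  refine ⟨C, hC, fun x t htx => ?_⟩
  set Y := C * x ^ (1 / (finrank ℚ K : ℝ)) with hY
  have hbd : ∀ a, IsMinimalGen ι a → (absNorm (span {a}) : ℝ) ≤ t → ∀ τ, |cj ι τ a| ≤ Y := fun a ha hN τ =>
    (hcj a ha τ).trans (mul_le_mul_of_nonneg_left (rpow_le_rpow (cast_nonneg _) (hN.trans htx) (by positivity)) (by linarith))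
  set S : Finset OK := ((finite_cj_le ι Y).subset (t := {a | IsMinimalGen ι a ∧ (absNorm (span {a}) : ℝ) ≤ t})
    fun a ha τ => hbd a ha.1 ha.2 τ).toFinset with hS
  have mS : ∀ a, a ∈ S ↔ IsMinimalGen ι a ∧ (absNorm (span {a}) : ℝ) ≤ t := fun a => by rw [hS, Set.Finite.mem_toFinset]; rfl
  set g : OK → OK := fun a => a - gal σ a with hg
  have gadd : ∀ (a : OK) (k : ℕ), g (a + (k : OK)) = g a := fun a k => by simp only [hg, map_add, map_natCast]; ring
  have hfib : ∀ γ ∈ S.image g, ∃ (α : OK) (L : ℕ), α ∈ S ∧ g α = γ ∧ (L : ℝ) ≤ Y + 1 ∧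
      S.filter (fun a => g a = γ) = (range L).image fun a : ℕ => α + (a : OK) := by
    intro γ hγ
    obtain ⟨a1, ha1, rfl⟩ := mem_image.1 hγ
    obtain ⟨α, hα, hmin⟩ := Finset.exists_min_image (S.filter fun a => g a = g a1) (cj ι 1) ⟨a1, by simp [ha1]⟩
    rw [mem_filter] at hα
    have hlt : ∀ k : ℕ, α + (k : OK) ∈ S → (k : ℝ) ≤ Y := by
      intro k hk
      have h1 := (le_abs_self _).trans (hbd _ ((mS _).1 hk).1 ((mS _).1 hk).2 1)
      rw [map_add, map_natCast] at h1
      have h2 := (totPos_iff ι _).1 ((mS _).1 hα.1).1.1 1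
      linarith
    have hex : ∃ k : ℕ, α + (k : OK) ∉ S := by
      refine ⟨⌊Y⌋₊ + 1, fun h => ?_⟩
      have := hlt _ h
      have := Nat.lt_floor_add_one Y
      push_cast at *
      linarith
    have hdown : ∀ k : ℕ, k < Nat.find hex ↔ α + (k : OK) ∈ S := by
      refine fun k => ⟨fun h => by_contra fun h1 => Nat.find_min hex h h1, fun h => ?_⟩
      by_contra! h1
      refine Nat.find_spec hex ((mS _).2 ⟨((mS _).1 hα.1).1.add_natCast ι _, ?_⟩)
      exact le_trans (by exact_mod_cast absNorm_span_add_natCast_le ι ((mS _).1 hα.1).1.1 h1) ((mS _).1 h).2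
    refine ⟨α, Nat.find hex, hα.1, hα.2, ?_, ?_⟩
    · have h0 : Nat.find hex ≠ 0 := fun h0 => (Nat.find_eq_zero hex).1 h0 (by simpa using hα.1)
      have := hlt (Nat.find hex - 1) ((hdown _).1 (by omega))
      rw [cast_pred (by omega)] at this
      linarith
    · ext a
      rw [mem_filter, mem_image]
      constructor
      · rintro ⟨haS, ha⟩
        have hfix : gal σ (a - α) = a - α := by
          have : g a = g α := ha.trans hα.2.symm
          rw [map_sub]
          simp only [hg] at this
          linear_combination -this
        obtain ⟨k, hk⟩ := gal_fixed_eq_intCast hσ hfix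
        have h1 := hmin a (mem_filter.2 ⟨haS, ha⟩)
        have ea : a = α + (k : OK) := by rw [← hk]; ring
        have h2 : 0 ≤ k := by
          rw [ea, map_add, map_intCast] at h1
          have : (0 : ℝ) ≤ k := by linarith
          exact_mod_cast this
        lift k to ℕ using h2
        rw [Int.cast_natCast] at ea
        exact ⟨k, mem_range.2 ((hdown k).2 (ea ▸ haS)), ea.symm⟩
      · rintro ⟨k, hk, rfl⟩
        exact ⟨(hdown k).1 (mem_range.1 hk), by rw [gadd, hα.2]⟩
  choose! A L hA1 hA2 hA3 hA4 using hfib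
  refine ⟨S.image g, A, L, fun γ hγ => ⟨?_, fun τ => ?_, ((mS _).1 (hA1 γ hγ)).1.1, hA2 γ hγ, hA3 γ hγ⟩, fun T hT => ?_⟩
  · rw [← hA2 γ hγ, trSum]
    simp only [hg, map_sub, cj_gal, sum_sub_distrib]
    rw [sub_eq_zero]
    exact (sum_equiv (Equiv.mulRight σ) _ _ fun τ => rfl).symm
  · rw [← hA2 γ hγ]
    simp only [hg, map_sub, cj_gal]
    have h := hbd _ ((mS _).1 (hA1 γ hγ)).1 ((mS _).1 (hA1 γ hγ)).2
    calc |cj ι τ (A γ) - cj ι (τ * σ) (A γ)| ≤ |cj ι τ (A γ)| + |cj ι (τ * σ) (A γ)| := abs_sub _ _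
      _ ≤ 2 * Y := by linarith [h τ, h (τ * σ)]
  · have h1 : ∑ 𝔠 ∈ idl K t, T 𝔠 = ∑ a ∈ S, T (span {a}) := by
      symm
      refine Finset.sum_of_injOn (fun a => span {a}) (fun a ha b hb h => ?_) (fun a ha => ?_) (fun 𝔠 hc hn => ?_) fun _ _ => rfl
      · exact ((mS a).1 ha).1.eq_of_span_eq ι ((mS b).1 hb).1 h
      · exact mem_idl.2 ⟨by simpa using ((mS a).1 ha).1.1.ne_zero ι, ((mS a).1 ha).2⟩
      · by_contra h
        obtain ⟨α, hα, rfl⟩ := hT 𝔠 h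
        obtain ⟨b, hb, e⟩ := exists_isMinimalGen ι hα
        exact hn ⟨b, (mS b).2 ⟨hb, e ▸ (mem_idl.1 hc).2⟩, e⟩
    rw [h1, ← sum_fiberwise_of_maps_to (g := g) (t := S.image g) fun a ha => mem_image_of_mem _ ha]
    refine sum_congr rfl fun γ hγ => ?_
    rw [hA4 γ hγ, sum_image fun a _ b _ h => by simpa using h]

/-- Counting elements of trace zero in an ideal by packing. -/
theorem card_le_prod_packing [IsGalois ℚ K] (ι : K →+* ℝ) (τ0 : Gal(K/ℚ)) {𝔤 : IK} {s : ℝ} (hs : 0 < s)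
    (hsN : (card (Gal(K/ℚ)) * s) ^ card (Gal(K/ℚ)) ≤ absNorm 𝔤) (Y : (Gal(K/ℚ)) → ℝ) (S : Finset OK)
    (hS : ∀ γ ∈ S, γ ∈ 𝔤 ∧ trSum ι γ = 0 ∧ ∀ τ, |cj ι τ γ| ≤ Y τ) (hY : ∀ τ, 0 ≤ Y τ) :
    (S.card : ℝ) ≤ ∏ τ ∈ univ.erase τ0, (2 * (Y τ / s) + 2) := by
  set N := card (Gal(K/ℚ)) with hN
  set P : Finset ((Gal(K/ℚ)) → ℤ) := piFinset fun τ => if τ = τ0 then {0} else Icc ⌊-(Y τ / s)⌋ ⌊Y τ / s⌋ with hP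
  set φ : OK → (Gal(K/ℚ)) → ℤ := fun γ τ => if τ = τ0 then 0 else ⌊cj ι τ γ / s⌋ with hφ
  have h1 : S.card ≤ P.card := by
    refine card_le_card_of_injOn φ (fun γ hγ => mem_piFinset.2 fun τ => ?_) fun γ hγ γ' hγ' h => ?_
    · simp only [hφ]
      split_ifs with h
      · simp
      · have h2 := abs_le.1 ((hS γ hγ).2.2 τ)
        rw [mem_Icc]
        refine ⟨Int.floor_le_floor ?_, Int.floor_le_floor ?_⟩
        · rw [← neg_div]; gcongr; exact h2.1
        · gcongr; exact h2.2
    · by_contra hne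
      set η := γ - γ' with hη
      have hη0 : η ≠ 0 := sub_ne_zero.2 hne
      have h2 : ∀ τ, τ ≠ τ0 → |cj ι τ η| < s := by
        intro τ hτ
        have h3 := congrFun h τ
        simp only [hφ, if_neg hτ] at h3
        have h4 := Int.abs_sub_lt_one_of_floor_eq_floor h3
        rwa [← sub_div, ← map_sub, abs_div, abs_of_pos hs, div_lt_one hs] at h4
      have h3 : cj ι τ0 η = -∑ τ ∈ univ.erase τ0, cj ι τ η := by
        have h4 : trSum ι η = 0 := by
          have h5 : trSum ι γ = trSum ι η + trSum ι γ' := by rw [← trSum_add, hη, sub_add_cancel]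
          rw [(hS γ hγ).2.1, (hS γ' hγ').2.1] at h5
          linarith
        rw [trSum, ← Finset.add_sum_erase _ _ (mem_univ τ0)] at h4
        linarith
      have hN1 : 1 ≤ N := card_pos
      have h4 : ∀ τ, |cj ι τ η| < N * s := by
        intro τ
        by_cases hτ : τ = τ0
        · rw [hτ, h3, abs_neg]
          calc |∑ τ ∈ univ.erase τ0, cj ι τ η| ≤ ∑ τ ∈ univ.erase τ0, |cj ι τ η| := abs_sum_le_sum_abs _ _
            _ ≤ ∑ τ ∈ univ.erase τ0, s := sum_le_sum fun τ hτ => (h2 τ (ne_of_mem_erase hτ)).le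
            _ = (N - 1) * s := by
              rw [sum_const, card_erase_of_mem (mem_univ _), card_univ, nsmul_eq_mul, cast_pred hN1]
            _ < N * s := by linarith
        · refine (h2 τ hτ).trans_le (le_mul_of_one_le_left hs.le (by exact_mod_cast hN1))
      have h5 : (absNorm 𝔤 : ℝ) ≤ absNorm (span {η}) := by
        exact_mod_cast absNorm_le_of_dvd (by simpa using hη0)
          (dvd_span_singleton.2 (𝔤.sub_mem (hS γ hγ).1 (hS γ' hγ').1))
      rw [absNorm_span_eq ι, abs_prod] at h5
      have h6 : ∏ τ, |cj ι τ η| < ∏ τ : Gal(K/ℚ), (N * s) :=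
        Finset.prod_lt_prod_of_nonempty (fun τ _ => abs_pos.2 ((map_ne_zero_iff _ (cj_injective ι τ)).2 hη0))
          (fun τ _ => h4 τ) univ_nonempty
      rw [prod_const, card_univ] at h6
      linarith
  refine (cast_le.2 h1).trans ?_
  rw [hP, card_piFinset, Nat.cast_prod, ← mul_prod_erase _ _ (mem_univ τ0), if_pos rfl]
  simp only [Finset.card_singleton, cast_one, one_mul]
  refine Finset.prod_le_prod (fun _ _ => cast_nonneg _) fun τ hτ => ?_
  rw [if_neg (ne_of_mem_erase hτ), Int.card_Icc]
  have h7 : 0 ≤ Y τ / s := div_nonneg (hY τ) hs.le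
  have h8 : ⌊-(Y τ / s)⌋ ≤ ⌊Y τ / s⌋ := Int.floor_le_floor (by linarith)
  have h9 : (((⌊Y τ / s⌋ + 1 - ⌊-(Y τ / s)⌋).toNat : ℤ) : ℝ) = (⌊Y τ / s⌋ : ℝ) + 1 - (⌊-(Y τ / s)⌋ : ℝ) := by
    rw [Int.toNat_of_nonneg (by omega)]; push_cast; ring
  rw [Int.cast_natCast] at h9
  rw [h9]
  linarith [Int.floor_le (Y τ / s), Int.lt_floor_add_one (-(Y τ / s))]

theorem card_divisors_le (K : Type*) [Field K] [NumberField K] {ε : ℝ} (hε : 0 < ε) :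
    ∃ C : ℝ, 1 ≤ C ∧ ∀ D : ℕ, D ≠ 0 → (D.divisors.card : ℝ) ≤ C * (D : ℝ) ^ ε := by
  have hn : 0 < finrank ℚ K := finrank_pos
  have hn' : (0 : ℝ) < finrank ℚ K := by exact_mod_cast hn
  obtain ⟨C, hC, h⟩ := card_divs_le (K := K) (ε := ε / finrank ℚ K) (by positivity)
  have hrk : finrank ℤ (𝓞 K) = finrank ℚ K := RingOfIntegers.rank K
  refine ⟨C, hC, fun D hD => ?_⟩
  have h0 : span {(D : (𝓞 K))} ≠ ⊥ := span_natCast_ne_bot hD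
  have h1 : D.divisors.card ≤ (divs (span {(D : (𝓞 K))})).card := by
    refine card_le_card_of_injOn (fun g : ℕ => span {(g : (𝓞 K))})
      (fun g hg => (mem_divs h0).2 (span_natCast_dvd (Nat.dvd_of_mem_divisors hg))) fun a _ b _ hab => ?_
    have h2 := congrArg absNorm hab
    simp only [Ideal.absNorm_span_natCast, hrk] at h2
    exact Nat.pow_left_injective hn.ne' h2
  refine (cast_le.2 h1).trans ((h _ h0).trans (le_of_eq ?_))
  rw [Ideal.absNorm_span_natCast, hrk, cast_pow, ← rpow_natCast, ← rpow_mul (cast_nonneg _)]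
  congr 2
  field_simp

theorem card_trace_zero_dvd_le [IsGalois ℚ K] (ι : K →+* ℝ) (hn : 3 ≤ finrank ℚ K) : ∃ C : ℝ, 1 ≤ C ∧
    ∀ (Y : ℝ) (𝔳 : IK) (S : Finset OK), 0 ≤ Y → 𝔳 ≠ ⊥ →
      (∀ γ ∈ S, γ ≠ 0 ∧ γ ∈ 𝔳 ∧ trSum ι γ = 0 ∧ ∀ τ, |cj ι τ γ| ≤ Y) →
      (S.card : ℝ) ≤ C * Y ^ (finrank ℚ K - 1) * (absNorm 𝔳 : ℝ) ^ (-(2 / 3) : ℝ) := by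
  have hcard : card (Gal(K/ℚ)) = finrank ℚ K := by
    rw [← Nat.card_eq_fintype_card, card_aut_eq_finrank]
  set n := finrank ℚ K with hn_def
  have hn0 : (3 : ℝ) ≤ n := by exact_mod_cast hn
  refine ⟨(4 * n) ^ (n - 1), one_le_pow₀ (by linarith), fun Y 𝔳 S hY h𝔳 h => ?_⟩
  have hN := one_le_absNorm h𝔳
  set N : ℝ := ((absNorm 𝔳 : ℕ) : ℝ)
  rcases S.eq_empty_or_nonempty with rfl | ⟨γ, hγ⟩
  · simp only [Finset.card_empty, Nat.cast_zero]; positivity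
  obtain ⟨g0, gv, -, gY⟩ := h γ hγ
  have h1 : N ≤ Y ^ n := by
    have h2 : N ≤ absNorm (span {γ}) := by
      exact absNorm_le_of_dvd (by simpa using g0) (dvd_span_singleton.2 gv)
    rw [absNorm_span_eq ι, abs_prod] at h2
    refine h2.trans ((Finset.prod_le_prod (fun _ _ => abs_nonneg _) fun τ _ => gY τ).trans_eq ?_)
    rw [prod_const, card_univ, hcard]
  set R := N ^ (1 / (n : ℝ)) with hR
  have hRn : R ^ n = N := by
    rw [hR, ← rpow_natCast, ← rpow_mul (by linarith), one_div_mul_cancel (by linarith), rpow_one]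
  have hR0 : 0 < R := by positivity
  have hRY : R ≤ Y := by
    by_contra! h2
    have := pow_lt_pow_left₀ h2 hY (by omega : n ≠ 0)
    linarith
  have h2 := card_le_prod_packing ι 1 (𝔤 := 𝔳) (s := R / n) (by positivity) (by
    rw [hcard, mul_div_cancel₀ _ (by linarith : (n : ℝ) ≠ 0), hRn]) (fun _ => Y) S (fun γ hγ => (h γ hγ).2) fun _ => hY
  refine h2.trans ?_
  rw [prod_const, card_erase_of_mem (mem_univ _), card_univ, hcard]
  have h3 : 2 * (Y / (R / n)) + 2 ≤ 4 * n * Y * R⁻¹ := by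
    have h4 : 1 ≤ Y / (R / n) := by
      rw [le_div_iff₀ (by positivity), one_mul]
      exact (div_le_self hR0.le (by linarith)).trans hRY
    calc 2 * (Y / (R / n)) + 2 ≤ 4 * (Y / (R / n)) := by linarith
      _ = _ := by field_simp
  refine (pow_le_pow_left₀ (by positivity) h3 _).trans ?_
  rw [mul_pow, mul_pow]
  refine mul_le_mul_of_nonneg_left ?_ (by positivity)
  rw [hR, ← Real.rpow_neg (by linarith), ← rpow_natCast, ← rpow_mul (by linarith)]
  refine rpow_le_rpow_of_exponent_le hN ?_
  rw [cast_pred (by omega)]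
  have : (1 : ℝ) / n ≤ 1 / 3 := one_div_le_one_div_of_le (by norm_num) hn0
  have h5 : (-(1 / (n : ℝ))) * (n - 1) = -1 + 1 / n := by field_simp; ring
  linarith

theorem card_trace_zero_le [IsGalois ℚ K] (ι : K →+* ℝ) (hn : 3 ≤ finrank ℚ K) : ∃ C : ℝ, 1 ≤ C ∧
    ∀ (Y H : ℝ) (S : Finset OK), 1 ≤ Y → 1 ≤ H →
      (∀ γ ∈ S, trSum ι γ = 0 ∧ (∀ τ, |cj ι τ γ| ≤ Y) ∧ ∃ τ, |cj ι τ γ| ≤ H) →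
      (S.card : ℝ) ≤ C * H * Y ^ (finrank ℚ K - 2) := by
  have hcard : card (Gal(K/ℚ)) = finrank ℚ K := by
    rw [← Nat.card_eq_fintype_card, card_aut_eq_finrank]
  set n := finrank ℚ K with hn_def
  have hn0 : (3 : ℝ) ≤ n := by exact_mod_cast hn
  refine ⟨n * (4 * n) ^ (n - 1), one_le_mul_of_one_le_of_one_le (by linarith) (one_le_pow₀ (by linarith)), fun Y H S hY hH h => ?_⟩
  have h1 : S ⊆ univ.biUnion fun τ1 => S.filter fun γ => |cj ι τ1 γ| ≤ H := by
    intro γ hγ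
    obtain ⟨τ, hτ⟩ := (h γ hγ).2.2
    exact Finset.mem_biUnion.2 ⟨τ, mem_univ _, mem_filter.2 ⟨hγ, hτ⟩⟩
  have h2 : ∀ τ1, ((S.filter fun γ => |cj ι τ1 γ| ≤ H).card : ℝ) ≤ (4 * n) ^ (n - 1) * (H * Y ^ (n - 2)) := by
    intro τ1
    have : Nontrivial (Gal(K/ℚ)) := Fintype.one_lt_card_iff_nontrivial.1 (by omega)
    obtain ⟨τ0, h01⟩ := exists_ne τ1
    refine (card_le_prod_packing ι τ0 (𝔤 := ⊤) (s := 1 / n) (by positivity) (by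
      rw [hcard, mul_one_div_cancel (by linarith), one_pow, absNorm_top, cast_one])
      (fun τ => if τ = τ1 then H else Y) _ (fun γ hγ => ⟨Submodule.mem_top, ?_⟩) fun τ => by split_ifs <;> linarith).trans ?_
    · rw [mem_filter] at hγ
      refine ⟨(h γ hγ.1).1, fun τ => ?_⟩
      split_ifs with h3
      · exact h3 ▸ hγ.2
      · exact (h γ hγ.1).2.1 τ
    · have hb : ∀ Z : ℝ, 1 ≤ Z → 2 * (Z / (1 / n)) + 2 ≤ 4 * n * Z := by
        intro Z hZ
        rw [div_div_eq_mul_div, div_one]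
        nlinarith
      calc ∏ τ ∈ univ.erase τ0, (2 * ((if τ = τ1 then H else Y) / (1 / (n : ℝ))) + 2)
          ≤ ∏ τ ∈ univ.erase τ0, (4 * n * (if τ = τ1 then H else Y)) := by
            refine Finset.prod_le_prod (fun τ _ => ?_) fun τ _ => hb _ ?_
            · split_ifs <;> positivity
            · split_ifs <;> assumption
        _ = _ := by
            rw [prod_mul_distrib, prod_const, card_erase_of_mem (mem_univ _), card_univ, hcard,
              ← mul_prod_erase _ _ (mem_erase.2 ⟨h01.symm, mem_univ τ1⟩), if_pos rfl,
              prod_congr rfl fun τ hτ => if_neg (ne_of_mem_erase hτ), prod_const,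
              card_erase_of_mem (mem_erase.2 ⟨h01.symm, mem_univ τ1⟩),
              card_erase_of_mem (mem_univ _), card_univ, hcard, Nat.sub_sub]
  calc (S.card : ℝ) ≤ ∑ τ1 : Gal(K/ℚ), ((S.filter fun γ => |cj ι τ1 γ| ≤ H).card : ℝ) := by
        exact_mod_cast (card_le_card h1).trans Finset.card_biUnion_le
    _ ≤ ∑ τ1 : Gal(K/ℚ), (4 * n) ^ (n - 1) * (H * Y ^ (n - 2)) := sum_le_sum fun τ1 _ => h2 τ1
    _ = _ := by rw [sum_const, card_univ, hcard, nsmul_eq_mul]; ring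

/-- Few elements of trace zero have a large powerful part. -/
theorem card_large_part_le [IsGalois ℚ K] (ι : K →+* ℝ) (hn : 3 ≤ finrank ℚ K) : ∃ C : ℝ, 1 ≤ C ∧
    ∀ (Y G : ℝ) (D : ℕ) (S : Finset OK), 0 ≤ Y → 1 ≤ G → D ≠ 0 →
      (∀ γ ∈ S, γ ≠ 0 ∧ trSum ι γ = 0 ∧ (∀ τ, |cj ι τ γ| ≤ Y) ∧ ∃ (𝔳 : IK) (g b c : ℕ), 𝔳 ∣ span {γ} ∧
        absNorm 𝔳 = g * (b ^ 3 * c ^ 2) ∧ g ∣ D ∧ G ≤ absNorm 𝔳) →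
      (S.card : ℝ) ≤ C * D.divisors.card * Y ^ (finrank ℚ K - 1) * G ^ (-(1 / 8) : ℝ) := by
  obtain ⟨C1, hC1, h1⟩ := card_trace_zero_dvd_le ι hn
  obtain ⟨C2, hC2, h2⟩ := card_norm_eq_le (K := K) (ε := 1 / 48) (by norm_num)
  have s1 : Summable fun b : ℕ => (b : ℝ) ^ (-(25 / 16) : ℝ) := Real.summable_nat_rpow.2 (by norm_num)
  have s2 : Summable fun c : ℕ => (c : ℝ) ^ (-(25 / 24) : ℝ) := Real.summable_nat_rpow.2 (by norm_num)
  set Z1 := ∑' b : ℕ, (b : ℝ) ^ (-(25 / 16) : ℝ) with hZ1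
  set Z2 := ∑' c : ℕ, (c : ℝ) ^ (-(25 / 24) : ℝ) with hZ2
  have p1 : 1 ≤ Z1 := by simpa using s1.le_tsum 1 fun b _ => by positivity
  have p2 : 1 ≤ Z2 := by simpa using s2.le_tsum 1 fun b _ => by positivity
  refine ⟨C2 * C1 * (Z1 * Z2), one_le_mul_of_one_le_of_one_le (one_le_mul_of_one_le_of_one_le hC2 hC1)
    (one_le_mul_of_one_le_of_one_le p1 p2), fun Y G D S hY hG hD hS => ?_⟩
  choose! 𝔳 g b c hdvd hN hg hG' using fun γ hγ => (hS γ hγ).2.2.2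
  set M := S.sup b + S.sup c + 1 with hM
  set W : ℕ × ℕ × ℕ → ℝ := fun p => C2 * C1 * Y ^ (finrank ℚ K - 1) * G ^ (-(1 / 8) : ℝ) *
    ((p.2.1 : ℝ) ^ (-(25 / 16) : ℝ) * (p.2.2 : ℝ) ^ (-(25 / 24) : ℝ)) with hW
  have hW0 : ∀ p, 0 ≤ W p := fun p => by positivity
  have hmaps : ∀ γ ∈ S, (g γ, b γ, c γ) ∈ D.divisors ×ˢ range M ×ˢ range M := by
    intro γ hγ
    have e1 : b γ ≤ S.sup b := le_sup hγ
    have e2 : c γ ≤ S.sup c := le_sup hγ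
    simp only [mem_product, Nat.mem_divisors, mem_range]
    exact ⟨⟨hg γ hγ, hD⟩, by omega, by omega⟩
  have hcount : ∀ p : ℕ × ℕ × ℕ, ((S.filter fun γ => (g γ, b γ, c γ) = p).card : ℝ) ≤ W p := by
    rintro ⟨g', b', c'⟩
    rcases (S.filter fun γ => (g γ, b γ, c γ) = (g', b', c')).eq_empty_or_nonempty with he | ⟨γ0, hγ0⟩
    · rw [he]; simpa using hW0 _
    set u := g' * (b' ^ 3 * c' ^ 2) with hu
    have hNu : ∀ γ ∈ S.filter (fun γ => (g γ, b γ, c γ) = (g', b', c')), absNorm (𝔳 γ) = u := by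
      intro γ hγ
      obtain ⟨hγ, e⟩ := mem_filter.1 hγ
      simp only [Prod.mk.injEq] at e
      rw [hN γ hγ, e.1, e.2.1, e.2.2]
    have huG : G ≤ u := by
      rw [← hNu γ0 hγ0]
      exact hG' γ0 (mem_filter.1 hγ0).1
    have hu1 : (1 : ℝ) ≤ u := hG.trans huG
    have hu0 : u ≠ 0 := by rintro h; rw [h] at hu1; norm_num at hu1
    have hg0 : g' ≠ 0 := fun h => hu0 (by rw [hu, h, zero_mul])
    have hb0 : b' ≠ 0 := fun h => hu0 (by rw [hu, h]; ring)
    have hc0 : c' ≠ 0 := fun h => hu0 (by rw [hu, h]; ring)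
    have h3 := Finset.card_eq_sum_card_image 𝔳 (S.filter fun γ => (g γ, b γ, c γ) = (g', b', c'))
    have h4 : ∀ 𝔴 ∈ (S.filter fun γ => (g γ, b γ, c γ) = (g', b', c')).image 𝔳, absNorm 𝔴 = u := by
      intro 𝔴 hw
      obtain ⟨γ, hγ, rfl⟩ := mem_image.1 hw
      exact hNu γ hγ
    rw [h3, Nat.cast_sum]
    calc _ ≤ ∑ 𝔴 ∈ (S.filter fun γ => (g γ, b γ, c γ) = (g', b', c')).image 𝔳,
          C1 * Y ^ (finrank ℚ K - 1) * (u : ℝ) ^ (-(2 / 3) : ℝ) := by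
          refine sum_le_sum fun 𝔴 hw => ?_
          rw [← h4 𝔴 hw]
          refine h1 Y 𝔴 _ hY (fun h => hu0 (by rw [← h4 𝔴 hw, h, Ideal.absNorm_bot])) fun γ hγ => ?_
          obtain ⟨m1, rfl⟩ := mem_filter.1 hγ
          have m2 := (mem_filter.1 m1).1
          exact ⟨(hS γ m2).1, dvd_span_singleton.1 (hdvd γ m2), (hS γ m2).2.1, (hS γ m2).2.2.1⟩
      _ ≤ (C2 * (u : ℝ) ^ (1 / 48 : ℝ)) * (C1 * Y ^ (finrank ℚ K - 1) * (u : ℝ) ^ (-(2 / 3) : ℝ)) := by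
          rw [sum_const, nsmul_eq_mul]
          exact mul_le_mul_of_nonneg_right (h2 u _ hu0 h4) (by positivity)
      _ = C2 * C1 * Y ^ (finrank ℚ K - 1) * ((u : ℝ) ^ (-(1 / 8) : ℝ) * (u : ℝ) ^ (-(25 / 48) : ℝ)) := by
          rw [← rpow_add (by linarith), show (-(1 / 8) + -(25 / 48) : ℝ) = 1 / 48 + -(2 / 3) by norm_num, rpow_add (by linarith)]
          ring
      _ ≤ W (g', b', c') := by
          simp only [hW]
          rw [mul_assoc (C2 * C1 * Y ^ (finrank ℚ K - 1))]
          refine mul_le_mul_of_nonneg_left (mul_le_mul (Real.rpow_le_rpow_of_nonpos (by linarith) huG (by norm_num)) ?_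
            (by positivity) (by positivity)) (by positivity)
          have hb1 : (0 : ℝ) < b' := by exact_mod_cast Nat.pos_of_ne_zero hb0
          have hc1 : (0 : ℝ) < c' := by exact_mod_cast Nat.pos_of_ne_zero hc0
          calc (u : ℝ) ^ (-(25 / 48) : ℝ) ≤ ((b' : ℝ) ^ 3 * (c' : ℝ) ^ 2) ^ (-(25 / 48) : ℝ) := by
                refine Real.rpow_le_rpow_of_nonpos (by positivity) ?_ (by norm_num)
                exact_mod_cast Nat.le_mul_of_pos_left _ (Nat.pos_of_ne_zero hg0)
            _ = _ := by
                rw [mul_rpow (by positivity) (by positivity), ← rpow_natCast, ← rpow_natCast,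
                  ← rpow_mul hb1.le, ← rpow_mul hc1.le]
                norm_num
  calc (S.card : ℝ) = ∑ p ∈ D.divisors ×ˢ range M ×ˢ range M, ((S.filter fun γ => (g γ, b γ, c γ) = p).card : ℝ) := by
        exact_mod_cast Finset.card_eq_sum_card_fiberwise hmaps
    _ ≤ ∑ p ∈ D.divisors ×ˢ range M ×ˢ range M, W p := sum_le_sum fun p _ => hcount p
    _ = D.divisors.card * (C2 * C1 * Y ^ (finrank ℚ K - 1) * G ^ (-(1 / 8) : ℝ) *
          ((∑ b ∈ range M, (b : ℝ) ^ (-(25 / 16) : ℝ)) * ∑ c ∈ range M, (c : ℝ) ^ (-(25 / 24) : ℝ))) := by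
        rw [sum_product]
        simp only [hW]
        rw [sum_const, nsmul_eq_mul, ← mul_sum, sum_product, sum_mul_sum]
    _ ≤ D.divisors.card * (C2 * C1 * Y ^ (finrank ℚ K - 1) * G ^ (-(1 / 8) : ℝ) * (Z1 * Z2)) := by
        have q1 := s1.sum_le_tsum (range M) fun b _ => by positivity
        have q2 := s2.sum_le_tsum (range M) fun b _ => by positivity
        gcongr
    _ = _ := by ring

/-- The congruence sums exhibit a power saving uniformly in the modulus. -/
theorem abs_sum_congTerm_le [IsGalois ℚ K] (ι : K →+* ℝ) (hunits : UnitsSq K)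
    (hn : 3 ≤ finrank ℚ K) {σ : Gal(K/ℚ)} (hσ : ∀ τ : Gal(K/ℚ), τ ∈ zpowers σ) {𝔐 : IK} {μ : OK}
    {f : ℕ} (hf0 : f ≠ 0) (hF : recMod K ∣ span {(f : OK)}) (hFM : 𝔐 ∣ span {(f : OK)})
    (hF2 : span {(2 : OK)} ∣ span {(f : OK)}) {δ ν : ℝ} (hδ0 : 0 < δ) (hδ1 : δ ≤ 1) (hν0 : 0 ≤ ν)
    (hν : 74 * finrank ℚ K * ν ≤ δ) (hconj : ConjectureC (finrank ℚ K) δ) {ε : ℝ} (hε : 0 < ε) :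
    ∃ C : ℝ, 1 ≤ C ∧ ∀ (x t : ℝ) (𝔡 : IK), 1 ≤ x → t ≤ x → 𝔡 ≠ ⊥ → (absNorm 𝔡 : ℝ) ≤ x ^ (4 * ν) →
      |∑ 𝔠 ∈ idl K t, congTerm σ 𝔐 μ f 𝔡 𝔠| ≤ C * x ^ (1 - 5 * ν + ε) := by
  have hcard : card (Gal(K/ℚ)) = finrank ℚ K := by
    rw [← Nat.card_eq_fintype_card, card_aut_eq_finrank]
  set n := finrank ℚ K with hn_def
  have hn0 : (3 : ℝ) ≤ n := by exact_mod_cast hn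
  set κ : ℝ := 1 / n with hκ
  have hκ0 : 0 < κ := by positivity
  have hκ3 : κ ≤ 1 / 3 := one_div_le_one_div_of_le (by norm_num) hn0
  have hnκ : κ * n = 1 := one_div_mul_cancel (by linarith)
  have hνκ : 74 * ν ≤ δ * κ := by
    have := mul_le_mul_of_nonneg_right hν hκ0.le
    linear_combination this - 74 * ν * hnκ
  have hδκ : δ * κ ≤ κ := mul_le_of_le_one_left hκ0.le hδ1
  have hδκκ : δ * κ * κ ≤ κ / 3 := by nlinarith
  obtain ⟨C0, hC0, hfib⟩ := exists_fibres ι hσ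
  obtain ⟨C1, hC1, hprog⟩ := hconj.progression hε
  obtain ⟨C2, hC2, hcnt⟩ := card_trace_zero_le ι hn
  obtain ⟨C3, hC3, hlarge⟩ := card_large_part_le ι hn
  obtain ⟨C4, hC4, hdiv⟩ := card_divisors_le K hε
  rw [← hn_def] at hfib hcnt hlarge
  set E := 1 - 5 * ν + ε with hE
  set R := (2 * C0 : ℝ) with hR
  have hR2 : 2 ≤ R := by linarith
  set W := (3 * R ^ n) ^ ((1 - δ) / n + ε) with hW
  have hWpos : 0 < W := by positivity
  set K1 := C2 * R * R ^ (n - 2) * (f * f * (C1 * W)) with hK1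
  set K2 := R * (C3 * (C4 * (f : ℝ) ^ ε) * R ^ (n - 1)) with hK2
  set K3 := R * (C2 * R ^ (n - 2)) with hK3
  have k1 : 0 ≤ K1 := by positivity
  have k2 : 0 ≤ K2 := by positivity
  have k3 : 0 ≤ K3 := by positivity
  refine ⟨K1 + R + K2 + K3, by linarith, fun x t 𝔡 hx htx h𝔡 hd => ?_⟩
  have hx0 : 0 < x := by linarith
  set X := x ^ κ with hX
  have hX1 : 1 ≤ X := one_le_rpow hx hκ0.le
  have hXpow : ∀ k : ℕ, X ^ k = x ^ (κ * k) := fun k => by rw [hX, ← rpow_natCast, ← rpow_mul hx0.le]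
  have hXn : X ^ n = x := by rw [hXpow, hnκ, rpow_one]
  set P := R * X with hP
  have hP1 : 2 ≤ P := hR2.trans (le_mul_of_one_le_right (by linarith) hX1)
  obtain ⟨Γ, A, L, hΓ, hsum⟩ := hfib x t htx
  have hPY : 2 * (C0 * x ^ (1 / (n : ℝ))) = P := by rw [hP, hR, hX, hκ]; ring
  rw [hPY] at hΓ
  set D := f * absNorm 𝔡 with hD
  have hNd := one_le_absNorm h𝔡
  have hD0 : D ≠ 0 := mul_ne_zero hf0 (by have := absNorm_pos h𝔡; omega)
  have hsq : ∀ γ : OK, ∃ q u g b c : ℕ, γ ≠ 0 → absNorm (span {γ}) = q * u ∧ Squarefree q ∧ q.Coprime u ∧ q.Coprime D ∧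
      u = g * (b ^ 3 * c ^ 2) ∧ g ∣ D := by
    intro γ
    by_cases h : γ = 0
    · exact ⟨0, 0, 0, 0, 0, fun h' => absurd h h'⟩
    · obtain ⟨q, u, g, b, c, H⟩ := exists_squarefree_part (D := D) (absNorm (span {γ})) (by
        rw [Ne, Ideal.absNorm_eq_zero_iff]; simpa using h)
      exact ⟨q, u, g, b, c, fun _ => H⟩
  choose q u g b c hq using hsq
  set G := x ^ (3 / 4 * (δ * κ)) with hG
  have hG1 : 1 ≤ G := one_le_rpow hx (by positivity)
  have hL : ∀ γ ∈ Γ, (L γ : ℝ) ≤ P := by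
    intro γ hγ
    have h1 := (hΓ γ hγ).2.2.2.2
    have h2 : C0 * x ^ (1 / (n : ℝ)) = P / 2 := by rw [← hPY]; ring
    rw [h2] at h1
    linarith
  set B := f * f * x ^ (4 * ν) * G * (C1 * (W * x ^ ((1 - δ) * κ + ε))) with hB
  set bad : Finset OK := Γ.filter fun γ => γ = 0 ∨ G < u γ ∨ q γ = 1 ∧ (u γ : ℝ) ≤ G with hbad
  have hone : ∀ γ ∈ Γ, |∑ a ∈ range (L γ), congTerm σ 𝔐 μ f 𝔡 (span {A γ + (a : OK)})| ≤ B + if γ ∈ bad then P else 0 := by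
    intro γ hγ
    by_cases hb : γ ∈ bad
    · rw [if_pos hb]
      have h1 : |∑ a ∈ range (L γ), congTerm σ 𝔐 μ f 𝔡 (span {A γ + (a : OK)})| ≤ P := by
        refine (abs_sum_le_sum_abs _ _).trans ((sum_le_sum fun a _ => abs_congTerm_le _ _ _ _ _ _).trans ?_)
        simpa using hL γ hγ
      exact h1.trans (le_add_of_nonneg_left (by positivity))
    · rw [if_neg hb, add_zero]
      rw [hbad, mem_filter] at hb
      push Not at hb
      obtain ⟨hγ0, huG, hq1⟩ := hb hγ
      obtain ⟨e1, e2, e3, e4, -⟩ := hq γ hγ0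
      have hqu : (q γ * u γ : ℝ) ≤ P ^ n := by
        rw [← cast_mul, ← e1, absNorm_span_eq ι, abs_prod]
        refine (Finset.prod_le_prod (fun _ _ => abs_nonneg _) fun τ _ => (hΓ γ hγ).2.1 τ).trans_eq ?_
        rw [prod_const, card_univ, hcard]
      have hu1 : (1 : ℝ) ≤ u γ := by
        have : u γ ≠ 0 := by
          intro h
          rw [h, mul_zero, Ideal.absNorm_eq_zero_iff, span_singleton_eq_bot] at e1
          exact hγ0 e1
        exact_mod_cast Nat.pos_of_ne_zero this
      have hPn : 2 ≤ P ^ n := hP1.trans (le_self_pow₀ (by linarith) (by omega))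
      have hrt : P ≤ (3 * P ^ n) ^ (1 / (n : ℝ)) := by
        calc P = (P ^ n) ^ (1 / (n : ℝ)) := by
              rw [← rpow_natCast, ← rpow_mul (by linarith), mul_one_div_cancel (by linarith), rpow_one]
          _ ≤ _ := rpow_le_rpow (by positivity) (by linarith) (by positivity)
      have h1 := abs_sum_fibre_le ι hunits (μ := μ) hf0 hF hFM hF2 h𝔡 (hΓ γ hγ).2.2.1 (hΓ γ hγ).2.2.2.1 hγ0 e1 e2 e3 e4
        (fun h => absurd (hq1 h) (not_lt.2 huG)) (L γ) (B := C1 * (3 * P ^ n) ^ ((1 - δ) / n + ε)) fun χ hχ r hr b J hJ =>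
          hprog _ (by linarith) (q γ) (Nat.pos_of_ne_zero e2.ne_zero)
            ((le_mul_of_one_le_right (cast_nonneg _) hu1).trans (hqu.trans (by linarith))) χ hχ r hr b J
            (((cast_le.2 hJ).trans (hL γ hγ)).trans hrt)
      refine h1.trans ?_
      have h2 : (3 * P ^ n) ^ ((1 - δ) / n + ε) = W * x ^ ((1 - δ) * κ + ε) := by
        rw [hP, mul_pow, hXn, ← mul_assoc, mul_rpow (by positivity) hx0.le, ← hW, hκ, mul_one_div]
      rw [h2, hB]
      push_cast
      gcongr
  have hGr : ∀ s : ℝ, G ^ s = x ^ (3 / 4 * (δ * κ) * s) := fun s => by rw [hG, ← rpow_mul hx0.le]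
  have hΓcard : (Γ.card : ℝ) ≤ C2 * P * P ^ (n - 2) := hcnt P P Γ (by linarith) (by linarith) fun γ hγ =>
    ⟨(hΓ γ hγ).1, (hΓ γ hγ).2.1, 1, (hΓ γ hγ).2.1 1⟩
  have hbadcard : (bad.card : ℝ) ≤ 1 + C3 * (C4 * ((f : ℝ) ^ ε * x ^ ε)) * P ^ (n - 1) * x ^ (-(3 / 32 * (δ * κ))) +
      C2 * x ^ (3 / 4 * (δ * κ) * κ) * P ^ (n - 2) := by
    set S1 := Γ.filter fun γ => γ ≠ 0 ∧ G < u γ with hS1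
    set S2 := Γ.filter fun γ => γ ≠ 0 ∧ q γ = 1 ∧ (u γ : ℝ) ≤ G with hS2
    have h1 : bad ⊆ {0} ∪ S1 ∪ S2 := by
      intro γ hγ
      rw [hbad, mem_filter] at hγ
      simp only [Finset.mem_union, mem_singleton, hS1, hS2, mem_filter]
      tauto
    have h2 : (bad.card : ℝ) ≤ 1 + S1.card + S2.card := by
      have := (card_le_card h1).trans ((Finset.card_union_le _ _).trans (Nat.add_le_add_right (Finset.card_union_le _ _) _))
      rw [Finset.card_singleton] at this
      exact_mod_cast this
    have h3 : (S1.card : ℝ) ≤ C3 * D.divisors.card * P ^ (n - 1) * G ^ (-(1 / 8) : ℝ) := by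
      refine hlarge P G D S1 (by linarith) hG1 hD0 fun γ hγ => ?_
      obtain ⟨m1, m2, m3⟩ := mem_filter.1 hγ
      obtain ⟨e1, e2, e3, e4, e5, e6⟩ := hq γ m2
      have hu0 : u γ ≠ 0 := by
        intro h
        rw [h, mul_zero, Ideal.absNorm_eq_zero_iff, span_singleton_eq_bot] at e1
        exact m2 e1
      obtain ⟨𝔮, 𝔳, e, -, hNv⟩ := exists_coprime_ideal_factors e1 e2.ne_zero hu0 e3
      exact ⟨m2, (hΓ γ m1).1, (hΓ γ m1).2.1, 𝔳, g γ, b γ, c γ, e ▸ dvd_mul_left _ _, by rw [hNv, e5], e6, by rw [hNv]; exact m3.le⟩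
    have h4 : (S2.card : ℝ) ≤ C2 * G ^ κ * P ^ (n - 2) := by
      refine hcnt P _ S2 (by linarith) (one_le_rpow hG1 hκ0.le) fun γ hγ => ?_
      obtain ⟨m1, m2, m3, m4⟩ := mem_filter.1 hγ
      refine ⟨(hΓ γ m1).1, (hΓ γ m1).2.1, ?_⟩
      by_contra! h
      have h5 : (absNorm (span {γ}) : ℝ) ≤ G := by rwa [(hq γ m2).1, m3, one_mul]
      rw [absNorm_span_eq ι, abs_prod] at h5
      have h6 : ∏ τ : Gal(K/ℚ), G ^ κ < ∏ τ, |cj ι τ γ| :=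
        Finset.prod_lt_prod_of_nonempty (fun τ _ => by positivity) (fun τ _ => h τ) univ_nonempty
      rw [prod_const, card_univ, hcard, ← rpow_natCast, ← rpow_mul (by linarith), hnκ, rpow_one] at h6
      linarith
    have h7 : (D.divisors.card : ℝ) ≤ C4 * ((f : ℝ) ^ ε * x ^ ε) := by
      refine (hdiv D hD0).trans (mul_le_mul_of_nonneg_left ?_ (by linarith))
      rw [← mul_rpow (cast_nonneg _) hx0.le, hD, cast_mul]
      refine rpow_le_rpow (by positivity) (mul_le_mul_of_nonneg_left (hd.trans ?_) (cast_nonneg _)) hε.le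
      calc x ^ (4 * ν) ≤ x ^ (1 : ℝ) := rpow_le_rpow_of_exponent_le hx (by linarith)
        _ = x := rpow_one x
    rw [hGr, show 3 / 4 * (δ * κ) * -(1 / 8) = -(3 / 32 * (δ * κ)) by ring] at h3
    rw [hGr] at h4
    have h8 : C3 * D.divisors.card * P ^ (n - 1) * x ^ (-(3 / 32 * (δ * κ))) ≤
        C3 * (C4 * ((f : ℝ) ^ ε * x ^ ε)) * P ^ (n - 1) * x ^ (-(3 / 32 * (δ * κ))) := by gcongr
    linarith
  have hP2 : P ^ (n - 2) = R ^ (n - 2) * x ^ (1 - 2 * κ) := by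
    rw [hP, mul_pow, hXpow, Nat.cast_sub (by omega), Nat.cast_two, mul_sub, hnκ, mul_comm κ 2]
  have hP3 : P ^ (n - 1) = R ^ (n - 1) * x ^ (1 - κ) := by
    rw [hP, mul_pow, hXpow, cast_pred (by omega), mul_sub, hnκ, mul_one]
  have hle : ∀ e : ℝ, e ≤ E → x ^ e ≤ x ^ E := fun e he => rpow_le_rpow_of_exponent_le hx he
  calc |∑ 𝔠 ∈ idl K t, congTerm σ 𝔐 μ f 𝔡 𝔠| = |∑ γ ∈ Γ, ∑ a ∈ range (L γ), congTerm σ 𝔐 μ f 𝔡 (span {A γ + (a : OK)})| := by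
        rw [hsum]
        intro 𝔠 h
        rw [congTerm] at h
        split_ifs at h with h1
        · rw [spinTerm] at h
          split_ifs at h with h2
          · obtain ⟨α, m1, m2, -⟩ := h2
            exact ⟨α, m2, m1⟩
          · exact absurd rfl h
        · exact absurd rfl h
    _ ≤ ∑ γ ∈ Γ, (B + if γ ∈ bad then P else 0) := (abs_sum_le_sum_abs _ _).trans (sum_le_sum hone)
    _ = Γ.card * B + bad.card * P := by
        rw [sum_add_distrib, sum_const, nsmul_eq_mul, ← sum_filter, sum_const, nsmul_eq_mul,
          Finset.filter_mem_eq_inter, Finset.inter_eq_right.2 (Finset.filter_subset _ _)]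
    _ ≤ (C2 * P * P ^ (n - 2)) * B + (1 + C3 * (C4 * ((f : ℝ) ^ ε * x ^ ε)) * P ^ (n - 1) * x ^ (-(3 / 32 * (δ * κ))) +
          C2 * x ^ (3 / 4 * (δ * κ) * κ) * P ^ (n - 2)) * P := by
        refine add_le_add (mul_le_mul_of_nonneg_right hΓcard (by positivity)) (mul_le_mul_of_nonneg_right hbadcard (by linarith))
    _ = K1 * (x ^ κ * x ^ (1 - 2 * κ) * x ^ (4 * ν) * x ^ (3 / 4 * (δ * κ)) * x ^ ((1 - δ) * κ + ε)) + R * x ^ κ +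
          K2 * (x ^ κ * x ^ ε * x ^ (1 - κ) * x ^ (-(3 / 32 * (δ * κ)))) +
          K3 * (x ^ κ * x ^ (3 / 4 * (δ * κ) * κ) * x ^ (1 - 2 * κ)) := by
        rw [hP2, hP3, hB, hP, hK1, hK2, hK3, hX, hG]
        ring
    _ ≤ K1 * x ^ E + R * x ^ E + K2 * x ^ E + K3 * x ^ E := by
        simp only [← rpow_add hx0]
        have i1 := hle (κ + (1 - 2 * κ) + 4 * ν + 3 / 4 * (δ * κ) + ((1 - δ) * κ + ε)) (by rw [hE]; linarith)
        have i2 := hle κ (by rw [hE]; linarith)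
        have i3 := hle (κ + ε + (1 - κ) + -(3 / 32 * (δ * κ))) (by rw [hE]; linarith)
        have i4 := hle (κ + 3 / 4 * (δ * κ) * κ + (1 - 2 * κ)) (by rw [hE]; linarith)
        gcongr
    _ = _ := by ring

/-- Regrouping a weighted sum over ideals according to the norm. -/
theorem sum_by_norm (x : ℝ) (w : ℕ → ℝ) (g : IK → ℝ) :
    ∑ e ∈ idl K x, w (absNorm e) * g e =
      ∑ i ∈ range (⌊x⌋₊ + 1), w i * ∑ e ∈ (idl K x).filter (fun e => absNorm e = i), g e := by
  rw [← sum_fiberwise_of_maps_to (s := idl K x) (t := range (⌊x⌋₊ + 1)) (g := fun e => absNorm e)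
    (fun e he => mem_range.2 (Nat.lt_succ_of_le (le_floor (mem_idl.1 he).2)))]
  refine sum_congr rfl fun i _ => ?_
  rw [mul_sum]
  exact sum_congr rfl fun e he => by rw [(mem_filter.1 he).2]

theorem sum_range_norm (x : ℝ) (g : IK → ℝ) (m : ℕ) :
    ∑ i ∈ range m, ∑ e ∈ (idl K x).filter (fun e => absNorm e = i), g e =
      ∑ e ∈ (idl K x).filter (fun e => absNorm e < m), g e := by
  rw [← sum_fiberwise_of_maps_to (s := (idl K x).filter (fun e => absNorm e < m)) (t := range m)
    (g := fun e => absNorm e) (fun e he => mem_range.2 (mem_filter.1 he).2)]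
  refine sum_congr rfl fun i hi => ?_
  rw [Finset.filter_filter]
  refine sum_congr (Finset.filter_congr fun e _ => ⟨fun h => ⟨h ▸ mem_range.1 hi, h⟩, fun h => h.2⟩) fun _ _ => rfl

theorem log_le_rpow_mul {ε : ℝ} (hε : 0 < ε) {x : ℝ} (hx : 1 ≤ x) : 1 + log x ≤ (1 + 1 / ε) * x ^ ε := by
  have h1 := Real.log_le_rpow_div (by linarith : 0 ≤ x) hε
  have h2 := one_le_rpow hx hε.le
  calc 1 + log x ≤ x ^ ε + x ^ ε / ε := by linarith
    _ = _ := by ring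

theorem log_absNorm_le {x : ℝ} {e : IK} (he : e ∈ idl K x) : log (absNorm e) ≤ log x := by
  have h := mem_idl.1 he
  exact log_le_log (by exact_mod_cast one_le_absNorm h.1) h.2

theorem mang_le_log {e : IK} (he : e ≠ ⊥) : mang e ≤ log (absNorm e) := by
  rw [← sum_mang e he]
  exact single_le_sum (fun c _ => mang_nonneg c) ((mem_divs he).2 dvd_rfl)

/-- The sum of type I weighted by a logarithm, from the unweighted one. -/
theorem abs_sum_log_mul_le {x M : ℝ} (hx : 1 ≤ x) {G : IK → ℝ} {b : IK} (hb : b ≠ ⊥)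
    (h : ∀ t, t ≤ x → |∑ 𝔠 ∈ (idl K t).filter (fun 𝔠 => b ∣ 𝔠), G 𝔠| ≤ M) :
    |∑ e ∈ idl K x, log (absNorm e) * (if b * e ∈ idl K x then G (b * e) else 0)| ≤ 2 * log x * M := by
  have hM : 0 ≤ M := (abs_nonneg _).trans (h x le_rfl)
  set g : IK → ℝ := fun e => if b * e ∈ idl K x then G (b * e) else 0 with hg
  set w : ℕ → ℝ := fun i => min (log i) (log x) with hw
  have h1 : ∑ e ∈ idl K x, log (absNorm e) * g e = ∑ e ∈ idl K x, w (absNorm e) * g e :=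
    sum_congr rfl fun e he => by rw [hw]; simp only; rw [min_eq_left (log_absNorm_le he)]
  have hmono : Monotone w := by
    intro i j hij
    refine min_le_min_right _ ?_
    rcases Nat.eq_zero_or_pos i with rfl | hi
    · simpa using Real.log_natCast_nonneg j
    · exact log_le_log (by exact_mod_cast hi) (by exact_mod_cast hij)
  have hN : (0 : ℝ) < absNorm b := by exact_mod_cast one_le_absNorm hb
  rw [h1, sum_by_norm]
  refine (abel_mono _ w (M := M) hmono (by simp [hw, log_nonneg hx]) _ fun m _ => ?_).trans
    (mul_le_mul_of_nonneg_right (mul_le_mul_of_nonneg_left (min_le_right _ _) (by norm_num)) hM)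
  rw [sum_range_norm, sum_filter]
  set F : IK → ℝ := fun 𝔠 => if 𝔠 ∈ idl K x ∧ absNorm 𝔠 < absNorm b * m then G 𝔠 else 0 with hF
  have h2 : ∀ e, (if absNorm e < m then g e else 0) = F (b * e) := by
    intro e
    have : absNorm (b * e) < absNorm b * m ↔ absNorm e < m := by
      rw [map_mul]; exact Nat.mul_lt_mul_left (by exact_mod_cast hN)
    simp only [hF, hg, this, ite_and]
    split_ifs <;> rfl
  rw [sum_congr rfl fun e _ => h2 e, sum_mul_left (x := x) (F := F) (fun e he => by
    by_contra hne
    exact he (if_neg fun hh => hne hh.1)) hb]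
  have h3 := h (min x ((absNorm b : ℝ) * m - 1)) (min_le_left _ _)
  convert h3 using 2
  rw [sum_filter, sum_filter]
  refine (Finset.sum_subset_zero_on_sdiff (fun 𝔠 h𝔠 => ?_) (fun 𝔠 h𝔠 => ?_) (fun 𝔠 h𝔠 => ?_)).symm
  · rw [mem_idl] at h𝔠 ⊢
    exact ⟨h𝔠.1, h𝔠.2.trans (min_le_left _ _)⟩
  · obtain ⟨h4, h5⟩ := Finset.mem_sdiff.1 h𝔠
    split_ifs with h6
    · refine if_neg fun h7 => h5 (mem_idl.2 ⟨(mem_idl.1 h4).1, le_min (mem_idl.1 h4).2 ?_⟩)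
      have : ((absNorm 𝔠 + 1 : ℕ) : ℝ) ≤ ((absNorm b * m : ℕ) : ℝ) := by exact_mod_cast h7.2
      push_cast at this
      linarith
    · rfl
  · have h4 := mem_idl.1 h𝔠
    have h5 : 𝔠 ∈ idl K x := mem_idl.2 ⟨h4.1, h4.2.trans (min_le_left _ _)⟩
    have h6 : absNorm 𝔠 < absNorm b * m := by
      have := h4.2.trans (min_le_right _ _)
      have h7 : (absNorm 𝔠 : ℝ) < (absNorm b : ℝ) * m := by linarith
      exact_mod_cast h7
    simp only [hF, if_pos (And.intro h5 h6)]

/-- The error bound for sums over primes, given sums of type I and type II. -/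
theorem abs_sum_mang_le {G : IK → ℝ} (hG : ∀ 𝔠, |G 𝔠| ≤ 1) {ν : ℝ} (hν0 : 0 < ν) (hν4 : ν ≤ 1 / 4)
    (hνn : ν ≤ 1 / (36 * (finrank ℚ K : ℝ) ^ 2))
    (hI : ∀ ε : ℝ, 0 < ε → ∃ C : ℝ, 1 ≤ C ∧ ∀ (x t : ℝ) (𝔡 : IK), 1 ≤ x → t ≤ x → 𝔡 ≠ ⊥ →
      (absNorm 𝔡 : ℝ) ≤ x ^ (4 * ν) → |∑ 𝔠 ∈ (idl K t).filter (fun 𝔠 => 𝔡 ∣ 𝔠), G 𝔠| ≤ C * x ^ (1 - 5 * ν + ε))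
    (hII : ∀ ε : ℝ, 0 < ε → ∃ C : ℝ, 1 ≤ C ∧ ∀ (x y : ℝ) (v w : IK → ℝ), 1 ≤ x → 1 ≤ y →
      (∀ b, |v b| ≤ 1) → (∀ e, |w e| ≤ 1) →
      (∀ b, (absNorm b : ℝ) ≤ y → v b = 0) → (∀ b, (absNorm b : ℝ) ≤ y → w b = 0) →
      |∑ b ∈ idl K x, ∑ e ∈ idl K x, v b * w e * (if b * e ∈ idl K x then G (b * e) else 0)| ≤
        C * x ^ (1 + ε) * (y ^ (-(1 / 2) : ℝ) + x ^ (-(1 / (36 * (finrank ℚ K : ℝ) ^ 2)))))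
    {ε : ℝ} (hε : 0 < ε) :
    ∃ C : ℝ, 1 ≤ C ∧ ∀ x : ℝ, 1 ≤ x → |∑ 𝔠 ∈ idl K x, mang 𝔠 * G 𝔠| ≤ C * x ^ (1 - ν + ε) := by
  obtain ⟨C1, hC1, h1⟩ := hI (ε / 3) (by positivity)
  obtain ⟨C2, hC2, h2⟩ := hII (ε / 3) (by positivity)
  obtain ⟨C3, hC3, h3⟩ := card_idl_le (K := K) (ε := ε / 3) (by positivity)
  refine ⟨(1 + 1 / (ε / 3)) * (2 * C2 + 2 * C1 * C3 + C3 ^ 2 * C1 + C3), ?_, ?_⟩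
  · have : 0 < 1 / (ε / 3) := by positivity
    exact one_le_mul_of_one_le_of_one_le (by linarith) (by nlinarith [mul_nonneg (by linarith : 0 ≤ C1) (by linarith : 0 ≤ C3), mul_nonneg (sq_nonneg C3) (by linarith : 0 ≤ C1)])
  intro x hx
  have hx0 : 0 < x := by linarith
  set y := x ^ (2 * ν) with hy
  set E := 1 - ν + 2 * (ε / 3) with hE
  have hy1 : 1 ≤ y := one_le_rpow hx (by linarith)
  have hyx : y ≤ x := (rpow_le_rpow_of_exponent_le hx (by linarith : 2 * ν ≤ 1)).trans_eq (rpow_one x)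
  set L := log x with hL
  have hL0 : 0 ≤ L := log_nonneg hx
  set A : IK → ℝ := fun e => if e ∈ idl K x then G e else 0 with hA
  have hA0 : ∀ e, A e ≠ 0 → e ∈ idl K x := fun e he => by
    by_contra hne
    exact he (if_neg hne)
  have hle : ∀ e : ℝ, e ≤ E → x ^ e ≤ x ^ E := fun e he => rpow_le_rpow_of_exponent_le hx he
  have hνε : ν * (ε / 3) ≤ 1 / 4 * (ε / 3) := mul_le_mul_of_nonneg_right hν4 (by positivity)
  have hεp : 0 < ε / 3 := by positivity
  set P : ℝ := ((((idl K x).filter (fun b => (absNorm b : ℝ) ≤ y)).card : ℕ) : ℝ) with hP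
  have hPle : P ≤ C3 * x ^ (2 * ν * (1 + ε / 3)) := by
    rw [rpow_mul hx0.le, ← hy]
    refine le_trans ?_ (h3 y hy1)
    refine cast_le.2 (card_le_card fun b hb => ?_)
    obtain ⟨h4, h5⟩ := mem_filter.1 hb
    exact mem_idl.2 ⟨(mem_idl.1 h4).1, h5⟩
  have hP0 : 0 ≤ P := cast_nonneg _
  have hsmall : ∀ (u : IK → ℝ) (B : ℝ), 0 ≤ B → (∀ b ∈ idl K x, (absNorm b : ℝ) ≤ y → |u b| ≤ B) →
      (∀ b ∈ idl K x, y < (absNorm b : ℝ) → u b = 0) → |∑ b ∈ idl K x, u b| ≤ P * B := by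
    intro u B hB hu hu0
    rw [← Finset.sum_filter_add_sum_filter_not (idl K x) (fun b => (absNorm b : ℝ) ≤ y),
      sum_eq_zero (s := (idl K x).filter _) (fun b hb => hu0 b (mem_filter.1 hb).1 (not_le.1 (mem_filter.1 hb).2)), add_zero,
      hP, ← nsmul_eq_mul]
    exact (abs_sum_le_sum_abs _ _).trans (sum_le_card_nsmul _ _ _ fun b hb =>
      hu b (mem_filter.1 hb).1 (mem_filter.1 hb).2)
  have hMg : ∀ c ∈ idl K x, |mang c| ≤ L := fun c hc => by
    rw [abs_of_nonneg (mang_nonneg c)]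
    exact (mang_le_log (mem_idl.1 hc).1).trans (log_absNorm_le hc)
  have hsplit : ∑ 𝔠 ∈ idl K x, mang 𝔠 * G 𝔠 = ∑ c ∈ idl K x, (if y < absNorm c then mang c else 0) * A c +
      ∑ c ∈ idl K x, (if y < absNorm c then 0 else mang c) * A c := by
    rw [← sum_add_distrib]
    refine sum_congr rfl fun c hc => ?_
    simp only [hA, if_pos hc]
    split_ifs <;> ring
  have hA1 : ∀ c, |A c| ≤ 1 := fun c => by
    simp only [hA]
    split_ifs
    · exact hG c
    · simp
  have k4 : |∑ c ∈ idl K x, (if y < absNorm c then 0 else mang c) * A c| ≤ P * L := by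
    refine hsmall _ L hL0 (fun c hc hcy => ?_) fun c hc hcy => by rw [if_pos hcy, zero_mul]
    rw [if_neg (not_lt.2 hcy), abs_mul]
    exact (mul_le_mul (hMg c hc) (hA1 c) (abs_nonneg _) hL0).trans_eq (mul_one _)
  have k2 : |∑ b ∈ idl K x, (if y < absNorm b then 0 else moeb b) *
        ∑ e ∈ idl K x, log (absNorm e) * A (b * e)| ≤ P * (2 * L * (C1 * x ^ (1 - 5 * ν + ε / 3))) := by
    refine hsmall _ _ (by positivity) (fun b hb hby => ?_) fun b hb hby => by rw [if_pos hby, zero_mul]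
    rw [if_neg (not_lt.2 hby), abs_mul]
    refine (mul_le_mul (abs_moeb_le b) (abs_sum_log_mul_le hx (mem_idl.1 hb).1 fun t ht => h1 x t b hx ht (mem_idl.1 hb).1
      (hby.trans (rpow_le_rpow_of_exponent_le hx (by linarith)))) (abs_nonneg _) zero_le_one).trans_eq (one_mul _)
  have k3 : |∑ b ∈ idl K x, (if y < absNorm b then 0 else moeb b) *
        ∑ c ∈ idl K x, (if y < absNorm c then 0 else mang c) * ∑ d ∈ idl K x, A (b * (c * d))| ≤
      P * (P * (L * (C1 * x ^ (1 - 5 * ν + ε / 3)))) := by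
    refine hsmall _ _ (by positivity) (fun b hb hby => ?_) fun b hb hby => by rw [if_pos hby, zero_mul]
    rw [if_neg (not_lt.2 hby), abs_mul]
    refine (mul_le_mul (abs_moeb_le b) ?_ (abs_nonneg _) zero_le_one).trans_eq (one_mul _)
    refine hsmall _ _ (by positivity) (fun c hc hcy => ?_) fun c hc hcy => by rw [if_pos hcy, zero_mul]
    rw [if_neg (not_lt.2 hcy), abs_mul]
    refine mul_le_mul (hMg c hc) ?_ (abs_nonneg _) hL0
    have hbc : b * c ≠ ⊥ := mul_ne_zero (mem_idl.1 hb).1 (mem_idl.1 hc).1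
    simp only [← mul_assoc]
    rw [sum_mul_left hA0 hbc, sum_congr rfl (g := G) fun e he => if_pos (mem_filter.1 he).1]
    refine h1 x x (b * c) hx le_rfl hbc ?_
    rw [map_mul, cast_mul, show 4 * ν = 2 * ν + 2 * ν by ring, rpow_add hx0]
    exact mul_le_mul hby hcy (cast_nonneg _) (by positivity)
  have k1 : |∑ b ∈ idl K x, ∑ e ∈ idl K x, (if y < absNorm b then moeb b else 0) * vwt y e * A (b * e)| ≤
      (1 + L) * (C2 * x ^ (1 + ε / 3) * (x ^ (-ν) + x ^ (-ν))) := by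
    have h5 := h2 x y (fun b => if y < absNorm b then moeb b else 0) (fun e => if e ∈ idl K x then vwt y e / (1 + L) else 0)
      hx hy1 (fun b => by split_ifs; exacts [abs_moeb_le b, by simp]) (fun e => by
        split_ifs with he
        · rw [abs_of_nonneg (div_nonneg (vwt_nonneg y e) (by linarith)), div_le_one (by linarith)]
          have := (vwt_le y (mem_idl.1 he).1).trans (log_absNorm_le he)
          linarith
        · simp) (fun b hb => if_neg (not_lt.2 hb)) (fun e he => by
          split_ifs with he'
          · rw [vwt_eq_zero (mem_idl.1 he').1 he, zero_div]
          · rfl)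
    have h6 : ∑ b ∈ idl K x, ∑ e ∈ idl K x, (if y < absNorm b then moeb b else 0) * vwt y e * A (b * e) =
        (1 + L) * ∑ b ∈ idl K x, ∑ e ∈ idl K x, (if y < absNorm b then moeb b else 0) *
          (if e ∈ idl K x then vwt y e / (1 + L) else 0) * (if b * e ∈ idl K x then G (b * e) else 0) := by
      simp only [mul_sum]
      refine sum_congr rfl fun b _ => sum_congr rfl fun e he => ?_
      rw [if_pos he]
      have : 1 + L ≠ 0 := by positivity
      field_simp
      rfl
    rw [h6, abs_mul, abs_of_nonneg (by linarith : 0 ≤ 1 + L)]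
    refine mul_le_mul_of_nonneg_left (h5.trans ?_) (by linarith)
    refine mul_le_mul_of_nonneg_left (add_le_add ?_ (rpow_le_rpow_of_exponent_le hx (by linarith))) (by positivity)
    rw [hy, ← rpow_mul hx0.le]
    exact rpow_le_rpow_of_exponent_le hx (by linarith)
  have hv := vaughan hx y hA0
  rw [hsplit, hv]
  have j1 : (1 + L) * (C2 * x ^ (1 + ε / 3) * (x ^ (-ν) + x ^ (-ν))) ≤ (1 + L) * (2 * C2 * x ^ E) := by
    have := hle (1 + ε / 3 + -ν) (by rw [hE]; linarith)
    rw [rpow_add hx0] at this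
    refine mul_le_mul_of_nonneg_left ?_ (by linarith)
    nlinarith
  have j2 : P * (2 * L * (C1 * x ^ (1 - 5 * ν + ε / 3))) ≤ (1 + L) * (2 * C1 * C3 * x ^ E) := by
    have := hle (2 * ν * (1 + ε / 3) + (1 - 5 * ν + ε / 3)) (by rw [hE]; linarith)
    rw [rpow_add hx0] at this
    calc P * (2 * L * (C1 * x ^ (1 - 5 * ν + ε / 3))) ≤ (C3 * x ^ (2 * ν * (1 + ε / 3))) * (2 * (1 + L) * (C1 * x ^ (1 - 5 * ν + ε / 3))) := by
          gcongr; linarith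
      _ = (1 + L) * (2 * C1 * C3 * (x ^ (2 * ν * (1 + ε / 3)) * x ^ (1 - 5 * ν + ε / 3))) := by ring
      _ ≤ _ := by gcongr
  have j3 : P * (P * (L * (C1 * x ^ (1 - 5 * ν + ε / 3)))) ≤ (1 + L) * (C3 ^ 2 * C1 * x ^ E) := by
    have := hle (2 * ν * (1 + ε / 3) + 2 * ν * (1 + ε / 3) + (1 - 5 * ν + ε / 3)) (by rw [hE]; linarith)
    rw [rpow_add hx0, rpow_add hx0] at this
    calc P * (P * (L * (C1 * x ^ (1 - 5 * ν + ε / 3)))) ≤ (C3 * x ^ (2 * ν * (1 + ε / 3))) * ((C3 * x ^ (2 * ν * (1 + ε / 3))) * ((1 + L) * (C1 * x ^ (1 - 5 * ν + ε / 3)))) := by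
          gcongr; linarith
      _ = (1 + L) * (C3 ^ 2 * C1 * (x ^ (2 * ν * (1 + ε / 3)) * x ^ (2 * ν * (1 + ε / 3)) * x ^ (1 - 5 * ν + ε / 3))) := by ring
      _ ≤ _ := by gcongr
  have j4 : P * L ≤ (1 + L) * (C3 * x ^ E) := by
    have := hle (2 * ν * (1 + ε / 3)) (by rw [hE]; linarith)
    calc P * L ≤ (C3 * x ^ (2 * ν * (1 + ε / 3))) * (1 + L) := by gcongr; linarith
      _ = (1 + L) * (C3 * x ^ (2 * ν * (1 + ε / 3))) := by ring
      _ ≤ _ := by gcongr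
  have j5 : (1 + L) * x ^ E ≤ (1 + 1 / (ε / 3)) * x ^ (1 - ν + ε) := by
    have := mul_le_mul_of_nonneg_right (log_le_rpow_mul hεp hx) (Real.rpow_nonneg hx0.le E)
    rw [mul_assoc, ← rpow_add hx0, show ε / 3 + E = 1 - ν + ε by rw [hE]; ring] at this
    exact this
  refine (abs_add_le _ _).trans ((add_le_add ((abs_sub _ _).trans (add_le_add ((abs_add_le _ _).trans (add_le_add (k1.trans j1) (k2.trans j2)))
    (k3.trans j3))) (k4.trans j4)).trans ?_)
  calc _ = (2 * C2 + 2 * C1 * C3 + C3 ^ 2 * C1 + C3) * ((1 + L) * x ^ E) := by ring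
    _ ≤ (2 * C2 + 2 * C1 * C3 + C3 ^ 2 * C1 + C3) * ((1 + 1 / (ε / 3)) * x ^ (1 - ν + ε)) := by gcongr
    _ = _ := by ring

/-- The proper prime powers contribute little to sums weighted by the von Mangoldt function. -/
theorem abs_sum_log_prime_le {G : IK → ℝ} (hG : ∀ 𝔠, |G 𝔠| ≤ 1) {ν : ℝ} (hν4 : ν ≤ 1 / 4)
    (h : ∀ ε : ℝ, 0 < ε → ∃ C : ℝ, 1 ≤ C ∧ ∀ x : ℝ, 1 ≤ x → |∑ 𝔠 ∈ idl K x, mang 𝔠 * G 𝔠| ≤ C * x ^ (1 - ν + ε))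
    {ε : ℝ} (hε : 0 < ε) :
    ∃ C : ℝ, 1 ≤ C ∧ ∀ x : ℝ, 1 ≤ x →
      |∑ 𝔭 ∈ (idl K x).filter Prime, log (absNorm 𝔭) * G 𝔭| ≤ C * x ^ (1 - ν + ε) := by
  obtain ⟨C1, hC1, h1⟩ := h ε hε
  have hεp : 0 < ε / 3 := by positivity
  obtain ⟨C2, hC2, h2⟩ := exists_succ_le_rpow hεp
  obtain ⟨C3, hC3, h3⟩ := card_idl_le (K := K) hεp
  refine ⟨C1 + C3 * (2 * C2) * (1 + 1 / (ε / 3)), le_add_of_le_of_nonneg hC1 (by positivity), fun x hx => ?_⟩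
  have hx0 : 0 < x := by linarith
  have hprime : ∀ 𝔭 : IK, Prime 𝔭 → mang 𝔭 = log (absNorm 𝔭) := fun 𝔭 hp => by
    simpa using mang_prime_pow hp 0
  set S := (idl K x).filter (fun c => ¬Prime c) with hS
  have hsplit : ∑ 𝔭 ∈ (idl K x).filter Prime, log (absNorm 𝔭) * G 𝔭 =
      ∑ 𝔠 ∈ idl K x, mang 𝔠 * G 𝔠 - ∑ 𝔠 ∈ S, mang 𝔠 * G 𝔠 := by
    rw [← Finset.sum_filter_add_sum_filter_not (idl K x) Prime (fun 𝔠 => mang 𝔠 * G 𝔠), add_sub_cancel_right]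
    exact sum_congr rfl fun 𝔭 hp => by rw [hprime 𝔭 (mem_filter.1 hp).2]
  set U := ((idl K (x ^ (1 / 2 : ℝ))) ×ˢ range (⌊C2 * x ^ (ε / 3)⌋₊ + 1)).image (fun q => q.1 ^ (q.2 + 2)) with hU
  have hxε : 1 ≤ x ^ (ε / 3) := one_le_rpow hx hεp.le
  have hUcard : (U.card : ℝ) ≤ C3 * (2 * C2) * x ^ (1 / 2 + ε / 3 + ε / 3) := by
    have e1 : (U.card : ℝ) ≤ (idl K (x ^ (1 / 2 : ℝ))).card * ((⌊C2 * x ^ (ε / 3)⌋₊ : ℝ) + 1) := by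
      have := card_image_le (s := (idl K (x ^ (1 / 2 : ℝ))) ×ˢ range (⌊C2 * x ^ (ε / 3)⌋₊ + 1)) (f := fun q => q.1 ^ (q.2 + 2))
      rw [card_product, card_range] at this
      exact_mod_cast this
    have e2 : (⌊C2 * x ^ (ε / 3)⌋₊ : ℝ) + 1 ≤ 2 * C2 * x ^ (ε / 3) := by
      have := floor_le (by positivity : 0 ≤ C2 * x ^ (ε / 3))
      nlinarith
    have e3 := h3 (x ^ (1 / 2 : ℝ)) (one_le_rpow hx (by norm_num))
    have e4 : (x ^ (1 / 2 : ℝ)) ^ (1 + ε / 3) ≤ x ^ (1 / 2 + ε / 3) := by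
      rw [← rpow_mul hx0.le]
      exact rpow_le_rpow_of_exponent_le hx (by linarith)
    calc (U.card : ℝ) ≤ (C3 * x ^ (1 / 2 + ε / 3)) * (2 * C2 * x ^ (ε / 3)) := by
          refine e1.trans (mul_le_mul (e3.trans (by gcongr)) e2 (by positivity) (by positivity))
      _ = _ := by rw [rpow_add hx0 (1 / 2 + ε / 3)]; ring
  have hSU : ∀ c ∈ S, c ∉ U → mang c * G c = 0 := by
    intro c hc hcU
    obtain ⟨hcx, hcp⟩ := mem_filter.1 hc
    rw [mang_eq_zero, zero_mul]
    rintro ⟨𝔭, hp, k, rfl⟩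
    rcases k with _ | k
    · exact hcp (by simpa using hp)
    have hN : (2 : ℝ) ≤ absNorm 𝔭 := by exact_mod_cast absNorm_prime_ge_two hp
    have hle := (mem_idl.1 hcx).2
    rw [map_pow, cast_pow] at hle
    refine hcU (mem_image.2 ⟨(𝔭, k), mem_product.2 ⟨mem_idl.2 ⟨hp.ne_zero, ?_⟩, mem_range.2 ?_⟩, rfl⟩)
    · have h4 : ((absNorm 𝔭 : ℝ)) ^ 2 ≤ x := (pow_le_pow_right₀ (by linarith) (by omega)).trans hle
      have := rpow_le_rpow (by positivity) h4 (by norm_num : (0 : ℝ) ≤ 1 / 2)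
      rwa [← sqrt_eq_rpow, sqrt_sq (by linarith)] at this
    · refine Nat.lt_succ_of_le (le_floor ?_)
      have h4 : (2 : ℝ) ^ k ≤ x := (pow_le_pow_left₀ (by norm_num) hN k).trans ((pow_le_pow_right₀ (by linarith) (by omega)).trans hle)
      have h5 := h2 k
      have h6 : ((2 : ℝ) ^ k) ^ (ε / 3) ≤ x ^ (ε / 3) := rpow_le_rpow (by positivity) h4 hεp.le
      nlinarith
  have hrest : |∑ 𝔠 ∈ S, mang 𝔠 * G 𝔠| ≤ U.card * (1 + log x) := by
    rw [← Finset.sum_subset (Finset.inter_subset_left (s₁ := S) (s₂ := U)) fun c hc hcU => hSU c hc fun h' => hcU (mem_inter.2 ⟨hc, h'⟩)]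
    refine (abs_sum_le_sum_abs _ _).trans ((sum_le_card_nsmul _ _ (1 + log x) fun c hc => ?_).trans ?_)
    · have hcx := (mem_filter.1 (mem_inter.1 hc).1).1
      rw [abs_mul, abs_of_nonneg (mang_nonneg c)]
      have h4 := (mang_le_log (mem_idl.1 hcx).1).trans (log_absNorm_le hcx)
      exact (mul_le_of_le_one_right (mang_nonneg c) (hG c)).trans (by linarith)
    · rw [nsmul_eq_mul]
      have := log_nonneg hx
      exact mul_le_mul_of_nonneg_right (by exact_mod_cast card_le_card Finset.inter_subset_right) (by linarith)
  rw [hsplit]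
  refine (abs_sub _ _).trans ((add_le_add (h1 x hx) (hrest.trans ?_)).trans_eq (add_mul _ _ _).symm)
  calc (U.card : ℝ) * (1 + log x) ≤ (C3 * (2 * C2) * x ^ (1 / 2 + ε / 3 + ε / 3)) * ((1 + 1 / (ε / 3)) * x ^ (ε / 3)) := by
        refine mul_le_mul hUcard (log_le_rpow_mul hεp hx) ?_ (by positivity)
        have := log_nonneg hx
        linarith
    _ = C3 * (2 * C2) * (1 + 1 / (ε / 3)) * (x ^ (1 / 2 + ε / 3 + ε / 3) * x ^ (ε / 3)) := by ring
    _ ≤ _ := by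
        rw [← rpow_add hx0]
        exact mul_le_mul_of_nonneg_left (rpow_le_rpow_of_exponent_le hx (by linarith)) (by positivity)

/-- Removing the logarithmic weight from a sum over primes. -/
theorem abs_sum_prime_le {G : IK → ℝ} {C θ : ℝ} (hC : 0 ≤ C) (hθ : 0 ≤ θ)
    (h : ∀ x : ℝ, 1 ≤ x → |∑ 𝔭 ∈ (idl K x).filter Prime, log (absNorm 𝔭) * G 𝔭| ≤ C * x ^ θ) {x : ℝ} (hx : 1 ≤ x) :
    |∑ 𝔭 ∈ (idl K x).filter Prime, G 𝔭| ≤ 2 * (C * x ^ θ) := by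
  have hx0 : 0 < x := by linarith
  set w : ℕ → ℝ := fun i => 1 / log (max (i : ℝ) 2) with hw
  have hlog : ∀ i : ℕ, log 2 ≤ log (max (i : ℝ) 2) := fun i => log_le_log (by norm_num) (le_max_right _ _)
  have hl2 : 1 / 2 < log 2 := by have := Real.log_two_gt_d9; linarith
  have hw0 : ∀ i, 0 ≤ w i := fun i => by have := hlog i; exact div_nonneg zero_le_one (by linarith)
  have hanti : Antitone w := fun i j hij => by
    have := hlog i
    exact one_div_le_one_div_of_le (by linarith) (log_le_log (by positivity) (max_le_max_right _ (by exact_mod_cast hij)))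
  set g : IK → ℝ := fun e => if Prime e then log (absNorm e) * G e else 0 with hg
  have h1 : ∑ 𝔭 ∈ (idl K x).filter Prime, G 𝔭 = ∑ e ∈ idl K x, w (absNorm e) * g e := by
    rw [sum_filter]
    refine sum_congr rfl fun e _ => ?_
    simp only [hg, hw]
    split_ifs with hp
    · have hN : (2 : ℝ) ≤ absNorm e := by exact_mod_cast absNorm_prime_ge_two hp
      have := hlog (absNorm e)
      rw [max_eq_left hN] at this ⊢
      have h0 : log (absNorm e) ≠ 0 := by linarith
      field_simp
    · rw [mul_zero]
  rw [h1, sum_by_norm]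
  refine (abel_anti _ w (M := C * x ^ θ) hanti hw0 _ fun m hm => ?_).trans (mul_le_mul_of_nonneg_right ?_ (by positivity))
  · rw [sum_range_norm]
    have hsub : (idl K x).filter (fun e => absNorm e < m) = idl K ((m : ℝ) - 1) := by
      ext e
      rw [mem_filter, mem_idl, mem_idl]
      have hmx : (m : ℝ) - 1 ≤ x := by
        have : (m : ℝ) ≤ (⌊x⌋₊ + 1 : ℕ) := by exact_mod_cast hm
        push_cast at this
        linarith [floor_le hx0.le]
      constructor
      · rintro ⟨⟨h2, -⟩, h4⟩
        have : ((absNorm e + 1 : ℕ) : ℝ) ≤ m := by exact_mod_cast h4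
        push_cast at this
        exact ⟨h2, by linarith⟩
      · rintro ⟨h2, h3⟩
        refine ⟨⟨h2, h3.trans hmx⟩, ?_⟩
        have : (absNorm e : ℝ) < m := by linarith
        exact_mod_cast this
    rw [hsub]
    by_cases hm1 : 1 ≤ (m : ℝ) - 1
    · rw [← sum_filter]
      refine (h _ hm1).trans (mul_le_mul_of_nonneg_left (rpow_le_rpow (by linarith) ?_ hθ) hC)
      have : (m : ℝ) ≤ (⌊x⌋₊ + 1 : ℕ) := by exact_mod_cast hm
      push_cast at this
      linarith [floor_le hx0.le]
    · rw [sum_eq_zero, abs_zero]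
      · positivity
      · intro e he
        have h2 := mem_idl.1 he
        have : (1 : ℝ) ≤ absNorm e := by exact_mod_cast one_le_absNorm h2.1
        exact absurd (this.trans h2.2) hm1
  · have := hlog 0
    simp only [hw]
    rw [div_le_iff₀ (by linarith)]
    linarith

theorem exists_gal_sq_ne [IsGalois ℚ K] (hn : 3 ≤ finrank ℚ K) {σ : Gal(K/ℚ)}
    (hσ : ∀ τ : Gal(K/ℚ), τ ∈ zpowers σ) : ∃ x0 : OK, gal (σ * σ) x0 - x0 ≠ 0 := by
  by_contra! h
  have h1 : σ * σ = 1 := by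
    ext a
    obtain ⟨p, q, -, rfl⟩ := IsFractionRing.div_surjective (A := OK) a
    have h2 : ∀ b : OK, (σ * σ) (b : K) = (b : K) := fun b => by rw [← coe_gal, sub_eq_zero.1 (h b)]
    rw [map_div₀, AlgEquiv.one_apply]
    exact congrArg₂ (· / ·) (h2 p) (h2 q)
  have h2 := orderOf_eq_card_of_forall_mem_zpowers hσ
  rw [card_aut_eq_finrank] at h2
  have h3 := orderOf_le_of_pow_eq_one (n := 2) (by norm_num) (by rw [pow_two, h1] : σ ^ 2 = 1)
  omega

/-- Cancellation in the sum of spins over primes away from a fixed modulus. -/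
theorem exists_abs_sum_spinTerm_prime_le [IsGalois ℚ K] (ι : K →+* ℝ)
    (hunits : UnitsSq K)
    (hn : 3 ≤ finrank ℚ K) {σ : Gal(K/ℚ)} (hσ : ∀ τ : Gal(K/ℚ), τ ∈ zpowers σ) {𝔐 : IK} (h𝔐 : 𝔐 ≠ ⊥)
    (μ : OK) {δ ν : ℝ} (hδ0 : 0 < δ) (hδ1 : δ ≤ 1) (hν0 : 0 < ν) (hν4 : ν ≤ 1 / 4)
    (hν : 74 * finrank ℚ K * ν ≤ δ) (hνn : ν ≤ 1 / (36 * (finrank ℚ K : ℝ) ^ 2))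
    (hconj : ConjectureC (finrank ℚ K) δ) {ε : ℝ} (hε : 0 < ε) :
    ∃ (F : IK) (C : ℝ), F ≠ ⊥ ∧ span {(2 : OK)} ∣ F ∧ 1 ≤ C ∧ ∀ x : ℝ, 1 ≤ x →
      |∑ 𝔭 ∈ (idl K x).filter Prime, if IsCoprime 𝔭 F then spinTerm σ 𝔐 μ 𝔭 else 0| ≤ C * x ^ (1 - ν + ε) := by
  obtain ⟨x0, hx0⟩ := exists_gal_sq_ne hn hσ
  have hs0 : span {gal (σ * σ) x0 - x0} ≠ ⊥ := by simpa using hx0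
  set N1 := absNorm (recMod K)
  set N2 := absNorm 𝔐
  set N3 := absNorm (span {gal (σ * σ) x0 - x0})
  have hN : ∀ 𝔟 : IK, 𝔟 ≠ ⊥ → absNorm 𝔟 ≠ 0 := fun 𝔟 h => one_le_iff_ne_zero.1 (absNorm_pos h)
  obtain ⟨f, hf0, hff, hbil⟩ := spinTerm_bilinear ι hunits σ 𝔐 μ (f0 := N1 * N2 * N3 * 2) (x0 := x0)
    (mul_ne_zero (mul_ne_zero (mul_ne_zero (hN _ recMod_ne_bot) (hN _ h𝔐)) (hN _ hs0)) two_ne_zero)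
    ((dvd_span_absNorm _).trans (span_natCast_dvd ⟨N2 * N3 * 2, by ring⟩))
    ((dvd_span_absNorm _).trans (span_natCast_dvd ⟨N1 * N3 * 2, by ring⟩))
    (by exact_mod_cast span_natCast_dvd (K := K) (a := 2) (b := N1 * N2 * N3 * 2) ⟨N1 * N2 * N3, by ring⟩)
    ((dvd_span_absNorm _).trans (span_natCast_dvd ⟨N1 * N2 * 2, by ring⟩))
  have hF2 : span {(2 : OK)} ∣ span {(f : OK)} := by
    exact_mod_cast span_natCast_dvd (K := K) (a := 2) (b := f) (dvd_trans ⟨N1 * N2 * N3, by ring⟩ hff)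
  set F : IK := span {(f : OK)} with hF
  set G : IK → ℝ := fun 𝔠 => if IsCoprime 𝔠 F then spinTerm σ 𝔐 μ 𝔠 else 0 with hG
  have hG1 : ∀ 𝔠, |G 𝔠| ≤ 1 := fun 𝔠 => by
    simp only [hG]
    split_ifs
    · exact abs_spinTerm_le _ _ _ _
    · simp
  have hψ : ∀ ε : ℝ, 0 < ε → ∃ C : ℝ, 1 ≤ C ∧ ∀ x : ℝ, 1 ≤ x → |∑ 𝔠 ∈ idl K x, mang 𝔠 * G 𝔠| ≤ C * x ^ (1 - ν + ε) := by
    intro ε hε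
    refine abs_sum_mang_le hG1 hν0 hν4 hνn (fun ε hε => ?_) (fun ε hε => ?_) hε
    · obtain ⟨C, hC, h⟩ := abs_sum_congTerm_le ι hunits hn hσ (𝔐 := 𝔐) (μ := μ) hf0
        ((dvd_span_absNorm _).trans (span_natCast_dvd (dvd_trans ⟨N2 * N3 * 2, by ring⟩ hff)))
        ((dvd_span_absNorm _).trans (span_natCast_dvd (dvd_trans ⟨N1 * N3 * 2, by ring⟩ hff))) hF2 hδ0 hδ1 hν0.le hν hconj hε
      refine ⟨C, hC, fun x t 𝔡 hx ht hd hdx => ?_⟩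
      rw [sum_filter]
      refine le_of_eq_of_le (congrArg _ (sum_congr rfl fun 𝔠 _ => ?_)) (h x t 𝔡 hx ht hd hdx)
      simp only [hG, congTerm, hF, ite_and]
    · obtain ⟨C, hC, h⟩ := BilinearBound.typeII (F := F) (T := spinTerm σ 𝔐 μ) hbil hε
      refine ⟨C, hC, fun x y v w hx hy hv hw hv0 hw0 => ?_⟩
      refine le_of_eq_of_le (congrArg _ (sum_congr rfl fun b _ => sum_congr rfl fun e _ => ?_)) (h x y v w hx hy hv hw hv0 hw0)
      simp only [hG, ite_and]
  obtain ⟨C, hC, h⟩ := abs_sum_log_prime_le hG1 hν4 hψ hε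
  refine ⟨F, 2 * C, span_natCast_ne_bot hf0, hF2, by linarith, fun x hx => ?_⟩
  exact (abs_sum_prime_le (by linarith) (by linarith) h hx).trans_eq (mul_assoc _ _ _).symm

theorem isCoprime_or_dvd {𝔭 : IK} (hp : Prime 𝔭) (F : IK) : IsCoprime 𝔭 F ∨ 𝔭 ∣ F := by
  by_cases h : 𝔭 ∣ F
  · exact Or.inr h
  · exact Or.inl (isCoprime_of_not_le ((isPrime_of_prime hp).isMaximal hp.ne_zero) fun h3 => h (dvd_iff_le.2 h3))

/-- The sum of spins over odd primes in a residue class, up to finitely many primes. -/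
theorem abs_finsum_spin_le {F : IK} (hF0 : F ≠ ⊥) (hF2 : span {(2 : OK)} ∣ F) (σ : Gal(K/ℚ)) (𝔐 : IK) (μ : OK)
    (x : ℝ) :
    |∑ᶠ 𝔭 : IK, Set.indicator
          {𝔭 : IK | 𝔭 ≠ ⊥ ∧ 𝔭.IsPrime ∧ OddIdeal 𝔭 ∧
            (absNorm 𝔭 : ℝ) ≤ x ∧
            ∃ π : OK, span {π} = 𝔭 ∧ TotPos π ∧ π - μ ∈ 𝔐}
          (fun 𝔭 => ((spin σ 𝔭 : ℤ) : ℝ)) 𝔭| ≤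
      |∑ 𝔭 ∈ (idl K x).filter Prime, if IsCoprime 𝔭 F then spinTerm σ 𝔐 μ 𝔭 else 0| + (divs F).card := by
  set S : Set IK := {𝔭 : IK | 𝔭 ≠ ⊥ ∧ 𝔭.IsPrime ∧ OddIdeal 𝔭 ∧
            (absNorm 𝔭 : ℝ) ≤ x ∧ ∃ π : OK, span {π} = 𝔭 ∧ TotPos π ∧ π - μ ∈ 𝔐} with hS
  set u : IK → ℝ := fun 𝔭 => Set.indicator S (fun 𝔭 => ((spin σ 𝔭 : ℤ) : ℝ)) 𝔭 with hu
  have hSu : ∀ 𝔭 ∈ S, u 𝔭 = spinTerm σ 𝔐 μ 𝔭 := fun 𝔭 hp => by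
    simp only [hu]
    rw [Set.indicator_of_mem hp, spinTerm, if_pos hp.2.2.2.2]
  have hSn : ∀ 𝔭, 𝔭 ∉ S → u 𝔭 = 0 := fun 𝔭 hp => Set.indicator_of_notMem hp _
  have hu1 : ∀ 𝔭, |u 𝔭| ≤ 1 := fun 𝔭 => by
    by_cases hp : 𝔭 ∈ S
    · rw [hSu 𝔭 hp]
      exact abs_spinTerm_le _ _ _ _
    · rw [hSn 𝔭 hp]
      simp
  have hsup : Function.support u ⊆ ((idl K x).filter Prime : Finset IK) := fun 𝔭 hp => by
    have h : 𝔭 ∈ S := by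
      by_contra h
      exact hp (hSn 𝔭 h)
    exact Finset.mem_coe.2 (mem_filter.2 ⟨mem_idl.2 ⟨h.1, h.2.2.2.1⟩, (Ideal.prime_iff_isPrime h.1).2 h.2.1⟩)
  rw [finsum_eq_sum_of_support_subset _ hsup]
  set G : IK → ℝ := fun 𝔭 => if IsCoprime 𝔭 F then spinTerm σ 𝔐 μ 𝔭 else 0 with hG
  have h1 : ∑ 𝔭 ∈ (idl K x).filter Prime, u 𝔭 = ∑ 𝔭 ∈ (idl K x).filter Prime, G 𝔭 + ∑ 𝔭 ∈ (idl K x).filter Prime, (u 𝔭 - G 𝔭) := by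
    rw [sum_sub_distrib, add_sub_cancel]
  rw [h1]
  refine (abs_add_le _ _).trans (add_le_add le_rfl ?_)
  have h2 : ∀ 𝔭 ∈ (idl K x).filter Prime, |u 𝔭 - G 𝔭| ≤ if 𝔭 ∈ divs F then 1 else 0 := by
    intro 𝔭 hp
    obtain ⟨hpx, hpp⟩ := mem_filter.1 hp
    by_cases hc : IsCoprime 𝔭 F
    · have h0 : u 𝔭 - G 𝔭 = 0 := by
        simp only [hG, if_pos hc]
        by_cases hpS : 𝔭 ∈ S
        · rw [hSu 𝔭 hpS, sub_self]
        · rw [hSn 𝔭 hpS, spinTerm, if_neg, sub_zero]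
          exact fun h => hpS ⟨hpp.ne_zero, isPrime_of_prime hpp, hc.of_isCoprime_of_dvd_right hF2, (mem_idl.1 hpx).2, h⟩
      rw [h0, abs_zero]
      split_ifs <;> norm_num
    · rw [if_pos ((mem_divs hF0).2 ((isCoprime_or_dvd hpp F).resolve_left hc))]
      simp only [hG, if_neg hc, sub_zero]
      exact hu1 𝔭
  refine (abs_sum_le_sum_abs _ _).trans ((sum_le_sum h2).trans ?_)
  rw [← sum_filter, sum_const, nsmul_eq_mul, mul_one]
  exact cast_le.2 (card_le_card fun 𝔭 hp => (mem_filter.1 hp).2)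

end

/-- **Theorem 1.2** (Friedlander–Iwaniec–Mazur–Rubin, "The spin of prime ideals").
With the hypotheses of Theorem 1.1 (degree `n ≥ 3`, totally real, cyclic, totally
positive units are squares, `σ` a generator, Conjecture `C_n` with `δ ≤ 2/n`,
`ν = δ/(2n(12n+1))`), and given a fixed integral ideal `𝔐` divisible by `(2)` and a fixed
`μ ∈ 𝓞` coprime to `𝔐`, the bound `≤ C x^{1-ν+ε}` still holds when the sum of spins is
further restricted to odd principal prime ideals possessing a totally positive generator
`π ≡ μ (mod 𝔐)`. -/
theorem spins_of_prime_ideals_stmt2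
    (n : ℕ) (hn : 3 ≤ n)
    (K : Type*) [Field K] [NumberField K] [IsGalois ℚ K]
    (hdeg : Module.finrank ℚ K = n)
    (htotreal : ∀ φ : K →+* ℂ, ComplexEmbedding.IsReal φ)
    (hcyc : IsCyclic (K ≃ₐ[ℚ] K))
    (hunits : ∀ u : (𝓞 K)ˣ, TotPos (u : 𝓞 K) → ∃ w : (𝓞 K)ˣ, u = w ^ 2)
    (σ : K ≃ₐ[ℚ] K) (hσ : ∀ τ : K ≃ₐ[ℚ] K, τ ∈ Subgroup.zpowers σ)
    (𝔐 : Ideal (𝓞 K)) (h𝔐 : Ideal.span {(2 : 𝓞 K)} ∣ 𝔐)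
    (μ : 𝓞 K) (hμ : IsCoprime (Ideal.span {μ}) 𝔐)
    (δ : ℝ) (hδ0 : 0 < δ) (hδ : δ ≤ 2 / n) (hconj : ConjectureC n δ)
    (ε : ℝ) (hε : 0 < ε) :
    ∃ C : ℝ, 0 < C ∧ ∀ x : ℝ, 2 ≤ x →
      |∑ᶠ 𝔭 : Ideal (𝓞 K), Set.indicator
          {𝔭 : Ideal (𝓞 K) | 𝔭 ≠ ⊥ ∧ 𝔭.IsPrime ∧ OddIdeal 𝔭 ∧
            (Ideal.absNorm 𝔭 : ℝ) ≤ x ∧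
            ∃ π : 𝓞 K, Ideal.span {π} = 𝔭 ∧ TotPos π ∧ π - μ ∈ 𝔐}
          (fun 𝔭 => ((spin σ 𝔭 : ℤ) : ℝ)) 𝔭|
        ≤ C * x ^ (1 - δ / (2 * n * (12 * n + 1)) + ε) := by
  subst hdeg
  rcases eq_or_ne 𝔐 ⊥ with rfl | hM0
  · refine ⟨1, one_pos, fun x hx => ?_⟩
    rw [finsum_eq_zero_of_forall_eq_zero, abs_zero]
    · positivity
    · intro 𝔭
      refine Set.indicator_of_notMem ?_ _
      rintro ⟨-, hp, -, -, π, rfl, -, hπ⟩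
      have h1 := Ideal.isCoprime_iff_sup_eq.1 hμ
      rw [sup_bot_eq] at h1
      rw [Ideal.mem_bot, sub_eq_zero] at hπ
      exact hp.ne_top (hπ ▸ h1)
  set n := Module.finrank ℚ K with hn_def
  have hn0 : (3 : ℝ) ≤ n := by exact_mod_cast hn
  have hn1 : (0 : ℝ) < n := by linarith
  have hnδ : δ * n ≤ 2 := (le_div_iff₀ hn1).1 hδ
  have hδ1 : δ ≤ 1 := by nlinarith
  set ν := δ / (2 * n * (12 * n + 1)) with hν
  have hν0 : 0 < ν := by positivity
  have hνeq : ν * (2 * n * (12 * n + 1)) = δ := div_mul_cancel₀ _ (by positivity)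
  have hνn : ν ≤ 1 / (36 * (n : ℝ) ^ 2) := by
    rw [hν, div_le_div_iff₀ (by positivity) (by positivity)]
    nlinarith [mul_le_mul_of_nonneg_right hnδ hn1.le]
  have hν4 : ν ≤ 1 / 4 := hνn.trans (one_div_le_one_div_of_le (by norm_num) (by nlinarith))
  have hν74 : 74 * n * ν ≤ δ := by
    have : 0 ≤ n * ν := by positivity
    nlinarith
  obtain ⟨φ⟩ : Nonempty (K →+* ℂ) := inferInstance
  obtain ⟨F, C, hF0, hF2, hC, h⟩ := exists_abs_sum_spinTerm_prime_le (ComplexEmbedding.IsReal.embedding (htotreal φ)) hunits hn hσ hM0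
    μ hδ0 hδ1 hν0 hν4 hν74 hνn hconj hε
  refine ⟨C + (divs F).card, by positivity, fun x hx => (abs_finsum_spin_le hF0 hF2 σ 𝔐 μ x).trans ?_⟩
  rw [add_mul]
  have h1 : 1 ≤ x ^ (1 - ν + ε) := Real.one_le_rpow (by linarith) (by linarith)
  exact add_le_add (h x (by linarith)) (le_mul_of_one_le_right (Nat.cast_nonneg _) h1)

end
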